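/- Let Z_1,…,Z_T be independent, centered m×m complex random matrices (m ≥ 2) whose entries have finite moments of all orders, and set X = ∑_{t=1}^T Z_t. Define σ(X) = max(‖E(XX*)‖^{1/2}, ‖E(X*X)‖^{1/2}), υ(X) = ‖Cov(X)‖^{1/2} where Cov(X) ∈ M_{m²}(ℂ) has entries Cov(X)_{(i,j),(k,l)} = E(X_{ij} · conj(X_{kl})) − E(X_{ij}) · conj(E(X_{kl})), and R_p(X) = (∑_{t=1}^T E Tr|Z_t|^{2p})^{1/(2p)} for p ∈ ℕ. Then there exist universal constants C, C' > 0 such that for every natural number p ≥ C' log m: E‖X‖ ≤ ‖E(XX*)‖^{1/2} + ‖E(X*X)‖^{1/2} + C( (log m)^{3/4} σ(X)^{1/2} υ(X)^{1/2} + (log m)^{2/3} σ(X)^{2/3} R_p(X)^{1/3} + (log m) R_p(X) ). -/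

import Mathlib

open MeasureTheory ProbabilityTheory Matrix
open scoped Kronecker ENNReal

/-- The (Borel) measurable space structure on matrices, obtained entrywise. -/
noncomputable instance matrixMeasurableSpace {m n α : Type*} [MeasurableSpace α] :
    MeasurableSpace (Matrix m n α) :=
  inferInstanceAs (MeasurableSpace (m → n → α))

/-- The ℓ²→ℓ² operator norm of a square matrix over `ℝ` or `ℂ`. -/
noncomputable def Matrix.opNorm2 {𝕜 : Type*} [RCLike 𝕜] {n : Type*} [Fintype n] [DecidableEq n]
    (A : Matrix n n 𝕜) : ℝ :=
  ‖LinearMap.toContinuousLinearMap (Matrix.toEuclideanLin A)‖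

/-- `Matrix.sval A k` is the `(k+1)`-st largest singular value of `A`, characterized via
best approximation in operator norm by matrices of rank at most `k`
(the Eckart–Young–Mirsky theorem); in particular `Matrix.sval A 0` is the largest singular
value `s_1(A)` and `Matrix.sval A 1` is the second largest singular value `s_2(A)`. -/
noncomputable def Matrix.sval {𝕜 : Type*} [RCLike 𝕜] {n : Type*} [Fintype n] [DecidableEq n]
    (A : Matrix n n 𝕜) (k : ℕ) : ℝ :=
  ⨅ B : {B : Matrix n n 𝕜 // B.rank ≤ k}, Matrix.opNorm2 (A - B.1)

/-- Entrywise expectation of a random matrix. -/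
noncomputable def matExp {Ω : Type*} [MeasurableSpace Ω] (μ : Measure Ω)
    {m n : Type*} (W : Ω → Matrix m n ℂ) : Matrix m n ℂ :=
  Matrix.of fun i j => ∫ ω, W ω i j ∂μ

/-- The parameter `σ(X) = max(‖E(XX*)‖^{1/2}, ‖E(X*X)‖^{1/2})`. -/
noncomputable def sigmaParam {Ω : Type*} [MeasurableSpace Ω] (μ : Measure Ω) {m : ℕ}
    (X : Ω → Matrix (Fin m) (Fin m) ℂ) : ℝ :=
  max (Real.sqrt (Matrix.opNorm2 (matExp μ fun ω => X ω * (X ω)ᴴ)))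
      (Real.sqrt (Matrix.opNorm2 (matExp μ fun ω => (X ω)ᴴ * X ω)))

/-- The covariance matrix `Cov(X) ∈ M_{m²}(ℂ)`, with entries
`Cov(X)_{(i,j),(k,l)} = E(X_{ij} conj(X_{kl})) − E(X_{ij}) conj(E(X_{kl}))`. -/
noncomputable def covMatrix {Ω : Type*} [MeasurableSpace Ω] (μ : Measure Ω) {m : ℕ}
    (X : Ω → Matrix (Fin m) (Fin m) ℂ) :
    Matrix (Fin m × Fin m) (Fin m × Fin m) ℂ :=
  Matrix.of fun p q =>
    (∫ ω, X ω p.1 p.2 * starRingEnd ℂ (X ω q.1 q.2) ∂μ)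
      - (∫ ω, X ω p.1 p.2 ∂μ) * starRingEnd ℂ (∫ ω, X ω q.1 q.2 ∂μ)

/-- The parameter `υ(X) = ‖Cov(X)‖^{1/2}`. -/
noncomputable def upsilonParam {Ω : Type*} [MeasurableSpace Ω] (μ : Measure Ω) {m : ℕ}
    (X : Ω → Matrix (Fin m) (Fin m) ℂ) : ℝ :=
  Real.sqrt (Matrix.opNorm2 (covMatrix μ X))

/-- The parameter `R_p(X) = (∑_t E Tr|Z_t|^{2p})^{1/(2p)}`, using that
`Tr|Z|^{2p} = Tr((Zᴴ Z)^p)`. -/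
noncomputable def RParam {Ω : Type*} [MeasurableSpace Ω] (μ : Measure Ω) {m T : ℕ}
    (Z : Fin T → Ω → Matrix (Fin m) (Fin m) ℂ) (p : ℕ) : ℝ :=
  (∑ t, ∫ ω, (((Z t ω)ᴴ * Z t ω) ^ p).trace.re ∂μ) ^ (1 / (2 * (p : ℝ)))

namespace NCK
noncomputable section
open scoped Matrix.Norms.L2Operator
open Finset (sum_comm mul_sum sum_mul univ mem_univ sum_add_distrib smul_sum sum_nonneg)
open Fintype (card sum_prod_type)
open Real (exp sin cos exp_pos exp_add exp_le_exp norm_eq_abs norm_of_nonneg sqrt log exp_zero sqrt_nonneg sq_sqrt)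
open Sum (inl inr)
open Filter.Eventually (of_forall)
open Function (update)
open Set (Icc Ioc Ioi uIoc)
open Complex (norm_real)
local notation:max "Mc" x:max => Matrix x x ℂ
local notation:max "crd" x:max => ((Fintype.card x : ℕ) : ℝ)
variable {n I V T E : Type*} [Fintype n] [DecidableEq n] [Fintype I] [DecidableEq I] [Fintype T] [DecidableEq T] [MeasurableSpace E] [NormedAddCommGroup V] [NormedSpace ℂ V] [CompleteSpace V] {κ ι Jx k : Type} [Fintype κ] [DecidableEq κ] [Fintype ι] [DecidableEq ι] [Fintype Jx] [DecidableEq Jx] [Fintype k] [DecidableEq k] {P : ι → Mc κ}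
theorem mlL {a b c : ℝ} (h : b ≤ c) (ha : 0 ≤ a) : a * b ≤ a * c := mul_le_mul_of_nonneg_left h ha
theorem mlR {a b c : ℝ} (h : b ≤ c) (ha : 0 ≤ a) : b * a ≤ c * a := mul_le_mul_of_nonneg_right h ha
theorem scg {α M : Type*} [AddCommMonoid M] {s : Finset α} {f g : α → M} (h : ∀ i, f i = g i) : ∑ i ∈ s, f i = ∑ i ∈ s, g i := Finset.sum_congr rfl fun i _ => h i
theorem sle {α : Type*} {s : Finset α} {f g : α → ℝ} (h : ∀ i, f i ≤ g i) : ∑ i ∈ s, f i ≤ ∑ i ∈ s, g i := Finset.sum_le_sum fun i _ => h i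
theorem nng {W : Type*} [SeminormedAddGroup W] {x : W} : 0 ≤ ‖x‖ := norm_nonneg x
abbrev Hm {I n : Type*} (B : I → Mc n) : Prop := ∀ i, (B i).IsHermitian
theorem exp0 {x : ℝ} : 0 ≤ exp x := x.exp_nonneg
@[reducible]
def ratAlg (n : Type*) [Fintype n] [DecidableEq n] : NormedAlgebra ℚ (Mc n) :=
  NormedAlgebra.restrictScalars ℚ ℂ (Mc n)
def ex (A : Mc n) : Mc n := NormedSpace.exp A
lemma ex_zero : ex (0 : Mc n) = 1 := by
  let _ := ratAlg n
  exact NormedSpace.exp_zero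
lemma ex_analytic (A : Mc n) : AnalyticAt ℂ (ex : Mc n → Mc n) A := by
  let _ := ratAlg n
  exact NormedSpace.exp_analytic A
lemma ex_differentiable : Differentiable ℂ (ex : Mc n → Mc n) :=
  fun A => (ex_analytic A).differentiableAt
@[fun_prop]
lemma ex_continuous : Continuous (ex : Mc n → Mc n) := ex_differentiable.continuous
lemma ex_hasDerivAt (A : Mc n) (x : ℝ) :
    HasDerivAt (fun x : ℝ => ex (x • A)) (ex (x • A) * A) x := hasDerivAt_exp_smul_const A x
lemma ex_hasDerivAt' (A : Mc n) (x : ℝ) :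
    HasDerivAt (fun x : ℝ => ex (x • A)) (A * ex (x • A)) x := hasDerivAt_exp_smul_const' A x
lemma ex_add (A : Mc n) (x y : ℝ) : ex ((x + y) • A) = ex (x • A) * ex (y • A) := by
  let _ := ratAlg n
  unfold ex
  rw [add_smul, NormedSpace.exp_add_of_commute]
  exact ((Commute.refl A).smul_left x).smul_right y
lemma ex_conj (U V A : Mc n) (h : U * V = 1) : ex (U * A * V) = U * ex A * V := by
  let _ := ratAlg n
  have : V = U⁻¹ := (inv_eq_right_inv h).symm
  subst this
  have hU : IsUnit U := by
    rw [isUnit_iff_isUnit_det]; exact isUnit_det_of_right_inverse h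
  exact Matrix.exp_conj U A hU
lemma ex_conjTranspose (A : Mc n) : (ex A)ᴴ = ex Aᴴ := (Matrix.exp_conjTranspose A).symm
lemma ex_diagonal (v : n → ℂ) : ex (diagonal v) = diagonal (fun i => Complex.exp (v i)) := by
  unfold ex
  rw [Matrix.exp_diagonal]
  congr 1
  funext i
  rw [Pi.coe_exp, Complex.exp_eq_exp_ℂ]
def Un (U : Mc n) : Prop := U * Uᴴ = 1 ∧ Uᴴ * U = 1
lemma ex_herm {K : Mc n} (hK : K.IsHermitian) (x : ℝ) : (ex (x • K)).IsHermitian := by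
  unfold IsHermitian
  rw [ex_conjTranspose]; congr 1
  rw [conjTranspose_smul, hK.eq]; simp
lemma eig {K : Mc n} (hK : K.IsHermitian) : ∃ (U : Mc n) (l : n → ℝ), Un U ∧
    K = U * diagonal (fun i => (l i : ℂ)) * Uᴴ ∧
    ∀ x : ℝ, ex (x • K) = U * diagonal (fun i => ((exp (x * l i) : ℝ) : ℂ)) * Uᴴ := by
  have h := hK.spectral_theorem
  rw [Unitary.conjStarAlgAut_apply] at h
  set U : Mc n := (hK.eigenvectorUnitary : Mc n)
  have h1 : U * Uᴴ = 1 := mem_unitaryGroup_iff.mp hK.eigenvectorUnitary.2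
  have h2 : Uᴴ * U = 1 := mem_unitaryGroup_iff'.mp hK.eigenvectorUnitary.2
  refine ⟨U, hK.eigenvalues, ⟨h1, h2⟩, h, fun x => ?_⟩
  have : x • K = U * diagonal (fun i => ((x * hK.eigenvalues i : ℝ) : ℂ)) * Uᴴ := by
    conv_lhs => rw [h]
    rw [star_eq_conjTranspose, ← smul_mul_assoc, ← mul_smul_comm, ← diagonal_smul]
    congr 3
    ext i
    simp [Function.comp]
  rw [this, ex_conj _ _ _ h1, ex_diagonal]
  simp
lemma norm_one_le : ‖(1 : Mc n)‖ ≤ 1 := by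
  rw [← diagonal_one, l2_opNorm_diagonal]
  refine (pi_norm_le_iff_of_nonneg zero_le_one).2 fun i => by simp
lemma norm_ex_le (A : Mc n) : ‖ex A‖ ≤ exp ‖A‖ := by
  let _ := ratAlg n
  have h1 := NormedSpace.exp_series_hasSum_exp' (𝕂 := ℂ) A
  have h2 : HasSum (fun k : ℕ => ‖A‖ ^ k / (k.factorial : ℝ)) (exp ‖A‖) := by
    have := NormedSpace.expSeries_div_hasSum_exp (𝔸 := ℝ) ‖A‖
    rwa [← Real.exp_eq_exp_ℝ] at this
  unfold ex
  rw [← h1.tsum_eq]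
  refine tsum_of_norm_bounded h2 fun k => ?_
  rw [norm_smul, norm_inv, Complex.norm_natCast, div_eq_inv_mul]
  gcongr
  rcases Nat.eq_zero_or_pos k with rfl | hk
  · simpa using norm_one_le
  · exact norm_pow_le' A hk
def hs {s t : Type*} [Fintype s] [Fintype t] (A : Matrix s t ℂ) : ℝ :=
  ∑ i, ∑ j, ‖A i j‖ ^ 2
lemma hs_nonneg {s t : Type*} [Fintype s] [Fintype t] (A : Matrix s t ℂ) : 0 ≤ hs A := by
  unfold hs; positivity
lemma hs_eq {s t : Type*} [Fintype s] [Fintype t] (A : Matrix s t ℂ) :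
    ((hs A : ℝ) : ℂ) = (A * Aᴴ).trace := by
  unfold hs
  simp only [trace, diag, Matrix.mul_apply, conjTranspose_apply]
  push_cast
  refine scg fun i => scg fun j => ?_
  rw [← Complex.mul_conj']; rfl
lemma hs_conjTranspose {s t : Type*} [Fintype s] [Fintype t] (A : Matrix s t ℂ) :
    hs Aᴴ = hs A := by
  unfold hs
  rw [sum_comm]
  simp
lemma hs_eq' {s t : Type*} [Fintype s] [Fintype t] (A : Matrix s t ℂ) :
    ((hs A : ℝ) : ℂ) = (Aᴴ * A).trace := by
  rw [← hs_conjTranspose, hs_eq, conjTranspose_conjTranspose]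
lemma norm_trace_mul_le (F G : Mc n) {r : ℝ} (hr : 0 < r) :
    ‖(F * G).trace‖ ≤ (r * hs F + hs G / r) / 2 := by
  have h1 : (F * G).trace = ∑ i, ∑ j, F i j * G j i := by
    simp [trace, Matrix.mul_apply]
  have h2 : hs G = ∑ i, ∑ j, ‖G j i‖ ^ 2 := by unfold hs; rw [sum_comm]
  rw [h1, h2]; unfold hs
  rw [mul_sum, Finset.sum_div, ← sum_add_distrib, Finset.sum_div]
  refine (norm_sum_le _ _).trans (sle fun i => ?_)
  rw [mul_sum, Finset.sum_div, ← sum_add_distrib, Finset.sum_div]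
  refine (norm_sum_le _ _).trans (sle fun j => ?_)
  rw [norm_mul]
  have : 0 ≤ (r * ‖F i j‖ - ‖G j i‖) ^ 2 / r := by positivity
  have e : (r * ‖F i j‖ - ‖G j i‖) ^ 2 / r = r * ‖F i j‖ ^ 2 + ‖G j i‖ ^ 2 / r - 2 * (‖F i j‖ * ‖G j i‖) := by
    field_simp; ring
  linarith
lemma hs_mul_le (Z G : Mc n) : hs (Z * G) ≤ ‖Z‖ ^ 2 * hs G := by
  have h2 : ∀ G : Mc n, hs G = ∑ i, ‖(WithLp.toLp 2 (fun j => G j i) : EuclideanSpace ℂ n)‖ ^ 2 := by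
    intro G
    unfold hs; rw [sum_comm]
    refine scg fun i => ?_
    rw [EuclideanSpace.norm_sq_eq]
  rw [h2, h2, mul_sum]
  refine sle fun i => ?_
  rw [← mul_pow]
  refine pow_le_pow_left₀ nng ?_ 2
  exact l2_opNorm_mulVec Z (WithLp.toLp 2 (fun j => G j i))
lemma norm_trace_mul3_le (F Z G : Mc n) {r : ℝ} (hr : 0 < r) (hZ : ‖Z‖ ≤ r) :
    ‖(F * Z * G).trace‖ ≤ r * (hs F + hs G) / 2 := by
  rw [mul_assoc]
  refine (norm_trace_mul_le F (Z * G) hr).trans ?_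
  have := hs_mul_le Z G
  have h3 : ‖Z‖ ^ 2 * hs G ≤ r ^ 2 * hs G :=
    mlR (pow_le_pow_left₀ nng hZ 2) (hs_nonneg _)
  have : hs (Z * G) / r ≤ r * hs G := by
    rw [div_le_iff₀ hr]; nlinarith
  linarith
lemma trace_diag_form {s t : Type*} [Fintype s] [DecidableEq s] [Fintype t] [DecidableEq t]
    (M : Matrix s t ℂ) (d : s → ℂ) (d' : t → ℂ) :
    (Mᴴ * diagonal d * M * diagonal d').trace = ∑ i, ∑ j, ((‖M i j‖ ^ 2 : ℝ) : ℂ) * d i * d' j := by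
  have e : ∀ i j, (diagonal d * M * diagonal d') i j = d i * M i j * d' j := by
    intro i j; rw [mul_diagonal, diagonal_mul]
  rw [Matrix.mul_assoc, Matrix.mul_assoc, ← Matrix.mul_assoc (diagonal d)]
  simp only [trace, diag, Matrix.mul_apply (M := Mᴴ), e, conjTranspose_apply]
  rw [sum_comm]
  refine scg fun i => scg fun j => ?_
  push_cast
  rw [← Complex.mul_conj']
  simp only [RCLike.star_def]
  ring
lemma trace_two_exp {K L : Mc n} (hK : K.IsHermitian) (hL : L.IsHermitian)
    (A : Mc n) : ∃ (M : Mc n) (l u : n → ℝ), ∀ x y : ℝ,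
    (Aᴴ * ex (x • K) * A * ex (y • L)).trace
      = ((∑ i, ∑ j, ‖M i j‖ ^ 2 * (exp (x * l i) * exp (y * u j)) : ℝ) : ℂ) := by
  obtain ⟨U, l, hU, -, hl⟩ := eig hK
  obtain ⟨V, u, hV, -, hu⟩ := eig hL
  refine ⟨Uᴴ * A * V, l, u, fun x y => ?_⟩
  rw [hl, hu]
  have := trace_diag_form (Uᴴ * A * V) (fun i => ((exp (x * l i) : ℝ) : ℂ))
    (fun i => ((exp (y * u i) : ℝ) : ℂ))
  have e : (Aᴴ * (U * diagonal (fun i => ((exp (x * l i) : ℝ) : ℂ)) * Uᴴ) * A *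
      (V * diagonal (fun i => ((exp (y * u i) : ℝ) : ℂ)) * Vᴴ)).trace =
      ((Uᴴ * A * V)ᴴ * diagonal (fun i => ((exp (x * l i) : ℝ) : ℂ)) * (Uᴴ * A * V) *
       diagonal (fun i => ((exp (y * u i) : ℝ) : ℂ))).trace := by
    rw [← mul_assoc, trace_mul_comm]
    simp only [conjTranspose_mul, conjTranspose_conjTranspose, mul_assoc]
  rw [e, this]
  push_cast
  simp only [mul_assoc]
lemma T2 {K L : Mc n} (hK : K.IsHermitian) (hL : L.IsHermitian)
    (A : Mc n) {x y : ℝ} (hx : 0 ≤ x) (hy : 0 ≤ y) (hxy : x + y = 1) :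
    ∃ r : ℝ, (Aᴴ * ex (x • K) * A * ex (y • L)).trace = r ∧ 0 ≤ r ∧
      r ≤ x * ((A * Aᴴ * ex K).trace).re + y * ((Aᴴ * A * ex L).trace).re := by
  obtain ⟨M, l, u, h⟩ := trace_two_exp hK hL A
  refine ⟨_, h x y, by positivity, ?_⟩
  have h1 := h 1 0
  have h2 := h 0 1
  rw [one_smul, zero_smul, ex_zero, mul_one] at h1
  rw [one_smul, zero_smul, ex_zero, mul_one] at h2
  have h1' : (A * Aᴴ * ex K).trace = (Aᴴ * ex K * A).trace := by
    rw [mul_assoc, trace_mul_comm]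
  rw [h1', h1, h2, Complex.ofReal_re, Complex.ofReal_re, mul_sum, mul_sum,
    ← sum_add_distrib]
  refine sle fun i => ?_
  rw [mul_sum, mul_sum, ← sum_add_distrib]
  refine sle fun j => ?_
  have hc := convexOn_exp.2 (Set.mem_univ (l i)) (Set.mem_univ (u j)) hx hy hxy
  simp only [smul_eq_mul] at hc
  rw [exp_add] at hc
  simp only [one_mul, zero_mul, exp_zero, mul_one]
  have := mlL hc (sq_nonneg ‖M i j‖)
  linarith
def rtr (A : Mc n) : ℝ := A.trace.re
def q (Z K : Mc n) : ℝ := rtr (Z * Z * ex K)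
lemma T2h {K L : Mc n} (hK : K.IsHermitian) (hL : L.IsHermitian)
    {A : Mc n} (hA : A.IsHermitian) {x y : ℝ} (hx : 0 ≤ x) (hy : 0 ≤ y) (hxy : x + y = 1) :
    ∃ r : ℝ, (A * ex (x • K) * A * ex (y • L)).trace = r ∧ 0 ≤ r ∧ r ≤ x * q A K + y * q A L := by
  have := T2 hK hL A hx hy hxy
  rwa [hA.eq] at this
lemma q_nonneg {Z K : Mc n} (hZ : Z.IsHermitian) (hK : K.IsHermitian) : 0 ≤ q Z K := by
  obtain ⟨r, h1, h2, -⟩ := T2h hK hK hZ (x := 0) (y := 1) le_rfl zero_le_one (by simp)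
  rw [zero_smul, ex_zero, mul_one, one_smul] at h1
  rw [q, rtr, h1]; simpa using h2
lemma q_eq {Z K : Mc n} (hZ : Z.IsHermitian) (hK : K.IsHermitian) :
    (Z * Z * ex K).trace = q Z K := by
  obtain ⟨r, h1, h2, -⟩ := T2h hK hK hZ (x := 0) (y := 1) le_rfl zero_le_one (by simp)
  rw [zero_smul, ex_zero, mul_one, one_smul] at h1
  rw [q, rtr, h1]; simp
lemma hs_exp_le {K L Z : Mc n} (hK : K.IsHermitian) (hL : L.IsHermitian)
    (hZ : Z.IsHermitian) {x y : ℝ} (hx : 0 ≤ x) (hy : 0 ≤ y) (hxy : x + y = 1 / 2) :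
    hs (ex (x • K) * Z * ex (y • L)) ≤ q Z K + q Z L := by
  have h0 : ((hs (ex (x • K) * Z * ex (y • L)) : ℝ) : ℂ) =
      (Z * ex ((2 * x) • K) * Z * ex ((2 * y) • L)).trace := by
    rw [hs_eq']
    simp only [conjTranspose_mul, (ex_herm hK x).eq, (ex_herm hL y).eq, hZ.eq]
    rw [two_mul, ex_add, two_mul, ex_add]
    simp only [mul_assoc]
    rw [trace_mul_comm]
    simp only [mul_assoc]
  obtain ⟨r, h1, h2, h3⟩ := T2h hK hL hZ (x := 2 * x) (y := 2 * y) (by linarith) (by linarith) (by linarith)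
  rw [h1] at h0
  have := q_nonneg hZ hK
  have := q_nonneg hZ hL
  rw [Complex.ofReal_inj.1 h0]
  nlinarith
lemma T3core {K1 K2 K3 Z1 Z2 Z3 : Mc n} (hK1 : K1.IsHermitian) (hK2 : K2.IsHermitian)
    (hK3 : K3.IsHermitian) (hZ1 : Z1.IsHermitian) (hZ3 : Z3.IsHermitian)
    {r : ℝ} (hr : 0 < r) (h2 : ‖Z2‖ ≤ r) {a b c : ℝ} (ha : 0 ≤ a) (hb : 0 ≤ b)
    (ha' : a ≤ 1 / 2) (hb' : b ≤ 1 / 2) (habc : a + b + c = 1) :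
    ‖(Z1 * ex (a • K1) * Z2 * ex (b • K2) * Z3 * ex (c • K3)).trace‖
      ≤ r * (q Z1 K3 + q Z1 K1 + q Z3 K2 + q Z3 K3) := by
  have hc : c = (1/2 - b) + (1/2 - a) := by linarith
  have e : (Z1 * ex (a • K1) * Z2 * ex (b • K2) * Z3 * ex (c • K3)).trace =
     ((ex ((1/2 - a) • K3) * Z1 * ex (a • K1)) * Z2 * (ex (b • K2) * Z3 * ex ((1/2 - b) • K3))).trace := by
    rw [hc, ex_add, ← mul_assoc, trace_mul_comm]
    simp only [mul_assoc]
  rw [e]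
  refine (norm_trace_mul3_le _ _ _ hr h2).trans ?_
  have e1 := hs_exp_le hK3 hK1 hZ1 (x := 1/2 - a) (y := a) (by linarith) ha (by linarith)
  have e2 := hs_exp_le hK2 hK3 hZ3 (x := b) (y := 1/2 - b) hb (by linarith) (by linarith)
  have := hs_nonneg (ex ((1/2 - a) • K3) * Z1 * ex (a • K1))
  have := hs_nonneg (ex (b • K2) * Z3 * ex ((1/2 - b) • K3))
  nlinarith
lemma T3 {K1 K2 K3 Z1 Z2 Z3 : Mc n} (hK1 : K1.IsHermitian) (hK2 : K2.IsHermitian)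
    (hK3 : K3.IsHermitian) (hZ1 : Z1.IsHermitian) (hZ2 : Z2.IsHermitian) (hZ3 : Z3.IsHermitian)
    {r : ℝ} (hr : 0 < r) (h1 : ‖Z1‖ ≤ r) (h2 : ‖Z2‖ ≤ r) (h3 : ‖Z3‖ ≤ r)
    {a b c : ℝ} (ha : 0 ≤ a) (hb : 0 ≤ b) (hc : 0 ≤ c) (habc : a + b + c = 1) :
    ‖(Z1 * ex (a • K1) * Z2 * ex (b • K2) * Z3 * ex (c • K3)).trace‖
      ≤ r * (q Z1 K1 + q Z1 K2 + q Z1 K3 + q Z2 K1 + q Z2 K2 + q Z2 K3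
        + q Z3 K1 + q Z3 K2 + q Z3 K3) := by
  have p11 := q_nonneg hZ1 hK1
  have p12 := q_nonneg hZ1 hK2
  have p13 := q_nonneg hZ1 hK3
  have p21 := q_nonneg hZ2 hK1
  have p22 := q_nonneg hZ2 hK2
  have p23 := q_nonneg hZ2 hK3
  have p31 := q_nonneg hZ3 hK1
  have p32 := q_nonneg hZ3 hK2
  have p33 := q_nonneg hZ3 hK3
  by_cases h : a ≤ 1 / 2
  · by_cases h' : b ≤ 1 / 2
    · refine (T3core hK1 hK2 hK3 hZ1 hZ3 hr h2 ha hb h h' habc).trans ?_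
      refine mlL ?_ hr.le
      linarith
    · have e : (Z1 * ex (a • K1) * Z2 * ex (b • K2) * Z3 * ex (c • K3)).trace =
        (Z3 * ex (c • K3) * Z1 * ex (a • K1) * Z2 * ex (b • K2)).trace := by
        rw [mul_assoc _ Z3, trace_mul_comm]; simp only [mul_assoc]
      rw [e]
      refine (T3core hK3 hK1 hK2 hZ3 hZ2 hr h1 hc ha (by linarith) h (by linarith)).trans ?_
      refine mlL ?_ hr.le
      linarith
  · have e : (Z1 * ex (a • K1) * Z2 * ex (b • K2) * Z3 * ex (c • K3)).trace =
        (Z2 * ex (b • K2) * Z3 * ex (c • K3) * Z1 * ex (a • K1)).trace := by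
        have : Z1 * ex (a • K1) * Z2 * ex (b • K2) * Z3 * ex (c • K3) =
          (Z1 * ex (a • K1)) * (Z2 * ex (b • K2) * Z3 * ex (c • K3)) := by simp only [mul_assoc]
        rw [this, trace_mul_comm]; simp only [mul_assoc]
    rw [e]
    refine (T3core hK2 hK3 hK1 hZ2 hZ1 hr h3 hb hc (by linarith) (by linarith) (by linarith)).trans ?_
    refine mlL ?_ hr.le
    linarith
def trL (P Q : Mc n) : Mc n →L[ℂ] ℂ :=
  LinearMap.toContinuousLinearMap
    { toFun := fun M => (P * M * Q).trace
      map_add' := by intro x y; simp [mul_add, add_mul]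
      map_smul' := by intro c x; simp }
@[simp] lemma trL_apply (P Q M : Mc n) : trL P Q M = (P * M * Q).trace := rfl
def enL (P Q : Mc n) (i j : n) : Mc n →L[ℂ] ℂ :=
  LinearMap.toContinuousLinearMap
    { toFun := fun M => (P * M * Q) i j
      map_add' := by intro x y; simp [mul_add, add_mul]
      map_smul' := by intro c x; simp }
@[simp] lemma enL_apply (P Q M : Mc n) (i j : n) : enL P Q i j M = (P * M * Q) i j := rfl
lemma duh_deriv (K1 K0 : Mc n) (a b : ℝ) :
    HasDerivAt (fun b : ℝ => ex (b • K1) * ex ((a - b) • K0))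
      (ex (b • K1) * (K1 - K0) * ex ((a - b) • K0)) b := by
  have h1 := ex_hasDerivAt K1 b
  have h2 : HasDerivAt (fun b : ℝ => ex ((a - b) • K0)) (-(K0 * ex ((a - b) • K0))) b := by
    have := (ex_hasDerivAt' K0 (a - b)).scomp b ((hasDerivAt_id b).const_sub a)
    refine HasDerivAt.congr_deriv (this :) ?_
    simp
  refine HasDerivAt.congr_deriv (h1.mul h2) ?_
  rw [mul_sub, sub_mul, mul_neg, ← sub_eq_add_neg]
  simp only [mul_assoc]
lemma duh_bound (l : Mc n →L[ℂ] ℂ) (K1 K0 : Mc n) {a C : ℝ} (ha : 0 ≤ a) (ha1 : a ≤ 1)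
    (h : ∀ b, 0 ≤ b → b ≤ a → ‖l (ex (b • K1) * (K1 - K0) * ex ((a - b) • K0))‖ ≤ C) :
    ‖l (ex (a • K1)) - l (ex (a • K0))‖ ≤ C := by
  have hC : 0 ≤ C := nng.trans (h 0 le_rfl ha)
  have hd : ∀ b : ℝ, HasDerivAt (fun b : ℝ => l (ex (b • K1) * ex ((a - b) • K0)))
      (l (ex (b • K1) * (K1 - K0) * ex ((a - b) • K0))) b := fun b =>
    (l.restrictScalars ℝ).hasFDerivAt.comp_hasDerivAt b (duh_deriv K1 K0 a b)
  have := norm_image_sub_le_of_norm_deriv_le_segment' (f := fun b : ℝ => l (ex (b • K1) * ex ((a - b) • K0)))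
    (a := 0) (b := a) (C := C) (fun x _ => (hd x).hasDerivWithinAt)
    (fun x hx => h x hx.1 hx.2.le) a ⟨ha, le_rfl⟩
  simp only [sub_self, zero_smul, ex_zero, mul_one, one_mul, sub_zero] at this
  exact this.trans (mul_le_of_le_one_right hC ha1)
def J (K B : Mc n) : Mc n :=
  ∫ a in 0..1, ex (a • K) * B * ex ((1 - a) • K)
lemma J_cont (K B : Mc n) : Continuous (fun a : ℝ => ex (a • K) * B * ex ((1 - a) • K)) := by
  fun_prop
lemma duhamel (K1 K0 : Mc n) :
    ex K1 - ex K0 = ∫ a in 0..1, ex (a • K1) * (K1 - K0) * ex ((1 - a) • K0) := by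
  rw [intervalIntegral.integral_eq_sub_of_hasDerivAt (f := fun b : ℝ => ex (b • K1) * ex ((1 - b) • K0))]
  · simp [ex_zero]
  · intro x _; exact duh_deriv K1 K0 1 x
  · apply Continuous.intervalIntegrable; fun_prop
lemma J_hasDerivAt (K B : Mc n) :
    HasDerivAt (fun s : ℝ => ex (K + s • B)) (J K B) 0 := by
  set f : ℝ → Mc n := fun s => ∫ a in 0..1, ex (a • (K + s • B)) * B * ex ((1 - a) • K)
  have hf : Continuous f := by
    apply intervalIntegral.continuous_parametric_intervalIntegral_of_continuous'
    unfold Function.uncurry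
    fun_prop
  have h0 : f 0 = J K B := by simp [f, J]
  have h1 : ∀ s : ℝ, ex (K + s • B) = ex K + s • f s := by
    intro s
    rw [← sub_eq_iff_eq_add', duhamel]
    simp only [f]
    rw [← intervalIntegral.integral_smul]
    congr 1
    funext a
    simp
  rw [hasDerivAt_iff_tendsto_slope]
  have : Filter.Tendsto f (nhdsWithin 0 {0}ᶜ) (nhds (J K B)) := by
    rw [← h0]; exact (hf.tendsto 0).mono_left nhdsWithin_le_nhds
  refine this.congr' ?_
  filter_upwards [self_mem_nhdsWithin] with s hs
  rw [slope_def_module, h1 s, h1 0, zero_smul, add_zero, add_sub_cancel_left, sub_zero, smul_smul,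
    inv_mul_cancel₀ hs, one_smul]
lemma J_eq_fderiv (K B : Mc n) : J K B = fderiv ℂ ex K B := by
  have h1 := (ex_differentiable K).hasFDerivAt.restrictScalars ℝ
  have h2 : HasDerivAt (fun s : ℝ => K + s • B) B 0 := by
    have := ((hasDerivAt_id (0:ℝ)).smul_const B).const_add K
    simpa using this
  have h3 := HasFDerivAt.comp_hasDerivAt (x := (0:ℝ)) (f := fun s : ℝ => K + s • B)
    (l := ex) (l' := (fderiv ℂ ex K).restrictScalars ℝ) (by simpa using h1) h2
  exact (J_hasDerivAt K B).unique h3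
lemma J_norm_le (K B : Mc n) : ‖J K B‖ ≤ ‖B‖ * exp ‖K‖ := by
  unfold J
  have := intervalIntegral.norm_integral_le_of_norm_le_const (a := (0:ℝ)) (b := 1)
    (f := fun a : ℝ => ex (a • K) * B * ex ((1 - a) • K)) (C := ‖B‖ * exp ‖K‖) ?_
  · simpa using this
  · intro x hx
    rw [Set.uIoc_of_le zero_le_one] at hx
    have h1 := norm_ex_le (x • K)
    have h2 := norm_ex_le ((1 - x) • K)
    rw [norm_smul, norm_of_nonneg hx.1.le] at h1
    rw [norm_smul, norm_of_nonneg (by linarith [hx.2])] at h2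
    calc _ ≤ ‖ex (x • K)‖ * ‖B‖ * ‖ex ((1 - x) • K)‖ :=
          (norm_mul_le _ _).trans (mlR (norm_mul_le _ _) nng)
      _ ≤ exp (x * ‖K‖) * ‖B‖ * exp ((1 - x) * ‖K‖) := by gcongr
      _ = ‖B‖ * exp ‖K‖ := by
          rw [mul_right_comm, ← exp_add, mul_comm]; congr 2; ring
lemma trace_mul_J (Y K B : Mc n) :
    (Y * J K B).trace = ∫ a in 0..1, (Y * ex (a • K) * B * ex ((1 - a) • K)).trace := by
  have := (trL Y 1).intervalIntegral_comp_comm (μ := volume) (a := 0) (b := 1)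
    ((J_cont K B).intervalIntegrable 0 1)
  simp only [trL_apply, mul_one] at this
  rw [J, ← this]
  simp only [mul_assoc]
lemma J_eig {K U : Mc n} {l : n → ℝ} (hU : Un U)
    (hl : ∀ x : ℝ, ex (x • K) = U * diagonal (fun i => ((exp (x * l i) : ℝ) : ℂ)) * Uᴴ)
    (x : ℝ) : ∃ mm : n → n → ℝ, (∀ i j, 0 ≤ mm i j ∧
      mm i j ≤ (exp (x * l i) + exp (x * l j)) / 2) ∧
      ∀ B, J (x • K) B = U * (of fun i j => (Uᴴ * B * U) i j * (mm i j : ℂ)) * Uᴴ := by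
  refine ⟨fun i j => ∫ a in 0..1, exp (a * x * l i + (1 - a) * x * l j), fun i j => ⟨?_, ?_⟩, fun B => ?_⟩
  · exact intervalIntegral.integral_nonneg zero_le_one fun a _ => exp0
  · have hb : ∫ a in 0..1, exp (a * x * l i + (1 - a) * x * l j) ≤
        ∫ a in 0..1, (a * exp (x * l i) + (1 - a) * exp (x * l j)) := by
      apply intervalIntegral.integral_mono_on zero_le_one
      · apply Continuous.intervalIntegrable; fun_prop
      · apply Continuous.intervalIntegrable; fun_prop
      · intro a ha
        have hc := convexOn_exp.2 (Set.mem_univ (x * l i)) (Set.mem_univ (x * l j)) ha.1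
          (sub_nonneg.2 ha.2) (by ring)
        simp only [smul_eq_mul] at hc
        simpa only [mul_assoc] using hc
    refine hb.trans (le_of_eq ?_)
    rw [intervalIntegral.integral_add, intervalIntegral.integral_mul_const,
      intervalIntegral.integral_mul_const, intervalIntegral.integral_sub]
    · simp; ring
    all_goals apply Continuous.intervalIntegrable; fun_prop
  · have h1 : Uᴴ * J (x • K) B * U = of fun i j => (Uᴴ * B * U) i j *
        ((∫ a in 0..1, exp (a * x * l i + (1 - a) * x * l j) : ℝ) : ℂ) := by
      ext i j
      have := (enL Uᴴ U i j).intervalIntegral_comp_comm (μ := volume) (a := 0) (b := 1)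
        ((J_cont (x • K) B).intervalIntegrable 0 1)
      simp only [enL_apply] at this
      rw [J, ← this, of_apply, ← intervalIntegral.integral_ofReal,
        ← intervalIntegral.integral_const_mul]
      congr 1
      funext a
      rw [smul_smul, smul_smul, hl, hl]
      have e : Uᴴ * (U * diagonal (fun i => ((exp (a * x * l i) : ℝ) : ℂ)) * Uᴴ * B *
          (U * diagonal (fun i => ((exp ((1 - a) * x * l i) : ℝ) : ℂ)) * Uᴴ)) * U
          = (Uᴴ * U) * diagonal (fun i => ((exp (a * x * l i) : ℝ) : ℂ)) * (Uᴴ * B * U) *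
            diagonal (fun i => ((exp ((1 - a) * x * l i) : ℝ) : ℂ)) * (Uᴴ * U) := by
        simp only [mul_assoc]
      rw [e, hU.2, one_mul, mul_one, mul_diagonal, diagonal_mul, exp_add]
      push_cast
      ring
    rw [← h1]
    simp only [mul_assoc]
    rw [hU.1, mul_one, ← mul_assoc, hU.1, one_mul]
lemma norm_entry_le (M : Mc n) (i j : n) : ‖M i j‖ ≤ ‖M‖ := by
  have h := l2_opNorm_mulVec M (EuclideanSpace.single j (1:ℂ))
  rw [EuclideanSpace.norm_single, norm_one, mul_one] at h
  refine le_trans ?_ h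
  refine le_trans (le_of_eq ?_) (PiLp.norm_apply_le _ i)
  simp
lemma Un.norm_le {U : Mc n} (hU : Un U) : ‖U‖ ≤ 1 := by
  have h := CStarRing.norm_star_mul_self (x := U)
  rw [star_eq_conjTranspose, hU.2] at h
  have := norm_one_le (n := n)
  nlinarith [norm_nonneg U]
lemma Un.ct {U : Mc n} (hU : Un U) : Un Uᴴ := ⟨by simpa using hU.2, by simpa using hU.1⟩
lemma hs_conj {U V F : Mc n} (hU : Un U) (hV : Un V) : hs (U * F * V) = hs F := by
  have h1 : hs (U * F) = hs F := by
    have := hs_eq' (U * F)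
    rw [conjTranspose_mul, mul_assoc, ← mul_assoc Uᴴ, hU.2, one_mul, ← hs_eq'] at this
    exact_mod_cast this
  rw [← h1]
  have := hs_eq (U * F * V)
  rw [conjTranspose_mul, mul_assoc (U * F) V, ← mul_assoc V, hV.1, one_mul, ← hs_eq] at this
  exact_mod_cast this
def HsB {ι s t : Type*} [Fintype ι] [Fintype s] [Fintype t] (M : ι → Matrix s t ℂ) (v : ℝ) : Prop :=
  ∀ x : ι → ℂ, hs (∑ j, x j • M j) ≤ v * ∑ j, ‖x j‖ ^ 2
lemma HsB.conj {ι : Type*} [Fintype ι] {A : ι → Mc n} {v : ℝ} (h : HsB A v)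
    {U V : Mc n} (hU : Un U) (hV : Un V) : HsB (fun j => U * A j * V) v := by
  intro x
  have : ∑ j, x j • (U * A j * V) = U * (∑ j, x j • A j) * V := by
    simp [mul_sum, sum_mul]
  rw [this, hs_conj hU hV]
  exact h x
lemma row_bound {ι : Type*} [Fintype ι] {A : ι → Mc n} (hA : Hm A)
    {s2 : ℝ} (h : ‖∑ j, A j * A j‖ ≤ s2)
    {U V : Mc n} (hU : Un U) (hV : Un V) (k : n) :
    ∑ p, ∑ j, ‖(U * A j * V) k p‖ ^ 2 ≤ s2 := by
  have h1 : ((∑ p, ∑ j, ‖(U * A j * V) k p‖ ^ 2 : ℝ) : ℂ) = (U * (∑ j, A j * A j) * Uᴴ) k k := by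
    have : U * (∑ j, A j * A j) * Uᴴ = ∑ j, (U * A j * V) * (U * A j * V)ᴴ := by
      rw [mul_sum, sum_mul]
      refine scg fun j => ?_
      simp only [conjTranspose_mul, (hA j).eq, mul_assoc]
      rw [← mul_assoc V, hV.1, one_mul]
    rw [this, Matrix.sum_apply, sum_comm]
    push_cast
    refine scg fun j => ?_
    rw [Matrix.mul_apply]
    refine scg fun p => ?_
    rw [conjTranspose_apply, ← Complex.mul_conj']; rfl
  have h2 : ‖(U * (∑ j, A j * A j) * Uᴴ) k k‖ ≤ s2 := by
    refine (norm_entry_le _ k k).trans (le_trans ?_ h)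
    refine (norm_mul_le _ _).trans ?_
    refine (mul_le_of_le_one_right nng hU.ct.norm_le).trans ?_
    refine (norm_mul_le _ _).trans ?_
    exact mul_le_of_le_one_left nng hU.norm_le
  rw [← h1, norm_real] at h2
  exact (Real.le_norm_self _).trans h2
lemma col_bound {ι : Type*} [Fintype ι] {A : ι → Mc n} (hA : Hm A)
    {s2 : ℝ} (h : ‖∑ j, A j * A j‖ ≤ s2)
    {U V : Mc n} (hU : Un U) (hV : Un V) (p : n) :
    ∑ k, ∑ j, ‖(U * A j * V) k p‖ ^ 2 ≤ s2 := by
  have := row_bound hA h hV.ct hU.ct p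
  refine le_trans (le_of_eq ?_) this
  refine scg fun k => scg fun j => ?_
  have : Vᴴ * A j * Uᴴ = (U * A j * V)ᴴ := by
    simp only [conjTranspose_mul, (hA j).eq, mul_assoc]
  rw [this, conjTranspose_apply, norm_star]
lemma gam {ι s s' t' : Type*} [Fintype ι] [Fintype s] [Fintype s'] [Fintype t']
    (x : ι → s → ℂ) (M : ι → Matrix s' t' ℂ) {v s2 : ℝ} (hv : 0 ≤ v) (hM : HsB M v)
    (hx : ∑ p, ∑ j, ‖x j p‖ ^ 2 ≤ s2) :
    ∑ p, ∑ a, ∑ b, ‖∑ j, x j p * M j a b‖ ^ 2 ≤ v * s2 := by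
  calc _ ≤ ∑ p, v * ∑ j, ‖x j p‖ ^ 2 := by
        refine sle fun p => ?_
        have := hM (fun j => x j p)
        unfold hs at this
        simpa [Matrix.sum_apply] using this
    _ = v * ∑ p, ∑ j, ‖x j p‖ ^ 2 := by rw [mul_sum]
    _ ≤ v * s2 := mlL hx hv
lemma sum4 (F : n → n → n → n → ℝ) (m1 m2 m3 m4 : n → ℝ) (D : ℝ)
    (hm1 : ∀ i, 0 ≤ m1 i) (hm2 : ∀ i, 0 ≤ m2 i) (hm3 : ∀ i, 0 ≤ m3 i) (hm4 : ∀ i, 0 ≤ m4 i)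
    (h1 : ∀ k, ∑ p, ∑ q, ∑ l, F k p q l ≤ D) (h2 : ∀ p, ∑ k, ∑ q, ∑ l, F k p q l ≤ D)
    (h3 : ∀ q, ∑ l, ∑ k, ∑ p, F k p q l ≤ D) (h4 : ∀ l, ∑ q, ∑ k, ∑ p, F k p q l ≤ D) :
    ∑ k, ∑ p, ∑ q, ∑ l, (m1 k + m2 p + m3 q + m4 l) * F k p q l
      ≤ D * (∑ i, m1 i + ∑ i, m2 i + ∑ i, m3 i + ∑ i, m4 i) := by
  have e1 : ∑ k, ∑ p, ∑ q, ∑ l, m1 k * F k p q l ≤ D * ∑ i, m1 i := by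
    rw [mul_sum]
    refine sle fun k => ?_
    simp_rw [← mul_sum]
    nlinarith [hm1 k, h1 k]
  have e2 : ∑ k, ∑ p, ∑ q, ∑ l, m2 p * F k p q l ≤ D * ∑ i, m2 i := by
    rw [mul_sum, sum_comm]
    refine sle fun k => ?_
    simp_rw [← mul_sum]
    nlinarith [hm2 k, h2 k]
  have e3 : ∑ k, ∑ p, ∑ q, ∑ l, m3 q * F k p q l ≤ D * ∑ i, m3 i := by
    have : ∑ k, ∑ p, ∑ q, ∑ l, m3 q * F k p q l = ∑ q, ∑ l, ∑ k, ∑ p, m3 q * F k p q l := by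
      calc _ = ∑ k, ∑ q, ∑ l, ∑ p, m3 q * F k p q l := by
            refine scg fun k => ?_
            rw [sum_comm]
            exact scg fun q => sum_comm
        _ = _ := by
            rw [sum_comm]
            exact scg fun q => sum_comm
    rw [mul_sum, this]
    refine sle fun k => ?_
    simp_rw [← mul_sum]
    nlinarith [hm3 k, h3 k]
  have e4 : ∑ k, ∑ p, ∑ q, ∑ l, m4 l * F k p q l ≤ D * ∑ i, m4 i := by
    have : ∑ k, ∑ p, ∑ q, ∑ l, m4 l * F k p q l = ∑ l, ∑ q, ∑ k, ∑ p, m4 l * F k p q l := by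
      rw [sum_comm (f := fun l q => ∑ k, ∑ p, m4 l * F k p q l)]
      calc _ = ∑ k, ∑ q, ∑ l, ∑ p, m4 l * F k p q l := by
            refine scg fun k => ?_
            rw [sum_comm]
            exact scg fun q => sum_comm
        _ = _ := by
            rw [sum_comm]
            exact scg fun q => sum_comm
    rw [mul_sum, this]
    refine sle fun k => ?_
    simp_rw [← mul_sum]
    nlinarith [hm4 k, h4 k]
  simp only [add_mul, sum_add_distrib, mul_add]
  linarith
lemma trace_mul4 (A B C D : Mc n) :
    (A * B * C * D).trace = ∑ k, ∑ p, ∑ q, ∑ l, A k p * B p q * C q l * D l k := by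
  simp only [trace, diag, mul_assoc]
  refine scg fun k => ?_
  simp only [Matrix.mul_apply, mul_sum, mul_assoc]
lemma tr_ex_eq {K U : Mc n} {l : n → ℝ} (hU : Un U)
    (hl : ∀ x : ℝ, ex (x • K) = U * diagonal (fun i => ((exp (x * l i) : ℝ) : ℂ)) * Uᴴ) :
    rtr (ex K) = ∑ i, exp (l i) := by
  have := hl 1
  rw [one_smul] at this
  rw [rtr, this, trace_mul_comm, ← mul_assoc, hU.2, one_mul, trace_diagonal, ← Complex.ofReal_sum, Complex.ofReal_re]
  simp
lemma crossing {ι κ : Type*} [Fintype ι] [Fintype κ] {A : ι → Mc n} {B : κ → Mc n}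
    (hA : Hm A) (hB : Hm B) {v s2 N : ℝ} (hN : 0 < N)
    (hv : 0 ≤ v)
    (hsA : HsB A (N * v)) (hsB : HsB B (v / N)) (h2A : ‖∑ j, A j * A j‖ ≤ s2)
    (h2B : ‖∑ j, B j * B j‖ ≤ s2) {K L : Mc n} (hK : K.IsHermitian) (hL : L.IsHermitian)
    {a b : ℝ} (ha : 0 ≤ a) (hb : 0 ≤ b) (hab : a + b = 1) :
    ‖∑ i, ∑ j, (A j * J (a • K) (B i) * A j * J (b • L) (B i)).trace‖
      ≤ v * s2 * (rtr (ex K) + rtr (ex L)) := by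
  obtain ⟨U, l, hU, -, hl⟩ := eig hK
  obtain ⟨V, u, hV, -, hu⟩ := eig hL
  obtain ⟨mm, hmm, hJ⟩ := J_eig hU hl a
  obtain ⟨nn, hnn, hJ'⟩ := J_eig hV hu b
  rw [tr_ex_eq hU hl, tr_ex_eq hV hu]
  set GA : n → n → n → n → ℂ := fun k p q l =>
    ∑ j, (Vᴴ * A j * U) k p * (Uᴴ * A j * V) q l with hGA
  set GB : n → n → n → n → ℂ := fun k p q l =>
    ∑ i, (Uᴴ * B i * U) p q * (Vᴴ * B i * V) l k with hGB
  have e1 : ∑ i, ∑ j, (A j * J (a • K) (B i) * A j * J (b • L) (B i)).trace =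
      ∑ k, ∑ p, ∑ q, ∑ l, ((mm p q * nn l k : ℝ) : ℂ) * (GA k p q l * GB k p q l) := by
    have : ∀ i j, (A j * J (a • K) (B i) * A j * J (b • L) (B i)).trace =
      ∑ k, ∑ p, ∑ q, ∑ l, ((mm p q * nn l k : ℝ) : ℂ) * (((Vᴴ * A j * U) k p * (Uᴴ * A j * V) q l)
        * ((Uᴴ * B i * U) p q * (Vᴴ * B i * V) l k)) := by
      intro i j
      rw [hJ, hJ']
      have : (A j * (U * (of fun i_1 j => (Uᴴ * B i * U) i_1 j * (mm i_1 j : ℂ)) * Uᴴ) * A j *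
          (V * (of fun i_1 j => (Vᴴ * B i * V) i_1 j * (nn i_1 j : ℂ)) * Vᴴ)).trace
          = ((Vᴴ * A j * U) * (of fun i_1 j => (Uᴴ * B i * U) i_1 j * (mm i_1 j : ℂ)) *
            (Uᴴ * A j * V) * (of fun i_1 j => (Vᴴ * B i * V) i_1 j * (nn i_1 j : ℂ))).trace := by
        rw [← mul_assoc, trace_mul_comm]
        simp only [mul_assoc]
      rw [this, trace_mul4]
      refine scg fun k => scg fun p =>
        scg fun q => scg fun l => ?_
      simp only [of_apply]
      push_cast
      ring
    simp only [this]
    have sw : ∀ (f : κ → ι → n → n → n → n → ℂ), ∑ i, ∑ j, ∑ k, ∑ p, ∑ q, ∑ l, f i j k p q l =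
        ∑ k, ∑ p, ∑ q, ∑ l, ∑ i, ∑ j, f i j k p q l := by
      intro f
      have step : ∀ g : κ → ι → n → ℂ, ∑ i, ∑ j, ∑ k, g i j k = ∑ k, ∑ i, ∑ j, g i j k := by
        intro g
        rw [sum_comm]
        simp only [sum_comm (s := (univ : Finset κ)) (t := (univ : Finset n))]
        rw [sum_comm]
        refine scg fun k => ?_
        rw [sum_comm]
      rw [step]
      refine scg fun k => ?_
      rw [step]
      refine scg fun k => ?_
      rw [step]
      refine scg fun k => ?_
      rw [step]
    rw [sw]
    refine scg fun k => scg fun p =>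
        scg fun q => scg fun l => ?_
    simp only [← mul_sum, ← sum_mul]
    rw [hGA, hGB]
  rw [e1]
  set F : n → n → n → n → ℝ := fun k p q l =>
    ‖GA k p q l‖ ^ 2 / N + N * ‖GB k p q l‖ ^ 2 with hF
  have hpt : ∀ k p q t, ‖((mm p q * nn t k : ℝ) : ℂ) * (GA k p q t * GB k p q t)‖ ≤
      (1/4) * ((exp (u k) + exp (l p) + exp (l q) + exp (u t)) * F k p q t) := by
    intro k p q t
    rw [norm_mul, norm_real, norm_mul (GA k p q t)]
    have hexp : ∀ x y : ℝ, exp (a * x) * exp (b * y) ≤ exp x + exp y := by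
      intro x y
      have hc := convexOn_exp.2 (Set.mem_univ x) (Set.mem_univ y) ha hb hab
      simp only [smul_eq_mul] at hc
      rw [← exp_add]
      have := exp_pos x
      have := exp_pos y
      nlinarith
    have h1 : ‖mm p q * nn t k‖ ≤ 1/2 * (exp (u k) + exp (l p) + exp (l q) + exp (u t)) := by
      rw [norm_of_nonneg (mul_nonneg (hmm p q).1 (hnn t k).1)]
      refine (mul_le_mul (hmm p q).2 (hnn t k).2 (hnn t k).1 (by positivity)).trans ?_
      have := hexp (l p) (u t)
      have := hexp (l p) (u k)
      have := hexp (l q) (u t)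
      have := hexp (l q) (u k)
      nlinarith
    have h2 : ‖GA k p q t‖ * ‖GB k p q t‖ ≤ 1/2 * F k p q t := by
      have : 0 ≤ (‖GA k p q t‖ - N * ‖GB k p q t‖) ^ 2 / N := by positivity
      have e : (‖GA k p q t‖ - N * ‖GB k p q t‖) ^ 2 / N = F k p q t - 2 * (‖GA k p q t‖ * ‖GB k p q t‖) := by
        simp only [hF]; field_simp; ring
      linarith
    refine (mul_le_mul h1 h2 (by positivity) (by positivity)).trans (le_of_eq ?_)
    ring
  have hFle : ∀ {α β γ : Type _} [Fintype α] [Fintype β] [Fintype γ] (x y : α → β → γ → ℂ) ,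
      ∑ i, ∑ j, ∑ k, ‖x i j k‖ ^ 2 ≤ (N * v) * s2 → ∑ i, ∑ j, ∑ k, ‖y i j k‖ ^ 2 ≤ (v / N) * s2 →
      ∑ i, ∑ j, ∑ k, (‖x i j k‖ ^ 2 / N + N * ‖y i j k‖ ^ 2) ≤ 2 * (v * s2) := by
    intro α β γ _ _ _ x y hx hy
    simp only [sum_add_distrib, ← Finset.sum_div, ← mul_sum]
    have : (∑ i, ∑ j, ∑ k, ‖x i j k‖ ^ 2) / N ≤ v * s2 := by
      rw [div_le_iff₀ hN]; linarith
    have : N * (∑ i, ∑ j, ∑ k, ‖y i j k‖ ^ 2) ≤ v * s2 := by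
      have := mlL hy hN.le
      refine this.trans (le_of_eq ?_)
      field_simp
    linarith
  have hNv : 0 ≤ N * v := by positivity
  have hvN : 0 ≤ v / N := by positivity
  have key := sum4 F (fun k => exp (u k)) (fun k => exp (l k)) (fun k => exp (l k))
    (fun k => exp (u k)) (2 * (v * s2)) (fun _ => exp0)
    (fun _ => exp0) (fun _ => exp0) (fun _ => exp0)
    (fun k => ?_) (fun p => ?_) (fun q => ?_) (fun t => ?_)
  · calc _ ≤ ∑ k, ∑ p, ∑ q, ∑ t, (1/4) * ((exp (u k) + exp (l p) + exp (l q)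
          + exp (u t)) * F k p q t) := by
          refine (norm_sum_le _ _).trans (sle fun k => ?_)
          refine (norm_sum_le _ _).trans (sle fun p => ?_)
          refine (norm_sum_le _ _).trans (sle fun q => ?_)
          exact (norm_sum_le _ _).trans (sle fun t => hpt k p q t)
      _ = (1/4) * ∑ k, ∑ p, ∑ q, ∑ t, ((exp (u k) + exp (l p) + exp (l q)
          + exp (u t)) * F k p q t) := by simp only [mul_sum]
      _ ≤ _ := by
          refine (mlL key (by norm_num)).trans (le_of_eq ?_)
          ring
  · refine hFle _ _ (gam (fun j p => (Vᴴ * A j * U) k p) _ hNv (hsA.conj hU.ct hV)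
      (row_bound hA h2A hV.ct hU k)) ?_
    have := gam (fun i t => (Vᴴ * B i * V) t k) _ hvN (hsB.conj hU.ct hU)
      (col_bound hB h2B hV.ct hV k)
    refine le_trans (le_of_eq ?_) this
    have : ∀ (f : n → n → n → ℝ), ∑ p, ∑ q, ∑ t, f p q t = ∑ t, ∑ p, ∑ q, f p q t := by
      intro f
      simp only [sum_comm (s := (univ : Finset n)) (f := fun q t => f _ q t)]
      rw [sum_comm]
    rw [this]
    simp only [hGB, mul_comm]
  · refine hFle _ _ (gam (fun j k => (Vᴴ * A j * U) k p) _ hNv (hsA.conj hU.ct hV)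
      (col_bound hA h2A hV.ct hU p)) ?_
    have := gam (fun i q => (Uᴴ * B i * U) p q) _ hvN (hsB.conj hV.ct hV)
      (row_bound hB h2B hU.ct hU p)
    refine le_trans (le_of_eq ?_) this
    rw [sum_comm]
    refine scg fun q => ?_
    rw [sum_comm]
  · have := gam (fun j t => (Uᴴ * A j * V) q t) _ hNv (hsA.conj hV.ct hU)
      (row_bound hA h2A hU.ct hV q)
    refine hFle _ _ (le_trans (le_of_eq ?_) this) ?_
    · simp only [hGA, mul_comm]
    have := gam (fun i p => (Uᴴ * B i * U) p q) _ hvN (hsB.conj hV.ct hV)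
      (col_bound hB h2B hU.ct hU q)
    refine le_trans (le_of_eq ?_) this
    have : ∀ (f : n → n → n → ℝ), ∑ t, ∑ k, ∑ p, f p t k = ∑ p, ∑ t, ∑ k, f p t k := by
      intro f
      simp only [sum_comm (s := (univ : Finset n)) (f := fun k p => f p _ k)]
      rw [sum_comm]
    exact this (fun p t k => ‖GB k p q t‖ ^ 2)
  · have := gam (fun j q => (Uᴴ * A j * V) q t) _ hNv (hsA.conj hV.ct hU)
      (col_bound hA h2A hU.ct hV t)
    refine hFle _ _ (le_trans (le_of_eq ?_) this) ?_
    · simp only [hGA, mul_comm]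
    have := gam (fun i k => (Vᴴ * B i * V) t k) _ hvN (hsB.conj hU.ct hU)
      (row_bound hB h2B hV.ct hV t)
    refine le_trans (le_of_eq ?_) this
    have : ∀ (f : n → n → n → ℝ), ∑ q, ∑ k, ∑ p, f k p q = ∑ k, ∑ p, ∑ q, f k p q := by
      intro f
      rw [sum_comm]
      refine scg fun k => ?_
      rw [sum_comm]
    rw [this (fun k p q => ‖GB k p q t‖ ^ 2)]
    simp only [hGB, mul_comm]
lemma J_continuous : Continuous (fun p : Mc n × Mc n => J p.1 p.2) := by
  have h : ContDiff ℂ 1 (ex : Mc n → Mc n) :=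
    contDiff_iff_contDiffAt.2 fun A => (ex_analytic A).contDiffAt
  have h2 := h.continuous_fderiv (by norm_num)
  simp only [J_eq_fderiv]
  exact (h2.comp continuous_fst).clm_apply continuous_snd
lemma J_cont2 {X : Type*} [TopologicalSpace X] {f g : X → Mc n} (hf : Continuous f)
    (hg : Continuous g) : Continuous (fun x => J (f x) (g x)) := by
  have h : ContDiff ℂ 1 (ex : Mc n → Mc n) :=
    contDiff_iff_contDiffAt.2 fun A => (ex_analytic A).contDiffAt
  have h2 := h.continuous_fderiv (by norm_num)
  simp only [J_eq_fderiv]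
  exact (h2.comp hf).clm_apply hg
attribute [fun_prop] J_cont2
@[fun_prop]
lemma rtr_cont {X : Type*} [TopologicalSpace X] {f : X → Mc n} (hf : Continuous f) :
    Continuous (fun x => rtr (f x)) := by
  unfold rtr
  exact Complex.continuous_re.comp hf.matrix_trace
@[fun_prop]
lemma q_cont {X : Type*} [TopologicalSpace X] {f g : X → Mc n} (hf : Continuous f)
    (hg : Continuous g) : Continuous (fun x => q (f x) (g x)) := by
  unfold q; fun_prop
lemma rtr_add (A B : Mc n) : rtr (A + B) = rtr A + rtr B := by simp [rtr]
lemma rtr_sub (A B : Mc n) : rtr (A - B) = rtr A - rtr B := by simp [rtr]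
lemma abs_rtr_le (A : Mc n) : |rtr A| ≤ ‖A.trace‖ := Complex.abs_re_le_norm _
lemma step1 {K0 Y : Mc n} (hK0 : K0.IsHermitian) (hY : Y.IsHermitian) {r : ℝ} (hr : 0 < r)
    (hYr : ‖Y‖ ≤ r) :
    |rtr (Y * ex (K0 + Y)) - rtr (Y * ex K0) - rtr (Y * J K0 Y)| ≤ 6 * r * (q Y K0 + q Y (K0 + Y)) := by
  have hK1 : (K0 + Y).IsHermitian := hK0.add hY
  have h0 := q_nonneg hY hK0
  have h1 := q_nonneg hY hK1
  have hb : ∀ a ∈ uIoc (0:ℝ) 1, ‖(trL Y (Y * ex ((1 - a) • K0))) (ex (a • (K0 + Y))) -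
      (trL Y (Y * ex ((1 - a) • K0))) (ex (a • K0))‖ ≤ 6 * r * (q Y K0 + q Y (K0 + Y)) := by
    intro a ha
    rw [Set.uIoc_of_le zero_le_one] at ha
    refine duh_bound _ _ _ ha.1.le ha.2 fun b hb hba => ?_
    have := T3 hK1 hK0 hK0 hY hY hY hr hYr hYr hYr (a := b) (b := a - b) (c := 1 - a) hb
      (by linarith) (by linarith [ha.2]) (by ring)
    simp only [trL_apply, add_sub_cancel_left]
    simp only [mul_assoc] at this ⊢
    refine this.trans ?_
    nlinarith
  have hc : ∀ K : Mc n, Continuous (fun a : ℝ => (trL Y (Y * ex ((1 - a) • K0))) (ex (a • K))) := by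
    intro K; simp only [trL_apply]; fun_prop
  have h3 : (Y * ex (K0 + Y)).trace - (Y * ex K0).trace - (Y * J K0 Y).trace =
      ∫ a in 0..1, ((trL Y (Y * ex ((1 - a) • K0))) (ex (a • (K0 + Y))) -
      (trL Y (Y * ex ((1 - a) • K0))) (ex (a • K0))) := by
    rw [intervalIntegral.integral_sub ((hc _).intervalIntegrable _ _) ((hc _).intervalIntegrable _ _)]
    congr 1
    · rw [← trace_sub, ← mul_sub, duhamel]
      have := (trL Y 1).intervalIntegral_comp_comm (μ := volume) (a := 0) (b := 1)
        (f := fun a : ℝ => ex (a • (K0 + Y)) * (K0 + Y - K0) * ex ((1 - a) • K0))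
        (by apply Continuous.intervalIntegrable; fun_prop)
      simp only [trL_apply, mul_one] at this
      rw [← this]
      simp only [trL_apply, add_sub_cancel_left, mul_assoc]
    · rw [trace_mul_J]
      simp only [trL_apply, mul_assoc]
  have h4 := intervalIntegral.norm_integral_le_of_norm_le_const hb
  rw [← h3] at h4
  simp only [sub_zero, abs_one, mul_one] at h4
  refine le_trans ?_ h4
  rw [← rtr_sub, ← rtr_sub, ← trace_sub, ← trace_sub]
  exact abs_rtr_le _
lemma step2 {K0 Y Y' : Mc n} (hK0 : K0.IsHermitian) (hY : Y.IsHermitian)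
    (hY' : Y'.IsHermitian) {r : ℝ} (hr : 0 < r) (hYr : ‖Y‖ ≤ r) (hYr' : ‖Y'‖ ≤ r) :
    |rtr (Y' * J (K0 + Y) Y') - rtr (Y' * J K0 Y')| ≤
      12 * r * (q Y K0 + q Y (K0 + Y) + q Y' K0 + q Y' (K0 + Y)) := by
  have hK1 : (K0 + Y).IsHermitian := hK0.add hY
  have h0 := q_nonneg hY hK0
  have h1 := q_nonneg hY hK1
  have h2 := q_nonneg hY' hK0
  have h3 := q_nonneg hY' hK1
  have hc : ∀ K : Mc n, Continuous (fun a : ℝ => (Y' * ex (a • K) * Y' * ex ((1 - a) • K)).trace) := by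
    intro K; fun_prop
  have hb : ∀ a ∈ uIoc (0:ℝ) 1, ‖(Y' * ex (a • (K0 + Y)) * Y' * ex ((1 - a) • (K0 + Y))).trace -
      (Y' * ex (a • K0) * Y' * ex ((1 - a) • K0)).trace‖ ≤
      12 * r * (q Y K0 + q Y (K0 + Y) + q Y' K0 + q Y' (K0 + Y)) := by
    intro a ha
    rw [Set.uIoc_of_le zero_le_one] at ha
    have e1 := duh_bound (trL Y' (Y' * ex ((1 - a) • K0))) (K0 + Y) K0 ha.1.le ha.2
      (C := 6 * r * (q Y K0 + q Y (K0 + Y) + q Y' K0 + q Y' (K0 + Y))) (fun b hb hba => by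
        have := T3 hK1 hK0 hK0 hY' hY hY' hr hYr' hYr hYr' (a := b) (b := a - b) (c := 1 - a) hb
          (by linarith) (by linarith [ha.2]) (by ring)
        simp only [trL_apply, add_sub_cancel_left]
        simp only [mul_assoc] at this ⊢
        refine this.trans ?_
        nlinarith)
    have e2 := duh_bound (trL (Y' * ex (a • (K0 + Y)) * Y') 1) (K0 + Y) K0 (a := 1 - a)
      (by linarith [ha.2]) (by linarith [ha.1])
      (C := 6 * r * (q Y K0 + q Y (K0 + Y) + q Y' K0 + q Y' (K0 + Y))) (fun b hb hba => by
        have := T3 hK1 hK1 hK0 hY' hY' hY hr hYr' hYr' hYr (a := a) (b := b) (c := 1 - a - b) ha.1.le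
          hb (by linarith [ha.2]) (by ring)
        simp only [trL_apply, add_sub_cancel_left, mul_one]
        simp only [mul_assoc] at this ⊢
        refine this.trans ?_
        nlinarith)
    have e3 := (norm_add_le _ _).trans (add_le_add e1 e2)
    simp only [trL_apply, mul_one] at e3
    refine le_trans (le_of_eq ?_) (e3.trans (le_of_eq (by ring)))
    congr 1
    simp only [mul_assoc]
    ring
  have h4 := intervalIntegral.norm_integral_le_of_norm_le_const hb
  rw [intervalIntegral.integral_sub ((hc _).intervalIntegrable _ _) ((hc _).intervalIntegrable _ _),
    ← trace_mul_J, ← trace_mul_J] at h4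
  simp only [sub_zero, abs_one, mul_one] at h4
  refine le_trans ?_ h4
  rw [← rtr_sub, ← trace_sub]
  exact abs_rtr_le _
lemma step3 {K0 Y Y' : Mc n} (hK0 : K0.IsHermitian) (hY : Y.IsHermitian)
    (hY' : Y'.IsHermitian) {r : ℝ} (hr : 0 < r) (hYr : ‖Y‖ ≤ r) (hYr' : ‖Y'‖ ≤ r) :
    |q Y' (K0 + Y) - q Y' K0| ≤
      6 * r * (q Y K0 + q Y (K0 + Y) + q Y' K0 + q Y' (K0 + Y)) := by
  have hK1 : (K0 + Y).IsHermitian := hK0.add hY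
  have h0 := q_nonneg hY hK0
  have h1 := q_nonneg hY hK1
  have h2 := q_nonneg hY' hK0
  have h3 := q_nonneg hY' hK1
  have e1 := duh_bound (trL (Y' * Y') 1) (K0 + Y) K0 (a := 1) zero_le_one le_rfl
      (C := 6 * r * (q Y K0 + q Y (K0 + Y) + q Y' K0 + q Y' (K0 + Y))) (fun b hb hba => by
        have := T3 hK0 hK1 hK0 hY' hY' hY hr hYr' hYr' hYr (a := 0) (b := b) (c := 1 - b) le_rfl
          hb (by linarith) (by ring)
        rw [zero_smul, ex_zero, mul_one] at this
        simp only [trL_apply, add_sub_cancel_left, mul_one]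
        simp only [mul_assoc] at this ⊢
        refine this.trans ?_
        nlinarith)
  simp only [trL_apply, mul_one, one_smul] at e1
  refine le_trans ?_ e1
  unfold q
  rw [← rtr_sub, ← trace_sub]
  exact abs_rtr_le _
lemma integrable_comp {E Ω : Type*} [NormedAddCommGroup E] [ProperSpace E] [MeasurableSpace Ω]
    {ν : Measure Ω} [IsFiniteMeasure ν] {X : Ω → E} (hX : AEStronglyMeasurable X ν) {r : ℝ}
    (hr : ∀ w, ‖X w‖ ≤ r) {F : Type*} [NormedAddCommGroup F] {Φ : E → F} (hΦ : Continuous Φ) :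
    Integrable (fun w => Φ (X w)) ν := by
  obtain ⟨C, hC⟩ := (isCompact_closedBall (0 : E) r).exists_bound_of_continuousOn hΦ.continuousOn
  refine Integrable.of_bound (hΦ.comp_aestronglyMeasurable hX) C ?_
  filter_upwards with w
  exact hC _ (by simpa using hr w)
instance matProper : ProperSpace (Mc n) := FiniteDimensional.proper ℂ _
lemma integral_lin {Ω : Type*} [MeasurableSpace Ω] {ν : Measure Ω} {Y : Ω → Mc n}
    (hi : Integrable Y ν) (h0 : ∀ i j, ∫ w, Y w i j ∂ν = 0) : ∫ w, Y w ∂ν = 0 := by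
  ext i j
  have := (enL (1 : Mc n) 1 i j).integral_comp_comm hi
  simp only [enL_apply, one_mul, mul_one] at this
  rw [← this, h0]; rfl
theorem L1 {Ω : Type*} [MeasurableSpace Ω] (ν : Measure Ω) [IsProbabilityMeasure ν]
    {Y : Ω → Mc n} (hYm : AEStronglyMeasurable Y ν) (hY : Hm Y)
    {r : ℝ} (hr : 0 < r) (hr1 : r ≤ 1 / 100) (hYr : ∀ w, ‖Y w‖ ≤ r)
    (h0 : ∀ i j, ∫ w, Y w i j ∂ν = 0) {K0 : Mc n} (hK0 : K0.IsHermitian) :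
    ∫ w, rtr (Y w * ex (K0 + Y w)) ∂ν ≤
      ∫ w, ∫ w', rtr (Y w' * J (K0 + Y w) (Y w')) ∂ν ∂ν +
      100 * r * ∫ w, ∫ w', q (Y w') (K0 + Y w) ∂ν ∂ν := by
  have I1 : ∀ {F : Mc n → ℝ}, Continuous F → Integrable (fun w => F (Y w)) ν :=
    fun hF => integrable_comp hYm hYr hF
  have hX : AEStronglyMeasurable (fun p : Ω × Ω => (Y p.1, Y p.2)) (ν.prod ν) :=
    (hYm.comp_fst).prodMk (hYm.comp_snd)
  have I2 : ∀ {F : Mc n × Mc n → ℝ}, Continuous F →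
      Integrable (fun p : Ω × Ω => F (Y p.1, Y p.2)) (ν.prod ν) :=
    fun hF => integrable_comp hX (r := r) (fun p => max_le (hYr _) (hYr _)) hF
  have hfst : ∀ {F : Mc n → ℝ}, ∫ p : Ω × Ω, F (Y p.1) ∂(ν.prod ν) = ∫ w, F (Y w) ∂ν := by
    intro F
    have := integral_fun_fst (μ := ν) (ν := ν) (fun w => F (Y w))
    simpa using this
  have hsnd : ∀ {F : Mc n → ℝ}, ∫ p : Ω × Ω, F (Y p.2) ∂(ν.prod ν) = ∫ w, F (Y w) ∂ν := by
    intro F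
    have := integral_fun_snd (μ := ν) (ν := ν) (fun w => F (Y w))
    simpa using this
  set G0 := ∫ w, q (Y w) K0 ∂ν with hG0
  set H1 := ∫ w, q (Y w) (K0 + Y w) ∂ν with hH1
  have c1 : Continuous (fun p : Mc n × Mc n => q p.2 (K0 + p.1)) := by fun_prop
  have c2 : Continuous (fun p : Mc n × Mc n => rtr (p.2 * J (K0 + p.1) p.2)) := by
    fun_prop
  have c3 : Continuous (fun p : Mc n × Mc n => rtr (p.2 * J K0 p.2)) := by
    fun_prop
  have d1 : Continuous (fun p : Mc n × Mc n => q p.1 K0) := by fun_prop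
  have d2 : Continuous (fun p : Mc n × Mc n => q p.1 (K0 + p.1)) := by fun_prop
  have d3 : Continuous (fun p : Mc n × Mc n => q p.2 K0) := by fun_prop
  have b1 : Continuous (fun p : Mc n => q p K0) := by fun_prop
  have b2 : Continuous (fun p : Mc n => q p (K0 + p)) := by fun_prop
  have b3 : Continuous (fun p : Mc n => rtr (p * ex (K0 + p))) := by fun_prop
  have b4 : Continuous (fun p : Mc n => rtr (p * ex K0)) := by fun_prop
  have b5 : Continuous (fun p : Mc n => rtr (p * J K0 p)) := by fun_prop
  rw [← integral_prod _ (I2 c1), ← integral_prod _ (I2 c2)]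
  set G1 := ∫ p : Ω × Ω, q (Y p.2) (K0 + Y p.1) ∂(ν.prod ν) with hG1
  have hG0n : 0 ≤ G0 := integral_nonneg fun w => q_nonneg (hY w) hK0
  have hH1n : 0 ≤ H1 := integral_nonneg fun w => q_nonneg (hY w) (hK0.add (hY w))
  have hG1n : 0 ≤ G1 := integral_nonneg fun w => q_nonneg (hY _) (hK0.add (hY _))
  have E4 : ∫ p : Ω × Ω, (q (Y p.1) K0 + q (Y p.1) (K0 + Y p.1) + q (Y p.2) K0
      + q (Y p.2) (K0 + Y p.1)) ∂(ν.prod ν) = 2 * G0 + H1 + G1 := by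
    have i12 : Integrable (fun p : Ω × Ω => q (Y p.1) K0 + q (Y p.1) (K0 + Y p.1)) (ν.prod ν) :=
      (I2 d1).add (I2 d2)
    have i123 : Integrable (fun p : Ω × Ω => q (Y p.1) K0 + q (Y p.1) (K0 + Y p.1) + q (Y p.2) K0)
      (ν.prod ν) := i12.add (I2 d3)
    rw [integral_add i123 (I2 c1), integral_add i12 (I2 d3), integral_add (I2 d1) (I2 d2),
      hfst (F := fun y => q y K0), hfst (F := fun y => q y (K0 + y)), hsnd (F := fun y => q y K0)]
    ring
  have cE4 := (((I2 d1).add (I2 d2)).add (I2 d3)).add (I2 c1)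
  have s1 : H1 - G0 ≤ 12 * r * (G0 + H1) := by
    rw [hH1, hG0, ← integral_sub (I1 b2) (I1 b1), ← integral_add (I1 b1) (I1 b2), ← integral_const_mul]
    refine integral_mono ((I1 b2).sub (I1 b1)) (((I1 b1).add (I1 b2)).const_mul _) fun w => ?_
    have := (abs_le.1 (step3 hK0 (hY w) (hY w) hr (hYr w) (hYr w))).2
    simp only [Pi.add_apply]
    linarith
  have s2 : G0 - G1 ≤ 6 * r * (2 * G0 + H1 + G1) := by
    rw [← E4, hG0, ← hsnd (F := fun y => q y K0), hG1, ← integral_sub (I2 d3) (I2 c1),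
      ← integral_const_mul]
    refine integral_mono ((I2 d3).sub (I2 c1)) (cE4.const_mul _) fun p => ?_
    have := (abs_le.1 (step3 hK0 (hY p.1) (hY p.2) hr (hYr _) (hYr _))).1
    simp only [Pi.add_apply]
    linarith
  have s3 : ∫ w, rtr (Y w * J K0 (Y w)) ∂ν - ∫ p : Ω × Ω, rtr (Y p.2 * J (K0 + Y p.1) (Y p.2)) ∂(ν.prod ν)
      ≤ 12 * r * (2 * G0 + H1 + G1) := by
    rw [← E4, ← hsnd (F := fun y => rtr (y * J K0 y)), ← integral_sub (I2 c3) (I2 c2),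
      ← integral_const_mul]
    refine integral_mono ((I2 c3).sub (I2 c2)) (cE4.const_mul _) fun p => ?_
    have := (abs_le.1 (step2 hK0 (hY p.1) (hY p.2) hr (hYr _) (hYr _))).1
    simp only [Pi.add_apply]
    linarith
  have hz : ∫ w, rtr (Y w * ex K0) ∂ν = 0 := by
    have hi : Integrable Y ν := integrable_comp hYm hYr continuous_id
    have h1 := (trL 1 (ex K0)).integral_comp_comm hi
    rw [integral_lin hi h0, map_zero] at h1
    simp only [trL_apply, one_mul] at h1
    have h2 := Complex.reCLM.integral_comp_comm (μ := ν) (φ := fun w => (Y w * ex K0).trace)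
      (integrable_comp hYm hYr (Φ := fun y : Mc n => (y * ex K0).trace) (by fun_prop))
    rw [h1] at h2
    simpa [rtr] using h2
  have s4 : ∫ w, rtr (Y w * ex (K0 + Y w)) ∂ν - ∫ w, rtr (Y w * J K0 (Y w)) ∂ν ≤ 6 * r * (G0 + H1) := by
    have : ∫ w, rtr (Y w * ex (K0 + Y w)) ∂ν - ∫ w, rtr (Y w * J K0 (Y w)) ∂ν =
      ∫ w, rtr (Y w * ex (K0 + Y w)) ∂ν - ∫ w, rtr (Y w * ex K0) ∂ν - ∫ w, rtr (Y w * J K0 (Y w)) ∂ν := by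
      rw [hz, sub_zero]
    have i34 : Integrable (fun w => rtr (Y w * ex (K0 + Y w)) - rtr (Y w * ex K0)) ν :=
      (I1 b3).sub (I1 b4)
    rw [this, ← integral_sub (I1 b3) (I1 b4), ← integral_sub i34 (I1 b5), ← integral_add (I1 b1) (I1 b2), ← integral_const_mul]
    refine integral_mono (i34.sub (I1 b5)) (((I1 b1).add (I1 b2)).const_mul _) fun w => ?_
    exact (abs_le.1 (step1 hK0 (hY w) hr (hYr w))).2
  have t1 : H1 ≤ 1.3 * G0 := by nlinarith
  have t2 : G0 ≤ 1.33 * G1 := by nlinarith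
  have t3 : 6 * r * (G0 + H1) + 12 * r * (2 * G0 + H1 + G1) ≤ 100 * r * G1 := by nlinarith
  linarith
lemma mp_update {I : Type*} [Fintype I] [DecidableEq I] {X : I → Type*} [∀ i, MeasurableSpace (X i)]
    (ν : ∀ i, Measure (X i)) [∀ i, IsProbabilityMeasure (ν i)] (i : I) :
    MeasurePreserving (fun p : (∀ i, X i) × X i => update p.1 i p.2)
      ((Measure.pi ν).prod (ν i)) (Measure.pi ν) := by
  have hm : Measurable (fun p : (∀ i, X i) × X i => update p.1 i p.2) := by
    refine measurable_pi_iff.2 fun j => ?_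
    by_cases h : j = i
    · subst h; simp only [Function.update_self]; exact measurable_snd
    · simp only [Function.update_of_ne h]; exact (measurable_pi_apply j).comp measurable_fst
  refine ⟨hm, (Measure.pi_eq fun s hs => ?_).symm⟩
  rw [Measure.map_apply hm (MeasurableSet.univ_pi hs)]
  have : (fun p : (∀ i, X i) × X i => update p.1 i p.2) ⁻¹' (Set.univ.pi s) =
      (Set.univ.pi (update s i Set.univ)) ×ˢ (s i) := by
    ext p
    simp only [Set.mem_preimage, Set.mem_univ_pi, Set.mem_prod]
    constructor
    · intro h
      refine ⟨fun j => ?_, by simpa using h i⟩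
      by_cases hj : j = i
      · subst hj; simp
      · simpa [hj] using h j
    · rintro ⟨h, h2⟩ j
      by_cases hj : j = i
      · subst hj; simpa using h2
      · simpa [hj] using h j
  rw [this, Measure.prod_prod, Measure.pi_pi,
    ← Finset.mul_prod_erase _ _ (mem_univ i), ← Finset.mul_prod_erase _ _ (mem_univ i)]
  simp only [Function.update_self, measure_univ, one_mul]
  rw [mul_comm]
  congr 1
  refine Finset.prod_congr rfl fun j hj => ?_
  rw [Function.update_of_ne (Finset.ne_of_mem_erase hj)]
lemma integral_update {I : Type*} [Fintype I] [DecidableEq I] {X : I → Type*}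
    [∀ i, MeasurableSpace (X i)] {V : Type*} [NormedAddCommGroup V] [NormedSpace ℝ V]
    (ν : ∀ i, Measure (X i)) [∀ i, IsProbabilityMeasure (ν i)] (i : I) {f : (∀ i, X i) → V}
    (hf : Integrable f (Measure.pi ν)) :
    ∫ z, f z ∂(Measure.pi ν) = ∫ z, ∫ w, f (update z i w) ∂(ν i) ∂(Measure.pi ν) := by
  have h := mp_update ν i
  rw [← h.map_eq] at hf
  conv_lhs => rw [← h.map_eq]
  rw [integral_map h.measurable.aemeasurable hf.1]
  exact integral_prod _ (hf.comp_measurable h.measurable)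
abbrev gam1 : Measure ℝ := gaussianReal 0 1
abbrev gG (I : Type*) [Fintype I] : Measure (I → ℝ) := Measure.pi fun _ => gam1
lemma intg1 (B : ℝ) : Integrable (fun x : ℝ => exp (B * |x|)) gam1 := by
  refine ((integrable_exp_mul_gaussianReal (μ := 0) (v := 1) B).add
    (integrable_exp_mul_gaussianReal (μ := 0) (v := 1) (-B))).mono'
    (by fun_prop) (of_forall fun x => ?_)
  simp only [Pi.add_apply, norm_eq_abs, Real.abs_exp]
  have h1 := exp_pos (B * x)
  have h2 := exp_pos (-B * x)
  rcases abs_choice x with h | h <;> rw [h]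
  · linarith
  · rw [mul_neg, ← neg_mul]; linarith
lemma intgI (A B : ℝ) : Integrable (fun g : I → ℝ => A * exp (B * ‖g‖)) (gG I) := by
  refine Integrable.const_mul ?_ A
  have : Integrable (fun g : I → ℝ => ∏ i, exp (|B| * |g i|)) (gG I) :=
    Integrable.fintype_prod (f := fun _ x => exp (|B| * |x|)) (fun i => intg1 |B|)
  refine this.mono' (by fun_prop) (of_forall fun g => ?_)
  rw [norm_eq_abs, Real.abs_exp, ← Real.exp_sum, ← mul_sum]
  refine exp_le_exp.2 (mul_le_mul (le_abs_self B) ?_ nng (abs_nonneg _))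
  refine (pi_norm_le_iff_of_nonneg (sum_nonneg fun i _ => abs_nonneg _)).2 fun i => ?_
  exact Finset.single_le_sum (f := fun i => |g i|) (fun i _ => abs_nonneg _) (mem_univ i)
lemma integrable_exp {W : Type*} [NormedAddCommGroup W] {f : (I → ℝ) → W} (hf : Continuous f)
    {A B : ℝ} (h : ∀ g, ‖f g‖ ≤ A * exp (B * ‖g‖)) : Integrable f (gG I) :=
  (intgI A B).mono' hf.aestronglyMeasurable (of_forall h)
lemma int_smul_pdf {v : ℝ → V} (h : Integrable v gam1) :
    Integrable (fun x => gaussianPDFReal 0 1 x • v x) := by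
  rw [gam1, gaussianReal_of_var_ne_zero _ one_ne_zero, integrable_withDensity_iff_integrable_smul'
    (measurable_gaussianPDF 0 1) (of_forall fun x => gaussianPDF_lt_top)] at h
  simpa only [toReal_gaussianPDF] using h
lemma stein1 {v v' : ℝ → V} (hd : ∀ x, HasDerivAt v (v' x) x) (h1 : Integrable v gam1)
    (h2 : Integrable v' gam1) (h3 : Integrable (fun x => x • v x) gam1) :
    ∫ x, x • v x ∂gam1 = ∫ x, v' x ∂gam1 := by
  rw [integral_gaussianReal_eq_integral_smul one_ne_zero,
    integral_gaussianReal_eq_integral_smul one_ne_zero]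
  have hu : ∀ x : ℝ, HasDerivAt (gaussianPDFReal 0 1) (-x * gaussianPDFReal 0 1 x) x := by
    intro x
    rw [gaussianPDFReal_def]
    simp only [sub_zero, NNReal.coe_one, mul_one]
    have h : HasDerivAt (fun x : ℝ => -x ^ 2 / 2) (-x) x := by
      have := ((hasDerivAt_pow 2 x).neg).div_const 2
      refine HasDerivAt.congr_deriv this ?_
      simp; ring
    refine HasDerivAt.congr_deriv (h.exp.const_mul _) ?_
    ring
  have e3 := int_smul_pdf h3
  have key := integral_bilinear_hasDerivAt_right_eq_neg_left_of_integrable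
    (L := ContinuousLinearMap.lsmul ℝ ℝ (E := V)) (u := gaussianPDFReal 0 1) (v := v)
    (u' := fun x => -x * gaussianPDFReal 0 1 x) (v' := v')
    (fun x _ => hu x) (fun x _ => hd x) (by simpa using int_smul_pdf h2)
    (by
      refine e3.neg.congr (of_forall fun x => ?_)
      simp [mul_smul, smul_comm x])
    (by simpa using int_smul_pdf h1)
  simp only [ContinuousLinearMap.lsmul_apply] at key
  rw [key, ← integral_neg]
  refine integral_congr_ae (of_forall fun x => ?_)
  simp [mul_smul, smul_comm x]
def EE (F : (I → ℂ) → V) : Prop :=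
  (∀ z, AnalyticAt ℂ F z) ∧ ∃ A B : ℝ, 0 ≤ A ∧ 0 ≤ B ∧ ∀ z, ‖F z‖ ≤ A * exp (B * ‖z‖)
def cx (g : I → ℝ) : I → ℂ := fun i => (g i : ℂ)
lemma norm_cx (g : I → ℝ) : ‖cx g‖ = ‖g‖ := by
  simp [cx, Pi.norm_def]
@[fun_prop]
lemma cx_cont : Continuous (cx : (I → ℝ) → (I → ℂ)) := by unfold cx; fun_prop
lemma EE.cont {F : (I → ℂ) → V} (h : EE F) : Continuous F :=
  continuous_iff_continuousAt.2 fun z => (h.1 z).continuousAt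
lemma EE.intg {F : (I → ℂ) → V} (h : EE F) : Integrable (fun g => F (cx g)) (gG I) := by
  obtain ⟨A, B, -, -, hb⟩ := h.2
  exact integrable_exp (h.cont.comp cx_cont) (fun g => by rw [← norm_cx g]; exact hb _)
lemma EE.D {F : (I → ℂ) → V} (h : EE F) (v : I → ℂ) : EE (fun z => fderiv ℂ F z v) := by
  obtain ⟨A, B, hA, hB, hb⟩ := h.2
  refine ⟨fun z => (ContinuousLinearMap.apply ℂ V v).analyticAt _ |>.comp (h.1 z).fderiv,
    A * exp (B * ‖v‖), B, by positivity, hB, fun z => ?_⟩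
  have hl : HasDerivAt (fun w : ℂ => F (z + w • v)) (fderiv ℂ F z v) 0 := by
    have h1 : HasFDerivAt F (fderiv ℂ F z) (z + (0:ℂ) • v) := by
      simpa using (h.1 z).differentiableAt.hasFDerivAt
    have h2 : HasDerivAt (fun w : ℂ => z + w • v) v 0 := by
      simpa using ((hasDerivAt_id (0:ℂ)).smul_const v).const_add z
    exact h1.comp_hasDerivAt (0:ℂ) h2
  have hd : Differentiable ℂ (fun w : ℂ => F (z + w • v)) := fun w =>
    (h.1 _).differentiableAt.comp w (by fun_prop)
  have := Complex.norm_deriv_le_of_forall_mem_sphere_norm_le (c := 0) (R := 1)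
    (C := A * exp (B * ‖v‖) * exp (B * ‖z‖)) one_pos hd.diffContOnCl (fun w hw => by
      refine (hb _).trans ?_
      rw [mul_assoc, ← exp_add]
      refine mlL (exp_le_exp.2 ?_) hA
      have : ‖z + w • v‖ ≤ ‖v‖ + ‖z‖ := by
        refine (norm_add_le _ _).trans ?_
        rw [norm_smul, mem_sphere_zero_iff_norm.1 hw]; linarith
      nlinarith)
  rw [hl.deriv] at this
  simpa using this
lemma EE.coord {F : (I → ℂ) → V} (h : EE F) (i : I) : EE (fun z => z i • F z) := by
  obtain ⟨A, B, hA, hB, hb⟩ := h.2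
  refine ⟨fun z => ((ContinuousLinearMap.proj (R := ℂ) (φ := fun _ : I => ℂ) i).analyticAt z).smul
    (h.1 z), A, B + 1, hA, by linarith, fun z => ?_⟩
  rw [norm_smul]
  have h1 : ‖z i‖ ≤ exp ‖z‖ := (norm_le_pi_norm z i).trans (by linarith [Real.add_one_le_exp ‖z‖])
  calc _ ≤ exp ‖z‖ * (A * exp (B * ‖z‖)) :=
        mul_le_mul h1 (hb z) nng (Real.exp_nonneg _)
    _ = _ := by rw [add_mul, exp_add]; ring_nf
lemma stein {F : (I → ℂ) → V} (h : EE F) (i : I) :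
    ∫ g, (g i : ℂ) • F (cx g) ∂(gG I) = ∫ g, fderiv ℂ F (cx g) (Pi.single i 1) ∂(gG I) := by
  have hc := (h.coord i).intg
  change ∫ g, cx g i • F (cx g) ∂(gG I) = _
  have hD := (h.D (Pi.single i 1)).intg
  rw [integral_update _ i hc, integral_update _ i hD]
  have key : ∀ {G : (I → ℂ) → V}, EE G → ∀ g : I → ℝ,
      Integrable (fun w => G (cx (update g i w))) gam1 := by
    intro G hG g
    obtain ⟨A, B, hA, hB, hb⟩ := hG.2
    refine ((intg1 B).const_mul (A * exp (B * ‖g‖))).mono' ?_ (of_forall fun w => ?_)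
    · exact (hG.cont.comp (cx_cont.comp (continuous_const.update i continuous_id))).aestronglyMeasurable
    · refine (hb _).trans ?_
      rw [mul_assoc, ← exp_add, norm_cx]
      refine mlL (exp_le_exp.2 ?_) hA
      rw [← mul_add]
      refine mlL ?_ hB
      refine (pi_norm_le_iff_of_nonneg (by positivity)).2 fun j => ?_
      by_cases hj : j = i
      · subst hj; simp
      · simp only [Function.update_of_ne hj]
        exact (norm_le_pi_norm g j).trans (by simp)
  refine integral_congr_ae (of_forall fun g => ?_)
  have e : ∀ w : ℝ, cx (update g i w) = cx (update g i 0) + (w:ℂ) • Pi.single i 1 := by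
    intro w; ext j
    by_cases hj : j = i
    · subst hj; simp [cx]
    · simp [cx, hj]
  have := stein1 (v := fun w => F (cx (update g i w)))
    (v' := fun w => fderiv ℂ F (cx (update g i w)) (Pi.single i 1)) (fun w => by
      have h1 := (h.1 (cx (update g i w))).differentiableAt.hasFDerivAt.restrictScalars ℝ
      have h2 : HasDerivAt (fun w : ℝ => cx (update g i w)) (Pi.single i 1) w := by
        rw [show (fun w : ℝ => cx (update g i w)) = fun w : ℝ =>
          cx (update g i 0) + (w:ℂ) • Pi.single i 1 from funext e]
        have := ((Complex.ofRealCLM.hasDerivAt (x := w)).smul_const (Pi.single i (1:ℂ) : I → ℂ)).const_add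
          (cx (update g i 0))
        simpa using this
      exact h1.comp_hasDerivAt w h2) (key h g) (key (h.D _) g)
      (by simpa [cx] using key (h.coord i) g)
  simpa [cx] using this
lemma EE.fderiv_bd {F : (I → ℂ) → V} (h : EE F) : ∃ A B : ℝ, 0 ≤ A ∧ 0 ≤ B ∧
    ∀ z v, ‖fderiv ℂ F z v‖ ≤ A * exp (B * (‖v‖ + ‖z‖)) := by
  obtain ⟨A, B, hA, hB, hb⟩ := h.2
  refine ⟨A, B, hA, hB, fun z v => ?_⟩
  have hl : HasDerivAt (fun w : ℂ => F (z + w • v)) (fderiv ℂ F z v) 0 := by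
    have h1 : HasFDerivAt F (fderiv ℂ F z) (z + (0:ℂ) • v) := by
      simpa using (h.1 z).differentiableAt.hasFDerivAt
    have h2 : HasDerivAt (fun w : ℂ => z + w • v) v 0 := by
      simpa using ((hasDerivAt_id (0:ℂ)).smul_const v).const_add z
    exact h1.comp_hasDerivAt (0:ℂ) h2
  have hd : Differentiable ℂ (fun w : ℂ => F (z + w • v)) := fun w =>
    (h.1 _).differentiableAt.comp w (by fun_prop)
  have := Complex.norm_deriv_le_of_forall_mem_sphere_norm_le (c := 0) (R := 1)
    (C := A * exp (B * (‖v‖ + ‖z‖))) one_pos hd.diffContOnCl (fun w hw => by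
      refine (hb _).trans ?_
      refine mlL (exp_le_exp.2 (mlL ?_ hB)) hA
      refine (norm_add_le _ _).trans ?_
      rw [norm_smul, mem_sphere_zero_iff_norm.1 hw]; linarith)
  rw [hl.deriv] at this
  simpa using this
lemma EE.clm {W : Type*} [NormedAddCommGroup W] [NormedSpace ℂ W] [CompleteSpace W]
    {F : (I → ℂ) → V} (h : EE F) (L : V →L[ℂ] W) : EE (fun z => L (F z)) := by
  obtain ⟨A, B, hA, hB, hb⟩ := h.2
  refine ⟨fun z => (L.analyticAt _).comp (h.1 z), ‖L‖ * A, B, by positivity, hB, fun z => ?_⟩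
  rw [mul_assoc]
  exact (L.le_opNorm _).trans (mlL (hb z) nng)
lemma EE.comp {I' : Type*} [Fintype I'] [DecidableEq I'] {F : (I → ℂ) → V} (h : EE F)
    (L : (I' → ℂ) →L[ℂ] (I → ℂ)) : EE (fun z => F (L z)) := by
  obtain ⟨A, B, hA, hB, hb⟩ := h.2
  refine ⟨fun z => (h.1 _).comp (L.analyticAt z), A, B * ‖L‖, hA, by positivity, fun z => (hb _).trans ?_⟩
  refine mlL (exp_le_exp.2 ?_) hA
  rw [mul_assoc]
  exact mlL (L.le_opNorm _) hB
lemma EE.mul {R : Type*} [NormedRing R] [NormedAlgebra ℂ R] [CompleteSpace R] {F G : (I → ℂ) → R}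
    (h : EE F) (k : EE G) : EE (fun z => F z * G z) := by
  obtain ⟨A, B, hA, hB, hb⟩ := h.2
  obtain ⟨A', B', hA', hB', hb'⟩ := k.2
  refine ⟨fun z => (h.1 z).mul (k.1 z), A * A', B + B', by positivity, by positivity, fun z => ?_⟩
  refine (norm_mul_le _ _).trans ((mul_le_mul (hb z) (hb' z) nng (by positivity)).trans ?_)
  rw [add_mul, exp_add]; apply le_of_eq; ring
lemma deriv_path {F : (I → ℂ) → V} (h : EE F) {I' : Type*} [Fintype I'] [DecidableEq I']
    (Pc Ps P0 : (I' → ℂ) →L[ℂ] (I → ℂ)) (α : ℝ) :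
    HasDerivAt (fun a : ℝ => ∫ w, F ((cos a • Pc + sin a • Ps + P0) (cx w)) ∂(gG I'))
      (∫ w, fderiv ℂ F ((cos α • Pc + sin α • Ps + P0) (cx w))
        ((-sin α • Pc + cos α • Ps) (cx w)) ∂(gG I')) α := by
  obtain ⟨A, B, hA, hB, hb⟩ := h.fderiv_bd
  set M : ℝ := ‖Pc‖ + ‖Ps‖ + ‖P0‖ with hM
  have hM1 : ∀ a : ℝ, ‖(cos a • Pc + sin a • Ps + P0)‖ ≤ M := by
    intro a
    refine (norm_add₃_le).trans ?_
    rw [norm_smul, norm_smul, norm_eq_abs, norm_eq_abs]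
    have h1 := mul_le_of_le_one_left (norm_nonneg Pc) (Real.abs_cos_le_one a)
    have h2 := mul_le_of_le_one_left (norm_nonneg Ps) (Real.abs_sin_le_one a)
    linarith
  have hM2 : ∀ a : ℝ, ‖(-sin a • Pc + cos a • Ps)‖ ≤ M := by
    intro a
    refine (norm_add_le _ _).trans ?_
    rw [norm_smul, norm_smul, norm_eq_abs, norm_eq_abs, abs_neg]
    have h1 := mul_le_of_le_one_left (norm_nonneg Pc) (Real.abs_sin_le_one a)
    have h2 := mul_le_of_le_one_left (norm_nonneg Ps) (Real.abs_cos_le_one a)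
    linarith [norm_nonneg P0]
  refine (hasDerivAt_integral_of_dominated_loc_of_deriv_le (𝕜 := ℝ) (s := Set.univ) (E := V) (μ := gG I')
    (F := fun a w => F ((cos a • Pc + sin a • Ps + P0) (cx w)))
    (F' := fun a w => fderiv ℂ F ((cos a • Pc + sin a • Ps + P0) (cx w))
        ((-sin a • Pc + cos a • Ps) (cx w)))
    (bound := fun w : I' → ℝ => A * exp ((B * (M + M)) * ‖w‖)) Filter.univ_mem ?_ ?_ ?_ ?_ ?_ ?_).2
  · exact of_forall fun a =>
      (h.comp (cos a • Pc + sin a • Ps + P0)).intg.1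
  · exact (h.comp _).intg
  · have hF : Continuous (fderiv ℂ F) :=
      continuous_iff_continuousAt.2 fun z => (h.1 z).fderiv.continuousAt
    refine Continuous.aestronglyMeasurable ?_
    exact (hF.comp ((ContinuousLinearMap.continuous _).comp cx_cont)).clm_apply
      ((ContinuousLinearMap.continuous _).comp cx_cont)
  · refine of_forall fun w a _ => (hb _ _).trans ?_
    refine mlL (exp_le_exp.2 ?_) hA
    rw [mul_assoc, add_mul, ← norm_cx w]
    refine mlL (add_le_add ?_ ?_) hB
    · exact (ContinuousLinearMap.le_opNorm _ _).trans
        (mlR (hM2 a) nng)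
    · exact (ContinuousLinearMap.le_opNorm _ _).trans
        (mlR (hM1 a) nng)
  · exact intgI _ _
  · refine of_forall fun w a _ => ?_
    have h1 := (h.1 ((cos a • Pc + sin a • Ps + P0) (cx w))).differentiableAt.hasFDerivAt.restrictScalars ℝ
    have h2 : HasDerivAt (fun a : ℝ => (cos a • Pc + sin a • Ps + P0) (cx w))
        ((-sin a • Pc + cos a • Ps) (cx w)) a := by
      have := (((Real.hasDerivAt_cos a).smul_const (Pc (cx w))).add
        ((Real.hasDerivAt_sin a).smul_const (Ps (cx w)))).add_const (P0 (cx w))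
      exact this
    exact h1.comp_hasDerivAt a h2
def xpt (τ : Finset I) (α : ℝ) (w : I ⊕ I → ℝ) : I → ℝ := fun i =>
  if i ∈ τ then cos α * w (inl i) + sin α * w (inr i) else w (inl i)
def xptL (τ : Finset I) : Fin 3 → ((I ⊕ I → ℂ) →L[ℂ] (I ⊕ I → ℂ)) :=
  ![ContinuousLinearMap.pi (Sum.elim (fun i => if i ∈ τ then ContinuousLinearMap.proj (inl i) else 0)
      (fun _ => 0)),
    ContinuousLinearMap.pi (Sum.elim (fun i => if i ∈ τ then ContinuousLinearMap.proj (inr i) else 0)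
      (fun _ => 0)),
    ContinuousLinearMap.pi (Sum.elim (fun i => if i ∈ τ then 0 else ContinuousLinearMap.proj (inl i))
      (fun i => ContinuousLinearMap.proj (inl i)))]
def ptL (τ : Finset I) (a : ℝ) : (I ⊕ I → ℂ) →L[ℂ] (I ⊕ I → ℂ) :=
  cos a • xptL τ 0 + sin a • xptL τ 1 + xptL τ 2
lemma ptL_eq (τ : Finset I) (α : ℝ) (w : I ⊕ I → ℝ) :
    ptL τ α (cx w) = Sum.elim (cx (xpt τ α w)) (fun i => cx w (inl i)) := by
  ext i
  rcases i with i | i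
  · by_cases hi : i ∈ τ <;> simp [ptL, xptL, xpt, cx, hi]
  · simp [ptL, xptL, cx]
lemma cov0 {F : (I ⊕ I → ℂ) → V} (h : EE F) (τ : Finset I) (α : ℝ) :
    HasDerivAt (fun a : ℝ => ∫ w, F (ptL τ a (cx w)) ∂(gG (I ⊕ I)))
      (-sin α • ∑ i ∈ τ, ∫ w, fderiv ℂ (fun z => fderiv ℂ F z (Pi.single (inl i) 1)) (ptL τ α (cx w))
        (Pi.single (inr i) 1) ∂(gG (I ⊕ I))) α := by
  have h0 := deriv_path h (xptL τ 0) (xptL τ 1) (xptL τ 2) α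
  refine HasDerivAt.congr_deriv h0 ?_
  change ∫ w, fderiv ℂ F (ptL τ α (cx w)) _ ∂_ = _
  have e1 : ∀ w : I ⊕ I → ℝ, fderiv ℂ F (ptL τ α (cx w))
        ((-sin α • xptL τ 0 + cos α • xptL τ 1) (cx w)) =
      ∑ i ∈ τ, (-sin α • ((w (inl i) : ℂ) • fderiv ℂ F (ptL τ α (cx w)) (Pi.single (inl i) 1)) +
        cos α • ((w (inr i) : ℂ) • fderiv ℂ F (ptL τ α (cx w)) (Pi.single (inl i) 1))) := by
    intro w
    have : (-sin α • xptL τ 0 + cos α • xptL τ 1) (cx w) =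
        ∑ i ∈ τ, ((-sin α : ℂ) * w (inl i) + cos α * w (inr i)) •
          (Pi.single (inl i) 1 : I ⊕ I → ℂ) := by
      ext i
      rcases i with i | i
      · by_cases hi : i ∈ τ
        · simp [xptL, cx, hi, Finset.sum_apply, Pi.single_apply]
        · simp [xptL, cx, hi, Finset.sum_apply, Pi.single_apply]
      · simp [xptL, Finset.sum_apply]
    rw [this, map_sum]
    refine scg fun i => ?_
    rw [map_smul, add_smul, mul_smul, mul_smul]
    congr 1
    rw [← Complex.ofReal_neg, Complex.coe_smul]
  simp only [e1]
  have hG : ∀ i : I, EE (fun z => fderiv ℂ F (ptL τ α z) (Pi.single (inl i) 1)) :=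
    fun i => (h.D (Pi.single (inl i) 1)).comp (ptL τ α)
  have i1 : ∀ i j, Integrable (fun w : I ⊕ I → ℝ => ((w j : ℂ) • fderiv ℂ F (ptL τ α (cx w)) (Pi.single (inl i) 1)))
      (gG (I ⊕ I)) := fun i j => ((hG i).coord j).intg
  have i2 : ∀ (c : ℝ) i j, Integrable (fun w : I ⊕ I → ℝ => c • ((w j : ℂ) • fderiv ℂ F (ptL τ α (cx w)) (Pi.single (inl i) 1)))
      (gG (I ⊕ I)) := fun c i j => (i1 i j).smul c
  rw [integral_finsetSum _ (fun i _ => by exact (i2 _ i _).add (i2 _ i _)), smul_sum]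
  refine Finset.sum_congr rfl fun i hi => ?_
  rw [integral_add (i2 _ i _) (i2 _ i _), integral_smul, integral_smul,
    stein (hG i) (inl i), stein (hG i) (inr i)]
  have e2 : ∀ (w : I ⊕ I → ℝ) (v : I ⊕ I → ℂ),
      fderiv ℂ (fun z => fderiv ℂ F (ptL τ α z) (Pi.single (inl i) 1)) (cx w) v =
      fderiv ℂ (fun z => fderiv ℂ F z (Pi.single (inl i) 1)) (ptL τ α (cx w)) (ptL τ α v) := by
    intro w v
    have := ((h.D (Pi.single (inl i) 1)).1 (ptL τ α (cx w))).differentiableAt.hasFDerivAt.comp (cx w)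
      (ptL τ α).hasFDerivAt
    have t := this.fderiv
    simp only [Function.comp_def] at t
    rw [t]; rfl
  have e3 : ptL τ α (Pi.single (inl i) 1) = (cos α:ℂ) • Pi.single (inl i) 1 + Pi.single (inr i) 1 := by
    ext j; rcases j with j | j
    · by_cases hj : j = i
      · subst hj; simp [ptL, xptL, hi]
      · by_cases hj' : j ∈ τ <;> simp [ptL, xptL, hj, hj']
    · by_cases hj : j = i
      · subst hj; simp [ptL, xptL]
      · simp [ptL, xptL, hj]
  have e4 : ptL τ α (Pi.single (inr i) 1) = (sin α:ℂ) • Pi.single (inl i) 1 := by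
    ext j; rcases j with j | j
    · by_cases hj : j = i
      · subst hj; simp [ptL, xptL, hi]
      · by_cases hj' : j ∈ τ <;> simp [ptL, xptL, hj, hj']
    · simp [ptL, xptL]
  simp only [e2, e3, e4, map_add, map_smul]
  have hH : ∀ v, Integrable (fun w => fderiv ℂ (fun z => fderiv ℂ F z (Pi.single (inl i) 1)) (ptL τ α (cx w)) v)
      (gG (I ⊕ I)) := fun v => (((h.D (Pi.single (inl i) 1)).D v).comp (ptL τ α)).intg
  have hH2 : ∀ (c : ℂ) v, Integrable (fun w => c • fderiv ℂ (fun z => fderiv ℂ F z (Pi.single (inl i) 1)) (ptL τ α (cx w)) v)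
      (gG (I ⊕ I)) := fun c v => (hH v).smul c
  rw [integral_add (hH2 _ _) (hH _), integral_smul, integral_smul]
  simp only [Complex.coe_smul, smul_add, smul_smul]
  rw [add_assoc, add_comm, add_assoc, ← add_smul]
  simp [mul_comm]
def Sg (B : I → Mc n) (z : I → ℂ) : Mc n := ∑ i, z i • B i
def SgL (B : I → Mc n) : (I → ℂ) →L[ℂ] Mc n :=
  ∑ i, (ContinuousLinearMap.proj (R := ℂ) (φ := fun _ : I => ℂ) i).smulRight (B i)
lemma SgL_apply (B : I → Mc n) (z : I → ℂ) : SgL B z = Sg B z := by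
  simp [SgL, Sg, ContinuousLinearMap.sum_apply]
lemma Sg_herm {B : I → Mc n} (hB : Hm B) (g : I → ℝ) :
    (Sg B (cx g)).IsHermitian := by
  unfold Sg IsHermitian
  rw [conjTranspose_sum]
  refine scg fun i => ?_
  rw [conjTranspose_smul, (hB i).eq]; simp [cx]
lemma Sg_single (B : I → Mc n) (i : I) : Sg B (Pi.single i 1) = B i := by
  unfold Sg
  rw [Finset.sum_eq_single i] <;> simp +contextual
lemma Sg_add (B : I → Mc n) (x y : I → ℂ) : Sg B (x + y) = Sg B x + Sg B y := by
  simp [← SgL_apply]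
lemma Sg_smul (B : I → Mc n) (c : ℂ) (x : I → ℂ) : Sg B (c • x) = c • Sg B x := by
  simp [← SgL_apply]
lemma Sg_elim (B C : I → Mc n) (z : I ⊕ I → ℂ) :
    Sg (Sum.elim B C) z = Sg B (z ∘ inl) + Sg C (z ∘ inr) := by
  simp [Sg, Fintype.sum_sum_type]
lemma EE_exS (H : Mc n) (B : I → Mc n) : EE (fun z => ex (H + Sg B z)) := by
  refine ⟨fun z => ?_, exp ‖H‖, ‖SgL B‖, by positivity, nng, fun z => ?_⟩
  · refine (ex_analytic _).comp (f := fun z => H + Sg B z) ?_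
    simp only [← SgL_apply]
    exact analyticAt_const.add ((SgL B).analyticAt z)
  · refine (norm_ex_le _).trans ?_
    rw [← exp_add]
    refine exp_le_exp.2 ((norm_add_le _ _).trans ?_)
    rw [← SgL_apply]
    linarith [(SgL B).le_opNorm z]
lemma EE_const (Q : V) : EE (fun _ : I → ℂ => Q) :=
  ⟨fun _ => analyticAt_const, ‖Q‖, 0, nng, le_rfl, fun z => by simp⟩
lemma ex_line (K B : Mc n) : HasDerivAt (fun t : ℂ => ex (K + t • B)) (J K B) 0 := by
  have h1 : HasFDerivAt (ex : Mc n → Mc n) (fderiv ℂ ex K) (K + (0:ℂ) • B) := by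
    simpa using (ex_analytic K).differentiableAt.hasFDerivAt
  have h2 : HasDerivAt (fun t : ℂ => K + t • B) B 0 := by
    simpa using ((hasDerivAt_id (0:ℂ)).smul_const B).const_add K
  rw [J_eq_fderiv]
  exact h1.comp_hasDerivAt (0:ℂ) h2
lemma EE.line {F : (I → ℂ) → V} (h : EE F) {z v : I → ℂ} {d : V}
    (hd : HasDerivAt (fun t : ℂ => F (z + t • v)) d 0) : fderiv ℂ F z v = d := by
  rw [← (h.1 z).differentiableAt.lineDeriv_eq_fderiv]
  exact hd.deriv
lemma EE_h (L : Mc n →L[ℂ] V) (Q H1 H2 : Mc n) (B C : I → Mc n) :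
    EE (fun z => L (ex (H1 + Sg B z) * Q * ex (H2 + Sg C z))) :=
  (((EE_exS H1 B).mul (EE_const Q)).mul (EE_exS H2 C)).clm L
lemma fderiv_exS (H : Mc n) (B : I → Mc n) (z : I → ℂ) (i : I) :
    fderiv ℂ (fun z => ex (H + Sg B z)) z (Pi.single i 1) = J (H + Sg B z) (B i) := by
  refine (EE_exS H B).line ?_
  simp only [Sg_add, Sg_smul, Sg_single, ← add_assoc]
  exact ex_line _ _
lemma cov (L : Mc n →L[ℂ] V) (Q H1 H2 : Mc n) (B C : I → Mc n)
    (τ : Finset I) (α : ℝ) :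
    HasDerivAt (fun a : ℝ => ∫ w, L (ex (H1 + Sg B (cx (xpt τ a w))) * Q *
        ex (H2 + Sg C (cx (w ∘ inl)))) ∂(gG (I ⊕ I)))
      (-sin α • ∑ i ∈ τ, ∫ w, L (J (H1 + Sg B (cx (xpt τ α w))) (B i) * Q *
        J (H2 + Sg C (cx (w ∘ inl))) (C i)) ∂(gG (I ⊕ I))) α := by
  set B' : I ⊕ I → Mc n := Sum.elim B 0
  set C' : I ⊕ I → Mc n := Sum.elim 0 C
  have h0 : ∀ x : I → ℂ, Sg (0 : I → Mc n) x = 0 := fun x => by simp [Sg]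
  have hF := EE_h L Q H1 H2 B' C'
  have hD := cov0 hF τ α
  have eB : ∀ a w, Sg B' (ptL τ a (cx w)) = Sg B (cx (xpt τ a w)) := by
    intro a w; rw [ptL_eq, Sg_elim, h0, add_zero]; rfl
  have eC : ∀ a w, Sg C' (ptL τ a (cx w)) = Sg C (cx (w ∘ inl)) := by
    intro a w; rw [ptL_eq, Sg_elim, h0, zero_add]; rfl
  have d1 : ∀ i z, fderiv ℂ (fun z => L (ex (H1 + Sg B' z) * Q * ex (H2 + Sg C' z))) z
      (Pi.single (inl i) 1) = L (J (H1 + Sg B' z) (B i) * Q * ex (H2 + Sg C' z)) := by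
    intro i z
    refine hF.line ?_
    simp only [Sg_add, Sg_smul, Sg_single, ← add_assoc]
    simp only [B', C', Sum.elim_inl, Pi.zero_apply, smul_zero, add_zero]
    have := ((ex_line (H1 + Sg B' z) (B i)).mul_const Q).mul_const (ex (H2 + Sg C' z))
    exact L.hasFDerivAt.comp_hasDerivAt _ this
  simp only [d1, eB, eC] at hD
  refine HasDerivAt.congr_deriv hD ?_
  congr 1
  refine scg fun i => ?_
  congr 1; ext w
  have hG : EE (fun z => L (J (H1 + Sg B' z) (B i) * Q * ex (H2 + Sg C' z))) := by
    have := hF.D (Pi.single (inl i) 1)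
    simpa only [d1] using this
  rw [hG.line (d := L (J (H1 + Sg B' (ptL τ α (cx w))) (B i) * Q * J (H2 + Sg C' (ptL τ α (cx w))) (C i)))]
  · rw [eB, eC]
  · simp only [Sg_add, Sg_smul, Sg_single, ← add_assoc]
    simp only [B', C', Sum.elim_inr, Pi.zero_apply, smul_zero, add_zero]
    have := (ex_line (H2 + Sg C' (ptL τ α (cx w))) (C i)).const_mul (J (H1 + Sg B' (ptL τ α (cx w))) (B i) * Q)
    exact L.hasFDerivAt.comp_hasDerivAt _ this
lemma J_zero_right (K : Mc n) : J K 0 = 0 := by rw [J_eq_fderiv]; simp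
@[fun_prop]
lemma Sg_cont {X : Type*} [TopologicalSpace X] {f : X → I → ℂ} (B : I → Mc n) (hf : Continuous f) :
    Continuous (fun x => Sg B (f x)) := by unfold Sg; fun_prop
lemma mp_inl : MeasurePreserving (fun w : I ⊕ I → ℝ => w ∘ inl) (gG (I ⊕ I)) (gG I) := by
  have := measurePreserving_sumPiEquivProdPi (fun _ : I ⊕ I => gam1)
  exact measurePreserving_fst.comp this
lemma integral_inl {f : (I → ℝ) → V} (hf : Integrable f (gG I)) :
    ∫ w, f (w ∘ inl) ∂(gG (I ⊕ I)) = ∫ g, f g ∂(gG I) := by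
  have h := mp_inl (I := I)
  have hf' := hf
  rw [← h.map_eq] at hf
  conv_rhs => rw [← h.map_eq]
  rw [integral_map h.measurable.aemeasurable hf.1]
lemma xpt_zero (τ : Finset I) (w : I ⊕ I → ℝ) : xpt τ 0 w = w ∘ inl := by
  ext i; simp [xpt]
lemma rot (L : Mc n →L[ℂ] V) (H : Mc n) (B : I → Mc n)
    (τ : Finset I) (α : ℝ) :
    ∫ w, L (ex (H + Sg B (cx (xpt τ α w)))) ∂(gG (I ⊕ I)) = ∫ g, L (ex (H + Sg B (cx g))) ∂(gG I) := by
  have h0 : ∀ x : I → ℂ, Sg (0 : I → Mc n) x = 0 := fun x => by simp [Sg]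
  have h := cov L 1 H 0 B 0 τ
  simp only [Pi.zero_apply, J_zero_right, mul_zero, map_zero, integral_zero, Finset.sum_const_zero,
    smul_zero, h0, add_zero, ex_zero, mul_one] at h
  have hc := is_const_of_deriv_eq_zero (fun a => (h a).differentiableAt) (fun a => (h a).deriv) α 0
  rw [hc]
  simp only [xpt_zero]
  exact integral_inl (f := fun g => L (ex (H + Sg B (cx g)))) ((EE_exS H B).clm L).intg
structure PF {κ ι : Type} [Fintype κ] [DecidableEq κ] [Fintype ι] [DecidableEq ι]
    (P : ι → Mc κ) : Prop where
  herm : Hm P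
  sq : ∀ c, P c * P c = 1
  comm : ∀ c d, P c * P d = P d * P c ∨ P c * P d = -(P d * P c)
  orth : ∀ c d, (P c * P d).trace = if c = d then (card κ : ℂ) else 0
  swap : ∀ x y z w, ∑ c, P c x y * P c z w = (if x = w then 1 else 0) * (if y = z then 1 else 0) * (card κ : ℂ)
  card : card ι = (card κ) ^ 2
def pau : Fin 4 → Mc (Fin 2) :=
  ![!![1, 0; 0, 1], !![0, 1; 1, 0], !![0, -Complex.I; Complex.I, 0], !![1, 0; 0, -1]]
lemma pau_PF : PF pau where
  herm c := by
    ext i j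
    fin_cases c <;> fin_cases i <;> fin_cases j <;> simp [pau]
  sq c := by
    fin_cases c <;> simp [pau, one_fin_two]
  comm c d := by
    fin_cases c <;> fin_cases d <;> simp [pau]
  orth c d := by
    fin_cases c <;> fin_cases d <;> simp [pau, trace_fin_two] <;> norm_num
  swap x y z w := by
    fin_cases x <;> fin_cases y <;> fin_cases z <;> fin_cases w <;>
      simp [pau, Fin.sum_univ_four] <;> norm_num
  card := by simp
lemma PF.kron {κ ι κ' ι' : Type} [Fintype κ] [DecidableEq κ] [Fintype ι] [DecidableEq ι]
    [Fintype κ'] [DecidableEq κ'] [Fintype ι'] [DecidableEq ι']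
    {P : ι → Mc κ} {Q : ι' → Matrix κ' κ' ℂ} (hP : PF P) (hQ : PF Q) :
    PF (fun c : ι × ι' => P c.1 ⊗ₖ Q c.2) where
  herm c := by
    unfold IsHermitian
    rw [conjTranspose_kronecker, (hP.herm _).eq, (hQ.herm _).eq]
  sq c := by rw [← mul_kronecker_mul, hP.sq, hQ.sq, one_kronecker_one]
  comm c d := by
    rw [← mul_kronecker_mul, ← mul_kronecker_mul]
    have e1 : ∀ (A : Mc κ) (B : Matrix κ' κ' ℂ), (-A) ⊗ₖ B = -(A ⊗ₖ B) := by
      intro A B; ext; simp [kroneckerMap_apply]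
    have e2 : ∀ (A : Mc κ) (B : Matrix κ' κ' ℂ), A ⊗ₖ (-B) = -(A ⊗ₖ B) := by
      intro A B; ext; simp [kroneckerMap_apply]
    rcases hP.comm c.1 d.1 with h | h <;> rcases hQ.comm c.2 d.2 with h' | h' <;> rw [h, h'] <;>
      simp [e1, e2]
  orth c d := by
    rw [← mul_kronecker_mul, trace_kronecker, hP.orth, hQ.orth, Fintype.card_prod]
    obtain ⟨c1, c2⟩ := c
    obtain ⟨d1, d2⟩ := d
    by_cases h1 : c1 = d1 <;> by_cases h2 : c2 = d2 <;> simp [h1, h2]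
  swap x y z w := by
    have : ∀ c : ι × ι', (P c.1 ⊗ₖ Q c.2) x y * (P c.1 ⊗ₖ Q c.2) z w =
        (P c.1 x.1 y.1 * P c.1 z.1 w.1) * (Q c.2 x.2 y.2 * Q c.2 z.2 w.2) := by
      intro c; simp only [kroneckerMap_apply]; ring
    simp only [this]
    rw [sum_prod_type]
    simp only [← mul_sum, ← sum_mul]
    rw [hP.swap, hQ.swap, Fintype.card_prod]
    obtain ⟨x1, x2⟩ := x
    obtain ⟨y1, y2⟩ := y
    obtain ⟨z1, z2⟩ := z
    obtain ⟨w1, w2⟩ := w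
    by_cases h1 : x1 = w1 <;> by_cases h2 : x2 = w2 <;> by_cases h3 : y1 = z1 <;>
      by_cases h4 : y2 = z2 <;> simp [h1, h2, h3, h4]
  card := by simp only [Fintype.card_prod, hP.card, hQ.card, mul_pow]
lemma exists_PF (k : ℕ) : ∃ (κ ι : Type) (_ : Fintype κ) (_ : DecidableEq κ) (_ : Fintype ι)
    (_ : DecidableEq ι) (P : ι → Mc κ), PF P ∧ card κ = 2 ^ (k + 1) := by
  induction k with
  | zero => exact ⟨Fin 2, Fin 4, inferInstance, inferInstance, inferInstance, inferInstance, pau, pau_PF, by simp⟩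
  | succ k ih =>
    obtain ⟨κ, ι, i1, i2, i3, i4, P, hP, hc⟩ := ih
    exact ⟨κ × Fin 2, ι × Fin 4, inferInstance, inferInstance, inferInstance, inferInstance, _,
      hP.kron pau_PF, by simp [hc, pow_succ]⟩
section
open scoped Matrix.Norms.L2Operator MatrixOrder ComplexOrder
lemma sq_nonneg' {A : Mc n} (hA : A.IsHermitian) : 0 ≤ A * A := by
  rw [nonneg_iff_posSemidef]
  have := posSemidef_self_mul_conjTranspose A
  rwa [hA.eq] at this
lemma norm_sub_sum_le {I : Type*} [Fintype I] {B : I → Mc n} (hB : Hm B)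
    (τ : Finset I) : ‖∑ i ∈ τ, B i * B i‖ ≤ ‖∑ i, B i * B i‖ := by
  refine CStarAlgebra.norm_le_norm_of_nonneg_of_le (sum_nonneg fun i _ => sq_nonneg' (hB i)) ?_
  exact Finset.sum_le_univ_sum_of_nonneg (fun i => sq_nonneg' (hB i))
def rst {I : Type*} [DecidableEq I] (τ : Finset I) (B : I → Mc n) : I → Mc n :=
  fun i => if i ∈ τ then B i else 0
lemma rst_herm {I : Type*} [DecidableEq I] (τ : Finset I) {B : I → Mc n}
    (hB : Hm B) (i : I) : (rst τ B i).IsHermitian := by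
  unfold rst; split_ifs
  · exact hB i
  · exact isHermitian_zero
lemma rst_HsB {I : Type*} [Fintype I] [DecidableEq I] (τ : Finset I) {B : I → Mc n} {v : ℝ}
    (hv : 0 ≤ v) (h : HsB B v) : HsB (rst τ B) v := by
  intro x
  have := h (fun i => if i ∈ τ then x i else 0)
  have e : ∑ j, x j • rst τ B j = ∑ j, (if j ∈ τ then x j else 0) • B j := by
    refine scg fun j => ?_
    unfold rst; split_ifs <;> simp
  rw [e]
  refine this.trans (mlL (sle fun j => ?_) hv)
  split_ifs
  · rfl
  · simp
lemma rst_norm {I : Type*} [Fintype I] [DecidableEq I] (τ : Finset I) {B : I → Mc n}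
    (hB : Hm B) {s : ℝ} (h : ‖∑ i, B i * B i‖ ≤ s) :
    ‖∑ i, rst τ B i * rst τ B i‖ ≤ s := by
  refine le_trans (le_of_eq ?_) ((norm_sub_sum_le hB τ).trans h)
  congr 1
  have : ∀ i, rst τ B i * rst τ B i = if i ∈ τ then B i * B i else 0 := by
    intro i; unfold rst; split_ifs <;> simp
  simp [this]
def amp (κ : Type) [DecidableEq κ] (A : Mc n) : Mc (n × κ) := A ⊗ₖ (1 : Mc κ)
lemma amp_mul (A B : Mc n) : amp κ (A * B) = amp κ A * amp κ B := by
  unfold amp; rw [← mul_kronecker_mul, one_mul]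
lemma amp_herm {A : Mc n} (hA : A.IsHermitian) : (amp κ A).IsHermitian := by
  unfold amp IsHermitian
  rw [conjTranspose_kronecker, hA.eq, conjTranspose_one]
def ampH (κ : Type) [Fintype κ] [DecidableEq κ] : Mc n →⋆ₙₐ[ℂ] Mc (n × κ) where
  toFun := amp κ
  map_smul' c A := by unfold amp; rw [smul_kronecker]; rfl
  map_zero' := by unfold amp; exact zero_kronecker _
  map_add' A B := by unfold amp; exact add_kronecker _ _ _
  map_mul' A B := amp_mul A B
  map_star' A := by
    simp only [amp, star_eq_conjTranspose]
    rw [conjTranspose_kronecker, conjTranspose_one]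
lemma ampH_apply (A : Mc n) : ampH κ A = amp κ A := rfl
lemma amp_norm_le (A : Mc n) : ‖amp κ A‖ ≤ ‖A‖ :=
  NonUnitalStarAlgHom.norm_apply_le (ampH κ) A
lemma amp_sum {I : Type*} (s : Finset I) (A : I → Mc n) : amp κ (∑ i ∈ s, A i) = ∑ i ∈ s, amp κ (A i) := by
  simp only [← ampH_apply, map_sum]
lemma amp_smul (c : ℂ) (A : Mc n) : amp κ (c • A) = c • amp κ A := by
  simp only [← ampH_apply, map_smul]
lemma amp_trace (A : Mc n) : (amp κ A).trace = A.trace * card κ := by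
  unfold amp; rw [trace_kronecker, trace_one]
lemma amp_hs (A : Mc n) : hs (amp κ A) = hs A * card κ := by
  have : ((hs (amp κ A) : ℝ) : ℂ) = ((hs A * card κ : ℝ) : ℂ) := by
    push_cast
    rw [hs_eq, hs_eq, ← amp_trace, amp_mul]
    congr 2
    unfold amp; rw [conjTranspose_kronecker, conjTranspose_one]
  exact_mod_cast this
lemma amp_HsB {A : Jx → Mc n} {v : ℝ} (h : HsB A v) :
    HsB (fun j => amp κ (A j)) (crd κ * v) := by
  intro x
  simp only [← amp_smul, ← amp_sum, amp_hs]
  nlinarith [h x, (Nat.cast_nonneg (card κ) : (0:ℝ) ≤ _)]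
lemma amp_sq {A : Jx → Mc n} {s : ℝ} (h : ‖∑ j, A j * A j‖ ≤ s) :
    ‖∑ j, amp κ (A j) * amp κ (A j)‖ ≤ s := by
  simp only [← amp_mul, ← amp_sum]
  exact (amp_norm_le _).trans h
def Bf (P : ι → Mc κ) (A : Jx → Mc n) : Jx × ι → Mc (n × κ) :=
  fun i => ((crd κ)⁻¹ : ℂ) • (A i.1 ⊗ₖ P i.2)
def Uf (P : ι → Mc κ) (c : ι) : Mc (n × κ) := (1 : Mc n) ⊗ₖ P c
lemma Bf_herm (hP : PF P) {A : Jx → Mc n} (hA : Hm A) (i : Jx × ι) : (Bf P A i).IsHermitian := by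
  unfold Bf IsHermitian
  rw [conjTranspose_smul, conjTranspose_kronecker, (hA _).eq, (hP.herm _).eq]
  simp
lemma Bf_HsB (hP : PF P) {A : Jx → Mc n} (hA : Hm A) {v : ℝ} (h : HsB A v)
    (hN : 0 < card κ) :
    HsB (Bf P A) (v / card κ) := by
  intro x
  set N : ℝ := crd κ with hNd
  have hN' : 0 < N := Nat.cast_pos.2 hN
  set Y : ι → Mc n := fun c => ∑ j, x (j, c) • A j with hY
  have e1 : ∑ i, x i • Bf P A i = (N⁻¹ : ℂ) • ∑ c, Y c ⊗ₖ P c := by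
    rw [sum_prod_type, sum_comm, smul_sum]
    refine scg fun c => ?_
    ext a b
    simp only [hY, Bf, Matrix.sum_apply, Matrix.smul_apply, kroneckerMap_apply, smul_eq_mul, mul_sum, sum_mul, hNd]
    refine scg fun j => ?_
    push_cast; ring
  have e2 : hs (∑ i, x i • Bf P A i) = N⁻¹ * ∑ c, hs (Y c) := by
    have : ((hs (∑ i, x i • Bf P A i) : ℝ) : ℂ) = ((N⁻¹ * ∑ c, hs (Y c) : ℝ) : ℂ) := by
      rw [e1, hs_eq]
      simp only [conjTranspose_smul, conjTranspose_sum, conjTranspose_kronecker, (hP.herm _).eq,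
        smul_mul_smul_comm, Finset.sum_mul_sum, ← mul_kronecker_mul, trace_smul, trace_sum, trace_kronecker,
        hP.orth]
      simp only [mul_ite, mul_zero, Finset.sum_ite_eq, mem_univ, if_true, ← hs_eq]
      rw [← sum_mul]
      simp only [← Complex.ofReal_sum]
      have : (N:ℂ) ≠ 0 := by exact_mod_cast hN'.ne'
      simp only [star_inv₀, Complex.star_def, Complex.conj_ofReal, smul_eq_mul]
      rw [show ((card κ : ℕ) : ℂ) = (N:ℂ) by simp [hNd]]
      push_cast
      field_simp
    exact_mod_cast this
  rw [e2]
  have : ∑ c, hs (Y c) ≤ v * ∑ i, ‖x i‖ ^ 2 := by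
    rw [sum_prod_type, sum_comm, mul_sum]
    exact sle fun c => h _
  rw [div_mul_eq_mul_div, div_eq_inv_mul]
  exact mlL this (by positivity)
lemma Bf_eq (hP : PF P) (A : Jx → Mc n) (i : Jx × ι) :
    Bf P A i = ((crd κ)⁻¹ : ℂ) • (amp κ (A i.1) * Uf P i.2) ∧
    Bf P A i = ((crd κ)⁻¹ : ℂ) • (Uf P i.2 * amp κ (A i.1)) := by
  unfold Bf amp Uf
  rw [← mul_kronecker_mul, ← mul_kronecker_mul]; simp
lemma Uf_sq (hP : PF P) (c : ι) : (Uf P c : Mc (n × κ)) * Uf P c = 1 := by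
  unfold Uf; rw [← mul_kronecker_mul, hP.sq, one_mul, one_kronecker_one]
lemma Uf_amp (hP : PF P) (c : ι) (A : Mc n) : Uf P c * amp κ A * Uf P c = amp κ A := by
  unfold Uf amp; rw [← mul_kronecker_mul, ← mul_kronecker_mul]; simp [hP.sq]
lemma Bf_sq (hP : PF P) {A : Jx → Mc n} (hN : 0 < card κ) :
    ∑ i, Bf P A i * Bf P A i = ∑ j, amp κ (A j) * amp κ (A j) := by
  rw [sum_prod_type]
  refine scg fun j => ?_
  have hN' : (crd κ : ℂ) ≠ 0 := by exact_mod_cast hN.ne'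
  have : ∀ c, Bf P A (j, c) * Bf P A (j, c) = (((crd κ)⁻¹ : ℂ) ^ 2) • (amp κ (A j) * amp κ (A j)) := by
    intro c
    conv_lhs => rw [(Bf_eq hP A (j, c)).1]
    conv_lhs => arg 2; rw [← (Bf_eq hP A (j, c)).1, (Bf_eq hP A (j, c)).2]
    rw [smul_mul_smul_comm, ← sq]
    congr 1
    rw [Matrix.mul_assoc, ← Matrix.mul_assoc (Uf P c), Uf_sq hP, Matrix.one_mul]
  simp only [this, Finset.sum_const, Finset.card_univ, hP.card]
  rw [← Nat.cast_smul_eq_nsmul ℂ, smul_smul]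
  push_cast
  have h2 : (card κ : ℂ) ≠ 0 := by exact_mod_cast hN.ne'
  field_simp
  rw [one_smul]
open Classical in
def tauf (P : ι → Mc κ) (Jx : Type*) [Fintype Jx] (c : ι) : Finset (Jx × ι) :=
  univ.filter fun i => P c * P i.2 ≠ P i.2 * P c
lemma Uf_Bf (hP : PF P) (A : Jx → Mc n) (c : ι) (i : Jx × ι) :
    Uf P c * Bf P A i * Uf P c = if i ∈ tauf P Jx c then - Bf P A i else Bf P A i := by
  unfold Bf Uf
  rw [Matrix.mul_smul, Matrix.smul_mul, ← mul_kronecker_mul, ← mul_kronecker_mul, one_mul, mul_one]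
  by_cases h : P c * P i.2 = P i.2 * P c
  · simp only [tauf, Finset.mem_filter, mem_univ, true_and, ne_eq, h, not_true, if_false]
    rw [Matrix.mul_assoc, hP.sq, Matrix.mul_one]
  · simp only [tauf, Finset.mem_filter, mem_univ, true_and, ne_eq, h, not_false_iff, if_true]
    rw [(hP.comm c i.2).resolve_left h, Matrix.neg_mul, Matrix.mul_assoc, hP.sq, Matrix.mul_one, ← smul_neg]
    congr 1; ext a b; simp [kroneckerMap_apply]
end
local notation:max "Sb" P:max A:max g:max => Sg (Bf P A) (cx g)
lemma J_smul (K B : Mc n) (c : ℝ) : J K (c • B) = c • J K B := by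
  rw [J_eq_fderiv, J_eq_fderiv]
  exact (((fderiv ℂ ex K).restrictScalars ℝ).map_smul c B)
def KK (H : Mc n) (t : ℝ) (B : I → Mc n) (g : I → ℝ) : Mc n :=
  H + t • Sg B (cx g)
lemma KK_eq (H : Mc n) (t a : ℝ) (B : I → Mc n) (g : I → ℝ) :
    a • KK H t B g = a • H + Sg (fun i => (a * t) • B i) (cx g) := by
  simp only [KK, Sg, smul_add, smul_sum, mul_smul]
  congr 1
  refine scg fun i => ?_
  rw [smul_comm (cx g i), smul_comm (cx g i)]
lemma KK_herm {H : Mc n} (hH : H.IsHermitian) (t : ℝ) {B : I → Mc n}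
    (hB : Hm B) (g : I → ℝ) : (KK H t B g).IsHermitian := by
  refine hH.add ?_
  have := Sg_herm hB g
  unfold IsHermitian at *
  rw [conjTranspose_smul, this]; simp
@[fun_prop]
lemma KK_cont (H : Mc n) (t : ℝ) (B : I → Mc n) {X : Type*} [TopologicalSpace X]
    {f : X → I → ℝ} (hf : Continuous f) : Continuous (fun x => KK H t B (f x)) := by
  unfold KK; fun_prop
lemma KK_norm (H : Mc n) (t : ℝ) (B : I → Mc n) (g : I → ℝ) :
    ‖KK H t B g‖ ≤ ‖H‖ + (|t| * ‖SgL B‖) * ‖g‖ := by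
  unfold KK
  refine (norm_add_le _ _).trans ?_
  rw [norm_smul, ← SgL_apply, norm_eq_abs, mul_assoc, ← norm_cx]
  linarith [mlL ((SgL B).le_opNorm (cx g)) (abs_nonneg t)]
lemma intgK {W : Type*} [NormedAddCommGroup W] (H : Mc n) (t : ℝ) (B : I → Mc n)
    {f : (I → ℝ) → W} (hf : Continuous f) {C c : ℝ} (hC : 0 ≤ C) (hc : 0 ≤ c)
    (h : ∀ g, ‖f g‖ ≤ C * exp (c * ‖KK H t B g‖)) : Integrable f (gG I) := by
  refine integrable_exp hf (A := C * exp (c * ‖H‖)) (B := c * (|t| * ‖SgL B‖)) fun g => (h g).trans ?_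
  rw [mul_assoc, ← exp_add, mul_assoc c, ← mul_add]
  exact mlL (exp_le_exp.2 (mlL (KK_norm H t B g) hc)) hC
lemma rtr_ex_nonneg {K : Mc n} (hK : K.IsHermitian) : 0 ≤ rtr (ex K) := by
  obtain ⟨U, l, hU, -, hl⟩ := eig hK
  rw [tr_ex_eq hU hl]
  exact sum_nonneg fun i _ => exp0
lemma trace_norm_le (M : Mc n) : ‖M.trace‖ ≤ ‖trL (n := n) 1 1‖ * ‖M‖ := by
  have := (trL (n := n) 1 1).le_opNorm M
  simpa using this
lemma rtr_norm_le (M : Mc n) : ‖rtr M‖ ≤ ‖trL (n := n) 1 1‖ * ‖M‖ :=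
  (abs_rtr_le M).trans (trace_norm_le M)
lemma intg_rtr_ex (H : Mc n) (t : ℝ) (B : I → Mc n) :
    Integrable (fun g => rtr (ex (KK H t B g))) (gG I) := by
  refine intgK H t B (by fun_prop) (C := ‖trL (n := n) 1 1‖) (c := 1) nng zero_le_one fun g => ?_
  rw [one_mul]
  exact (rtr_norm_le _).trans (mlL (norm_ex_le _) nng)
@[fun_prop]
lemma xpt_cont (τ : Finset I) (α : ℝ) : Continuous (fun w : I ⊕ I → ℝ => xpt τ α w) := by
  refine continuous_pi fun i => ?_
  unfold xpt; split_ifs <;> fun_prop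
lemma xpt_norm (τ : Finset I) (α : ℝ) (w : I ⊕ I → ℝ) : ‖xpt τ α w‖ ≤ 2 * ‖w‖ := by
  refine (pi_norm_le_iff_of_nonneg (by positivity)).2 fun i => ?_
  have h1 := norm_le_pi_norm w (inl i)
  have h2 := norm_le_pi_norm w (inr i)
  unfold xpt; split_ifs
  · refine (norm_add_le _ _).trans ?_
    rw [norm_mul, norm_mul]
    have := mul_le_of_le_one_left (norm_nonneg (w (inl i))) (Real.abs_cos_le_one α)
    have := mul_le_of_le_one_left (norm_nonneg (w (inr i))) (Real.abs_sin_le_one α)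
    simp only [norm_eq_abs] at *
    linarith
  · linarith [norm_nonneg w]
lemma intgK2 {W : Type*} [NormedAddCommGroup W] (H : Mc n) (t : ℝ) (B : I → Mc n)
    (τ : Finset I) (α : ℝ)
    {f : (I ⊕ I → ℝ) → W} (hf : Continuous f) {C c : ℝ} (hC : 0 ≤ C) (hc : 0 ≤ c)
    (h : ∀ w, ‖f w‖ ≤ C * exp (c * (‖KK H t B (xpt τ α w)‖ + ‖KK H t B (w ∘ inl)‖))) :
    Integrable f (gG (I ⊕ I)) := by
  refine integrable_exp hf (A := C * exp (c * (2 * ‖H‖))) (B := c * (|t| * ‖SgL B‖ * 4)) fun w => (h w).trans ?_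
  rw [mul_assoc, ← exp_add, mul_assoc c, ← mul_add]
  refine mlL (exp_le_exp.2 (mlL ?_ hc)) hC
  have h1 := KK_norm H t B (xpt τ α w)
  have h2 := KK_norm H t B (w ∘ inl)
  have h3 := xpt_norm τ 0 w
  rw [xpt_zero] at h3
  have p : 0 ≤ |t| * ‖SgL B‖ := by positivity
  have := mlL (xpt_norm τ α w) p
  have := mlL h3 p
  linarith
lemma rtr_rot (H : Mc n) (t : ℝ) (B : I → Mc n) (τ : Finset I) (α : ℝ) :
    ∫ w, rtr (ex (KK H t B (xpt τ α w))) ∂(gG (I ⊕ I)) = ∫ g, rtr (ex (KK H t B g)) ∂(gG I) ∧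
    Integrable (fun w => rtr (ex (KK H t B (xpt τ α w)))) (gG (I ⊕ I)) := by
  have h := rot (trL (n := n) 1 1) H (fun i => t • B i) τ α
  have e : ∀ g, KK H t B g = H + Sg (fun i => t • B i) (cx g) := fun g => by
    have := KK_eq H t 1 B g; simpa using this
  simp only [trL_apply, Matrix.one_mul, Matrix.mul_one] at h
  have i1 : Integrable (fun g => (ex (KK H t B g)).trace) (gG I) := by
    refine intgK H t B (by fun_prop) (C := ‖trL (n := n) 1 1‖) (c := 1) nng zero_le_one fun g => ?_
    rw [one_mul]
    exact (trace_norm_le _).trans (mlL (norm_ex_le _) nng)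
  have i2 : Integrable (fun w => (ex (KK H t B (xpt τ α w))).trace) (gG (I ⊕ I)) := by
    have hx := xpt_cont (I := I) τ α
    have hxn := fun w => xpt_norm (I := I) τ α w
    refine integrable_exp (by fun_prop) (A := ‖trL (n := n) 1 1‖ * exp ‖H‖)
      (B := |t| * ‖SgL B‖ * 2) fun w => ?_
    refine (trace_norm_le _).trans ?_
    rw [mul_assoc, ← exp_add]
    refine mlL ((norm_ex_le _).trans (exp_le_exp.2 ((KK_norm _ _ _ _).trans ?_))) nng
    have := mlL (hxn w) (show 0 ≤ |t| * ‖SgL B‖ by positivity)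
    linarith
  refine ⟨?_, i2.re⟩
  simp only [← e] at h
  have r1 := integral_re (𝕜 := ℂ) i1
  have r2 := integral_re (𝕜 := ℂ) i2
  simp only [RCLike.re_eq_complex_re] at r1 r2
  unfold rtr
  rw [r1, r2, h]
lemma covA {Jx : Type*} [Fintype Jx] {A : Jx → Mc n} {B : I → Mc n}
    (hA : Hm A) (hB : Hm B) {N v s2 : ℝ} (hN : 0 < N) (hv : 0 ≤ v)
    (hsA : HsB A (N * v)) (hsB : HsB B (v / N)) (hA2 : ‖∑ j, A j * A j‖ ≤ s2)
    (hB2 : ‖∑ j, B j * B j‖ ≤ s2) {H : Mc n} (hH : H.IsHermitian) (t : ℝ) (τ : Finset I)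
    {a b : ℝ} (ha : 0 ≤ a) (hb : 0 ≤ b) (hab : a + b = 1) :
    ‖(∑ j, ∫ w, (A j * ex (a • KK H t B (xpt τ Real.pi w)) * A j * ex (b • KK H t B (w ∘ inl))).trace ∂(gG (I ⊕ I))) -
      ∑ j, ∫ w, (A j * ex (a • KK H t B (w ∘ inl)) * A j * ex (b • KK H t B (w ∘ inl))).trace ∂(gG (I ⊕ I))‖
    ≤ 8 * (t ^ 2 * v * s2 * ∫ g, rtr (ex (KK H t B g)) ∂(gG I)) := by
  set ψ := ∫ g, rtr (ex (KK H t B g)) ∂(gG I) with hψ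
  have hψ0 : 0 ≤ ψ := integral_nonneg fun g => rtr_ex_nonneg (KK_herm hH t hB g)
  have hs2 : 0 ≤ s2 := nng.trans hA2
  set f : ℝ → ℂ := fun α => ∑ j, ∫ w, (A j * ex (a • KK H t B (xpt τ α w)) * A j * ex (b • KK H t B (w ∘ inl))).trace ∂(gG (I ⊕ I)) with hf
  set f' : ℝ → ℂ := fun α => ∑ j, (-sin α • ∑ i ∈ τ, ∫ w,
      (A j * J (a • KK H t B (xpt τ α w)) ((a * t) • B i) * A j * J (b • KK H t B (w ∘ inl)) ((b * t) • B i)).trace ∂(gG (I ⊕ I))) with hf'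
  have hd : ∀ α, HasDerivAt f (f' α) α := by
    intro α
    refine HasDerivAt.fun_sum fun j _ => ?_
    have := cov (trL (A j) 1) (A j) (a • H) (b • H) (fun i => (a * t) • B i) (fun i => (b * t) • B i) τ α
    simp only [← KK_eq, trL_apply, Matrix.mul_one, ← Matrix.mul_assoc] at this
    exact this
  have hbd : ∀ α, ‖f' α‖ ≤ 2 * (t ^ 2 * v * s2 * ψ) := by
    intro α
    have hi : ∀ j i, Integrable (fun w => (A j * J (a • KK H t B (xpt τ α w)) ((a * t) • B i) * A j *
        J (b • KK H t B (w ∘ inl)) ((b * t) • B i)).trace) (gG (I ⊕ I)) := by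
      intro j i
      refine intgK2 H t B τ α (by fun_prop)
        (C := ‖trL (n := n) 1 1‖ * (‖A j‖ * ‖(a * t) • B i‖ * ‖A j‖ * ‖(b * t) • B i‖)) (c := 1) (by positivity) zero_le_one fun w => ?_
      refine (trace_norm_le _).trans ?_
      rw [mul_assoc ‖trL (n := n) 1 1‖]
      refine mlL ?_ nng
      have l1 := J_norm_le (a • KK H t B (xpt τ α w)) ((a * t) • B i)
      have l2 := J_norm_le (b • KK H t B (w ∘ inl)) ((b * t) • B i)
      have ea : exp ‖a • KK H t B (xpt τ α w)‖ ≤ exp ‖KK H t B (xpt τ α w)‖ := by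
        refine exp_le_exp.2 ?_
        rw [norm_smul, norm_eq_abs, abs_of_nonneg ha]
        exact mul_le_of_le_one_left nng (by linarith)
      have eb : exp ‖b • KK H t B (w ∘ inl)‖ ≤ exp ‖KK H t B (w ∘ inl)‖ := by
        refine exp_le_exp.2 ?_
        rw [norm_smul, norm_eq_abs, abs_of_nonneg hb]
        exact mul_le_of_le_one_left nng (by linarith)
      rw [one_mul, exp_add]
      calc _ ≤ ‖A j‖ * ‖J (a • KK H t B (xpt τ α w)) ((a * t) • B i)‖ * ‖A j‖ * ‖J (b • KK H t B (w ∘ inl)) ((b * t) • B i)‖ := by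
            refine (norm_mul_le _ _).trans (mlR ?_ nng)
            refine (norm_mul_le _ _).trans (mlR ?_ nng)
            exact norm_mul_le _ _
        _ ≤ ‖A j‖ * (‖(a * t) • B i‖ * exp ‖KK H t B (xpt τ α w)‖) * ‖A j‖ *
            (‖(b * t) • B i‖ * exp ‖KK H t B (w ∘ inl)‖) := by
            have l1' := l1.trans (mlL ea nng)
            have l2' := l2.trans (mlL eb nng)
            gcongr
        _ = _ := by ring
    have e : f' α = -sin α • ∫ w, (a * t) * (b * t) * (∑ i, ∑ j, (A j * J (a • KK H t B (xpt τ α w)) (rst τ B i) * A j *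
        J (b • KK H t B (w ∘ inl)) (rst τ B i)).trace) ∂(gG (I ⊕ I)) := by
      have e1 : ∀ w : I ⊕ I → ℝ, ((a * t : ℝ) : ℂ) * ((b * t : ℝ) : ℂ) * (∑ i, ∑ j, (A j * J (a • KK H t B (xpt τ α w)) (rst τ B i) * A j *
        J (b • KK H t B (w ∘ inl)) (rst τ B i)).trace) = ∑ j, ∑ i ∈ τ, (A j * J (a • KK H t B (xpt τ α w)) ((a * t) • B i) * A j *
        J (b • KK H t B (w ∘ inl)) ((b * t) • B i)).trace := by
        intro w
        rw [sum_comm, mul_sum]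
        refine scg fun j => ?_
        rw [mul_sum, ← Finset.sum_subset (Finset.subset_univ τ)]
        · refine Finset.sum_congr rfl fun i hi => ?_
          simp only [rst, hi, if_true, J_smul, Matrix.smul_mul, Matrix.mul_smul, trace_smul, Complex.real_smul]
          ring
        · intro i _ hi
          simp [rst, hi, J_zero_right]
      simp only [Complex.ofReal_mul] at e1
      simp only [e1, hf']
      rw [← smul_sum, integral_finsetSum _ (fun j _ => integrable_finsetSum _ (fun i _ => hi j i))]
      congr 1
      refine scg fun j => ?_
      rw [integral_finsetSum _ (fun i _ => hi j i)]
    rw [e, norm_smul, norm_eq_abs, abs_neg]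
    refine (mul_le_of_le_one_left nng (Real.abs_sin_le_one α)).trans ?_
    have i1 := rtr_rot H t B τ α
    have i0 := rtr_rot H t B τ 0
    simp only [xpt_zero] at i0
    have hle : ‖∫ w, (a * t) * (b * t) * (∑ i, ∑ j, (A j * J (a • KK H t B (xpt τ α w)) (rst τ B i) * A j *
        J (b • KK H t B (w ∘ inl)) (rst τ B i)).trace) ∂(gG (I ⊕ I))‖ ≤
        ∫ w, t ^ 2 * (v * s2) * (rtr (ex (KK H t B (xpt τ α w))) + rtr (ex (KK H t B (w ∘ inl)))) ∂(gG (I ⊕ I)) := by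
      refine norm_integral_le_of_norm_le ((i1.2.add i0.2).const_mul _) (of_forall fun w => ?_)
      have := crossing hA (rst_herm τ hB) hN hv hsA (rst_HsB τ (by positivity) hsB) hA2 (rst_norm τ hB hB2)
        (KK_herm hH t hB (xpt τ α w)) (KK_herm hH t hB (w ∘ inl)) ha hb hab
      rw [norm_mul, mul_assoc (t ^ 2)]
      refine mul_le_mul ?_ this nng (sq_nonneg t)
      rw [norm_mul, norm_mul, norm_mul]
      simp only [norm_real, norm_eq_abs, abs_of_nonneg ha, abs_of_nonneg hb]
      rw [← sq_abs t]
      have : a * b ≤ 1 := by nlinarith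
      nlinarith [sq_nonneg |t|]
    refine hle.trans (le_of_eq ?_)
    rw [integral_const_mul, integral_add i1.2 i0.2, i1.1, i0.1]
    ring
  have := norm_image_sub_le_of_norm_deriv_le_segment' (a := 0) (b := Real.pi) (f := f) (f' := f') (C := 2 * (t ^ 2 * v * s2 * ψ))
    (fun x _ => (hd x).hasDerivWithinAt) (fun x _ => hbd x) Real.pi ⟨Real.pi_pos.le, le_rfl⟩
  simp only [hf, xpt_zero] at this
  refine this.trans ?_
  have : 0 ≤ t ^ 2 * v * s2 * ψ := by positivity
  nlinarith [Real.pi_le_four, Real.pi_pos]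
lemma fub {W : Type*} [NormedAddCommGroup W] [NormedSpace ℝ W] [SecondCountableTopology W] {f : ℝ → (I → ℝ) → W}
    (hf : Continuous (Function.uncurry f)) {s A B : ℝ} (hs : 0 ≤ s)
    (h : ∀ a ∈ Icc 0 s, ∀ g, ‖f a g‖ ≤ A * exp (B * ‖g‖)) :
    (∫ g, (∫ a in 0..s, f a g) ∂(gG I) = ∫ a in 0..s, ∫ g, f a g ∂(gG I)) ∧
    IntervalIntegrable (fun a => ∫ g, f a g ∂(gG I)) volume 0 s := by
  have hi : Integrable (Function.uncurry f) ((volume.restrict (uIoc 0 s)).prod (gG I)) := by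
    have : IsFiniteMeasure (volume.restrict (uIoc 0 s)) := by
      rw [Set.uIoc_of_le hs]; infer_instance
    have h0 : Integrable (fun z : ℝ × (I → ℝ) => (1:ℝ) * (A * exp (B * ‖z.2‖))) ((volume.restrict (uIoc 0 s)).prod (gG I)) :=
      Integrable.mul_prod (f := fun _ : ℝ => (1:ℝ)) (integrable_const _) (intgI A B)
    refine h0.mono' hf.aestronglyMeasurable ?_
    have hae : ∀ᵐ z ∂((volume.restrict (uIoc 0 s)).prod (gG I)), z.1 ∈ uIoc 0 s := by
      have := (ae_restrict_mem (μ := volume) (measurableSet_uIoc (a := 0) (b := s)))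
      exact Measure.quasiMeasurePreserving_fst.ae this
    filter_upwards [hae] with z hz
    rw [Set.uIoc_of_le hs] at hz
    rw [one_mul]
    exact h z.1 ⟨hz.1.le, hz.2⟩ z.2
  refine ⟨(intervalIntegral_integral_swap hi).symm, ?_⟩
  rw [intervalIntegrable_iff]
  exact hi.integral_prod_left
lemma bd4 (K Y Z : Mc n) {a : ℝ} (ha : a ∈ Icc (0:ℝ) 1) :
    ‖(Y * ex (a • K) * Z * ex ((1 - a) • K)).trace‖ ≤ ‖trL (n := n) 1 1‖ * (‖Y‖ * ‖Z‖) * exp ‖K‖ := by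
  refine (trace_norm_le _).trans ?_
  rw [mul_assoc ‖trL (n := n) 1 1‖]
  refine mlL ?_ (norm_nonneg (trL (n := n) 1 1))
  have h1 := norm_ex_le (a • K)
  have h2 := norm_ex_le ((1 - a) • K)
  rw [norm_smul, norm_eq_abs, abs_of_nonneg ha.1] at h1
  rw [norm_smul, norm_eq_abs, abs_of_nonneg (by linarith [ha.2])] at h2
  calc _ ≤ ‖Y‖ * ‖ex (a • K)‖ * ‖Z‖ * ‖ex ((1 - a) • K)‖ := by
        refine (norm_mul_le _ _).trans (mlR ?_ nng)
        refine (norm_mul_le _ _).trans (mlR ?_ nng)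
        exact norm_mul_le _ _
    _ ≤ ‖Y‖ * exp (a * ‖K‖) * ‖Z‖ * exp ((1 - a) * ‖K‖) := by gcongr
    _ = ‖Y‖ * ‖Z‖ * exp ‖K‖ := by
        have : exp ‖K‖ = exp (a * ‖K‖) * exp ((1 - a) * ‖K‖) := by
          rw [← exp_add]; congr 1; ring
        rw [this]; ring
lemma int_trJ (H : Mc n) (t : ℝ) (B : I → Mc n) (Y Z : Mc n) :
    (∫ g, (Y * J (KK H t B g) Z).trace ∂(gG I) =
      ∫ a in 0..1, ∫ g, (Y * ex (a • KK H t B g) * Z * ex ((1 - a) • KK H t B g)).trace ∂(gG I)) ∧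
    IntervalIntegrable (fun a : ℝ => ∫ g, (Y * ex (a • KK H t B g) * Z * ex ((1 - a) • KK H t B g)).trace ∂(gG I)) volume 0 1 := by
  simp only [trace_mul_J]
  refine fub (A := ‖trL (n := n) 1 1‖ * (‖Y‖ * ‖Z‖) * exp ‖H‖) (B := |t| * ‖SgL B‖) ?_ zero_le_one ?_
  · simp only [Function.uncurry_def]; fun_prop
  · intro a ha g
    refine (bd4 _ Y Z ha).trans ?_
    rw [mul_assoc _ (exp ‖H‖), ← exp_add]
    exact mlL (exp_le_exp.2 (KK_norm H t B g)) (by positivity)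
lemma flipK (hP : PF P) (A : Jx → Mc n) (c : ι) (H0 : Mc n) (t a : ℝ) (w : (Jx × ι) ⊕ (Jx × ι) → ℝ) :
    Uf P c * ex (a • KK (amp κ H0) t (Bf P A) (w ∘ inl)) * Uf P c =
      ex (a • KK (amp κ H0) t (Bf P A) (xpt (tauf P Jx c) Real.pi w)) := by
  rw [← ex_conj _ _ _ (Uf_sq hP c)]
  congr 1
  unfold KK Sg
  simp only [Matrix.mul_smul, Matrix.smul_mul, Matrix.mul_add, Matrix.add_mul, Uf_amp hP, mul_sum, sum_mul, Uf_Bf hP]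
  congr 3
  refine scg fun i => ?_
  unfold cx xpt
  split_ifs <;> simp
lemma partA (hP : PF P) (hN : 0 < card κ) {A : Jx → Mc n} (hA : Hm A) {v s2 : ℝ} (hv : 0 ≤ v)
    (hs : HsB A v) (hA2 : ‖∑ j, A j * A j‖ ≤ s2) {H0 : Mc n} (hH : H0.IsHermitian) (t : ℝ) :
    ‖(∑ j, ∫ g, (amp κ (A j) * J (KK (amp κ H0) t (Bf P A) g) (amp κ (A j))).trace ∂(gG (Jx × ι))) -
      ∑ i, ∫ g, (Bf P A i * J (KK (amp κ H0) t (Bf P A) g) (Bf P A i)).trace ∂(gG (Jx × ι))‖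
    ≤ 8 * (t ^ 2 * v * s2 * ∫ g, rtr (ex (KK (amp κ H0) t (Bf P A) g)) ∂(gG (Jx × ι))) := by
  set K : (Jx × ι → ℝ) → Mc (n × κ) := KK (amp κ H0) t (Bf P A) with hK
  set bd := 8 * (t ^ 2 * v * s2 * ∫ g, rtr (ex (K g)) ∂(gG (Jx × ι))) with hbd
  set N : ℝ := crd κ with hNd
  have hN' : 0 < N := Nat.cast_pos.2 hN
  have hB := Bf_herm hP hA
  have iT := fun (Y : Mc (n × κ)) => int_trJ (amp κ H0) t (Bf P A) Y Y
  simp only [← hK] at iT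
  simp only [(iT _).1]
  rw [← intervalIntegral.integral_finsetSum (fun i _ => (iT _).2), ← intervalIntegral.integral_finsetSum (fun i _ => (iT _).2),
    ← intervalIntegral.integral_sub (by simpa only [Finset.sum_fn] using IntervalIntegrable.sum (univ) fun i _ => (iT (amp κ (A i))).2)
      (by simpa only [Finset.sum_fn] using IntervalIntegrable.sum (univ) fun i _ => (iT (Bf P A i)).2)]
  have key : ∀ a ∈ uIoc (0:ℝ) 1, ‖(∑ j, ∫ g, (amp κ (A j) * ex (a • K g) * amp κ (A j) * ex ((1 - a) • K g)).trace ∂(gG (Jx × ι))) -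
      ∑ i, ∫ g, (Bf P A i * ex (a • K g) * Bf P A i * ex ((1 - a) • K g)).trace ∂(gG (Jx × ι))‖ ≤ bd := by
    intro a ha
    rw [Set.uIoc_of_le zero_le_one] at ha
    have hKc : Continuous K := KK_cont _ _ _ continuous_id
    have hint : ∀ Y Z : Mc (n × κ), Integrable (fun g => (Y * ex (a • K g) * Z * ex ((1 - a) • K g)).trace) (gG (Jx × ι)) := by
      intro Y Z
      refine intgK (amp κ H0) t (Bf P A) (by fun_prop) (C := ‖trL (n := n × κ) 1 1‖ * (‖Y‖ * ‖Z‖)) (c := 1) (by positivity) zero_le_one fun g => ?_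
      rw [one_mul]
      exact bd4 _ _ _ ⟨ha.1.le, ha.2⟩
    have c0 := fun c : ι => covA (τ := tauf P Jx c) (fun j => amp_herm (κ := κ) (hA j)) hB hN' hv (amp_HsB hs) (Bf_HsB hP hA hs hN) (amp_sq hA2)
      (by rw [Bf_sq hP hN]; exact amp_sq hA2) (amp_herm (κ := κ) hH) t ha.1.le (by linarith [ha.2] : 0 ≤ 1 - a) (by ring)
    have fl := fun c w => flipK hP A c H0 t a w
    simp only [← hK] at fl
    simp only [← hK, ← hbd, ← fl] at c0
    set F : ι → Jx → (Jx × ι → ℝ) → ℂ := fun c j g => (amp κ (A j) * (Uf P c * ex (a • K g) * Uf P c) * amp κ (A j) * ex ((1 - a) • K g)).trace with hF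
    set G : Jx → (Jx × ι → ℝ) → ℂ := fun j g => (amp κ (A j) * ex (a • K g) * amp κ (A j) * ex ((1 - a) • K g)).trace with hG
    have hFi : ∀ c j, Integrable (F c j) (gG (Jx × ι)) := by
      intro c j
      have := hint (amp κ (A j) * Uf P c) (Uf P c * amp κ (A j))
      simpa only [hF, Matrix.mul_assoc] using this
    have c1 : ∀ c, ‖(∑ j, ∫ g, F c j g ∂(gG (Jx × ι))) - ∑ j, ∫ g, G j g ∂(gG (Jx × ι))‖ ≤ bd := by
      intro c
      have := c0 c
      rw [scg fun j => integral_inl (hFi c j), scg fun j => integral_inl (f := G j) (hint _ _)] at this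
      exact this
    have e1 : ∀ j c, ∫ g, (Bf P A (j, c) * ex (a • K g) * Bf P A (j, c) * ex ((1 - a) • K g)).trace ∂(gG (Jx × ι)) =
        ((N ^ 2)⁻¹ : ℝ) * ∫ g, F c j g ∂(gG (Jx × ι)) := by
      intro j c
      rw [← integral_const_mul]
      congr 1; funext g
      have b1 : Bf P A (j, c) * ex (a • K g) * Bf P A (j, c) =
          (((N ^ 2)⁻¹ : ℝ) : ℂ) • (amp κ (A j) * (Uf P c * ex (a • K g) * Uf P c) * amp κ (A j)) := by
        conv_lhs => rw [show Bf P A (j, c) * ex (a • K g) * Bf P A (j, c) = (((crd κ)⁻¹ : ℂ) • (amp κ (A j) * Uf P c)) * ex (a • K g) *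
          (((crd κ)⁻¹ : ℂ) • (Uf P c * amp κ (A j))) from by rw [← (Bf_eq hP A (j, c)).1, ← (Bf_eq hP A (j, c)).2]]
        simp only [Matrix.smul_mul, Matrix.mul_smul, smul_smul, Matrix.mul_assoc]
        congr 1
        push_cast [hNd]
        ring
      rw [b1, Matrix.smul_mul, trace_smul, smul_eq_mul]
    rw [Fintype.sum_prod_type_right]
    simp only [e1, ← mul_sum]
    have e2 : (∑ j, ∫ g, G j g ∂(gG (Jx × ι))) - ((N ^ 2)⁻¹ : ℝ) * ∑ c, ∑ j, ∫ g, F c j g ∂(gG (Jx × ι)) =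
        ((N ^ 2)⁻¹ : ℝ) * ∑ c : ι, -((∑ j, ∫ g, F c j g ∂(gG (Jx × ι))) - ∑ j, ∫ g, G j g ∂(gG (Jx × ι))) := by
      simp only [neg_sub, Finset.sum_sub_distrib, Finset.sum_const, Finset.card_univ, hP.card, mul_sub]
      congr 1
      rw [nsmul_eq_mul, ← mul_assoc, hNd]
      push_cast
      rw [inv_mul_cancel₀ (pow_ne_zero _ (Nat.cast_ne_zero.2 hN.ne')), one_mul]
    refine (le_of_eq (congrArg _ e2)).trans ?_
    rw [norm_mul, norm_real, norm_eq_abs, abs_of_pos (by positivity)]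
    have : ‖∑ c : ι, -((∑ j, ∫ g, F c j g ∂(gG (Jx × ι))) - ∑ j, ∫ g, G j g ∂(gG (Jx × ι)))‖ ≤ N ^ 2 * bd := by
      refine (norm_sum_le _ _).trans ((Finset.sum_le_card_nsmul _ _ bd fun c _ => by rw [norm_neg]; exact c1 c).trans (le_of_eq ?_))
      rw [Finset.card_univ, hP.card, nsmul_eq_mul, hNd]; push_cast; ring
    calc _ ≤ (N ^ 2)⁻¹ * (N ^ 2 * bd) := mlL this (by positivity)
      _ = bd := by field_simp
  have := intervalIntegral.norm_integral_le_of_norm_le_const key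
  simpa using this
lemma rtr_sum {α : Type*} (s : Finset α) (f : α → Mc n) : rtr (∑ i ∈ s, f i) = ∑ i ∈ s, rtr (f i) := by
  simp [rtr, trace_sum]
lemma rtr_smul (c : ℝ) (M : Mc n) : rtr (c • M) = c * rtr M := by
  simp [rtr, trace_smul]
lemma rtr_mul_ex_le (M : Mc n) {K : Mc n} (hK : K.IsHermitian) :
    rtr (M * ex K) ≤ ‖M‖ * rtr (ex K) := by
  obtain ⟨U, l, hU, -, hl⟩ := eig hK
  rw [tr_ex_eq hU hl]
  have h1 := hl 1
  rw [one_smul] at h1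
  rw [h1]
  have : (M * (U * diagonal (fun i => ((exp (1 * l i) : ℝ) : ℂ)) * Uᴴ)).trace =
      (Uᴴ * M * U * diagonal (fun i => ((exp (1 * l i) : ℝ) : ℂ))).trace := by
    rw [← Matrix.mul_assoc, trace_mul_comm]; simp only [Matrix.mul_assoc]
  rw [rtr, this, trace, Complex.re_sum, mul_sum]
  refine sle fun i => ?_
  rw [diag_apply, mul_diagonal, one_mul, Complex.re_mul_ofReal]
  refine mlR ?_ exp0
  refine (Complex.re_le_norm _).trans ((norm_entry_le _ i i).trans ?_)
  have a1 := hU.norm_le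
  have a2 : ‖Uᴴ‖ ≤ 1 := by rw [← star_eq_conjTranspose, norm_star]; exact a1
  calc _ ≤ ‖Uᴴ * M‖ * ‖U‖ := norm_mul_le _ _
    _ ≤ ‖Uᴴ‖ * ‖M‖ * ‖U‖ := mlR (norm_mul_le _ _) nng
    _ ≤ 1 * ‖M‖ * 1 := by gcongr
    _ = _ := by ring
lemma sum_q_le {Jx : Type*} [Fintype Jx] {A : Jx → Mc n} {s2 : ℝ} (hA2 : ‖∑ j, A j * A j‖ ≤ s2) {K : Mc n} (hK : K.IsHermitian) :
    ∑ j, q (A j) K ≤ s2 * rtr (ex K) := by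
  unfold q
  rw [← rtr_sum, ← sum_mul]
  exact (rtr_mul_ex_le _ hK).trans (mlR hA2 (rtr_ex_nonneg hK))
def CovEq {T E Jx : Type*} [Fintype T] [MeasurableSpace E] [Fintype Jx] (ν : T → Measure E)
    (Y : T → E → Mc n) (A : Jx → Mc n) : Prop :=
  ∀ L : Mc n →ₗ[ℂ] Mc n →ₗ[ℂ] ℂ, ∑ t, ∫ e, L (Y t e) (Y t e) ∂(ν t) = ∑ j, L (A j) (A j)
def JL (K : Mc n) : Mc n →ₗ[ℂ] Mc n →ₗ[ℂ] ℂ :=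
  LinearMap.mk₂ ℂ (fun X Y => (X * J K Y).trace)
    (fun _ _ _ => by simp [Matrix.add_mul]) (fun _ _ _ => by simp)
    (fun _ _ _ => by simp [J_eq_fderiv, Matrix.mul_add]) (fun _ _ _ => by simp [J_eq_fderiv])
def QL (K : Mc n) : Mc n →ₗ[ℂ] Mc n →ₗ[ℂ] ℂ :=
  LinearMap.mk₂ ℂ (fun X Y => (X * Y * ex K).trace)
    (fun _ _ _ => by simp [Matrix.add_mul]) (fun _ _ _ => by simp)
    (fun _ _ _ => by simp [Matrix.mul_add, Matrix.add_mul]) (fun _ _ _ => by simp)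
lemma integrable_update {V : Type*} [NormedAddCommGroup V]
    (ν : T → Measure E) [∀ i, IsProbabilityMeasure (ν i)] (i : T) {f : (T → E) → V}
    (hf : Integrable f (Measure.pi ν)) :
    Integrable (fun p : (T → E) × E => f (update p.1 i p.2)) ((Measure.pi ν).prod (ν i)) := by
  have h := mp_update ν i
  rw [← h.map_eq] at hf
  exact hf.comp_measurable h.measurable
lemma re_int {Ω : Type*} [MeasurableSpace Ω] {ν : Measure Ω} {f : Ω → Mc n} (h : Integrable (fun e => (f e).trace) ν) :
    (∫ e, (f e).trace ∂ν).re = ∫ e, rtr (f e) ∂ν := (integral_re (𝕜 := ℂ) h).symm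
set_option maxHeartbeats 800000 in
lemma Xpart (ν : T → Measure E) [∀ i, IsProbabilityMeasure (ν i)] {Y : T → E → Mc n}
    (hm : ∀ t, StronglyMeasurable (Y t)) (hY : ∀ t e, (Y t e).IsHermitian) {r : ℝ} (hr : 0 < r) (hr1 : r ≤ 1 / 100)
    (hYr : ∀ t e, ‖Y t e‖ ≤ r) (h0 : ∀ t i j, ∫ e, Y t e i j ∂(ν t) = 0) {A : Jx → Mc n}
    (hc : CovEq ν Y A) {s2 : ℝ} (hA2 : ‖∑ j, A j * A j‖ ≤ s2) {H : Mc n} (hH : H.IsHermitian) :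
    ∫ z, rtr ((∑ t, Y t (z t)) * ex (H + ∑ t, Y t (z t))) ∂(Measure.pi ν) ≤
      ∫ z, (∑ j, rtr (A j * J (H + ∑ t, Y t (z t)) (A j))) ∂(Measure.pi ν) +
      100 * r * s2 * ∫ z, rtr (ex (H + ∑ t, Y t (z t))) ∂(Measure.pi ν) := by
  set X : (T → E) → Mc n := fun z => ∑ t, Y t (z t) with hX
  have hYm : ∀ t, StronglyMeasurable (fun z : T → E => Y t (z t)) := fun t => (hm t).comp_measurable (measurable_pi_apply t)
  have hXm : StronglyMeasurable X := Finset.stronglyMeasurable_fun_sum _ fun t _ => hYm t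
  have hXb : ∀ z, ‖X z‖ ≤ card T * r := fun z =>
    (norm_sum_le_of_le _ fun t _ => hYr t (z t)).trans (by simp)
  have hXh : Hm X := fun z => by
    simp only [hX, IsHermitian, conjTranspose_sum, (hY _ _).eq]
  set ρ : ℝ := max r (card T * r)
  have iP : ∀ t {F : Mc n × Mc n → ℝ}, Continuous F →
      Integrable (fun p : (T → E) × E => F (X p.1, Y t p.2)) ((Measure.pi ν).prod (ν t)) := by
    intro t F hF
    refine integrable_comp (X := fun p : (T → E) × E => (X p.1, Y t p.2)) (r := ρ) ?_ ?_ hF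
    · exact ((hXm.comp_measurable measurable_fst).prodMk ((hm t).comp_measurable measurable_snd)).aestronglyMeasurable
    · intro p
      exact max_le ((hXb _).trans (le_max_right _ _)) ((hYr _ _).trans (le_max_left _ _))
  have iX : ∀ {F : Mc n → ℝ}, Continuous F → Integrable (fun z => F (X z)) (Measure.pi ν) :=
    fun hF => integrable_comp hXm.aestronglyMeasurable hXb hF
  have iY : ∀ t {F : Mc n → ℝ}, Continuous F → Integrable (fun e => F (Y t e)) (ν t) :=
    fun t _ hF => integrable_comp (hm t).aestronglyMeasurable (hYr t) hF
  have iYc : ∀ t {F : Mc n → ℂ}, Continuous F → Integrable (fun e => F (Y t e)) (ν t) :=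
    fun t _ hF => integrable_comp (hm t).aestronglyMeasurable (hYr t) hF
  set G : T → Mc n → ℝ := fun t K => ∫ e, (rtr (Y t e * J K (Y t e)) + 100 * r * q (Y t e) K) ∂(ν t) with hG
  have iG : ∀ t, Integrable (fun z => G t (H + X z)) (Measure.pi ν) := by
    intro t
    exact (iP t (F := fun x => rtr (x.2 * J (H + x.1) x.2) + 100 * r * q x.2 (H + x.1)) (by fun_prop)).integral_prod_left
  have if0 : ∀ t, Integrable (fun z => rtr (Y t (z t) * ex (H + X z))) (Measure.pi ν) := by
    intro t
    refine integrable_comp (X := fun z : T → E => (X z, Y t (z t))) (r := ρ) ?_ ?_ (Φ := fun x => rtr (x.2 * ex (H + x.1))) (by fun_prop)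
    · exact (hXm.prodMk (hYm t)).aestronglyMeasurable
    · intro p
      exact max_le ((hXb _).trans (le_max_right _ _)) ((hYr _ _).trans (le_max_left _ _))
  have key : ∀ t, ∫ z, rtr (Y t (z t) * ex (H + X z)) ∂(Measure.pi ν) ≤ ∫ z, G t (H + X z) ∂(Measure.pi ν) := by
    intro t
    rw [integral_update ν t (if0 t), integral_update ν t (iG t)]
    refine integral_mono (integrable_update ν t (if0 t)).integral_prod_left (integrable_update ν t (iG t)).integral_prod_left fun z => ?_
    set K0 := H + ∑ s ∈ univ.erase t, Y s (z s) with hK0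
    have hK0h : K0.IsHermitian := by
      simp only [hK0, IsHermitian, conjTranspose_add, conjTranspose_sum, (hY _ _).eq, hH.eq]
    have eX : ∀ e, H + X (update z t e) = K0 + Y t e := by
      intro e
      simp only [hX, hK0]
      rw [← Finset.sum_erase_add _ _ (mem_univ t), Function.update_self, ← add_assoc]
      congr 2
      refine Finset.sum_congr rfl fun s hs => ?_
      rw [Function.update_of_ne (Finset.ne_of_mem_erase hs)]
    simp only [eX, Function.update_self]
    have := L1 (ν t) (hm t).aestronglyMeasurable (hY t) hr hr1 (hYr t) (h0 t) hK0h
    refine this.trans (le_of_eq ?_)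
    have iYY : ∀ {F : Mc n × Mc n → ℝ}, Continuous F →
        Integrable (fun p : E × E => F (Y t p.1, Y t p.2)) ((ν t).prod (ν t)) := by
      intro F hF
      refine integrable_comp (X := fun p : E × E => (Y t p.1, Y t p.2)) (r := r) ?_ ?_ hF
      · exact (((hm t).comp_measurable measurable_fst).prodMk ((hm t).comp_measurable measurable_snd)).aestronglyMeasurable
      · intro p
        exact max_le (hYr _ _) (hYr _ _)
    have i1 := (iYY (F := fun x => rtr (x.2 * J (K0 + x.1) x.2)) (by fun_prop)).integral_prod_left
    have i2 := (iYY (F := fun x => q x.2 (K0 + x.1)) (by fun_prop)).integral_prod_left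
    rw [← integral_const_mul, ← integral_add i1 (i2.const_mul _)]
    congr 1; funext e
    simp only [hG]
    rw [integral_add (iY t (F := fun y => rtr (y * J (K0 + Y t e) y)) (by fun_prop)) ((iY t (F := fun y => q y (K0 + Y t e)) (by fun_prop)).const_mul _),
      integral_const_mul]
  have eG : ∀ z, ∑ t, G t (H + X z) ≤ (∑ j, rtr (A j * J (H + X z) (A j))) + 100 * r * s2 * rtr (ex (H + X z)) := by
    intro z
    set K := H + X z
    have hK : K.IsHermitian := hH.add (hXh z)
    have c1 := congrArg Complex.re (hc (JL K))
    have c2 := congrArg Complex.re (hc (QL K))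
    simp only [JL, QL, LinearMap.mk₂_apply, Complex.re_sum] at c1 c2
    have r1 : ∀ t, (∫ e, (Y t e * J K (Y t e)).trace ∂(ν t)).re = ∫ e, rtr (Y t e * J K (Y t e)) ∂(ν t) := by
      intro t
      exact re_int (iYc t (F := fun y => (y * J K y).trace) (by fun_prop))
    have r2 : ∀ t, (∫ e, (Y t e * Y t e * ex K).trace ∂(ν t)).re = ∫ e, q (Y t e) K ∂(ν t) := by
      intro t
      exact re_int (iYc t (F := fun y => (y * y * ex K).trace) (by fun_prop))
    simp only [r1, r2] at c1 c2
    have e3 : ∀ t, G t K = ∫ e, rtr (Y t e * J K (Y t e)) ∂(ν t) + 100 * r * ∫ e, q (Y t e) K ∂(ν t) := by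
      intro t
      simp only [hG]
      rw [integral_add (iY t (F := fun y => rtr (y * J K y)) (by fun_prop)) ((iY t (F := fun y => q y K) (by fun_prop)).const_mul _),
        integral_const_mul]
    simp only [e3, sum_add_distrib, ← mul_sum, c1, c2]
    have := mlL (sum_q_le hA2 hK) (by positivity : 0 ≤ 100 * r)
    unfold q rtr at *
    linarith
  calc _ = ∑ t, ∫ z, rtr (Y t (z t) * ex (H + X z)) ∂(Measure.pi ν) := by
        rw [← integral_finsetSum _ fun t _ => if0 t]
        congr 1; funext z
        rw [← rtr_sum, ← sum_mul]
    _ ≤ ∑ t, ∫ z, G t (H + X z) ∂(Measure.pi ν) := sle fun t => key t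
    _ = ∫ z, ∑ t, G t (H + X z) ∂(Measure.pi ν) := by rw [integral_finsetSum _ fun t _ => iG t]
    _ ≤ ∫ z, ((∑ j, rtr (A j * J (H + X z) (A j))) + 100 * r * s2 * rtr (ex (H + X z))) ∂(Measure.pi ν) := by
        refine integral_mono (integrable_finsetSum _ fun t _ => iG t) ?_ eG
        exact iX (F := fun x => (∑ j, rtr (A j * J (H + x) (A j))) + 100 * r * s2 * rtr (ex (H + x))) (by fun_prop)
    _ = _ := by
        rw [integral_add (iX (F := fun x => (∑ j, rtr (A j * J (H + x) (A j)))) (by fun_prop))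
          ((iX (F := fun x => rtr (ex (H + x))) (by fun_prop)).const_mul _), integral_const_mul]
lemma intg_KJ (H : Mc n) (t : ℝ) (B : I → Mc n) (Y Z : Mc n) :
    Integrable (fun g => (Y * J (KK H t B g) Z).trace) (gG I) := by
  refine intgK H t B (by fun_prop) (C := ‖trL (n := n) 1 1‖ * (‖Y‖ * ‖Z‖)) (c := 1) (by positivity) zero_le_one fun g => ?_
  rw [one_mul, mul_assoc, mul_assoc]
  refine (trace_norm_le _).trans (mlL ?_ nng)
  exact (norm_mul_le _ _).trans (mlL (J_norm_le _ _) nng)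
lemma Spart (H : Mc n) (t : ℝ) (B : I → Mc n) :
    ∫ g, rtr (Sg B (cx g) * ex (KK H t B g)) ∂(gG I) = t * ∑ i, ∫ g, rtr (B i * J (KK H t B g) (B i)) ∂(gG I) := by
  have e : ∀ g, KK H t B g = H + Sg (fun i => t • B i) (cx g) := fun g => by
    have := KK_eq H t 1 B g; simpa using this
  have hE := fun i => (EE_exS H (fun i => t • B i)).clm (trL (B i) 1)
  have st := fun i => stein (hE i) i
  have i1 := fun i => ((hE i).coord i).intg
  have hi : ∀ i, ∫ g, rtr ((g i : ℝ) • (B i * ex (KK H t B g))) ∂(gG I) = t * ∫ g, rtr (B i * J (KK H t B g) (B i)) ∂(gG I) ∧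
     Integrable (fun g => rtr ((g i : ℝ) • (B i * ex (KK H t B g)))) (gG I) := by
    intro i
    have h1 := i1 i
    have h2 := st i
    have hfd : ∀ z, fderiv ℂ (fun z => trL (B i) 1 (ex (H + Sg (fun i => t • B i) z))) z (Pi.single i 1) =
        t • (B i * J (H + Sg (fun i => t • B i) z) (B i)).trace := by
      intro z
      have := ((trL (B i) 1).hasFDerivAt.comp z ((EE_exS H (fun i => t • B i)).1 z).differentiableAt.hasFDerivAt).fderiv
      have h3 := congrArg (fun L => L (Pi.single i 1)) this
      refine h3.trans ?_
      rw [ContinuousLinearMap.comp_apply, fderiv_exS, J_smul]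
      simp
    rw [integral_congr_ae (of_forall fun g => hfd (cx g))] at h2
    simp only [← e, trL_apply, Matrix.mul_one, smul_eq_mul] at h1 h2
    change Integrable (fun g => (g i : ℂ) * (B i * ex (KK H t B g)).trace) (gG I) at h1
    have h4 : (fun g : I → ℝ => (g i : ℂ) * (B i * ex (KK H t B g)).trace) = fun g => ((g i : ℝ) • (B i * ex (KK H t B g))).trace := by
      funext g; rw [trace_smul]; simp
    rw [h4] at h1 h2
    refine ⟨?_, h1.re⟩
    rw [← re_int h1, h2, integral_smul, Complex.smul_re, re_int (intg_KJ H t B _ _), smul_eq_mul]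
  rw [mul_sum, ← scg fun i => (hi i).1, ← integral_finsetSum _ fun i _ => (hi i).2]
  congr 1; funext g
  rw [← rtr_sum]
  congr 1
  simp only [Sg, sum_mul, cx, Matrix.smul_mul]
  rfl
lemma tr_J (K B : Mc n) : (J K B).trace = (B * ex K).trace := by
  have := trace_mul_J 1 K B
  rw [one_mul] at this
  rw [this]
  have h : ∀ a : ℝ, (1 * ex (a • K) * B * ex ((1 - a) • K)).trace = (B * ex K).trace := by
    intro a
    rw [one_mul, Matrix.mul_assoc, trace_mul_comm, Matrix.mul_assoc, ← ex_add]
    congr 3; rw [sub_add_cancel, one_smul]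
  simp only [h]; simp
@[fun_prop]
lemma amp_cont {X : Type*} [TopologicalSpace X] {f : X → Mc n} (hf : Continuous f) : Continuous (fun x => amp κ (f x)) := by
  have h : Continuous (((ampH κ : Mc n →⋆ₙₐ[ℂ] _) : Mc n →ₙₐ[ℂ] Mc (n × κ)) : Mc n →ₗ[ℂ] Mc (n × κ)) :=
    LinearMap.continuous_of_finiteDimensional _
  exact h.comp hf
lemma amp_one : amp κ (1 : Mc n) = 1 := by unfold amp; exact one_kronecker_one
lemma ex_amp (M : Mc n) : ex (amp κ M) = amp κ (ex M) := by
  let f : Mc n →+* Mc (n × κ) :=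
    { toFun := amp κ, map_one' := amp_one, map_mul' := amp_mul, map_zero' := (ampH κ).map_zero, map_add' := (ampH κ).map_add }
  let _ := ratAlg n
  let _ := ratAlg (n × κ)
  exact (NormedSpace.map_exp f (amp_cont continuous_id) M).symm
lemma intP {S : Type*} [MeasurableSpace S] {m : Measure S} [IsProbabilityMeasure m] {X : S → Mc n} (hX : StronglyMeasurable X) {ρ : ℝ} (hb : ∀ z, ‖X z‖ ≤ ρ)
    {V : Type*} [NormedAddCommGroup V] {Φ : Mc n → (I → ℝ) → V} (hΦ : Continuous (fun x : Mc n × (I → ℝ) => Φ x.1 x.2)) {C c : ℝ} (hC : 0 ≤ C)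
    (hc : 0 ≤ c) (h : ∀ x g, ‖Φ x g‖ ≤ C * exp (c * (‖x‖ + ‖g‖))) :
    Integrable (fun p : S × (I → ℝ) => Φ (X p.1) p.2) (m.prod (gG I)) := by
  have h0 : Integrable (fun z : S × (I → ℝ) => (1:ℝ) * ((C * exp (c * ρ)) * exp (c * ‖z.2‖))) (m.prod (gG I)) :=
    Integrable.mul_prod (f := fun _ : S => (1:ℝ)) (integrable_const _) (intgI _ _)
  refine h0.mono' ?_ (of_forall fun p => ?_)
  · exact hΦ.comp_aestronglyMeasurable ((hX.comp_measurable measurable_fst).prodMk measurable_snd.stronglyMeasurable).aestronglyMeasurable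
  · refine (h _ _).trans ?_
    rw [one_mul, mul_assoc, ← exp_add, ← mul_add]
    refine mlL (exp_le_exp.2 (mlL ?_ hc)) hC
    linarith [hb p.1]
lemma CovEq.map {n' : Type*} {ν : T → Measure E} {Y : T → E → Mc n} {A : Jx → Mc n}
    (h : CovEq ν Y A) (f : Mc n →ₗ[ℂ] Matrix n' n' ℂ) : CovEq ν (fun t e => f (Y t e)) (fun j => f (A j)) := by
  intro L
  exact h (L.compl₁₂ f f)
def Wm (P : ι → Mc κ) (A : Jx → Mc n) (θ φ : ℝ) (x : Mc n) (g : Jx × ι → ℝ) : Mc (n × κ) :=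
  KK (amp κ ((θ * sin φ) • x)) (θ * cos φ) (Bf P A) g
def Wd (P : ι → Mc κ) (A : Jx → Mc n) (θ φ : ℝ) (x : Mc n) (g : Jx × ι → ℝ) : Mc (n × κ) :=
  (θ * cos φ) • amp κ x - (θ * sin φ) • Sb P A g
lemma amp_rsmul (c : ℝ) (x : Mc n) : amp κ (c • x) = c • amp κ x := amp_smul (c : ℂ) x
lemma Wm_deriv (A : Jx → Mc n) (θ φ : ℝ) (x : Mc n) (g : Jx × ι → ℝ) :
    HasDerivAt (fun φ => rtr (ex (Wm P A θ φ x g))) (rtr (Wd P A θ φ x g * ex (Wm P A θ φ x g))) φ := by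
  have h1 : HasDerivAt (fun φ => Wm P A θ φ x g) (Wd P A θ φ x g) φ := by
    unfold Wm Wd KK
    simp only [amp_rsmul]
    have := (((Real.hasDerivAt_sin φ).const_mul θ).smul_const (amp κ x)).add (((Real.hasDerivAt_cos φ).const_mul θ).smul_const (Sb P A g))
    refine this.congr_deriv ?_
    rw [mul_neg, neg_smul, sub_eq_add_neg]
  have h2 : HasFDerivAt (ex : Mc (n × κ) → _) ((fderiv ℂ ex (Wm P A θ φ x g)).restrictScalars ℝ) (Wm P A θ φ x g) :=
    ((ex_analytic _).differentiableAt.hasFDerivAt).restrictScalars ℝ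
  have h3 := h2.comp_hasDerivAt φ h1
  have h4 := ((Complex.reCLM.comp ((trL (n := n × κ) 1 1).restrictScalars ℝ)).hasFDerivAt).comp_hasDerivAt φ h3
  have e : (fun φ => rtr (ex (Wm P A θ φ x g))) = (Complex.reCLM.comp ((trL (n := n × κ) 1 1).restrictScalars ℝ)) ∘ (ex ∘ fun φ => Wm P A θ φ x g) := by
    funext φ; simp [rtr]
  rw [e]
  refine h4.congr_deriv ?_
  simp only [ContinuousLinearMap.comp_apply, ContinuousLinearMap.coe_restrictScalars', ← J_eq_fderiv, trL_apply, one_mul, mul_one, tr_J]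
  rfl
lemma Wm_norm (A : Jx → Mc n) {θ : ℝ} (hθ : 0 ≤ θ) (φ : ℝ) (x : Mc n) (g : Jx × ι → ℝ) :
    ‖Wm P A θ φ x g‖ ≤ (θ * (1 + ‖SgL (Bf P A)‖)) * (‖x‖ + ‖g‖) ∧ ‖Wd P A θ φ x g‖ ≤ (θ * (1 + ‖SgL (Bf P A)‖)) * (‖x‖ + ‖g‖) := by
  have hs : |θ * sin φ| ≤ θ := by
    rw [abs_mul, abs_of_nonneg hθ]; exact mul_le_of_le_one_right hθ (Real.abs_sin_le_one φ)
  have hc : |θ * cos φ| ≤ θ := by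
    rw [abs_mul, abs_of_nonneg hθ]; exact mul_le_of_le_one_right hθ (Real.abs_cos_le_one φ)
  have hx := amp_norm_le (κ := κ) x
  have hS : ‖Sb P A g‖ ≤ ‖SgL (Bf P A)‖ * ‖g‖ := by
    rw [← SgL_apply, ← norm_cx]; exact (SgL (Bf P A)).le_opNorm (cx g)
  have b : ∀ a b : ℝ, |a| ≤ θ → |b| ≤ θ → ‖a • amp κ x‖ + ‖b • Sb P A g‖ ≤ (θ * (1 + ‖SgL (Bf P A)‖)) * (‖x‖ + ‖g‖) := by
    intro a b ha hb
    rw [norm_smul, norm_smul, norm_eq_abs, norm_eq_abs]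
    have h1 := mul_le_mul ha hx nng hθ
    have h2 := mul_le_mul hb hS nng hθ
    have : 0 ≤ θ * ‖SgL (Bf P A)‖ * ‖x‖ := by positivity
    have : 0 ≤ θ * ‖g‖ := by positivity
    nlinarith
  constructor
  · unfold Wm KK
    rw [amp_rsmul]
    exact (norm_add_le _ _).trans (b _ _ hs hc)
  · exact (norm_sub_le _ _).trans (b _ _ hc hs)
section
lemma bdP (M W : Mc n) {L u : ℝ} (hL : 0 ≤ L) (hu : 0 ≤ u) (hM : ‖M‖ ≤ L * u) (hW : ‖W‖ ≤ L * u) :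
    ‖(M * ex W).trace‖ ≤ (‖trL (n := n) 1 1‖ * L) * exp ((1 + L) * u) := by
  refine (trace_norm_le _).trans ?_
  rw [mul_assoc]
  refine mlL ((norm_mul_le _ _).trans ?_) nng
  rw [add_mul, exp_add, one_mul, ← mul_assoc]
  refine mul_le_mul (hM.trans (mlL ?_ hL)) ((norm_ex_le _).trans (exp_le_exp.2 hW)) nng (by positivity)
  linarith [Real.add_one_le_exp u]
lemma Wm_herm (hP : PF P) {A : Jx → Mc n} (hA : Hm A) (θ φ : ℝ) {x : Mc n} (hx : x.IsHermitian) (g : Jx × ι → ℝ) :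
    (Wm P A θ φ x g).IsHermitian := by
  refine KK_herm (amp_herm ?_) _ (Bf_herm hP hA) g
  exact (hx.smul (IsSelfAdjoint.all _))
lemma Wm_cont (A : Jx → Mc n) (θ φ : ℝ) : Continuous (fun x : Mc n × (Jx × ι → ℝ) => Wm P A θ φ x.1 x.2) := by
  unfold Wm KK; fun_prop
lemma Wd_cont (A : Jx → Mc n) (θ φ : ℝ) : Continuous (fun x : Mc n × (Jx × ι → ℝ) => Wd P A θ φ x.1 x.2) := by
  unfold Wd; fun_prop
variable {S : Type*} [MeasurableSpace S] {m : Measure S} [IsProbabilityMeasure m]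
lemma intM {X : S → Mc n} (hX : StronglyMeasurable X) {ρ : ℝ} (hb : ∀ z, ‖X z‖ ≤ ρ) (A : Jx → Mc n) {θ : ℝ} (hθ : 0 ≤ θ) (φ : ℝ)
    {M : Mc n → (Jx × ι → ℝ) → Mc (n × κ)} (hM : Continuous (fun x : Mc n × (Jx × ι → ℝ) => M x.1 x.2))
    {c : ℝ} (hc : 0 ≤ c) (h : ∀ x g, ‖M x g‖ ≤ c * (1 + ‖x‖ + ‖g‖)) :
    Integrable (fun p : S × (Jx × ι → ℝ) => (M (X p.1) p.2 * ex (Wm P A θ φ (X p.1) p.2)).trace) (m.prod (gG (Jx × ι))) := by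
  set L := θ * (1 + ‖SgL (Bf P A)‖)
  have hL : 0 ≤ L := by positivity
  have hW := Wm_cont (P := P) A θ φ
  refine intP hX hb (Φ := fun x g => (M x g * ex (Wm P A θ φ x g)).trace) (by fun_prop)
    (C := (‖trL (n := n × κ) 1 1‖ * (L + c)) * exp (1 + (L + c))) (c := 1 + (L + c)) (by positivity) (by positivity) fun x g => ?_
  rw [mul_assoc, ← exp_add]
  have h1 := (Wm_norm (P := P) A hθ φ x g).1
  have h2 : L * (‖x‖ + ‖g‖) ≤ (L + c) * (1 + ‖x‖ + ‖g‖) := by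
    have : 0 ≤ c * (1 + ‖x‖ + ‖g‖) := by positivity
    nlinarith
  have h3 : c * (1 + ‖x‖ + ‖g‖) ≤ (L + c) * (1 + ‖x‖ + ‖g‖) := mlR (by linarith) (by positivity)
  refine (bdP _ _ (L := L + c) (u := 1 + ‖x‖ + ‖g‖) (by positivity) (by positivity) ((h x g).trans h3) (h1.trans h2)).trans (le_of_eq ?_)
  congr 2; ring
lemma SgBf_norm (A : Jx → Mc n) (g : Jx × ι → ℝ) : ‖Sb P A g‖ ≤ ‖SgL (Bf P A)‖ * ‖g‖ := by
  rw [← SgL_apply, ← norm_cx]; exact (SgL (Bf P A)).le_opNorm (cx g)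
lemma intM1 {X : S → Mc n} (hX : StronglyMeasurable X) {ρ : ℝ} (hb : ∀ z, ‖X z‖ ≤ ρ) (A : Jx → Mc n) {θ : ℝ} (hθ : 0 ≤ θ) (φ : ℝ) :
    Integrable (fun p : S × (Jx × ι → ℝ) => (amp κ (X p.1) * ex (Wm P A θ φ (X p.1) p.2)).trace) (m.prod (gG (Jx × ι))) := by
  refine intM hX hb A hθ φ (M := fun x _ => amp κ x) (by fun_prop) (c := 1) zero_le_one fun x g => ?_
  have := amp_norm_le (κ := κ) x
  nlinarith [norm_nonneg g]
lemma intM2 {X : S → Mc n} (hX : StronglyMeasurable X) {ρ : ℝ} (hb : ∀ z, ‖X z‖ ≤ ρ) (A : Jx → Mc n) {θ : ℝ} (hθ : 0 ≤ θ) (φ : ℝ) :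
    Integrable (fun p : S × (Jx × ι → ℝ) => (Sg (Bf P A) (cx p.2) * ex (Wm P A θ φ (X p.1) p.2)).trace) (m.prod (gG (Jx × ι))) := by
  refine intM hX hb A hθ φ (M := fun _ g => Sb P A g) (by fun_prop) (c := ‖SgL (Bf P A)‖) nng fun x g => ?_
  refine (SgBf_norm A g).trans (mlL ?_ nng)
  linarith [norm_nonneg x]
lemma intM3 {X : S → Mc n} (hX : StronglyMeasurable X) {ρ : ℝ} (hb : ∀ z, ‖X z‖ ≤ ρ) (A : Jx → Mc n) {θ : ℝ} (hθ : 0 ≤ θ) (φ : ℝ) :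
    Integrable (fun p : S × (Jx × ι → ℝ) => (ex (Wm P A θ φ (X p.1) p.2)).trace) (m.prod (gG (Jx × ι))) := by
  have := intM (P := P) (m := m) hX hb A hθ φ (M := fun _ _ => 1) (by fun_prop) (c := 1) zero_le_one fun x g => by
    refine norm_one_le.trans ?_
    linarith [norm_nonneg x, norm_nonneg g]
  simpa only [one_mul] using this
lemma intMJ {X : S → Mc n} (hX : StronglyMeasurable X) {ρ : ℝ} (hb : ∀ z, ‖X z‖ ≤ ρ) (A : Jx → Mc n) {θ : ℝ} (hθ : 0 ≤ θ) (φ : ℝ)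
    (Y : Mc (n × κ)) :
    Integrable (fun p : S × (Jx × ι → ℝ) => (Y * J (Wm P A θ φ (X p.1) p.2) Y).trace) (m.prod (gG (Jx × ι))) := by
  set L := θ * (1 + ‖SgL (Bf P A)‖)
  have hL : 0 ≤ L := by positivity
  have hW := Wm_cont (P := P) A θ φ
  refine intP hX hb (Φ := fun x g => (Y * J (Wm P A θ φ x g) Y).trace) (by fun_prop)
    (C := (‖trL (n := n × κ) 1 1‖ * (‖Y‖ * ‖Y‖))) (c := L) (by positivity) (by positivity) fun x g => ?_
  have h1 := (Wm_norm (P := P) A hθ φ x g).1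
  rw [mul_assoc, mul_assoc]
  refine (trace_norm_le _).trans (mlL ?_ nng)
  refine (norm_mul_le _ _).trans (mlL ((J_norm_le _ _).trans ?_) nng)
  exact mlL (exp_le_exp.2 h1) nng
lemma int_re {Ω : Type*} [MeasurableSpace Ω] {ν : Measure Ω} {f : Ω → Mc n} (h : Integrable (fun e => (f e).trace) ν) :
    Integrable (fun e => rtr (f e)) ν := h.re
end
section
def ampL (κ : Type) [Fintype κ] [DecidableEq κ] : Mc n →ₗ[ℂ] Mc (n × κ) :=
  (((ampH κ : Mc n →⋆ₙₐ[ℂ] _) : Mc n →ₙₐ[ℂ] Mc (n × κ)) : Mc n →ₗ[ℂ] Mc (n × κ))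
lemma ampL_apply (A : Mc n) : ampL κ A = amp κ A := rfl
structure Mod (ν : T → Measure E) (h : T → E → Mc n) (A : Jx → Mc n) (ρ v s2 : ℝ) : Prop where
  hm : ∀ t, StronglyMeasurable (h t)
  hY : ∀ t e, (h t e).IsHermitian
  hρ : 0 < ρ
  hb : ∀ t e, ‖h t e‖ ≤ ρ
  h0 : ∀ t i j, ∫ e, h t e i j ∂(ν t) = 0
  hc : CovEq ν h A
  hA : Hm A
  hv : 0 ≤ v
  hs : HsB A v
  hA2 : ‖∑ j, A j * A j‖ ≤ s2
def Xs (h : T → E → Mc n) (z : T → E) : Mc n := ∑ t, h t (z t)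
variable {ν : T → Measure E} [∀ i, IsProbabilityMeasure (ν i)] {h : T → E → Mc n} {A : Jx → Mc n} {ρ v s2 : ℝ}
lemma Mod.Xm (M : Mod ν h A ρ v s2) : StronglyMeasurable (Xs h) :=
  Finset.stronglyMeasurable_fun_sum _ fun t _ => (M.hm t).comp_measurable (measurable_pi_apply t)
lemma Mod.Xb (M : Mod ν h A ρ v s2) (z : T → E) : ‖Xs h z‖ ≤ crd T * ρ := by
  refine (norm_sum_le _ _).trans ((sle fun t => M.hb t (z t)).trans ?_)
  simp
lemma Mod.Xh (M : Mod ν h A ρ v s2) (z : T → E) : (Xs h z).IsHermitian := by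
  unfold Xs IsHermitian
  rw [conjTranspose_sum]
  exact scg fun t => M.hY t _
lemma Mod.s2_nonneg (M : Mod ν h A ρ v s2) : 0 ≤ s2 := nng.trans M.hA2
lemma psiX (M : Mod ν h A ρ v s2) (hP : PF P) {θ φ : ℝ} (hθ : 0 ≤ θ) (hs : 0 < θ * sin φ) (hr : θ * sin φ * ρ ≤ 1 / 100) :
    ∫ p, rtr (amp κ (Xs h p.1) * ex (Wm P A θ φ (Xs h p.1) p.2)) ∂((Measure.pi ν).prod (gG (Jx × ι))) ≤
    (θ * sin φ) * ∑ j, ∫ p, rtr (amp κ (A j) * J (Wm P A θ φ (Xs h p.1) p.2) (amp κ (A j))) ∂((Measure.pi ν).prod (gG (Jx × ι)))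
    + 100 * (θ * sin φ) ^ 2 * ρ * s2 * ∫ p, rtr (ex (Wm P A θ φ (Xs h p.1) p.2)) ∂((Measure.pi ν).prod (gG (Jx × ι))) := by
  set s := θ * sin φ with hsd
  have I1 := int_re (intM1 (P := P) (m := Measure.pi ν) M.Xm M.Xb A hθ φ)
  have I3 := int_re (intM3 (P := P) (m := Measure.pi ν) M.Xm M.Xb A hθ φ)
  have IJ := fun j => int_re (intMJ (P := P) (m := Measure.pi ν) M.Xm M.Xb A hθ φ (amp κ (A j)))
  rw [← integral_finsetSum _ (fun j _ => IJ j), ← integral_const_mul, ← integral_const_mul,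
    ← integral_add ((integrable_finsetSum _ fun j _ => IJ j).const_mul _) (I3.const_mul _),
    integral_prod_symm _ I1]
  have I5 : Integrable (fun a : (T → E) × (Jx × ι → ℝ) => s * ∑ i, rtr (amp κ (A i) * J (Wm P A θ φ (Xs h a.1) a.2) (amp κ (A i))) +
        100 * s ^ 2 * ρ * s2 * rtr (ex (Wm P A θ φ (Xs h a.1) a.2))) ((Measure.pi ν).prod (gG (Jx × ι))) :=
    ((integrable_finsetSum univ fun j _ => IJ j).const_mul s).add (I3.const_mul (100 * s ^ 2 * ρ * s2))
  rw [integral_prod_symm _ I5]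
  have ae := I5.prod_left_ae
  have aeJ := (integrable_finsetSum univ fun j _ => IJ j).prod_left_ae
  have ae3 := I3.prod_left_ae
  refine integral_mono_ae I1.integral_prod_right I5.integral_prod_right ?_
  filter_upwards [aeJ, ae3] with g gJ g3
  have e := integral_add (gJ.const_mul s) (g3.const_mul (100 * s ^ 2 * ρ * s2))
  refine le_trans ?_ (le_of_eq e.symm)
  rw [integral_const_mul, integral_const_mul]
  have hc : CovEq ν (fun t e => s • amp κ (h t e)) (fun j => s • amp κ (A j)) := by
    have := M.hc.map ((s : ℂ) • ampL κ)
    exact this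
  have hA2 : ‖∑ j, (s • amp κ (A j)) * (s • amp κ (A j))‖ ≤ s ^ 2 * s2 := by
    have : ∑ j, (s • amp κ (A j)) * (s • amp κ (A j)) = (s ^ 2) • ∑ j, amp κ (A j) * amp κ (A j) := by
      simp only [Matrix.smul_mul, Matrix.mul_smul, smul_smul, smul_sum, sq]
    rw [this, norm_smul, norm_of_nonneg (sq_nonneg s)]
    exact mlL (amp_sq M.hA2) (sq_nonneg s)
  have hH : ((θ * cos φ) • Sb P A g).IsHermitian := by
    exact (Sg_herm (Bf_herm hP M.hA) g).smul (IsSelfAdjoint.all _)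
  have X := Xpart ν (Y := fun t e => s • amp κ (h t e)) (r := s * ρ) (fun t => ((by fun_prop : Continuous fun x : Mc n => s • amp κ x)).comp_stronglyMeasurable (M.hm t))
    (fun t e => (amp_herm (M.hY t e)).smul (IsSelfAdjoint.all _)) (mul_pos hs M.hρ) hr
    (fun t e => by
      rw [norm_smul, norm_of_nonneg hs.le]
      exact mlL ((amp_norm_le _).trans (M.hb t e)) hs.le)
    (fun t i j => by
      have : ∀ e, (s • amp κ (h t e)) i j = (s : ℂ) * (h t e i.1 j.1 * (1 : Mc κ) i.2 j.2) := fun e => rfl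
      simp only [this]
      rw [integral_const_mul, integral_mul_const, M.h0, zero_mul, mul_zero]) hc hA2 hH
  have eW : ∀ z : T → E, (θ * cos φ) • Sb P A g + ∑ t, s • amp κ (h t (z t)) = Wm P A θ φ (Xs h z) g := by
    intro z
    unfold Wm KK Xs
    rw [amp_rsmul, amp_sum, smul_sum, add_comm]
  have eX : ∀ z : T → E, ∑ t, s • amp κ (h t (z t)) = s • amp κ (Xs h z) := by
    intro z
    unfold Xs
    rw [amp_sum, smul_sum]
  simp only [eW] at X
  simp only [eX, Matrix.smul_mul, Matrix.mul_smul, J_smul, rtr_smul] at X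
  simp only [← mul_sum] at X
  rw [integral_const_mul, integral_const_mul, integral_const_mul] at X
  have := le_of_mul_le_mul_left (a := s) (b := ∫ z, rtr (amp κ (Xs h z) * ex (Wm P A θ φ (Xs h z) g)) ∂(Measure.pi ν)) (X.trans (le_of_eq (by
    show _ = s * (s * ∫ z, ∑ j, rtr (amp κ (A j) * J (Wm P A θ φ (Xs h z) g) (amp κ (A j))) ∂(Measure.pi ν) + 100 * s ^ 2 * ρ * s2 * ∫ z, rtr (ex (Wm P A θ φ (Xs h z) g)) ∂(Measure.pi ν))
    ring))) hs
  exact this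
lemma psiS (M : Mod ν h A ρ v s2) {θ φ : ℝ} (hθ : 0 ≤ θ) :
    ∫ p, rtr (Sg (Bf P A) (cx p.2) * ex (Wm P A θ φ (Xs h p.1) p.2)) ∂((Measure.pi ν).prod (gG (Jx × ι))) =
    (θ * cos φ) * ∑ i, ∫ p, rtr (Bf P A i * J (Wm P A θ φ (Xs h p.1) p.2) (Bf P A i)) ∂((Measure.pi ν).prod (gG (Jx × ι))) := by
  have I2 := int_re (intM2 (P := P) (m := Measure.pi ν) M.Xm M.Xb A hθ φ)
  have IJ := fun i => int_re (intMJ (P := P) (m := Measure.pi ν) M.Xm M.Xb A hθ φ (Bf P A i))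
  rw [integral_prod _ I2]
  simp only [fun i => integral_prod _ (IJ i)]
  rw [← integral_finsetSum _ (fun i _ => (IJ i).integral_prod_left), ← integral_const_mul]
  congr 1; funext z
  exact Spart _ _ _
lemma psiA (M : Mod ν h A ρ v s2) (hP : PF P) (hN : 0 < card κ) {θ φ : ℝ} (hθ : 0 ≤ θ) :
    (∑ j, ∫ p, rtr (amp κ (A j) * J (Wm P A θ φ (Xs h p.1) p.2) (amp κ (A j))) ∂((Measure.pi ν).prod (gG (Jx × ι)))) -
    ∑ i, ∫ p, rtr (Bf P A i * J (Wm P A θ φ (Xs h p.1) p.2) (Bf P A i)) ∂((Measure.pi ν).prod (gG (Jx × ι))) ≤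
    8 * ((θ * cos φ) ^ 2 * v * s2) * ∫ p, rtr (ex (Wm P A θ φ (Xs h p.1) p.2)) ∂((Measure.pi ν).prod (gG (Jx × ι))) := by
  have IJ := fun Y => int_re (intMJ (P := P) (m := Measure.pi ν) M.Xm M.Xb A hθ φ Y)
  have I3 := int_re (intM3 (P := P) (m := Measure.pi ν) M.Xm M.Xb A hθ φ)
  simp only [fun Y => integral_prod _ (IJ Y), integral_prod _ I3]
  rw [← integral_finsetSum _ (fun i _ => (IJ _).integral_prod_left), ← integral_finsetSum _ (fun i _ => (IJ _).integral_prod_left),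
    ← integral_sub (integrable_finsetSum _ (fun i _ => (IJ _).integral_prod_left)) (integrable_finsetSum _ (fun i _ => (IJ _).integral_prod_left)),
    ← integral_const_mul]
  refine integral_mono ((integrable_finsetSum _ (fun i _ => (IJ _).integral_prod_left)).sub (integrable_finsetSum _ (fun i _ => (IJ _).integral_prod_left)))
    (I3.integral_prod_left.const_mul _) fun z => ?_
  have hX : ((θ * sin φ) • Xs h z).IsHermitian := (M.Xh z).smul (IsSelfAdjoint.all _)
  have := partA hP hN M.hA M.hv M.hs M.hA2 hX (θ * cos φ)
  have := (Complex.re_le_norm _).trans this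
  rw [Complex.sub_re, Complex.re_sum, Complex.re_sum] at this
  simp only [fun Y => re_int (intg_KJ (amp κ ((θ * sin φ) • Xs h z)) (θ * cos φ) (Bf P A) Y Y)] at this
  refine this.trans (le_of_eq ?_)
  show _ = 8 * _ * ∫ g, rtr (ex (KK _ _ _ g)) ∂_
  ring
variable {ν : T → Measure E} [∀ i, IsProbabilityMeasure (ν i)] {h : T → E → Mc n} {A : Jx → Mc n} {ρ v s2 : ℝ}
lemma psi_deriv (M : Mod ν h A ρ v s2) {θ : ℝ} (hθ : 0 ≤ θ) (φ : ℝ) :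
    HasDerivAt (fun φ => ∫ p, rtr (ex (Wm P A θ φ (Xs h p.1) p.2)) ∂((Measure.pi ν).prod (gG (Jx × ι))))
      (∫ p, rtr (Wd P A θ φ (Xs h p.1) p.2 * ex (Wm P A θ φ (Xs h p.1) p.2)) ∂((Measure.pi ν).prod (gG (Jx × ι)))) φ := by
  set L := θ * (1 + ‖SgL (Bf P A)‖) with hLd
  have hL : 0 ≤ L := by positivity
  have I3 := fun φ => int_re (intM3 (P := P) (m := Measure.pi ν) M.Xm M.Xb A hθ φ)
  have Id : Integrable (fun p : (T → E) × (Jx × ι → ℝ) => rtr (Wd P A θ φ (Xs h p.1) p.2 * ex (Wm P A θ φ (Xs h p.1) p.2))) ((Measure.pi ν).prod (gG (Jx × ι))) := by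
    refine int_re (intM (P := P) (m := Measure.pi ν) M.Xm M.Xb A hθ φ (M := fun x g => Wd P A θ φ x g) (Wd_cont A θ φ) hL fun x g => ?_)
    refine (Wm_norm (P := P) A hθ φ x g).2.trans (mlL (by linarith) hL)
  have Ib : Integrable (fun p : (T → E) × (Jx × ι → ℝ) => (‖trL (n := n × κ) 1 1‖ * L) * exp ((1 + L) * (‖Xs h p.1‖ + ‖p.2‖))) ((Measure.pi ν).prod (gG (Jx × ι))) := by
    refine intP M.Xm M.Xb (Φ := fun x g => (‖trL (n := n × κ) 1 1‖ * L) * exp ((1 + L) * (‖x‖ + ‖g‖))) (by fun_prop)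
      (C := ‖trL (n := n × κ) 1 1‖ * L) (c := 1 + L) (by positivity) (by positivity) fun x g => ?_
    rw [norm_of_nonneg (by positivity)]
  refine (hasDerivAt_integral_of_dominated_loc_of_deriv_le (μ := (Measure.pi ν).prod (gG (Jx × ι)))
    (F := fun φ p => rtr (ex (Wm P A θ φ (Xs h p.1) p.2))) (F' := fun φ p => rtr (Wd P A θ φ (Xs h p.1) p.2 * ex (Wm P A θ φ (Xs h p.1) p.2)))
    (bound := fun p => (‖trL (n := n × κ) 1 1‖ * L) * exp ((1 + L) * (‖Xs h p.1‖ + ‖p.2‖)))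
    (s := Set.univ) Filter.univ_mem (of_forall fun φ => (I3 φ).aestronglyMeasurable) (I3 φ) Id.aestronglyMeasurable
    (of_forall fun p φ _ => ?_) Ib (of_forall fun p φ _ => Wm_deriv A θ φ _ _)).2
  have w := Wm_norm (P := P) A hθ φ (Xs h p.1) p.2
  exact (abs_rtr_le _).trans (bdP _ _ hL (by positivity) w.2 w.1)
lemma psi_ineq (M : Mod ν h A ρ v s2) (hP : PF P) (hN : 0 < card κ) {θ φ : ℝ} (hθ : 0 < θ) (hr : θ * ρ ≤ 1 / 100)
    (hφ : 0 < φ) (hφ2 : φ < Real.pi / 2) :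
    (∫ p, rtr (Wd P A θ φ (Xs h p.1) p.2 * ex (Wm P A θ φ (Xs h p.1) p.2)) ∂((Measure.pi ν).prod (gG (Jx × ι)))) ≤
      (8 * θ ^ 4 * v * s2 + 100 * θ ^ 3 * ρ * s2) * ∫ p, rtr (ex (Wm P A θ φ (Xs h p.1) p.2)) ∂((Measure.pi ν).prod (gG (Jx × ι))) := by
  have hsin : 0 < sin φ := Real.sin_pos_of_pos_of_lt_pi hφ (by linarith [Real.pi_pos])
  have hcos : 0 < cos φ := Real.cos_pos_of_mem_Ioo ⟨by linarith [Real.pi_pos], hφ2⟩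
  have hsin1 := Real.sin_le_one φ
  have hcos1 := Real.cos_le_one φ
  have hs0 : 0 < θ * sin φ := mul_pos hθ hsin
  have hs1 : θ * sin φ ≤ θ := mul_le_of_le_one_right hθ.le hsin1
  have hc0 : 0 < θ * cos φ := mul_pos hθ hcos
  have hc1 : θ * cos φ ≤ θ := mul_le_of_le_one_right hθ.le hcos1
  have hρ := M.hρ
  have hs2 := M.s2_nonneg
  have hv := M.hv
  have I1 := int_re (intM1 (P := P) (m := Measure.pi ν) M.Xm M.Xb A hθ.le φ)
  have I2 := int_re (intM2 (P := P) (m := Measure.pi ν) M.Xm M.Xb A hθ.le φ)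
  have X := psiX M hP hθ.le hs0 ((mlR hs1 hρ.le).trans hr)
  have S := psiS (P := P) M (φ := φ) hθ.le
  have Y := psiA M hP hN (φ := φ) hθ.le
  have e : ∀ p : (T → E) × (Jx × ι → ℝ), rtr (Wd P A θ φ (Xs h p.1) p.2 * ex (Wm P A θ φ (Xs h p.1) p.2)) =
    (θ * cos φ) * rtr (amp κ (Xs h p.1) * ex (Wm P A θ φ (Xs h p.1) p.2)) - (θ * sin φ) * rtr (Sg (Bf P A) (cx p.2) * ex (Wm P A θ φ (Xs h p.1) p.2)) := by
    intro p
    unfold Wd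
    rw [Matrix.sub_mul, Matrix.smul_mul, Matrix.smul_mul, rtr_sub, rtr_smul, rtr_smul]
  simp only [e]
  rw [integral_sub (I1.const_mul _) (I2.const_mul _), integral_const_mul, integral_const_mul, S]
  have hψ : 0 ≤ ∫ p, rtr (ex (Wm P A θ φ (Xs h p.1) p.2)) ∂((Measure.pi ν).prod (gG (Jx × ι))) :=
    integral_nonneg fun p => rtr_ex_nonneg (Wm_herm hP M.hA θ φ (M.Xh p.1) p.2)
  generalize (∫ p, rtr (ex (Wm P A θ φ (Xs h p.1) p.2)) ∂((Measure.pi ν).prod (gG (Jx × ι)))) = ψ at *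
  generalize (∑ j, ∫ p, rtr (amp κ (A j) * J (Wm P A θ φ (Xs h p.1) p.2) (amp κ (A j))) ∂((Measure.pi ν).prod (gG (Jx × ι)))) = D1 at *
  generalize (∑ i, ∫ p, rtr (Bf P A i * J (Wm P A θ φ (Xs h p.1) p.2) (Bf P A i)) ∂((Measure.pi ν).prod (gG (Jx × ι)))) = D2 at *
  generalize θ * sin φ = s at *
  generalize θ * cos φ = c at *
  have h1 := mlL X hc0.le
  have h2 := mlL Y (mul_pos hc0 hs0).le
  have hc3 : c * s ^ 2 ≤ θ ^ 3 := by
    calc c * s ^ 2 ≤ θ * θ ^ 2 := by gcongr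
      _ = _ := by ring
  have hc4 : c * s * c ^ 2 ≤ θ ^ 4 := by
    calc c * s * c ^ 2 ≤ θ * θ * θ ^ 2 := by gcongr
      _ = _ := by ring
  have k1 : (c * s ^ 2) * (100 * ρ * s2 * ψ) ≤ θ ^ 3 * (100 * ρ * s2 * ψ) := mlR hc3 (by positivity)
  have k2 : (c * s * c ^ 2) * (8 * v * s2 * ψ) ≤ θ ^ 4 * (8 * v * s2 * ψ) := mlR hc4 (by positivity)
  nlinarith
lemma psi_final (M : Mod ν h A ρ v s2) (hP : PF P) (hN : 0 < card κ) {θ : ℝ} (hθ : 0 < θ) (hr : θ * ρ ≤ 1 / 100) :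
    crd κ * ∫ z, rtr (ex (θ • Xs h z)) ∂(Measure.pi ν) ≤
      exp (2 * (8 * θ ^ 4 * v * s2 + 100 * θ ^ 3 * ρ * s2)) * ∫ g, rtr (ex (KK 0 θ (Bf P A) g)) ∂(gG (Jx × ι)) := by
  set k := 8 * θ ^ 4 * v * s2 + 100 * θ ^ 3 * ρ * s2 with hk
  have hρ := M.hρ
  have hs2 := M.s2_nonneg
  have hv := M.hv
  have hk0 : 0 ≤ k := by positivity
  set ψ : ℝ → ℝ := fun φ => ∫ p, rtr (ex (Wm P A θ φ (Xs h p.1) p.2)) ∂((Measure.pi ν).prod (gG (Jx × ι))) with hψ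
  have dψ := fun φ => psi_deriv (P := P) M hθ.le φ
  have df : ∀ φ, HasDerivAt (fun φ => exp (-(k * φ)) * ψ φ) (exp (-(k * φ)) * (-(k * 1)) * ψ φ + exp (-(k * φ)) * _) φ := fun φ =>
    (((hasDerivAt_id' φ).const_mul k).neg.exp).mul (dψ φ)
  have anti : AntitoneOn (fun φ => exp (-(k * φ)) * ψ φ) (Icc 0 (Real.pi / 2)) := by
    refine antitoneOn_of_deriv_nonpos (convex_Icc _ _) (fun φ _ => (df φ).continuousAt.continuousWithinAt)
      (fun φ _ => (df φ).differentiableAt.differentiableWithinAt) fun φ hφ => ?_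
    rw [interior_Icc] at hφ
    rw [(df φ).deriv]
    have := psi_ineq M hP hN hθ hr hφ.1 hφ.2
    have e := exp_pos (-(k * φ))
    have := mlL this e.le
    simp only [hψ]
    nlinarith
  have hpi := Real.pi_pos
  have fin := anti (Set.left_mem_Icc.2 (by positivity)) (Set.right_mem_Icc.2 (by positivity)) (by positivity)
  simp only [mul_zero, neg_zero, exp_zero, one_mul] at fin
  have e0 : ψ 0 = ∫ g, rtr (ex (KK 0 θ (Bf P A) g)) ∂(gG (Jx × ι)) := by
    have : ∀ p : (T → E) × (Jx × ι → ℝ), rtr (ex (Wm P A θ 0 (Xs h p.1) p.2)) = rtr (ex (KK 0 θ (Bf P A) p.2)) := by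
      intro p
      unfold Wm
      rw [Real.sin_zero, Real.cos_zero, mul_zero, zero_smul, mul_one]
      congr 3; exact (ampH κ).map_zero
    simp only [hψ, this]
    have := integral_fun_snd (μ := Measure.pi ν) (ν := gG (Jx × ι)) (fun g => rtr (ex (KK 0 θ (Bf P A) g)))
    simpa using this
  have e1 : ψ (Real.pi / 2) = crd κ * ∫ z, rtr (ex (θ • Xs h z)) ∂(Measure.pi ν) := by
    have : ∀ p : (T → E) × (Jx × ι → ℝ), rtr (ex (Wm P A θ (Real.pi / 2) (Xs h p.1) p.2)) = crd κ * rtr (ex (θ • Xs h p.1)) := by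
      intro p
      unfold Wm KK
      rw [Real.sin_pi_div_two, Real.cos_pi_div_two, mul_zero, zero_smul, mul_one, add_zero, ex_amp]
      unfold rtr
      rw [amp_trace]
      simp [mul_comm]
    simp only [hψ, this]
    rw [integral_const_mul]
    have := integral_fun_fst (μ := Measure.pi ν) (ν := gG (Jx × ι)) (fun z => rtr (ex (θ • Xs h z)))
    rw [this]
    simp
  rw [e0, e1] at fin
  have hI : 0 ≤ crd κ * ∫ z, rtr (ex (θ • Xs h z)) ∂(Measure.pi ν) := by
    refine mul_nonneg (Nat.cast_nonneg _) (integral_nonneg fun z => rtr_ex_nonneg ((M.Xh z).smul (IsSelfAdjoint.all _)))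
  generalize (crd κ * ∫ z, rtr (ex (θ • Xs h z)) ∂(Measure.pi ν)) = a at *
  generalize (∫ g, rtr (ex (KK 0 θ (Bf P A) g)) ∂(gG (Jx × ι))) = b at *
  have e2 : exp (2 * k) * exp (-(k * (Real.pi / 2))) ≥ 1 := by
    rw [← exp_add]
    refine Real.one_le_exp ?_
    nlinarith [Real.pi_le_four]
  calc a ≤ (exp (2 * k) * exp (-(k * (Real.pi / 2)))) * a := le_mul_of_one_le_left hI e2
    _ = exp (2 * k) * (exp (-(k * (Real.pi / 2))) * a) := by ring
    _ ≤ _ := mlL fin exp0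
end
lemma mulL_exists (B : Mc n) (L : Mc n →L[ℂ] V) : ∃ L' : Mc n →L[ℂ] V, ∀ M, L' M = L (B * M) :=
  ⟨L.comp (LinearMap.toContinuousLinearMap (LinearMap.mulLeft ℂ B)), fun M => by simp⟩
lemma Sg_norm (B : I → Mc n) (g : I → ℝ) : ‖Sg B (cx g)‖ ≤ ‖SgL B‖ * ‖g‖ := by
  rw [← SgL_apply, ← norm_cx]; exact (SgL B).le_opNorm (cx g)
lemma intS (B : I → Mc n) (L : Mc n →L[ℂ] V) (s : ℝ) :
    Integrable (fun g => L (ex (s • Sg B (cx g)))) (gG I) := by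
  refine integrable_exp (by fun_prop) (A := ‖L‖) (B := |s| * ‖SgL B‖) fun g => ?_
  refine (L.le_opNorm _).trans (mlL ((norm_ex_le _).trans (exp_le_exp.2 ?_)) nng)
  rw [norm_smul, mul_assoc, norm_eq_abs]
  exact mlL (Sg_norm B g) (abs_nonneg _)
lemma dS_bd (B : I → Mc n) (L : Mc n →L[ℂ] V) {s R : ℝ} (hs : |s| ≤ R) (g : I → ℝ) :
    ‖L (Sg B (cx g) * ex (s • Sg B (cx g)))‖ ≤ ‖L‖ * exp ((1 + R) * ‖SgL B‖ * ‖g‖) := by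
  refine (L.le_opNorm _).trans (mlL ((norm_mul_le _ _).trans ?_) nng)
  have h := Sg_norm B g
  have h2 : ‖ex (s • Sg B (cx g))‖ ≤ exp (R * (‖SgL B‖ * ‖g‖)) := by
    refine (norm_ex_le _).trans (exp_le_exp.2 ?_)
    rw [norm_smul, norm_eq_abs]
    exact mul_le_mul hs h nng ((abs_nonneg _).trans hs)
  have h1 : ‖Sg B (cx g)‖ ≤ exp (‖SgL B‖ * ‖g‖) := h.trans (by linarith [Real.add_one_le_exp (‖SgL B‖ * ‖g‖)])
  refine (mul_le_mul h1 h2 nng exp0).trans (le_of_eq ?_)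
  rw [← exp_add]; congr 1; ring
lemma PS_deriv (B : I → Mc n) (L : Mc n →L[ℂ] V) (s : ℝ) :
    HasDerivAt (fun s : ℝ => ∫ g, L (ex (s • Sg B (cx g))) ∂(gG I)) (∫ g, L (Sg B (cx g) * ex (s • Sg B (cx g))) ∂(gG I)) s := by
  refine (hasDerivAt_integral_of_dominated_loc_of_deriv_le (μ := gG I) (𝕜 := ℝ)
    (F := fun (s : ℝ) g => L (ex (s • Sg B (cx g)))) (F' := fun (s : ℝ) g => L (Sg B (cx g) * ex (s • Sg B (cx g))))
    (bound := fun g => ‖L‖ * exp ((1 + (|s| + 1)) * ‖SgL B‖ * ‖g‖))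
    (s := Metric.ball s 1) (Metric.ball_mem_nhds _ one_pos) (of_forall fun s => (intS B L s).aestronglyMeasurable)
    (intS B L s) ?_ (of_forall fun g t ht => ?_) (intgI _ _) (of_forall fun g t _ => ?_)).2
  · exact (by fun_prop : Continuous fun g => L (Sg B (cx g) * ex (s • Sg B (cx g)))).aestronglyMeasurable
  · refine dS_bd B L ?_ g
    have := Metric.mem_ball.1 ht
    rw [Real.dist_eq] at this
    have := abs_sub_abs_le_abs_sub t s
    linarith
  · have h := (ex_hasDerivAt' (Sg B (cx g)) t)
    exact (L.restrictScalars ℝ).hasFDerivAt.comp_hasDerivAt t h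
lemma PS_stein (B : I → Mc n) (L : Mc n →L[ℂ] V) (s : ℝ) :
    ∫ g, L (Sg B (cx g) * ex (s • Sg B (cx g))) ∂(gG I) = s • ∑ i, ∫ g, L (B i * J (s • Sg B (cx g)) (B i)) ∂(gG I) := by
  choose L' hL' using fun i => mulL_exists (B i) L
  have e : ∀ g, s • Sg B (cx g) = 0 + Sg (fun i => s • B i) (cx g) := fun g => by
    simp only [Sg, smul_sum, zero_add]
    exact scg fun i => smul_comm _ _ _
  have hE := fun i => (EE_exS 0 (fun i => s • B i)).clm (L' i)
  have st := fun i => stein (hE i) i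
  have i1 : ∀ i, Integrable (fun g => ((g i : ℂ)) • L' i (ex (0 + Sg (fun i => s • B i) (cx g)))) (gG I) := fun i => ((hE i).coord i).intg
  have fd : ∀ i z, fderiv ℂ (fun z => L' i (ex (0 + Sg (fun i => s • B i) z))) z (Pi.single i 1) = L' i (J (0 + Sg (fun i => s • B i) z) (s • B i)) := by
    intro i z
    have h := ((L' i).hasFDerivAt.comp z ((EE_exS 0 (fun i => s • B i)).1 z).differentiableAt.hasFDerivAt).fderiv
    have h2 : fderiv ℂ (fun z => L' i (ex (0 + Sg (fun i => s • B i) z))) z = _ := h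
    rw [h2, ContinuousLinearMap.comp_apply, fderiv_exS]
  simp only [e]
  rw [smul_sum]
  have e2 : ∀ g, L (Sg B (cx g) * ex (0 + Sg (fun i => s • B i) (cx g))) = ∑ i, ((g i : ℂ)) • L' i (ex (0 + Sg (fun i => s • B i) (cx g))) := by
    intro g
    simp only [hL', ← map_smul, ← map_sum]
    congr 1
    conv_lhs => rw [Sg, sum_mul]
    refine scg fun i => ?_
    rw [Matrix.smul_mul]; rfl
  simp only [e2]
  rw [integral_finsetSum _ (fun i _ => i1 i)]
  refine scg fun i => ?_
  rw [st i, ← integral_smul]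
  congr 1; funext g
  rw [fd, J_smul, hL', Matrix.mul_smul]
  exact (L.restrictScalars ℝ).map_smul s _
lemma unif {B : I → Mc n} (hB : Hm B) {s2 : ℝ} (hB2 : ‖∑ i, B i * B i‖ ≤ s2) {s : ℝ} (hs : 0 ≤ s) :
    ∫ g, rtr (ex (s • Sg B (cx g))) ∂(gG I) ≤ crd n * exp (s ^ 2 * s2 / 2) := by
  set y : ℝ → ℝ := fun s => ∫ g, rtr (ex (s • Sg B (cx g))) ∂(gG I) with hy
  have hh : ∀ (s : ℝ) g, (s • Sg B (cx g)).IsHermitian := fun s g => (Sg_herm hB g).smul (IsSelfAdjoint.all _)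
  have ye : y = fun s => (∫ g, trL (n := n) 1 1 (ex (s • Sg B (cx g))) ∂(gG I)).re := by
    funext s
    have := integral_re (𝕜 := ℂ) (intS B (trL (n := n) 1 1) s)
    exact (by simp [rtr] : ∫ g, rtr (ex (s • Sg B (cx g))) ∂(gG I) = ∫ g, (trL (n := n) 1 1 (ex (s • Sg B (cx g)))).re ∂(gG I)).trans this
  have hd : ∀ s, HasDerivAt y (∫ g, trL (n := n) 1 1 (Sg B (cx g) * ex (s • Sg B (cx g))) ∂(gG I)).re s := by
    intro s
    rw [ye]
    exact Complex.reCLM.hasFDerivAt.comp_hasDerivAt s (PS_deriv B (trL (n := n) 1 1) s)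
  have hle : ∀ s, 0 ≤ s → (∫ g, trL (n := n) 1 1 (Sg B (cx g) * ex (s • Sg B (cx g))) ∂(gG I)).re ≤ s * s2 * y s := by
    intro s hs
    rw [PS_stein, Complex.real_smul, Complex.re_ofReal_mul, mul_assoc]
    refine mlL ?_ hs
    have iJ := fun i => intg_KJ 0 s B (B i) (B i)
    simp only [KK, zero_add] at iJ
    simp only [trL_apply, one_mul, mul_one]
    rw [Complex.re_sum]
    simp only [fun i => re_int (iJ i)]
    rw [← integral_finsetSum _ (fun i _ => int_re (iJ i)), hy, ← integral_const_mul]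
    have i3 := intg_rtr_ex 0 s B
    simp only [KK, zero_add] at i3
    refine integral_mono (integrable_finsetSum _ (fun i _ => int_re (iJ i))) (i3.const_mul _) fun g => ?_
    refine le_trans (sle fun i => ?_) (sum_q_le hB2 (hh s g))
    unfold rtr
    rw [trace_mul_J]
    have hT := fun a : ℝ => fun (ha : a ∈ Icc (0:ℝ) 1) => T2h (hh s g) (hh s g) (hB i) ha.1 (sub_nonneg.2 ha.2) (by ring : a + (1 - a) = 1)
    have hT' : ∀ a ∈ Icc (0:ℝ) 1, ‖(B i * ex (a • (s • Sg B (cx g))) * B i * ex ((1 - a) • (s • Sg B (cx g)))).trace‖ ≤ q (B i) (s • Sg B (cx g)) := by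
      intro a ha
      obtain ⟨r, h1, h2, h3⟩ := hT a ha
      rw [h1, norm_real, norm_of_nonneg h2]
      linarith
    have := intervalIntegral.norm_integral_le_of_norm_le_const (a := (0:ℝ)) (b := 1) (C := q (B i) (s • Sg B (cx g)))
      (f := fun a => (B i * ex (a • (s • Sg B (cx g))) * B i * ex ((1 - a) • (s • Sg B (cx g)))).trace) (fun a ha => by
        rw [Set.uIoc_of_le zero_le_one] at ha
        exact hT' a ⟨ha.1.le, ha.2⟩)
    simp only [sub_zero, abs_one, mul_one] at this
    exact (Complex.re_le_norm _).trans this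
  have df : ∀ s, HasDerivAt (fun s => exp (-(s ^ 2 * s2 / 2)) * y s) (exp (-(s ^ 2 * s2 / 2)) * (-(s * s2)) * y s + exp (-(s ^ 2 * s2 / 2)) * _) s := fun s =>
    (((((hasDerivAt_pow 2 s).mul_const s2).div_const 2).neg.congr_deriv (by push_cast; ring) : HasDerivAt (fun s : ℝ => -(s ^ 2 * s2 / 2)) (-(s * s2)) s).exp).mul (hd s)
  have anti : AntitoneOn (fun s => exp (-(s ^ 2 * s2 / 2)) * y s) (Set.Ici 0) := by
    refine antitoneOn_of_deriv_nonpos (convex_Ici _) (fun φ _ => (df φ).continuousAt.continuousWithinAt)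
      (fun φ _ => (df φ).differentiableAt.differentiableWithinAt) fun φ hφ => ?_
    rw [interior_Ici] at hφ
    rw [(df φ).deriv]
    have e := exp_pos (-(φ ^ 2 * s2 / 2))
    have := mlL (hle φ (le_of_lt hφ)) e.le
    nlinarith
  have fin := anti Set.self_mem_Ici hs hs
  have y0 : y 0 = card n := by
    simp only [hy, zero_smul, ex_zero, rtr, trace_one]
    simp
  simp only [y0] at fin
  rw [show -((0:ℝ) ^ 2 * s2 / 2) = 0 by ring, exp_zero, one_mul, Real.exp_neg] at fin
  have := mlL fin (exp_pos (s ^ 2 * s2 / 2)).le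
  rw [← mul_assoc, mul_inv_cancel₀ (exp_pos _).ne', one_mul] at this
  linarith [mul_comm (exp (s ^ 2 * s2 / 2)) crd n]
lemma exp_norm_le [Nonempty n] {K : Mc n} (hK : K.IsHermitian) : exp ‖K‖ ≤ rtr (ex K) + rtr (ex (-K)) := by
  obtain ⟨U, l, hU, hKe, hl⟩ := eig hK
  have h1 := tr_ex_eq hU hl
  have h2 := tr_ex_eq (K := -K) (l := fun i => - l i) hU (fun x => by
    have := hl (-x)
    rw [smul_neg, ← neg_smul, this]
    simp only [neg_mul, mul_neg])
  have hn : ‖K‖ ≤ ‖(fun i => (l i : ℂ))‖ := by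
    rw [← l2_opNorm_diagonal]
    rw [hKe]
    refine (norm_mul_le _ _).trans ((mlR (norm_mul_le _ _) nng).trans ?_)
    have a := hU.norm_le
    have b := hU.ct.norm_le
    calc _ ≤ 1 * ‖diagonal fun i => (l i : ℂ)‖ * 1 := by gcongr
      _ = _ := by ring
  obtain ⟨i, hi⟩ := Finite.exists_max (fun i => ‖(l i : ℂ)‖)
  have hn2 : ‖K‖ ≤ |l i| := by
    refine hn.trans ((pi_norm_le_iff_of_nonneg (abs_nonneg _)).2 fun j => ?_)
    have := hi j
    rwa [norm_real, norm_real] at *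
  refine (exp_le_exp.2 hn2).trans ?_
  rw [h1, h2, ← sum_add_distrib]
  refine le_trans ?_ (Finset.single_le_sum (f := fun i => exp (l i) + exp (- l i)) (fun j _ => by positivity) (mem_univ i))
  rcases abs_cases (l i) with ⟨h, _⟩ | ⟨h, _⟩ <;> rw [h]
  · linarith [exp_pos (- l i)]
  · linarith [exp_pos (l i)]
def Phi : Mc (n × κ) →L[ℂ] Mc n := LinearMap.toContinuousLinearMap
  { toFun := fun M => of fun x y => (card κ : ℂ)⁻¹ * ∑ k, M (x, k) (y, k)
    map_add' := fun M M' => by ext x y; simp [sum_add_distrib, mul_add]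
    map_smul' := fun c M => by ext x y; simp [← mul_sum]; ring }
lemma Phi_apply (M : Mc (n × κ)) (x y : n) : Phi M x y = (card κ : ℂ)⁻¹ * ∑ k, M (x, k) (y, k) := rfl
lemma Phi_amp_mul (A : Mc n) (M : Mc (n × κ)) : Phi (amp κ A * M) = A * Phi M := by
  ext x y
  simp only [Phi_apply, Matrix.mul_apply, amp, kronecker_apply, sum_prod_type, Matrix.one_apply]
  simp only [mul_ite, mul_one, mul_zero, ite_mul, zero_mul, Finset.sum_ite_eq, mem_univ, if_true]
  rw [sum_comm]
  simp only [mul_sum]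
  refine scg fun z => scg fun k => by ring
lemma Phi_trace (M : Mc (n × κ)) : (Phi M).trace = (card κ : ℂ)⁻¹ * M.trace := by
  simp only [trace, diag, Phi_apply, sum_prod_type, mul_sum]
lemma Phi_one (hN : 0 < card κ) : Phi (1 : Mc (n × κ)) = 1 := by
  have h : (card κ : ℂ) ≠ 0 := by exact_mod_cast hN.ne'
  ext x y
  simp only [Phi_apply, Matrix.one_apply, Prod.mk.injEq, and_true]
  split_ifs <;> simp [h]
lemma amp_Phi (hP : PF P) (hN : 0 < card κ) (M : Mc (n × κ)) :
    ∑ c, Uf P c * M * Uf P c = ((card κ : ℂ) ^ 2) • amp κ (Phi M) := by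
  have h : (card κ : ℂ) ≠ 0 := by exact_mod_cast hN.ne'
  ext ⟨x, k⟩ ⟨y, l⟩
  simp only [Matrix.sum_apply, Matrix.smul_apply, amp, kronecker_apply, Uf, Matrix.mul_apply, sum_prod_type, Phi_apply, Matrix.one_apply]
  simp only [ite_mul, one_mul, zero_mul, Finset.sum_ite_irrel, Finset.sum_const_zero, Finset.sum_ite_eq, mem_univ, if_true, mul_ite, mul_zero, Finset.sum_ite_eq']
  have e : ∀ c, ∑ l', (∑ k', P c k k' * M (x, k') (y, l')) * P c l' l = ∑ l', ∑ k', M (x, k') (y, l') * (P c k k' * P c l' l) := fun c => by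
    refine Finset.sum_congr rfl fun l' _ => ?_
    rw [sum_mul]
    exact Finset.sum_congr rfl fun k' _ => by ring
  simp only [e]
  rw [sum_comm]
  simp only [sum_comm (s := (univ : Finset ι))]
  simp only [← mul_sum, hP.swap]
  by_cases hkl : k = l
  · subst hkl
    simp only [if_true, one_mul, ite_mul, zero_mul, mul_ite, mul_zero, Finset.sum_ite_eq', mem_univ, mul_one, smul_eq_mul]
    rw [← sum_mul]
    field_simp
  · simp [hkl]
lemma sw (hP : PF P) (hN : 0 < card κ) (A : Jx → Mc n) (M : Mc (n × κ)) :
    ∑ i, Bf P A i * M * Bf P A i = ∑ j, amp κ (A j * Phi M * A j) := by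
  have h : (card κ : ℂ) ≠ 0 := by exact_mod_cast hN.ne'
  rw [sum_prod_type]
  refine scg fun j => ?_
  have e : ∀ c, Bf P A (j, c) * M * Bf P A (j, c) = (((card κ : ℂ) ^ 2)⁻¹) • (amp κ (A j) * (Uf P c * M * Uf P c) * amp κ (A j)) := by
    intro c
    conv_lhs => rw [(Bf_eq hP A (j, c)).1]; arg 2; rw [← (Bf_eq hP A (j, c)).1, (Bf_eq hP A (j, c)).2]
    simp only [Matrix.smul_mul, Matrix.mul_smul, smul_smul, Matrix.mul_assoc]
    congr 1
    push_cast
    rw [sq, mul_inv]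
  simp only [e]
  rw [← smul_sum, ← sum_mul, ← mul_sum, amp_Phi hP hN]
  simp only [Matrix.smul_mul, Matrix.mul_smul, smul_smul]
  rw [inv_mul_cancel₀ (pow_ne_zero 2 h), one_smul, ← amp_mul, ← amp_mul]
def Pm (P : ι → Mc κ) (A : Jx → Mc n) (s : ℝ) : Mc n :=
  ∫ g, Phi (ex (s • Sb P A g)) ∂(gG (Jx × ι))
def Gc (A : Jx → Mc n) (a b : ℝ) (K : Mc (n × κ)) : Mc n :=
  ∑ j, A j * Phi (ex (a • K)) * A j * Phi (ex (b • K))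
lemma Phi_J (hP : PF P) (hN : 0 < card κ) (A : Jx → Mc n) (K : Mc (n × κ)) :
    ∑ i, Phi (Bf P A i * J K (Bf P A i)) = ∫ a in 0..1, Gc A a (1 - a) K := by
  have h1 : ∀ i, Phi (Bf P A i * J K (Bf P A i)) = ∫ a in 0..1, Phi (Bf P A i * (ex (a • K) * Bf P A i * ex ((1 - a) • K))) := by
    intro i
    obtain ⟨L', hL'⟩ := mulL_exists (Bf P A i) (Phi (n := n) (κ := κ))
    rw [← hL']
    simp only [← hL']
    unfold J
    exact (L'.intervalIntegral_comp_comm (Continuous.intervalIntegrable (by fun_prop) _ _)).symm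
  simp only [h1]
  rw [← intervalIntegral.integral_finsetSum (fun i _ => Continuous.intervalIntegrable (by fun_prop) _ _)]
  congr 1; funext a
  rw [← map_sum]
  simp only [← Matrix.mul_assoc]
  rw [← sum_mul, sw hP hN, sum_mul, map_sum]
  exact scg fun j => Phi_amp_mul _ _
lemma Phi_ex_norm (K : Mc (n × κ)) : ‖Phi (ex K)‖ ≤ ‖Phi (n := n) (κ := κ)‖ * exp ‖K‖ :=
  ((Phi (n := n) (κ := κ)).le_opNorm _).trans (mlL (norm_ex_le _) nng)
lemma Gc_norm (A : Jx → Mc n) {a b : ℝ} (ha : a ∈ Icc (0:ℝ) 1) (hb : b ∈ Icc (0:ℝ) 1) (K : Mc (n × κ)) :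
    ‖Gc A a b K‖ ≤ ((∑ j, ‖A j‖ ^ 2) * ‖Phi (n := n) (κ := κ)‖ ^ 2) * exp (2 * ‖K‖) := by
  have h : ∀ a ∈ Icc (0:ℝ) 1, ‖Phi (ex (a • K))‖ ≤ ‖Phi (n := n) (κ := κ)‖ * exp ‖K‖ := by
    intro a ha
    refine (Phi_ex_norm _).trans (mlL (exp_le_exp.2 ?_) nng)
    rw [norm_smul, norm_of_nonneg ha.1]
    exact mul_le_of_le_one_left nng ha.2
  unfold Gc
  refine (norm_sum_le _ _).trans ?_
  rw [sum_mul, sum_mul]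
  refine sle fun j => ?_
  have h1 := h a ha
  have h2 := h b hb
  refine (norm_mul_le _ _).trans ((mlR ((norm_mul_le _ _).trans (mlR (norm_mul_le _ _) nng)) nng).trans ?_)
  calc ‖A j‖ * ‖Phi (ex (a • K))‖ * ‖A j‖ * ‖Phi (ex (b • K))‖ ≤ ‖A j‖ * (‖Phi (n := n) (κ := κ)‖ * exp ‖K‖) * ‖A j‖ * (‖Phi (n := n) (κ := κ)‖ * exp ‖K‖) := by gcongr
    _ = ‖A j‖ ^ 2 * ‖Phi (n := n) (κ := κ)‖ ^ 2 * (exp ‖K‖ * exp ‖K‖) := by ring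
    _ = _ := by rw [← exp_add]; ring_nf
lemma Pm_deriv (hP : PF P) (hN : 0 < card κ) (A : Jx → Mc n) (s : ℝ) :
    HasDerivAt (Pm P A) (s • ∫ a in 0..1, ∫ g, Gc A a (1 - a) (s • Sb P A g) ∂(gG (Jx × ι))) s ∧
    IntervalIntegrable (fun a => ∫ g, Gc A a (1 - a) (s • Sb P A g) ∂(gG (Jx × ι))) volume 0 1 := by
  have hf := fub (I := Jx × ι) (W := Mc n) (f := fun a g => Gc A a (1 - a) (s • Sb P A g)) (by
    unfold Gc Function.uncurry; fun_prop) (s := 1) (A := (∑ j, ‖A j‖ ^ 2) * ‖Phi (n := n) (κ := κ)‖ ^ 2) (B := 2 * (|s| * ‖SgL (Bf P A)‖)) zero_le_one (by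
    intro a ha g
    refine (Gc_norm A ha ⟨by linarith [ha.2], by linarith [ha.1]⟩ _).trans (mlL (exp_le_exp.2 ?_) (by positivity))
    rw [norm_smul, norm_eq_abs, mul_assoc, mul_assoc]
    exact mlL (mlL (Sg_norm _ _) (abs_nonneg _)) (by norm_num))
  refine ⟨?_, hf.2⟩
  refine (PS_deriv (Bf P A) (Phi (n := n) (κ := κ)) s).congr_deriv ?_
  rw [PS_stein]
  congr 1
  rw [← hf.1, ← integral_finsetSum]
  · congr 1; funext g
    exact Phi_J hP hN A _
  · intro i _
    refine integrable_exp (by fun_prop) (A := ‖Phi (n := n) (κ := κ)‖ * (‖Bf P A i‖ * ‖Bf P A i‖)) (B := |s| * ‖SgL (Bf P A)‖) fun g => ?_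
    refine ((Phi (n := n) (κ := κ)).le_opNorm _).trans ?_
    rw [mul_assoc, mul_assoc]
    refine mlL ((norm_mul_le _ _).trans (mlL ((J_norm_le _ _).trans (mlL (exp_le_exp.2 ?_) nng)) nng)) nng
    rw [norm_smul, norm_eq_abs, mul_assoc]
    exact mlL (Sg_norm _ _) (abs_nonneg _)
lemma sum_tr_sq {I : Type*} [Fintype I] {B : I → Mc n} {u : ℝ} (hu : 0 < u) (h : HsB B u) (M : Mc n) :
    ∑ i, ‖(B i * M).trace‖ ^ 2 ≤ u * hs M := by
  set x : I → ℂ := fun i => starRingEnd ℂ (B i * M).trace with hx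
  have h1 := h x
  have h2 : ∑ j, ‖x j‖ ^ 2 = ∑ i, ‖(B i * M).trace‖ ^ 2 := by simp [hx]
  rw [h2] at h1
  set S := ∑ i, ‖(B i * M).trace‖ ^ 2 with hS
  have h3 : ((∑ j, x j • B j) * M).trace = (S : ℂ) := by
    rw [sum_mul, trace_sum, hS]
    push_cast
    refine scg fun i => ?_
    rw [Matrix.smul_mul, trace_smul, smul_eq_mul, hx]
    exact Complex.conj_mul' _
  have h4 := norm_trace_mul_le (∑ j, x j • B j) M (r := u⁻¹) (inv_pos.2 hu)
  have hS0 : 0 ≤ S := sum_nonneg fun i _ => by positivity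
  rw [h3, norm_real, norm_of_nonneg hS0, div_inv_eq_mul] at h4
  have h5 : u⁻¹ * hs (∑ j, x j • B j) ≤ S := by
    rw [inv_mul_le_iff₀ hu]; exact h1
  linarith
lemma hs_le_norm (M : Mc n) : hs M ≤ crd n * ‖M‖ ^ 2 := by
  have h := hs_mul_le M 1
  have h1 : hs (1 : Mc n) = card n := by
    have := hs_eq (1 : Mc n)
    rw [conjTranspose_one, mul_one, trace_one] at this
    exact_mod_cast this
  rw [mul_one, h1] at h
  linarith
def eN (n : Type*) [Fintype n] [DecidableEq n] : ℝ := ∑ p : n × n, ‖single p.1 p.2 (1:ℂ)‖ ^ 2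
lemma eN_nonneg : 0 ≤ eN n := sum_nonneg fun i _ => by positivity
lemma norm_sq_le_hs (M : Mc n) : ‖M‖ ^ 2 ≤ eN n * hs M := by
  have h1 : ‖M‖ ≤ ∑ p : n × n, ‖single p.1 p.2 (1:ℂ)‖ * ‖M p.1 p.2‖ := by
    conv_lhs => rw [matrix_eq_sum_single M, ← Fintype.sum_prod_type' (f := fun i j => single i j (M i j))]
    refine (norm_sum_le _ _).trans (sle fun p => ?_)
    have : single p.1 p.2 (M p.1 p.2) = M p.1 p.2 • single p.1 p.2 (1:ℂ) := by simp
    rw [this, norm_smul, mul_comm]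
  refine (pow_le_pow_left₀ nng h1 2).trans ((Finset.sum_mul_sq_le_sq_mul_sq _ _ _).trans ?_)
  unfold eN hs
  rw [← Fintype.sum_prod_type' (f := fun i j => ‖M i j‖ ^ 2)]
lemma trace_J_symm (Y K B : Mc n) : (Y * J K B).trace = (B * J K Y).trace := by
  rw [trace_mul_J, trace_mul_J]
  have := intervalIntegral.integral_comp_sub_left (a := (0:ℝ)) (b := 1) (fun a => (B * ex (a • K) * Y * ex ((1 - a) • K)).trace) 1
  rw [sub_self, sub_zero] at this
  rw [← this]
  congr 1; funext a
  rw [sub_sub_cancel, Matrix.mul_assoc, trace_mul_comm]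
  simp only [Matrix.mul_assoc]
lemma Phi_entry (M : Mc (n × κ)) (x y : n) :
    Phi M x y = (card κ : ℂ)⁻¹ * (amp κ (single y x 1) * M).trace := by
  rw [← Phi_trace, Phi_amp_mul, trace_single_mul]
  simp
lemma PhiJ_bd (hP : PF P) (hN : 0 < card κ) {A : Jx → Mc n} (hA : Hm A) {v : ℝ} (hv : 0 < v)
    (h : HsB A v) (K : Mc (n × κ)) :
    ∑ i, ‖Phi (J K (Bf P A i))‖ ^ 2 ≤ (eN n * eN n * v * card n) * (crd κ ^ 2)⁻¹ * exp (2 * ‖K‖) := by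
  have hN' : (0:ℝ) < crd κ := Nat.cast_pos.2 hN
  have hB := Bf_HsB hP hA h hN
  have h1 : ∀ i, ‖Phi (J K (Bf P A i))‖ ^ 2 ≤ eN n * ∑ p : n × n, (crd κ ^ 2)⁻¹ * ‖(Bf P A i * J K (amp κ (single p.2 p.1 1))).trace‖ ^ 2 := by
    intro i
    refine (norm_sq_le_hs _).trans (mlL (le_of_eq ?_) eN_nonneg)
    unfold hs
    rw [← Fintype.sum_prod_type' (f := fun i_1 j => ‖Phi (J K (Bf P A i)) i_1 j‖ ^ 2)]
    refine scg fun p => ?_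
    rw [Phi_entry, trace_J_symm, norm_mul, mul_pow, norm_inv, Complex.norm_natCast, inv_pow]
  refine (sle fun i => h1 i).trans ?_
  rw [← mul_sum, sum_comm]
  have h2 : ∀ p : n × n, ∑ i, (crd κ ^ 2)⁻¹ * ‖(Bf P A i * J K (amp κ (single p.2 p.1 1))).trace‖ ^ 2 ≤
      ‖single p.2 p.1 (1:ℂ)‖ ^ 2 * (v * card n * (crd κ ^ 2)⁻¹ * exp (2 * ‖K‖)) := by
    intro p
    rw [← mul_sum]
    have h3 := sum_tr_sq (div_pos hv hN') hB (J K (amp κ (single p.2 p.1 1)))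
    have h4 := hs_le_norm (J K (amp κ (single p.2 p.1 (1:ℂ))))
    have h5 : ‖J K (amp κ (single p.2 p.1 (1:ℂ)))‖ ^ 2 ≤ ‖single p.2 p.1 (1:ℂ)‖ ^ 2 * exp (2 * ‖K‖) := by
      have := (J_norm_le K (amp κ (single p.2 p.1 (1:ℂ)))).trans (mlR (amp_norm_le _) exp0)
      refine (pow_le_pow_left₀ nng this 2).trans (le_of_eq ?_)
      rw [mul_pow, ← Real.exp_nat_mul]; push_cast; rfl
    rw [Fintype.card_prod] at h4
    push_cast at h4
    calc (crd κ ^ 2)⁻¹ * _ ≤ (crd κ ^ 2)⁻¹ * (v / card κ * (card n * card κ * (‖single p.2 p.1 (1:ℂ)‖ ^ 2 * exp (2 * ‖K‖)))) := by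
          refine mlL (h3.trans (mlL (h4.trans ?_) (by positivity))) (by positivity)
          exact mlL h5 (by positivity)
      _ = _ := by field_simp
  refine (mlL (sle fun p => h2 p) eN_nonneg).trans (le_of_eq ?_)
  rw [← sum_mul]
  have h6 : ∑ p : n × n, ‖single p.2 p.1 (1:ℂ)‖ ^ 2 = eN n := by
    unfold eN
    exact Fintype.sum_equiv (Equiv.prodComm n n) _ _ fun p => rfl
  rw [h6]; ring
lemma expm [Nonempty n] {I : Type*} [Fintype I] [DecidableEq I] {B : I → Mc n} (hB : Hm B) {s2 : ℝ}
    (h2 : ‖∑ i, B i * B i‖ ≤ s2) {s θ : ℝ} (hs : 0 ≤ s) (hsθ : s ≤ θ) (τ : Finset I) (α : ℝ) :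
    Integrable (fun w => exp (2 * ‖s • Sg B (cx (xpt τ α w))‖)) (gG (I ⊕ I)) ∧
    ∫ w, exp (2 * ‖s • Sg B (cx (xpt τ α w))‖) ∂(gG (I ⊕ I)) ≤ 2 * card n * exp (2 * θ ^ 2 * s2) := by
  have hs2 : 0 ≤ s2 := nng.trans h2
  have hI : Integrable (fun w => exp (2 * ‖s • Sg B (cx (xpt τ α w))‖)) (gG (I ⊕ I)) := by
    refine integrable_exp (by have := xpt_cont τ α; fun_prop) (A := 1) (B := 2 * (s * (‖SgL B‖ * 2))) fun w => ?_
    rw [norm_of_nonneg exp0, one_mul, exp_le_exp, norm_smul, norm_of_nonneg hs, mul_assoc, mul_assoc, mul_assoc]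
    refine mlL (mlL ((Sg_norm B _).trans ?_) hs) (by norm_num)
    exact mlL (xpt_norm τ α w) nng
  refine ⟨hI, ?_⟩
  have hp := rtr_rot 0 (2 * s) B τ α
  have hm := rtr_rot 0 (2 * s) (fun i => -B i) τ α
  have e1 : ∀ g, KK 0 (2 * s) (fun i => -B i) g = - KK 0 (2 * s) B g := fun g => by simp [KK, Sg, Finset.sum_neg_distrib]
  have hu1 := unif hB h2 (s := 2 * s) (by positivity)
  have hu2 := unif (B := fun i => -B i) (fun i => (hB i).neg) (s2 := s2) (by simpa using h2) (s := 2 * s) (by positivity)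
  have e2 : ∀ B : I → Mc n, (fun g => rtr (ex (KK 0 (2 * s) B g))) = fun g => rtr (ex ((2 * s) • Sg B (cx g))) := fun B => by simp [KK]
  have hle : exp ((2 * s) ^ 2 * s2 / 2) ≤ exp (2 * θ ^ 2 * s2) := exp_le_exp.2 (by nlinarith [mlR (pow_le_pow_left₀ hs hsθ 2) hs2])
  calc ∫ w, exp (2 * ‖s • Sg B (cx (xpt τ α w))‖) ∂(gG (I ⊕ I)) ≤ ∫ w, (rtr (ex (KK 0 (2 * s) B (xpt τ α w))) + rtr (ex (KK 0 (2 * s) (fun i => -B i) (xpt τ α w)))) ∂(gG (I ⊕ I)) := by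
        refine integral_mono hI (hp.2.add hm.2) fun w => ?_
        have hK : (KK 0 (2 * s) B (xpt τ α w)).IsHermitian := KK_herm isHermitian_zero _ hB _
        have := exp_norm_le hK
        rw [← e1] at this
        refine le_trans (le_of_eq ?_) this
        congr 1
        simp only [KK, zero_add]
        rw [norm_smul, norm_smul, norm_mul, norm_of_nonneg hs, norm_of_nonneg (zero_le_two)]; ring
    _ = _ + _ := integral_add hp.2 hm.2
    _ ≤ card n * exp (2 * θ ^ 2 * s2) + card n * exp (2 * θ ^ 2 * s2) := by
        rw [hp.1, hm.1, e2, e2]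
        exact add_le_add (hu1.trans (mlL hle (Nat.cast_nonneg _))) (hu2.trans (mlL hle (Nat.cast_nonneg _)))
    _ = _ := by ring
def TL (A : Jx → Mc n) : Mc n →L[ℂ] Mc n := LinearMap.toContinuousLinearMap
  { toFun := fun M => ∑ j, A j * M * A j
    map_add' := fun M M' => by simp [mul_add, add_mul, sum_add_distrib]
    map_smul' := fun c M => by simp [← smul_sum] }
lemma TL_apply (A : Jx → Mc n) (M : Mc n) : TL A M = ∑ j, A j * M * A j := rfl
lemma TL_eq (hP : PF P) (hN : 0 < card κ) (A : Jx → Mc n) (X Y : Mc (n × κ)) :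
    TL A (Phi X) * Phi Y = ∑ i, Phi (Bf P A i * (X * Bf P A i * Y)) := by
  rw [← map_sum]
  simp only [← Matrix.mul_assoc]
  rw [← sum_mul, sw hP hN, sum_mul, map_sum, TL_apply, sum_mul]
  exact scg fun j => (Phi_amp_mul _ _).symm
lemma Gc_eq (A : Jx → Mc n) (a b : ℝ) (K : Mc (n × κ)) : Gc A a b K = TL A (Phi (ex (a • K))) * Phi (ex (b • K)) := by
  rw [TL_apply, sum_mul]; rfl
lemma xpt_pi (I : Type*) [Fintype I] [DecidableEq I] (w : I ⊕ I → ℝ) : xpt univ (Real.pi / 2) w = w ∘ inr := by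
  ext i; simp [xpt]
lemma smulSg {I : Type*} [Fintype I] (s : ℝ) (B : I → Mc n) (z : I → ℂ) : s • Sg B z = Sg (fun i => s • B i) z := by
  unfold Sg
  rw [smul_sum]
  exact scg fun i => smul_comm _ _ _
def Fd (P : ι → Mc κ) (A : Jx → Mc n) (s1 s2 a : ℝ) : Mc n :=
  ∫ w, TL A (Phi (ex (s1 • Sb P A (xpt univ a w)))) * Phi (ex (s2 • Sb P A (w ∘ inl))) ∂(gG ((Jx × ι) ⊕ (Jx × ι)))
lemma int2 {I : Type*} [Fintype I] [DecidableEq I] {W : Type*} [NormedAddCommGroup W] (B : I → Mc n) (s1 s2 a c : ℝ) {f : (I ⊕ I → ℝ) → W} (hc : 0 ≤ c) (hf : Continuous f)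
    (h : ∀ w, ‖f w‖ ≤ c * (exp ‖s1 • Sg B (cx (xpt univ a w))‖ * exp ‖s2 • Sg B (cx (w ∘ inl))‖)) : Integrable f (gG (I ⊕ I)) := by
  refine integrable_exp hf (A := c) (B := (|s1| * (‖SgL B‖ * 2) + |s2| * ‖SgL B‖)) fun w => (h w).trans (mlL ?_ hc)
  rw [← exp_add, exp_le_exp, norm_smul, norm_smul, norm_eq_abs, norm_eq_abs, add_mul]
  refine add_le_add ?_ ?_
  · rw [mul_assoc, mul_assoc]
    exact mlL ((Sg_norm B _).trans (mlL (xpt_norm _ _ w) nng)) (abs_nonneg _)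
  · rw [mul_assoc]
    refine mlL ((Sg_norm B _).trans (mlL ?_ nng)) (abs_nonneg _)
    exact (pi_norm_le_iff_of_nonneg nng).2 fun i => norm_le_pi_norm w _
lemma Fd_zero (P : ι → Mc κ) (A : Jx → Mc n) (s1 s2 : ℝ) :
    Fd P A s1 s2 0 = ∫ g, TL A (Phi (ex (s1 • Sb P A g))) * Phi (ex (s2 • Sb P A g)) ∂(gG (Jx × ι)) := by
  unfold Fd
  simp only [xpt_zero]
  refine integral_inl (f := fun g => TL A (Phi (ex (s1 • Sb P A g))) * Phi (ex (s2 • Sb P A g))) ?_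
  refine integrable_exp (by fun_prop) (A := ‖TL A‖ * ‖Phi (n := n) (κ := κ)‖ * ‖Phi (n := n) (κ := κ)‖) (B := |s1| * ‖SgL (Bf P A)‖ + |s2| * ‖SgL (Bf P A)‖) fun g => ?_
  refine (norm_mul_le _ _).trans ((mul_le_mul (((TL A).le_opNorm _).trans (mlL (Phi_ex_norm _) nng)) (Phi_ex_norm _) nng (by positivity)).trans ?_)
  have h : ∀ s : ℝ, exp ‖s • Sb P A g‖ ≤ exp (|s| * ‖SgL (Bf P A)‖ * ‖g‖) := fun s => by
    rw [exp_le_exp, norm_smul, norm_eq_abs, mul_assoc]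
    exact mlL (Sg_norm _ _) (abs_nonneg _)
  rw [add_mul, exp_add]
  calc _ = ‖TL A‖ * ‖Phi (n := n) (κ := κ)‖ * ‖Phi (n := n) (κ := κ)‖ * (exp ‖s1 • Sb P A g‖ * exp ‖s2 • Sb P A g‖) := by ring
    _ ≤ _ := mlL (mul_le_mul (h _) (h _) exp0 exp0) (by positivity)
lemma Fd_pi (P : ι → Mc κ) (A : Jx → Mc n) (s1 s2 : ℝ) :
    Fd P A s1 s2 (Real.pi / 2) = TL A (Pm P A s1) * Pm P A s2 := by
  unfold Fd
  simp only [xpt_pi]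
  have hm := measurePreserving_sumPiEquivProdPi (fun _ : (Jx × ι) ⊕ (Jx × ι) => gam1)
  have i1 : Integrable (fun g => TL A (Phi (ex (s1 • Sb P A g)))) (gG (Jx × ι)) := intS (Bf P A) ((TL A).comp Phi) s1
  have i2 : Integrable (fun g => Phi (ex (s2 • Sb P A g))) (gG (Jx × ι)) := intS (Bf P A) Phi s2
  have e := hm.integral_comp' (G := Mc n) (fun z => TL A (Phi (ex (s1 • Sg (Bf P A) (cx z.2)))) * Phi (ex (s2 • Sg (Bf P A) (cx z.1))))
  refine Eq.trans (show _ = _ from e) ?_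
  refine (integral_prod _ (show Integrable _ _ from (i1.mul_prod i2).swap)).trans ?_
  have e3 : ∀ x : Jx × ι → ℝ, ∫ y, TL A (Phi (ex (s1 • Sb P A y))) * Phi (ex (s2 • Sb P A x)) ∂(gG (Jx × ι)) = TL A (Pm P A s1) * Phi (ex (s2 • Sb P A x)) := by
    intro x
    rw [integral_mul_const_of_integrable i1]
    congr 1
    exact (TL A).integral_comp_comm (intS (Bf P A) Phi s1)
  refine (integral_congr_ae (of_forall e3)).trans ?_
  exact integral_const_mul_of_integrable i2
lemma LXQY {V : Type*} [NormedAddCommGroup V] [NormedSpace ℂ V] (L : Mc n →L[ℂ] V) {X Y : Mc n} (Q : Mc n) {x y : ℝ} (hx : ‖X‖ ≤ x) (hy : ‖Y‖ ≤ y) :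
    ‖L (X * Q * Y)‖ ≤ (‖L‖ * ‖Q‖) * (x * y) := by
  have h1 : ‖X * Q * Y‖ ≤ ‖X‖ * ‖Q‖ * ‖Y‖ := norm_mul₃_le
  have h2 : ‖X‖ * ‖Q‖ * ‖Y‖ ≤ x * ‖Q‖ * y := mul_le_mul (mlR hx nng) hy nng (mul_nonneg (nng.trans hx) nng)
  exact ((L.le_opNorm _).trans (mlL (h1.trans h2) nng)).trans (le_of_eq (by ring))
set_option maxHeartbeats 1000000 in
lemma Fd_deriv (hP : PF P) (hN : 0 < card κ) (A : Jx → Mc n) (s1 s2 α : ℝ) :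
    HasDerivAt (Fd P A s1 s2) (-sin α • ∑ i, ∫ w, TL A (Phi (J (s1 • Sb P A (xpt univ α w)) (s1 • Bf P A i))) *
      Phi (J (s2 • Sb P A (w ∘ inl)) (s2 • Bf P A i)) ∂(gG ((Jx × ι) ⊕ (Jx × ι)))) α := by
  have hL : ∀ l, ∃ L' : Mc (n × κ) →L[ℂ] Mc n, ∀ M, L' M = Phi (Bf P A l * M) := fun l => mulL_exists _ _
  choose L hL using hL
  have h1 := HasDerivAt.sum (u := univ) fun l _ => cov (L l) (Bf P A l) 0 0 (fun i => s1 • Bf P A i) (fun i => s2 • Bf P A i) univ α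
  simp only [zero_add, ← smulSg] at h1
  have hf : ∀ a, Fd P A s1 s2 a = ∑ l, ∫ w, L l (ex (s1 • Sb P A (xpt univ a w)) * Bf P A l * ex (s2 • Sb P A (w ∘ inl))) ∂(gG ((Jx × ι) ⊕ (Jx × ι))) := by
    intro a
    rw [← integral_finsetSum]
    · unfold Fd
      simp only [hL]
      refine integral_congr_ae (of_forall fun w => ?_)
      exact TL_eq hP hN A _ _
    · intro l _
      refine int2 (Bf P A) s1 s2 a (‖L l‖ * ‖Bf P A l‖) (by positivity) (by have := xpt_cont (univ : Finset (Jx × ι)) a; fun_prop) fun w => ?_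
      exact LXQY (L l) _ (norm_ex_le _) (norm_ex_le _)
  have h2 : HasDerivAt (Fd P A s1 s2) _ α := h1.congr_of_eventuallyEq (of_forall fun a => by rw [hf a, Finset.sum_apply])
  refine h2.congr_deriv ?_
  rw [← smul_sum, sum_comm]
  congr 1
  refine scg fun i => ?_
  rw [← integral_finsetSum]
  · simp only [hL]
    refine integral_congr_ae (of_forall fun w => ?_)
    exact (TL_eq hP hN A _ _).symm
  · intro l _
    refine int2 (Bf P A) s1 s2 α (‖L l‖ * (‖s1 • Bf P A i‖ * ‖Bf P A l‖ * ‖s2 • Bf P A i‖)) (by positivity) (by have := xpt_cont (univ : Finset (Jx × ι)) α; fun_prop) fun w => ?_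
    exact (LXQY (L l) _ (J_norm_le _ _) (J_norm_le _ _)).trans (le_of_eq (by ring))
lemma amgm {a s1 s2 p q t : ℝ} (ha : 0 ≤ a) (hp : 0 ≤ p) (hq : 0 ≤ q) (ht : 0 ≤ t) (h : s1 * s2 ≤ t) :
    a * (s1 * p) * (s2 * q) ≤ (a * t / 2) * (p ^ 2 + q ^ 2) := by
  have h1 : (s1 * s2) * (p * q) ≤ t * (p * q) := mlR h (mul_nonneg hp hq)
  have h2 : t * (p * q) ≤ t * ((p ^ 2 + q ^ 2) / 2) := mlL (by nlinarith [sq_nonneg (p - q)]) ht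
  have := mlL (h1.trans h2) ha
  linarith
set_option maxHeartbeats 1000000 in
lemma decor [Nonempty n] [Nonempty κ] (hP : PF P) (hN : 0 < card κ) {A : Jx → Mc n} (hA : Hm A) {v : ℝ} (hv : 0 < v)
    (h : HsB A v) {sg : ℝ} (h2 : ‖∑ j, A j * A j‖ ≤ sg) {s1 s2 θ : ℝ} (h10 : 0 ≤ s1) (h1θ : s1 ≤ θ) (h20 : 0 ≤ s2) (h2θ : s2 ≤ θ) :
    ‖(∫ g, TL A (Phi (ex (s1 • Sb P A g))) * Phi (ex (s2 • Sb P A g)) ∂(gG (Jx × ι))) - TL A (Pm P A s1) * Pm P A s2‖ ≤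
      (4 * ‖TL A‖ * θ ^ 2 * (eN n * eN n * v * card n) * card n * exp (2 * θ ^ 2 * sg)) / card κ := by
  have hN' : (0:ℝ) < crd κ := Nat.cast_pos.2 hN
  have hB2 : ‖∑ i, Bf P A i * Bf P A i‖ ≤ sg := by
    rw [Bf_sq hP hN]
    simp only [← amp_mul, ← amp_sum]
    exact (amp_norm_le _).trans h2
  set c := eN n * eN n * v * card n with hc
  have hc0 : 0 ≤ c := by have := eN_nonneg (n := n); positivity
  have hθ : 0 ≤ θ := h10.trans h1θ
  have key : ∀ α, ‖-sin α • ∑ i, ∫ w, TL A (Phi (J (s1 • Sb P A (xpt univ α w)) (s1 • Bf P A i))) *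
      Phi (J (s2 • Sb P A (w ∘ inl)) (s2 • Bf P A i)) ∂(gG ((Jx × ι) ⊕ (Jx × ι)))‖ ≤ (2 * ‖TL A‖ * θ ^ 2 * c * card n * exp (2 * θ ^ 2 * sg)) / card κ := by
    intro α
    have x1 := expm (Bf_herm hP hA) hB2 h10 h1θ univ α
    have x2 := expm (Bf_herm hP hA) hB2 h20 h2θ univ 0
    simp only [xpt_zero] at x2
    set E1 : (((Jx × ι) ⊕ (Jx × ι)) → ℝ) → ℝ := fun w => exp (2 * ‖s1 • Sb P A (xpt univ α w)‖) with hE1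
    set E2 : (((Jx × ι) ⊕ (Jx × ι)) → ℝ) → ℝ := fun w => exp (2 * ‖s2 • Sb P A (w ∘ inl)‖) with hE2
    have hint : ∀ i, Integrable (fun w => TL A (Phi (J (s1 • Sb P A (xpt univ α w)) (s1 • Bf P A i))) *
      Phi (J (s2 • Sb P A (w ∘ inl)) (s2 • Bf P A i))) (gG ((Jx × ι) ⊕ (Jx × ι))) := by
      intro i
      refine int2 (Bf P A) s1 s2 α (‖TL A‖ * (‖Phi (n := n) (κ := κ)‖ * ‖s1 • Bf P A i‖) * (‖Phi (n := n) (κ := κ)‖ * ‖s2 • Bf P A i‖)) (by positivity) (by have := xpt_cont (univ : Finset (Jx × ι)) α; fun_prop) fun w => ?_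
      have hh : ∀ K B : Mc (n × κ), ‖Phi (J K B)‖ ≤ ‖Phi (n := n) (κ := κ)‖ * (‖B‖ * exp ‖K‖) := fun K B =>
        ((Phi (n := n) (κ := κ)).le_opNorm _).trans (mlL (J_norm_le _ _) nng)
      refine (norm_mul_le _ _).trans ((mul_le_mul (((TL A).le_opNorm _).trans (mlL (hh _ _) nng)) (hh _ _) nng (by positivity)).trans (le_of_eq (by ring)))
    have pt : ∀ w, ∑ i, ‖TL A (Phi (J (s1 • Sb P A (xpt univ α w)) (s1 • Bf P A i))) *
      Phi (J (s2 • Sb P A (w ∘ inl)) (s2 • Bf P A i))‖ ≤ (‖TL A‖ * θ ^ 2 * c * (crd κ ^ 2)⁻¹ / 2) * (E1 w + E2 w) := by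
      intro w
      have b1 := PhiJ_bd hP hN hA hv h (s1 • Sb P A (xpt univ α w))
      have b2 := PhiJ_bd hP hN hA hv h (s2 • Sb P A (w ∘ inl))
      set p := fun i => ‖Phi (J (s1 • Sb P A (xpt univ α w)) (Bf P A i))‖
      set q := fun i => ‖Phi (J (s2 • Sb P A (w ∘ inl)) (Bf P A i))‖
      have s : ∀ i, ‖TL A (Phi (J (s1 • Sb P A (xpt univ α w)) (s1 • Bf P A i))) *
          Phi (J (s2 • Sb P A (w ∘ inl)) (s2 • Bf P A i))‖ ≤ (‖TL A‖ * θ ^ 2 / 2) * (p i ^ 2 + q i ^ 2) := by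
        intro i
        refine (norm_mul_le _ _).trans ((mlR ((TL A).le_opNorm _) nng).trans ?_)
        rw [J_smul, J_smul]
        have m1 : ∀ (r : ℝ) (M : Mc (n × κ)), 0 ≤ r → ‖Phi (r • M)‖ = r * ‖Phi M‖ := fun r M hr => by
          rw [← Complex.coe_smul, map_smul, norm_smul, norm_real, norm_of_nonneg hr]
        rw [m1 _ _ h10, m1 _ _ h20]
        have hp : 0 ≤ p i := nng
        have hq : 0 ≤ q i := nng
        have hss : s1 * s2 ≤ θ ^ 2 := by rw [sq]; exact mul_le_mul h1θ h2θ h20 hθ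
        exact amgm nng hp hq (sq_nonneg θ) hss
      refine (sle fun i => s i).trans ?_
      rw [← mul_sum, sum_add_distrib]
      calc _ ≤ (‖TL A‖ * θ ^ 2 / 2) * (c * (crd κ ^ 2)⁻¹ * E1 w + c * (crd κ ^ 2)⁻¹ * E2 w) := by gcongr
        _ = _ := by ring
    rw [norm_smul, norm_neg]
    refine (mul_le_of_le_one_left nng (Real.abs_sin_le_one α)).trans ?_
    rw [← integral_finsetSum _ fun i _ => hint i]
    have hd := (x1.1.add x2.1).const_mul (‖TL A‖ * θ ^ 2 * c * (crd κ ^ 2)⁻¹ / 2)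
    refine (norm_integral_le_of_norm_le hd (of_forall fun w => (norm_sum_le _ _).trans (pt w))).trans ?_
    have e0 : ∫ w, (‖TL A‖ * θ ^ 2 * c * (crd κ ^ 2)⁻¹ / 2) * (E1 w + E2 w) ∂(gG ((Jx × ι) ⊕ (Jx × ι))) = (‖TL A‖ * θ ^ 2 * c * (crd κ ^ 2)⁻¹ / 2) * ((∫ w, E1 w ∂(gG ((Jx × ι) ⊕ (Jx × ι)))) + ∫ w, E2 w ∂(gG ((Jx × ι) ⊕ (Jx × ι)))) := by
      rw [integral_const_mul, integral_add x1.1 x2.1]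
    refine (show _ = _ from e0).trans_le ?_
    have y1 := x1.2
    have y2 := x2.2
    rw [Fintype.card_prod] at y1 y2
    push_cast at y1 y2
    refine (mlL (add_le_add y1 y2) (by positivity)).trans (le_of_eq ?_)
    field_simp
    ring
  have hmv := norm_image_sub_le_of_norm_deriv_le_segment' (f := Fd P A s1 s2) (a := 0) (b := Real.pi / 2) (fun x _ => (Fd_deriv hP hN A s1 s2 x).hasDerivWithinAt) (fun x _ => key x) (Real.pi / 2) ⟨by positivity, le_rfl⟩
  rw [Fd_pi, Fd_zero, norm_sub_rev] at hmv
  refine hmv.trans ?_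
  have hpi : Real.pi / 2 - 0 ≤ 2 := by linarith [Real.pi_le_four]
  refine (mlL hpi (by positivity)).trans (le_of_eq (by ring))
lemma conv_le {F G : ℝ → ℝ} (hF : Continuous F) (hG : Continuous G) (hF0 : ∀ x, 0 ≤ F x) (hG0 : ∀ x, 0 ≤ G x) {t : ℝ} (ht : 0 ≤ t) :
    ∫ s in 0..t, ∫ x in 0..s, F x * G (s - x) ≤ (∫ x in 0..t, F x) * ∫ x in 0..t, G x := by
  set f := (Ioc 0 t).indicator F
  set g := (Ioc 0 t).indicator G
  have hi : ∀ {H : ℝ → ℝ}, Continuous H → Integrable ((Ioc 0 t).indicator H) := fun hH =>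
    (integrable_indicator_iff measurableSet_Ioc).2 ((hH.intervalIntegrable 0 t).1)
  have hsub : Ioi (0:ℝ) ∩ Ioc 0 t = Ioc 0 t := Set.inter_eq_right.2 fun x hx => hx.1
  have hv : ∀ H : ℝ → ℝ, ∫ x in Ioi (0:ℝ), (Ioc 0 t).indicator H x = ∫ x in 0..t, H x := fun H => by
    rw [setIntegral_indicator measurableSet_Ioc, hsub, intervalIntegral.integral_of_le ht]
  have h1 := integral_posConvolution (μ := volume) (ν := volume) (f := f) (g := g) (hi hF).integrableOn (hi hG).integrableOn (ContinuousLinearMap.mul ℝ ℝ)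
  have h2 := integrable_posConvolution (μ := volume) (ν := volume) (f := f) (g := g) (hi hF).integrableOn (hi hG).integrableOn (ContinuousLinearMap.mul ℝ ℝ)
  simp only [ContinuousLinearMap.mul_apply'] at h1
  rw [hv F, hv G] at h1
  rw [← h1, intervalIntegral.integral_of_le ht]
  have hf0 : ∀ x, 0 ≤ f x := fun x => Set.indicator_nonneg (fun x _ => hF0 x) x
  have hg0 : ∀ x, 0 ≤ g x := fun x => Set.indicator_nonneg (fun x _ => hG0 x) x
  have h3 : IntegrableOn (fun x => ∫ y in 0..x, f y * g (x - y)) (Ioi 0) := (integrable_indicator_iff measurableSet_Ioi).1 h2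
  have h4 : ∫ s in Ioc 0 t, ∫ x in 0..s, F x * G (s - x) = ∫ s in Ioc 0 t, ∫ x in 0..s, f x * g (s - x) := by
    refine setIntegral_congr_fun measurableSet_Ioc fun s hs => ?_
    refine intervalIntegral.integral_congr_ae ?_
    have : ∀ᵐ x : ℝ, x ≠ s := by simp [ae_iff, measure_singleton]
    filter_upwards [this] with x hx hx'
    rw [Set.uIoc_of_le hs.1.le] at hx'
    have hlt : x < s := lt_of_le_of_ne hx'.2 hx
    have m1 : f x = F x := Set.indicator_of_mem (show x ∈ Ioc 0 t from ⟨hx'.1, hx'.2.trans hs.2⟩) F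
    have m2 : g (s - x) = G (s - x) := Set.indicator_of_mem (show s - x ∈ Ioc 0 t from ⟨by linarith, by linarith [hx'.1, hs.2]⟩) G
    rw [m1, m2]
  rw [h4]
  refine setIntegral_mono_set h3 ?_ (of_forall fun x hx => hx.1)
  refine (ae_restrict_iff' measurableSet_Ioi).2 (of_forall fun s hs => ?_)
  exact intervalIntegral.integral_nonneg (le_of_lt hs) fun x _ => mul_nonneg (hf0 _) (hg0 _)
lemma scal1 {u w : ℝ → ℝ} (hu : Continuous u) (hw : Continuous w) {a2 K θ l : ℝ} (hl : 0 < l)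
    (h : ∀ t ∈ Icc 0 θ, u t ≤ K + a2 * ∫ s in 0..t, w s) {t : ℝ} (ht : t ∈ Icc 0 θ) :
    l * (∫ s in 0..t, exp (-l * s) * u s) + exp (-l * t) * (K + a2 * ∫ s in 0..t, w s) ≤ K + a2 * ∫ s in 0..t, exp (-l * s) * w s := by
  have hW : ∀ t, HasDerivAt (fun t => ∫ s in 0..t, w s) (w t) t := fun t => (hw.integral_hasStrictDerivAt 0 t).hasDerivAt
  have hf : ∀ t, HasDerivAt (fun t => ∫ s in 0..t, exp (-l * s) * u s) (exp (-l * t) * u t) t := fun t =>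
    (Continuous.integral_hasStrictDerivAt (by fun_prop) 0 t).hasDerivAt
  have hg : ∀ t, HasDerivAt (fun t => ∫ s in 0..t, exp (-l * s) * w s) (exp (-l * t) * w t) t := fun t =>
    (Continuous.integral_hasStrictDerivAt (by fun_prop) 0 t).hasDerivAt
  have he : ∀ t, HasDerivAt (fun t => exp (-l * t)) (exp (-l * t) * (-l)) t := fun t => by
    have := ((hasDerivAt_id t).const_mul (-l)).exp
    simpa using this
  set Ψ : ℝ → ℝ := fun t => (l * (∫ s in 0..t, exp (-l * s) * u s) + exp (-l * t) * (K + a2 * ∫ s in 0..t, w s)) - a2 * ∫ s in 0..t, exp (-l * s) * w s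
  have hΨ : ∀ t, HasDerivAt Ψ ((l * (exp (-l * t) * u t) + ((exp (-l * t) * (-l)) * (K + a2 * ∫ s in 0..t, w s) + exp (-l * t) * (a2 * w t))) - a2 * (exp (-l * t) * w t)) t := fun t =>
    (((hf t).const_mul l).add ((he t).mul (((hW t).const_mul a2).const_add K))).sub ((hg t).const_mul a2)
  have hanti : AntitoneOn Ψ (Icc 0 θ) := by
    refine antitoneOn_of_deriv_nonpos (convex_Icc _ _) (fun t _ => (hΨ t).continuousAt.continuousWithinAt) (fun t _ => (hΨ t).differentiableAt.differentiableWithinAt) fun t ht => ?_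
    rw [interior_Icc] at ht
    rw [(hΨ t).deriv]
    have := mlL (h t ⟨ht.1.le, ht.2.le⟩) (mul_pos hl (exp_pos (-l * t))).le
    linarith
  have := hanti ⟨le_rfl, ht.1.trans ht.2⟩ ht ht.1
  simp only [Ψ, intervalIntegral.integral_same, mul_zero, exp_zero, one_mul, add_zero, zero_add, sub_zero] at this
  linarith
lemma scal {u1 u2 : ℝ → ℝ} (hu1 : Continuous u1) (hu2 : Continuous u2) (h10 : ∀ x, 0 ≤ u1 x) (h20 : ∀ x, 0 ≤ u2 x)
    {a b K θ l : ℝ} (ha : 0 < a) (hb : 0 < b) (hK : 1 ≤ K) (hθ : 0 ≤ θ) (hl : (a + b) * K < l)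
    (h1 : ∀ t ∈ Icc 0 θ, u1 t ≤ K + a ^ 2 * ∫ s in 0..t, ∫ x in 0..s, u2 x * u1 (s - x))
    (h2 : ∀ t ∈ Icc 0 θ, u2 t ≤ K + b ^ 2 * ∫ s in 0..t, ∫ x in 0..s, u2 x * u1 (s - x)) :
    u1 θ ≤ exp (l * θ) * (K + a / b * K ^ 2) ∧ u2 θ ≤ exp (l * θ) * (K + b / a * K ^ 2) := by
  have hK0 : 0 < K := by linarith
  have hl0 : 0 < l := lt_trans (by positivity) hl
  set w : ℝ → ℝ := fun s => ∫ x in 0..s, u2 x * u1 (s - x) with hw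
  have hwc : Continuous w := intervalIntegral.continuous_parametric_intervalIntegral_of_continuous (f := fun s x => u2 x * u1 (s - x)) (by unfold Function.uncurry; fun_prop) continuous_id
  set f : ℝ → ℝ := fun t => ∫ s in 0..t, exp (-l * s) * u1 s with hf
  set g : ℝ → ℝ := fun t => ∫ s in 0..t, exp (-l * s) * u2 s with hg
  have hfc : Continuous f := intervalIntegral.continuous_primitive (fun _ _ => Continuous.intervalIntegrable (by fun_prop) _ _) 0
  have hgc : Continuous g := intervalIntegral.continuous_primitive (fun _ _ => Continuous.intervalIntegrable (by fun_prop) _ _) 0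
  have hf0 : ∀ t, 0 ≤ t → 0 ≤ f t := fun t ht => intervalIntegral.integral_nonneg ht fun x _ => mul_nonneg exp0 (h10 x)
  have hg0 : ∀ t, 0 ≤ t → 0 ≤ g t := fun t ht => intervalIntegral.integral_nonneg ht fun x _ => mul_nonneg exp0 (h20 x)
  have hconv : ∀ t, 0 ≤ t → ∫ s in 0..t, exp (-l * s) * w s ≤ g t * f t := by
    intro t ht
    have := conv_le (F := fun s => exp (-l * s) * u2 s) (G := fun s => exp (-l * s) * u1 s) (by fun_prop) (by fun_prop) (fun x => mul_nonneg exp0 (h20 x)) (fun x => mul_nonneg exp0 (h10 x)) ht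
    refine le_trans (le_of_eq ?_) this
    congr 1; funext s
    rw [hw, ← intervalIntegral.integral_const_mul]
    congr 1; funext x
    have : exp (-l * s) = exp (-l * x) * exp (-l * (s - x)) := by rw [← exp_add]; ring_nf
    rw [this]; ring
  have k1 : ∀ t ∈ Icc 0 θ, l * f t + exp (-l * t) * (K + a ^ 2 * ∫ s in 0..t, w s) ≤ K + a ^ 2 * (g t * f t) := fun t ht =>
    (scal1 hu1 hwc hl0 h1 ht).trans (by have := mlL (hconv t ht.1) (sq_nonneg a); linarith)
  have k2 : ∀ t ∈ Icc 0 θ, l * g t + exp (-l * t) * (K + b ^ 2 * ∫ s in 0..t, w s) ≤ K + b ^ 2 * (g t * f t) := fun t ht =>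
    (scal1 hu2 hwc hl0 h2 ht).trans (by have := mlL (hconv t ht.1) (sq_nonneg b); linarith)
  have hW0 : ∀ t, 0 ≤ t → 0 ≤ ∫ s in 0..t, w s := fun t ht => intervalIntegral.integral_nonneg ht fun s hs =>
    intervalIntegral.integral_nonneg hs.1 fun x _ => mul_nonneg (h20 _) (h10 _)
  have hmax : max (b * f θ) (a * g θ) < K := by
    by_contra hcon
    push Not at hcon
    obtain ⟨t, ht, hteq⟩ := intermediate_value_Icc hθ (f := fun t => max (b * f t) (a * g t)) (by fun_prop) (show K ∈ Icc _ _ from ⟨by simp [hf, hg, hK0.le], hcon⟩)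
    simp only at hteq
    have e1 := k1 t ht
    have e2 := k2 t ht
    have p1 : 0 ≤ exp (-l * t) * (K + a ^ 2 * ∫ s in 0..t, w s) := by have := hW0 t ht.1; positivity
    have p2 : 0 ≤ exp (-l * t) * (K + b ^ 2 * ∫ s in 0..t, w s) := by have := hW0 t ht.1; positivity
    have q1 : b * f t ≤ K := hteq ▸ le_max_left _ _
    have q2 : a * g t ≤ K := hteq ▸ le_max_right _ _
    have r : (b * f t) * (a * g t) ≤ K * K := mul_le_mul q1 q2 (mul_nonneg ha.le (hg0 t ht.1)) hK0.le
    have hKK : K ≤ K * K := by nlinarith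
    rcases le_total (b * f t) (a * g t) with hle | hle
    · rw [max_eq_right hle] at hteq
      have : l * K ≤ a * K + b * (K * K) := by
        have := mlL (show l * g t ≤ K + b ^ 2 * (g t * f t) by linarith) ha.le
        have := mlL r hb.le
        rw [← hteq] at *
        nlinarith
      nlinarith [mlL hKK ha.le]
    · rw [max_eq_left hle] at hteq
      have : l * K ≤ b * K + a * (K * K) := by
        have := mlL (show l * f t ≤ K + a ^ 2 * (g t * f t) by linarith) hb.le
        have := mlL r ha.le
        rw [← hteq] at *
        nlinarith
      nlinarith [mlL hKK hb.le]
  have m1 : b * f θ ≤ K := (le_max_left _ _).trans hmax.le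
  have m2 : a * g θ ≤ K := (le_max_right _ _).trans hmax.le
  have r : (b * f θ) * (a * g θ) ≤ K ^ 2 := by
    rw [sq]; exact mul_le_mul m1 m2 (mul_nonneg ha.le (hg0 θ hθ)) hK0.le
  have hmem : θ ∈ Icc 0 θ := ⟨hθ, le_rfl⟩
  have fin : ∀ x y : ℝ, exp (-l * θ) * x ≤ y → x ≤ exp (l * θ) * y := fun x y h => by
    have := mlL h (exp_pos (l * θ)).le
    rwa [← mul_assoc, ← exp_add, neg_mul, add_neg_cancel, exp_zero, one_mul] at this
  constructor
  · refine (h1 θ hmem).trans (fin _ _ ?_)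
    have := k1 θ hmem
    have : a ^ 2 * (g θ * f θ) = a / b * ((b * f θ) * (a * g θ)) := by field_simp
    have := mlL r (div_pos ha hb).le
    have := mul_nonneg hl0.le (hf0 θ hθ)
    linarith
  · refine (h2 θ hmem).trans (fin _ _ ?_)
    have := k2 θ hmem
    have : b ^ 2 * (g θ * f θ) = b / a * ((b * f θ) * (a * g θ)) := by field_simp
    have := mlL r (div_pos hb ha).le
    have := mul_nonneg hl0.le (hg0 θ hθ)
    linarith
lemma sand_norm {b : Jx → Mc k} {a2 : ℝ} (h : ‖∑ j, b j * (b j)ᴴ‖ ≤ a2) (M : Mc k) :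
    ‖∑ j, b j * M * (b j)ᴴ‖ ≤ a2 * ‖M‖ := by
  set R : Matrix k (k × Jx) ℂ := of fun x y => b y.2 x y.1 with hR
  have h1 : ∀ M : Mc k, R * (amp Jx M) * Rᴴ = ∑ j, b j * M * (b j)ᴴ := by
    intro M
    ext x y
    simp only [Matrix.sum_apply, Matrix.mul_apply, hR, of_apply, conjTranspose_apply, amp, kronecker_apply, sum_prod_type, Matrix.one_apply, mul_ite, mul_one, mul_zero, Finset.sum_ite_eq', mem_univ, if_true]
    rw [sum_comm]
  have h2 : R * Rᴴ = ∑ j, b j * (b j)ᴴ := by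
    have := h1 1
    rw [amp_one, Matrix.mul_one] at this
    simpa using this
  have h3 : ‖R‖ * ‖R‖ ≤ a2 := by
    have := l2_opNorm_conjTranspose_mul_self Rᴴ
    rw [conjTranspose_conjTranspose, h2, l2_opNorm_conjTranspose] at this
    rw [← this]; exact h
  rw [← h1]
  calc ‖R * amp Jx M * Rᴴ‖ ≤ ‖R * amp Jx M‖ * ‖Rᴴ‖ := l2_opNorm_mul _ _
    _ ≤ ‖R‖ * ‖M‖ * ‖R‖ := by
        rw [l2_opNorm_conjTranspose]
        exact mlR ((l2_opNorm_mul _ _).trans (mlL (amp_norm_le _) nng)) nng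
    _ = ‖R‖ * ‖R‖ * ‖M‖ := by ring
    _ ≤ _ := mlR h3 nng
def dil (B : Mc k) : Mc (k ⊕ k) := fromBlocks 0 B Bᴴ 0
def Dm (k : Type) [Fintype k] [DecidableEq k] : Mc (k ⊕ k) := fromBlocks 1 0 0 (-1)
lemma Dm_sq : Dm k * Dm k = 1 := by simp [Dm, fromBlocks_multiply]
lemma Dm_dil (B : Mc k) : Dm k * dil B * Dm k = - dil B := by
  simp [Dm, dil, fromBlocks_multiply, fromBlocks_neg]
lemma dil_herm (B : Mc k) : (dil B).IsHermitian := by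
  unfold IsHermitian dil
  rw [fromBlocks_conjTranspose]; simp
lemma dil_sq (B : Mc k) : dil B * dil B = fromBlocks (B * Bᴴ) 0 0 (Bᴴ * B) := by
  simp [dil, fromBlocks_multiply]
def blk1 (k : Type) [Fintype k] [DecidableEq k] : Mc (k ⊕ k) →L[ℂ] Mc k := LinearMap.toContinuousLinearMap
  { toFun := fun M => M.toBlocks₁₁
    map_add' := fun M M' => rfl
    map_smul' := fun c M => rfl }
def blk2 (k : Type) [Fintype k] [DecidableEq k] : Mc (k ⊕ k) →L[ℂ] Mc k := LinearMap.toContinuousLinearMap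
  { toFun := fun M => M.toBlocks₂₂
    map_add' := fun M M' => rfl
    map_smul' := fun c M => rfl }
lemma blk1_apply (p q r s : Mc k) : blk1 k (fromBlocks p q r s) = p := rfl
lemma blk2_apply (p q r s : Mc k) : blk2 k (fromBlocks p q r s) = s := rfl
lemma diag_of_D {M : Mc (k ⊕ k)} (h : Dm k * M * Dm k = M) : M = fromBlocks (blk1 k M) 0 0 (blk2 k M) := by
  have e : M = fromBlocks M.toBlocks₁₁ M.toBlocks₁₂ M.toBlocks₂₁ M.toBlocks₂₂ := (fromBlocks_toBlocks M).symm
  have h' := h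
  rw [e] at h'
  simp only [Dm, fromBlocks_multiply, fromBlocks_inj] at h'
  simp only [one_mul, mul_one, zero_mul, mul_zero, zero_add, add_zero, neg_mul, mul_neg, neg_neg, neg_zero] at h'
  have z : ∀ X : Mc k, -X = X → X = 0 := fun X hX => by
    ext i j
    have := congrFun (congrFun hX i) j
    simp only [Matrix.neg_apply, Matrix.zero_apply] at *
    exact self_eq_neg.1 this.symm
  have z1 := z _ h'.2.1
  have z2 := z _ h'.2.2.1
  rw [z1, z2] at e
  exact e
lemma Phi_mul_amp (A : Mc n) (M : Mc (n × κ)) : Phi (M * amp κ A) = Phi M * A := by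
  ext x y
  simp only [Phi_apply, Matrix.mul_apply, amp, kronecker_apply, sum_prod_type, Matrix.one_apply]
  simp only [mul_ite, mul_one, mul_zero, Finset.sum_ite_eq', mem_univ, if_true]
  rw [sum_comm]
  simp only [mul_sum, sum_mul]
  refine scg fun z => scg fun k => by ring
lemma Pm_neg (P : ι → Mc κ) (A : Jx → Mc n) (s : ℝ) :
    ∫ g, Phi (ex (-(s • Sb P A g))) ∂(gG (Jx × ι)) = Pm P A s := by
  have h := rot (Phi (n := n) (κ := κ)) 0 (fun i => s • Bf P A i) univ Real.pi
  simp only [zero_add, ← smulSg] at h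
  have e : ∀ w : (Jx × ι) ⊕ (Jx × ι) → ℝ, s • Sb P A (xpt univ Real.pi w) = -(s • Sb P A (w ∘ inl)) := by
    intro w
    have : cx (xpt univ Real.pi w) = (-1 : ℂ) • cx (w ∘ inl) := by ext i; simp [xpt, cx]
    rw [this, Sg_smul]; simp
  simp only [e] at h
  unfold Pm
  rw [← h]
  refine (integral_inl (f := fun g => Phi (ex (-(s • Sb P A g)))) ?_).symm
  have := intS (Bf P A) (Phi (n := n) (κ := κ)) (-s)
  simpa only [neg_smul] using this
lemma Bf_neg (A : Jx → Mc (k ⊕ k)) (hD : ∀ j, Dm k * A j * Dm k = - A j) (i : Jx × ι) :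
    amp κ (Dm k) * Bf P A i * amp κ (Dm k) = - Bf P A i := by
  unfold Bf amp
  rw [Matrix.mul_smul, Matrix.smul_mul, ← mul_kronecker_mul, ← mul_kronecker_mul, hD, Matrix.one_mul, Matrix.mul_one]
  rw [← smul_neg]; congr 1
  ext ⟨a, b⟩ ⟨c, d⟩; simp [kronecker_apply]
lemma Pm_diag (A : Jx → Mc (k ⊕ k)) (hD : ∀ j, Dm k * A j * Dm k = - A j) (s : ℝ) :
    Pm P A s = fromBlocks (blk1 k (Pm P A s)) 0 0 (blk2 k (Pm P A s)) := by
  refine diag_of_D ?_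
  have i1 : Integrable (fun g => Phi (ex (s • Sb P A g))) (gG (Jx × ι)) := intS (Bf P A) Phi s
  conv_rhs => rw [← Pm_neg]
  unfold Pm
  rw [← integral_const_mul_of_integrable i1, ← integral_mul_const_of_integrable (i1.const_mul _)]
  congr 1; funext g
  have e : -(s • Sb P A g) = amp κ (Dm k) * (s • Sb P A g) * amp κ (Dm k) := by
    unfold Sg
    rw [Matrix.mul_smul, Matrix.smul_mul, mul_sum, sum_mul, ← smul_neg, ← Finset.sum_neg_distrib]
    congr 1
    refine scg fun i => ?_
    rw [Matrix.mul_smul, Matrix.smul_mul, Bf_neg A hD, smul_neg]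
  rw [e, ex_conj _ _ _ (by rw [← amp_mul, Dm_sq, amp_one]), Phi_mul_amp, Phi_amp_mul]
lemma TL_diag (b : Jx → Mc k) (p r : Mc k) :
    TL (fun j => dil (b j)) (fromBlocks p 0 0 r) = fromBlocks (∑ j, b j * r * (b j)ᴴ) 0 0 (∑ j, (b j)ᴴ * p * (b j)) := by
  rw [TL_apply]
  have : ∀ j, dil (b j) * fromBlocks p 0 0 r * dil (b j) = fromBlocks (b j * r * (b j)ᴴ) 0 0 ((b j)ᴴ * p * (b j)) := fun j => by
    simp [dil, fromBlocks_multiply]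
  simp only [this]
  ext x y
  rcases x with x | x <;> rcases y with y | y <;> simp [Matrix.sum_apply]
lemma Pm_zero (hN : 0 < card κ) (A : Jx → Mc n) : Pm P A 0 = 1 := by
  unfold Pm
  simp only [zero_smul, ex_zero, Phi_one hN]
  simp
lemma Pm_cont (hP : PF P) (hN : 0 < card κ) (A : Jx → Mc n) : Continuous (Pm P A) :=
  continuous_iff_continuousAt.2 fun s => (Pm_deriv hP hN A s).1.continuousAt
lemma conv_scale {F G : ℝ → ℝ} (s : ℝ) : s * ∫ a in 0..1, F (a * s) * G ((1 - a) * s) = ∫ x in 0..s, F x * G (s - x) := by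
  have := intervalIntegral.smul_integral_comp_mul_right (a := 0) (b := 1) (fun x => F x * G (s - x)) s
  simp only [zero_mul, one_mul, smul_eq_mul] at this
  rw [← this]
  congr 2; funext a; ring_nf
lemma conv_symm {F G : ℝ → ℝ} (s : ℝ) : ∫ x in 0..s, F x * G (s - x) = ∫ x in 0..s, G x * F (s - x) := by
  have := intervalIntegral.integral_comp_sub_left (a := 0) (b := s) (fun x => F x * G (s - x)) s
  simp only [sub_self, sub_zero, sub_sub_cancel] at this
  rw [← this]
  congr 1; funext a; ring
set_option maxHeartbeats 1000000 in
lemma Pm_ode [Nonempty n] [Nonempty κ] (hP : PF P) (hN : 0 < card κ) {A : Jx → Mc n} (hA : Hm A) {v : ℝ} (hv : 0 < v)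
    (h : HsB A v) {sg : ℝ} (h2 : ‖∑ j, A j * A j‖ ≤ sg) {θ C : ℝ}
    (hC : C = (4 * ‖TL A‖ * θ ^ 2 * (eN n * eN n * v * card n) * card n * exp (2 * θ ^ 2 * sg)) / card κ)
    (L : Mc n →L[ℂ] Mc k) (hL : ‖L 1‖ ≤ 1) {c : ℝ} {F G : ℝ → ℝ} (hF : Continuous F) (hG : Continuous G)
    (hFG : ∀ x y, ‖L (TL A (Pm P A x) * Pm P A y)‖ ≤ c * (F x * G y)) (hθ : 0 ≤ θ) :
    ∀ t ∈ Icc 0 θ, ‖L (Pm P A t)‖ ≤ 1 + ‖L‖ * (θ * C) * θ + c * ∫ s in 0..t, ∫ x in 0..s, F x * G (s - x) := by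
  have hC0 : 0 ≤ C := by rw [hC]; have := eN_nonneg (n := n); positivity
  set w : ℝ → ℝ := fun s => ∫ x in 0..s, F x * G (s - x) with hw
  have hwc : Continuous w := intervalIntegral.continuous_parametric_intervalIntegral_of_continuous (f := fun s x => F x * G (s - x)) (by unfold Function.uncurry; fun_prop) continuous_id
  have dP : ∀ s, HasDerivAt (fun s => L (Pm P A s)) (L (s • ∫ a in 0..1, ∫ g, Gc A a (1 - a) (s • Sb P A g) ∂(gG (Jx × ι)))) s := fun s =>
    (L.restrictScalars ℝ).hasFDerivAt.comp_hasDerivAt s (Pm_deriv hP hN A s).1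
  have hB : ∀ x, HasDerivAt (fun t => 1 + ‖L‖ * (θ * C) * t + c * ∫ s in 0..t, w s) (‖L‖ * (θ * C) + c * w x) x := fun x => by
    have := (((hasDerivAt_id' x).const_mul (‖L‖ * (θ * C))).const_add 1).add ((hwc.integral_hasStrictDerivAt 0 x).hasDerivAt.const_mul c)
    refine HasDerivAt.congr_deriv (this :) (by simp)
  have main := image_norm_le_of_norm_deriv_right_le_deriv_boundary (a := 0) (b := θ) (f := fun s => L (Pm P A s))
    (L.continuous.comp (Pm_cont hP hN A)).continuousOn (fun s _ => (dP s).hasDerivWithinAt) (B := fun t => 1 + ‖L‖ * (θ * C) * t + c * ∫ s in 0..t, w s)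
    (by simp [Pm_zero hN, hL]) hB (fun s hs => by
      have hs0 := hs.1
      rw [L.map_smul_of_tower, norm_smul, norm_eq_abs, abs_of_nonneg hs0]
      have e1 : L (∫ a in 0..1, ∫ g, Gc A a (1 - a) (s • Sb P A g) ∂(gG (Jx × ι))) = ∫ a in 0..1, L (∫ g, Gc A a (1 - a) (s • Sb P A g) ∂(gG (Jx × ι))) :=
        (L.intervalIntegral_comp_comm (Pm_deriv hP hN A s).2).symm
      rw [e1]
      have e2 : ‖∫ a in 0..1, L (∫ g, Gc A a (1 - a) (s • Sb P A g) ∂(gG (Jx × ι)))‖ ≤ ∫ a in 0..1, (‖L‖ * C + c * (F (a * s) * G ((1 - a) * s))) := by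
        refine intervalIntegral.norm_integral_le_of_norm_le zero_le_one (of_forall fun a ha => ?_) (Continuous.intervalIntegrable (by fun_prop) _ _)
        have d := decor hP hN hA hv h h2 (s1 := a * s) (s2 := (1 - a) * s) (θ := θ) (mul_nonneg ha.1.le hs0) (by nlinarith [ha.1, ha.2, hs.2]) (mul_nonneg (by linarith [ha.2]) hs0) (by nlinarith [ha.1, ha.2, hs.2])
        rw [← hC] at d
        simp only [Gc_eq, smul_smul]
        have := norm_add_le (L ((∫ g, TL A (Phi (ex ((a * s) • Sb P A g))) * Phi (ex (((1 - a) * s) • Sb P A g)) ∂(gG (Jx × ι))) - TL A (Pm P A (a * s)) * Pm P A ((1 - a) * s))) (L (TL A (Pm P A (a * s)) * Pm P A ((1 - a) * s)))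
        rw [← map_add, sub_add_cancel] at this
        exact this.trans (add_le_add ((L.le_opNorm _).trans (mlL d nng)) (hFG _ _))
      rw [intervalIntegral.integral_add (by simp) (Continuous.intervalIntegrable (by fun_prop) _ _)] at e2
      simp only [intervalIntegral.integral_const, sub_zero, one_smul] at e2
      rw [intervalIntegral.integral_const_mul] at e2
      refine (mlL e2 hs0).trans ?_
      have e3 := conv_scale (F := F) (G := G) s
      rw [mul_add, mul_left_comm s c, e3]
      have : s * (‖L‖ * C) ≤ θ * (‖L‖ * C) := mlR hs.2.le (mul_nonneg nng hC0)
      show _ ≤ ‖L‖ * (θ * C) + c * (∫ x in 0..s, F x * G (s - x))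
      linarith)
  intro t ht
  have m := main ht
  refine m.trans ?_
  have : ‖L‖ * (θ * C) * t ≤ ‖L‖ * (θ * C) * θ := mlL ht.2 (by positivity)
  linarith
section
lemma rtr_Pm (hN : 0 < card κ) (A : Jx → Mc n) (θ : ℝ) :
    ∫ g, rtr (ex (KK 0 θ (Bf P A) g)) ∂(gG (Jx × ι)) = crd κ * rtr (Pm P A θ) := by
  have hN' : (0:ℝ) < crd κ := Nat.cast_pos.2 hN
  have i1 : Integrable (fun g => Phi (ex (θ • Sb P A g))) (gG (Jx × ι)) := intS (Bf P A) Phi θ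
  have i2 : Integrable (fun g => trL (n := n) 1 1 (Phi (ex (θ • Sb P A g)))) (gG (Jx × ι)) := (trL (n := n) 1 1).integrable_comp i1
  have e1 : rtr (Pm P A θ) = ∫ g, rtr (Phi (ex (θ • Sb P A g))) ∂(gG (Jx × ι)) := by
    have e := (trL (n := n) 1 1).integral_comp_comm i1
    have e' := integral_re i2
    have e'' : trL (n := n) 1 1 (Pm P A θ) = (Pm P A θ).trace := by simp
    unfold Pm at e''
    rw [e, e''] at e'
    have e3 : ∀ M : Mc n, trL (n := n) 1 1 M = M.trace := fun M => by simp
    simp only [e3] at e'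
    exact e'.symm
  rw [e1, ← integral_const_mul]
  congr 1; funext g
  unfold rtr KK
  rw [Phi_trace, zero_add, ← Complex.re_ofReal_mul]
  congr 1
  push_cast
  rw [← mul_assoc, mul_inv_cancel₀ (by exact_mod_cast hN'.ne'), one_mul]
lemma tr_diag_le (p r : Mc k) : rtr (fromBlocks p 0 0 r) ≤ crd k * (‖p‖ + ‖r‖) := by
  have h : ∀ M : Mc k, rtr M ≤ crd k * ‖M‖ := fun M => by
    have : rtr M = ∑ i, (M i i).re := by unfold rtr trace; simp
    rw [this]
    refine (sle fun i => (Complex.re_le_norm _).trans (norm_entry_le M i i)).trans (by simp)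
  have e : rtr (fromBlocks p 0 0 r) = rtr p + rtr r := by unfold rtr; simp [trace, Fintype.sum_sum_type]
  rw [e, mul_add]
  exact add_le_add (h p) (h r)
set_option maxHeartbeats 1000000 in
lemma free_bd [Nonempty k] [Nonempty κ] (hP : PF P) (hN : 0 < card κ) {b : Jx → Mc k} {v : ℝ} (hv : 0 < v)
    (h : HsB (fun j => dil (b j)) v) {a c : ℝ} (ha : 0 < a) (hc : 0 < c) (h1 : ‖∑ j, b j * (b j)ᴴ‖ ≤ a ^ 2) (h2 : ‖∑ j, (b j)ᴴ * b j‖ ≤ c ^ 2)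
    {sg : ℝ} (hsg : ‖∑ j, dil (b j) * dil (b j)‖ ≤ sg) {θ C K l : ℝ} (hθ : 0 ≤ θ)
    (hC : C = (4 * ‖TL (fun j => dil (b j))‖ * θ ^ 2 * (eN (k ⊕ k) * eN (k ⊕ k) * v * card (k ⊕ k)) * card (k ⊕ k) * exp (2 * θ ^ 2 * sg)) / card κ)
    (hK1 : 1 ≤ K) (hK : 1 + (‖blk1 k‖ + ‖blk2 k‖) * (θ * C) * θ ≤ K) (hl : (a + c) * K < l) :
    rtr (Pm P (fun j => dil (b j)) θ) ≤ crd k * (exp (l * θ) * (K + a / c * K ^ 2) + exp (l * θ) * (K + c / a * K ^ 2)) := by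
  set A := fun j => dil (b j) with hA
  have hD : ∀ j, Dm k * A j * Dm k = - A j := fun j => Dm_dil _
  have hH : Hm A := fun j => dil_herm _
  have hC0 : 0 ≤ C := by rw [hC]; have := eN_nonneg (n := k ⊕ k); positivity
  have hcont := Pm_cont hP hN A
  have u1c : Continuous fun s => ‖blk1 k (Pm P A s)‖ := ((blk1 k).continuous.comp hcont).norm
  have u2c : Continuous fun s => ‖blk2 k (Pm P A s)‖ := ((blk2 k).continuous.comp hcont).norm
  have hone : (1 : Mc (k ⊕ k)) = fromBlocks 1 0 0 1 := fromBlocks_one.symm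
  have ed : ∀ x y, TL A (Pm P A x) * Pm P A y = fromBlocks ((∑ j, b j * blk2 k (Pm P A x) * (b j)ᴴ) * blk1 k (Pm P A y)) 0 0 ((∑ j, (b j)ᴴ * blk1 k (Pm P A x) * b j) * blk2 k (Pm P A y)) := by
    intro x y
    conv_lhs => rw [Pm_diag A hD x, Pm_diag A hD y]
    rw [TL_diag, fromBlocks_multiply]
    simp
  have o1 := Pm_ode hP hN hH hv h hsg hC (blk1 k) (by rw [hone, blk1_apply]; exact norm_one_le) (c := a ^ 2) u2c u1c (fun x y => by
    rw [ed, blk1_apply, ← mul_assoc]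
    exact (norm_mul_le _ _).trans (mlR (sand_norm h1 _) nng)) hθ
  have o2 := Pm_ode hP hN hH hv h hsg hC (blk2 k) (by rw [hone, blk2_apply]; exact norm_one_le) (c := c ^ 2) u1c u2c (fun x y => by
    rw [ed, blk2_apply, ← mul_assoc]
    have := sand_norm (b := fun j => (b j)ᴴ) (a2 := c ^ 2) (by simpa only [conjTranspose_conjTranspose] using h2) (blk1 k (Pm P A x))
    simp only [conjTranspose_conjTranspose] at this
    exact (norm_mul_le _ _).trans (mlR this nng)) hθ
  have cs : ∀ s, ∫ x in 0..s, ‖blk1 k (Pm P A x)‖ * ‖blk2 k (Pm P A (s - x))‖ = ∫ x in 0..s, ‖blk2 k (Pm P A x)‖ * ‖blk1 k (Pm P A (s - x))‖ := fun s => conv_symm (F := fun s => ‖blk1 k (Pm P A s)‖) (G := fun s => ‖blk2 k (Pm P A s)‖) s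
  simp only [cs] at o2
  have p1 : 0 ≤ ‖blk1 k‖ * (θ * C) * θ := by positivity
  have p2 : 0 ≤ ‖blk2 k‖ * (θ * C) * θ := by positivity
  have hK' : 1 + (‖blk1 k‖ * (θ * C) * θ + ‖blk2 k‖ * (θ * C) * θ) ≤ K := by rw [add_mul, add_mul] at hK; exact hK
  have := scal u1c u2c (fun x => nng) (fun x => nng) ha hc hK1 hθ hl (fun t ht => (o1 t ht).trans (by gcongr; linarith)) (fun t ht => (o2 t ht).trans (by
    gcongr; linarith))
  rw [Pm_diag A hD θ]
  refine (tr_diag_le _ _).trans (mlL (add_le_add this.1 this.2) (by positivity))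
variable {ν : T → Measure E} [∀ i, IsProbabilityMeasure (ν i)] {h : T → E → Mc (k ⊕ k)} {b : Jx → Mc k} {ρ v s2 : ℝ}
set_option maxHeartbeats 1000000 in
lemma model_bd [Nonempty k] (M : Mod ν h (fun j => dil (b j)) ρ v s2) {a c : ℝ} (ha : 0 < a) (hc : 0 < c) (h1 : ‖∑ j, b j * (b j)ᴴ‖ ≤ a ^ 2) (h2 : ‖∑ j, (b j)ᴴ * b j‖ ≤ c ^ 2)
    {θ : ℝ} (hθ : 0 < θ) (hr : θ * ρ ≤ 1 / 100) :
    ∫ z, rtr (ex (θ • Xs h z)) ∂(Measure.pi ν) ≤ exp (2 * (8 * θ ^ 4 * v * s2 + 100 * θ ^ 3 * ρ * s2)) *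
      (crd k * exp ((a + c) * θ) * (2 + a / c + c / a)) := by
  have key : ∀ δ : ℝ, 0 < δ → ∫ z, rtr (ex (θ • Xs h z)) ∂(Measure.pi ν) ≤ exp (2 * (8 * θ ^ 4 * v * s2 + 100 * θ ^ 3 * ρ * s2)) *
      (crd k * (exp (((a + c) * (1 + δ) + δ) * θ) * ((1 + δ) + a / c * (1 + δ) ^ 2) + exp (((a + c) * (1 + δ) + δ) * θ) * ((1 + δ) + c / a * (1 + δ) ^ 2))) := by
    intro δ hδ
    have hv := M.hv
    set C0 := 4 * ‖TL (fun j => dil (b j))‖ * θ ^ 2 * (eN (k ⊕ k) * eN (k ⊕ k) * (v + 1) * card (k ⊕ k)) * card (k ⊕ k) * exp (2 * θ ^ 2 * s2) with hC0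
    have hC00 : 0 ≤ C0 := by have := eN_nonneg (n := k ⊕ k); positivity
    set D := (‖blk1 k‖ + ‖blk2 k‖) * (θ * C0) * θ with hD
    obtain ⟨N, hN⟩ := exists_nat_gt (D / δ)
    obtain ⟨κ, ι, i1, i2, i3, i4, P, hP, hcard⟩ := exists_PF N
    have hpos : 0 < card κ := by rw [hcard]; positivity
    have hpos' : (0:ℝ) < crd κ := Nat.cast_pos.2 hpos
    have : Nonempty κ := Fintype.card_pos_iff.1 hpos
    have hge : D / δ ≤ crd κ := by
      refine hN.le.trans ?_
      rw [hcard]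
      have : N < 2 ^ (N + 1) := (Nat.lt_succ_self N).trans Nat.lt_two_pow_self
      exact_mod_cast this.le
    have hs : HsB (fun j => dil (b j)) (v + 1) := fun x => (M.hs x).trans (mlR (by linarith) (sum_nonneg fun _ _ => by positivity))
    have f := free_bd (P := P) (K := 1 + δ) (l := (a + c) * (1 + δ) + δ) hP hpos (by linarith : 0 < v + 1) hs ha hc h1 h2 M.hA2 hθ.le rfl (by linarith) (by
      rw [div_le_iff₀ hδ] at hge
      rw [← hC0]
      have : (‖blk1 k‖ + ‖blk2 k‖) * (θ * (C0 / crd κ)) * θ = D / crd κ := by rw [hD]; ring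
      rw [this]
      have : D / crd κ ≤ δ := by rw [div_le_iff₀ hpos']; linarith
      linarith) (by linarith)
    have m := psi_final (P := P) M hP hpos hθ hr
    rw [rtr_Pm hpos, mul_left_comm] at m
    exact (le_of_mul_le_mul_left m hpos').trans (mlL f exp0)
  have lim : Filter.Tendsto (fun δ : ℝ => exp (2 * (8 * θ ^ 4 * v * s2 + 100 * θ ^ 3 * ρ * s2)) *
      (crd k * (exp (((a + c) * (1 + δ) + δ) * θ) * ((1 + δ) + a / c * (1 + δ) ^ 2) + exp (((a + c) * (1 + δ) + δ) * θ) * ((1 + δ) + c / a * (1 + δ) ^ 2)))) (nhdsWithin 0 (Ioi 0)) (nhds (exp (2 * (8 * θ ^ 4 * v * s2 + 100 * θ ^ 3 * ρ * s2)) *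
      (crd k * (exp (((a + c) * (1 + 0) + 0) * θ) * ((1 + 0) + a / c * (1 + 0) ^ 2) + exp (((a + c) * (1 + 0) + 0) * θ) * ((1 + 0) + c / a * (1 + 0) ^ 2))))) := by
    refine Filter.Tendsto.mono_left (Continuous.tendsto ?_ 0) nhdsWithin_le_nhds
    fun_prop
  refine (ge_of_tendsto lim (Filter.eventually_of_mem self_mem_nhdsWithin key)).trans (le_of_eq ?_)
  simp only [add_zero, mul_one, one_pow]
  ring
end
lemma mv_le {s t : Type*} [Fintype s] [Fintype t] [DecidableEq t] (M : Matrix s t ℂ) (u : t → ℂ) :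
    ∑ x, ‖∑ y, M x y * u y‖ ^ 2 ≤ ‖M‖ ^ 2 * ∑ y, ‖u y‖ ^ 2 := by
  have h := l2_opNorm_mulVec M (WithLp.toLp 2 u)
  have h2 := pow_le_pow_left₀ nng h 2
  rw [mul_pow, EuclideanSpace.norm_sq_eq, EuclideanSpace.norm_sq_eq] at h2
  exact h2
lemma norm_le_of {s t : Type*} [Fintype s] [Fintype t] [DecidableEq t] {M : Matrix s t ℂ} {c : ℝ} (hc : 0 ≤ c)
    (h : ∀ u : t → ℂ, ∑ x, ‖∑ y, M x y * u y‖ ^ 2 ≤ c ^ 2 * ∑ y, ‖u y‖ ^ 2) : ‖M‖ ≤ c := by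
  rw [l2_opNorm_def]
  refine ContinuousLinearMap.opNorm_le_bound _ hc fun x => ?_
  refine le_of_sq_le_sq ?_ (by positivity)
  have := h x.ofLp
  rw [mul_pow, EuclideanSpace.norm_sq_eq, EuclideanSpace.norm_sq_eq]
  exact this
lemma norm_sq_le_hs' (M : Mc n) : ‖M‖ ^ 2 ≤ hs M := by
  have h0 := hs_nonneg M
  have : ‖M‖ ≤ sqrt (hs M) := norm_le_of (sqrt_nonneg _) fun u => by
    rw [sq_sqrt h0]
    unfold hs
    rw [sum_mul]
    refine sle fun x => ?_
    refine le_trans ?_ (Finset.sum_mul_sq_le_sq_mul_sq _ _ _)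
    refine pow_le_pow_left₀ nng ((norm_sum_le _ _).trans (le_of_eq ?_)) 2
    simp only [norm_mul]
  calc ‖M‖ ^ 2 ≤ sqrt (hs M) ^ 2 := pow_le_pow_left₀ nng this 2
    _ = _ := sq_sqrt h0
lemma quad_le (S : Mc n) (u : n → ℂ) : ‖∑ x, ∑ y, u x * S x y * star (u y)‖ ≤ ‖S‖ * ∑ x, ‖u x‖ ^ 2 := by
  have h1 := mv_le S (fun y => star (u y))
  simp only [norm_star] at h1
  have h2 : ‖∑ x, ∑ y, u x * S x y * star (u y)‖ ≤ ∑ x, ‖u x‖ * ‖∑ y, S x y * star (u y)‖ := by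
    refine (norm_sum_le _ _).trans (sle fun x => ?_)
    rw [← norm_mul, mul_sum]
    simp only [mul_assoc]; rfl
  refine h2.trans (le_of_sq_le_sq ?_ (by positivity))
  refine (Finset.sum_mul_sq_le_sq_mul_sq _ _ _).trans ?_
  have : 0 ≤ ∑ x, ‖u x‖ ^ 2 := by positivity
  calc _ ≤ (∑ x, ‖u x‖ ^ 2) * (‖S‖ ^ 2 * ∑ y, ‖u y‖ ^ 2) := mlL h1 this
    _ = _ := by ring
def lf (u X : Mc k) : ℂ := ∑ x, ∑ y, u x y * X x y
lemma gram_norm {b : Jx → Mc k} {a : ℝ} (ha : 0 ≤ a)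
    (h : ∀ u : k → ℂ, ∑ y, ∑ j, ‖∑ x, u x * b j x y‖ ^ 2 ≤ a ^ 2 * ∑ x, ‖u x‖ ^ 2) : ‖∑ j, b j * (b j)ᴴ‖ ≤ a ^ 2 := by
  set R : Matrix k (k × Jx) ℂ := of fun x y => b y.2 x y.1 with hR
  have h2 : R * Rᴴ = ∑ j, b j * (b j)ᴴ := by
    ext x y
    simp only [Matrix.sum_apply, Matrix.mul_apply, hR, of_apply, conjTranspose_apply, sum_prod_type]
    rw [sum_comm]
  have h3 : ‖Rᴴ‖ ≤ a := norm_le_of ha fun u => by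
    refine le_trans (le_of_eq ?_) ((h fun x => star (u x)).trans (le_of_eq (by simp only [norm_star])))
    rw [sum_prod_type]
    refine scg fun y => scg fun j => ?_
    rw [← norm_star, star_sum]
    simp only [star_mul', conjTranspose_apply, star_star, hR, of_apply, mul_comm]
  have := l2_opNorm_conjTranspose_mul_self Rᴴ
  rw [conjTranspose_conjTranspose, h2] at this
  rw [this, sq]
  exact mul_le_mul h3 h3 nng ha
def V1 (k : Type) [Fintype k] [DecidableEq k] : Matrix (k ⊕ k) k ℂ := fromRows 1 0
def V2 (k : Type) [Fintype k] [DecidableEq k] : Matrix (k ⊕ k) k ℂ := fromRows 0 1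
lemma V1_norm : ‖V1 k‖ ≤ 1 ∧ ‖V2 k‖ ≤ 1 := by
  have h : ∀ V : Matrix (k ⊕ k) k ℂ, Vᴴ * V = 1 → ‖V‖ ≤ 1 := fun V hV => by
    have := l2_opNorm_conjTranspose_mul_self V
    rw [hV] at this
    have := this ▸ norm_one_le (n := k)
    nlinarith [norm_nonneg V]
  constructor <;> refine h _ ?_ <;> ext x y <;> simp [V1, V2, Matrix.mul_apply, Matrix.one_apply, eq_comm]
lemma sand1 {s t s' t' : Type*} [Fintype s] [Fintype t] [Fintype s'] [Fintype t'] [DecidableEq s] [DecidableEq t] [DecidableEq s'] [DecidableEq t'] {U : Matrix s t ℂ} {V : Matrix t' s' ℂ} (hU : ‖U‖ ≤ 1) (hV : ‖V‖ ≤ 1) (M : Matrix t t' ℂ) : ‖U * M * V‖ ≤ ‖M‖ := by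
  calc ‖U * M * V‖ ≤ ‖U * M‖ * ‖V‖ := l2_opNorm_mul _ _
    _ ≤ ‖U * M‖ * 1 := mlL hV nng
    _ ≤ ‖U‖ * ‖M‖ := by rw [mul_one]; exact l2_opNorm_mul _ _
    _ ≤ 1 * ‖M‖ := mlR hU nng
    _ = _ := one_mul _
lemma bd_norm (P Q : Mc k) : ‖fromBlocks P 0 0 Q‖ ≤ ‖P‖ + ‖Q‖ := by
  have e : fromBlocks P 0 0 Q = V1 k * P * (V1 k)ᴴ + V2 k * Q * (V2 k)ᴴ := by
    ext x y; rcases x with x | x <;> rcases y with y | y <;> simp [V1, V2, Matrix.mul_apply, Matrix.one_apply]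
  rw [e]
  obtain ⟨h1, h2⟩ := V1_norm (k := k)
  refine (norm_add_le _ _).trans (add_le_add (sand1 h1 (by rwa [l2_opNorm_conjTranspose]) _) (sand1 h2 (by rwa [l2_opNorm_conjTranspose]) _))
lemma dil_norm (W : Mc k) : ‖dil W‖ ≤ 2 * ‖W‖ := by
  have e : dil W = V1 k * W * (V2 k)ᴴ + V2 k * Wᴴ * (V1 k)ᴴ := by
    ext x y; rcases x with x | x <;> rcases y with y | y <;> simp [V1, V2, dil, Matrix.mul_apply, Matrix.one_apply]
  rw [e]
  obtain ⟨h1, h2⟩ := V1_norm (k := k)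
  refine (norm_add_le _ _).trans ((add_le_add (sand1 h1 (by rwa [l2_opNorm_conjTranspose]) _) (sand1 h2 (by rwa [l2_opNorm_conjTranspose]) _)).trans (le_of_eq ?_))
  rw [l2_opNorm_conjTranspose]; ring
lemma norm_le_dil (W : Mc k) : ‖W‖ ≤ ‖dil W‖ := by
  have e : W = (V1 k)ᴴ * dil W * V2 k := by
    ext x y; simp [V1, V2, dil, Matrix.mul_apply, Matrix.one_apply]
  obtain ⟨h1, h2⟩ := V1_norm (k := k)
  calc ‖W‖ = ‖(V1 k)ᴴ * dil W * V2 k‖ := by rw [← e]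
    _ ≤ _ := sand1 (by rwa [l2_opNorm_conjTranspose]) h2 _
lemma dil_add (W W' : Mc k) : dil (W + W') = dil W + dil W' := by
  ext x y; rcases x with x | x <;> rcases y with y | y <;> simp [dil]
lemma dil_sum {ι : Type*} (s : Finset ι) (f : ι → Mc k) : dil (∑ i ∈ s, f i) = ∑ i ∈ s, dil (f i) := by
  ext x y; rcases x with x | x <;> rcases y with y | y <;> simp [dil, Matrix.sum_apply]
lemma pow_norm_le [Nonempty n] (Z : Mc n) (p : ℕ) : ‖Z‖ ^ (2 * p) ≤ ((Zᴴ * Z) ^ p).trace.re := by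
  have hK : (Zᴴ * Z).IsHermitian := isHermitian_conjTranspose_mul_self Z
  obtain ⟨U, l, hU, hKe, -⟩ := eig hK
  have hpow : (Zᴴ * Z) ^ p = U * diagonal (fun i => ((l i ^ p : ℝ) : ℂ)) * Uᴴ := by
    induction p with
    | zero => simp [hU.1]
    | succ p ih =>
      rw [pow_succ, ih]
      conv_lhs => rw [hKe]
      calc _ = U * diagonal (fun i => ((l i ^ p : ℝ) : ℂ)) * (Uᴴ * U) * diagonal (fun i => (l i : ℂ)) * Uᴴ := by simp only [mul_assoc]
        _ = _ := by
          rw [hU.2, mul_one, mul_assoc U, diagonal_mul_diagonal]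
          congr 4; funext i; push_cast; ring
  have hl : ∀ i, 0 ≤ l i := fun i => by
    have e : Uᴴ * (Zᴴ * Z) * U = diagonal (fun i => (l i : ℂ)) := by
      rw [hKe]
      calc _ = (Uᴴ * U) * diagonal (fun i => (l i : ℂ)) * (Uᴴ * U) := by simp only [mul_assoc]
        _ = _ := by rw [hU.2, mul_one, one_mul]
    have e2 : Uᴴ * (Zᴴ * Z) * U = (Z * U)ᴴ * (Z * U) := by rw [conjTranspose_mul]; simp only [mul_assoc]
    have := congrFun (congrFun (e2.symm.trans e) i) i
    rw [diagonal_apply_eq, Matrix.mul_apply] at this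
    have h3 : (l i : ℂ) = ((∑ x, ‖(Z * U) x i‖ ^ 2 : ℝ) : ℂ) := by
      rw [← this]; push_cast
      refine scg fun x => ?_
      rw [conjTranspose_apply, ← Complex.conj_mul']; rfl
    have h4 : l i = ∑ x, ‖(Z * U) x i‖ ^ 2 := by exact_mod_cast h3
    rw [h4]; positivity
  have htr : ((Zᴴ * Z) ^ p).trace.re = ∑ i, l i ^ p := by
    rw [hpow, trace_mul_comm, ← mul_assoc, hU.2, one_mul, trace_diagonal, ← Complex.ofReal_sum, Complex.ofReal_re]
  have hn : ‖Zᴴ * Z‖ ≤ ‖(fun i => (l i : ℂ))‖ := by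
    rw [← l2_opNorm_diagonal]
    conv_lhs => rw [hKe]
    exact sand1 hU.norm_le hU.ct.norm_le _
  obtain ⟨i, hi⟩ := Finite.exists_max (fun i => ‖(l i : ℂ)‖)
  have hn2 : ‖Zᴴ * Z‖ ≤ l i := by
    refine hn.trans ((pi_norm_le_iff_of_nonneg (hl i)).2 fun j => ?_)
    have := hi j
    rw [norm_real, norm_real, norm_eq_abs, norm_eq_abs, abs_of_nonneg (hl i)] at this
    rwa [norm_real]
  rw [htr, pow_mul, sq, ← l2_opNorm_conjTranspose_mul_self]
  exact (pow_le_pow_left₀ nng hn2 p).trans (Finset.single_le_sum (f := fun i => l i ^ p) (fun j _ => pow_nonneg (hl j) p) (mem_univ i))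
section
variable {ν : T → Measure E} [∀ i, IsProbabilityMeasure (ν i)] {W : T → E → Mc k} {r : ℝ}
open scoped MatrixOrder in
lemma psd_factor {N : ℕ} {G : Matrix (Fin N) (Fin N) ℝ} (h1 : G.IsHermitian) (h2 : ∀ c : Fin N → ℝ, 0 ≤ ∑ i, ∑ j, c i * c j * G i j) :
    ∃ R : Matrix (Fin N) (Fin N) ℝ, ∀ i j, G i j = ∑ l, R l i * R l j := by
  have hG : G.PosSemidef := PosSemidef.of_dotProduct_mulVec_nonneg h1 fun x => by
    refine (h2 x).trans (le_of_eq ?_)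
    simp only [dotProduct, mulVec, mul_sum]
    refine scg fun i => scg fun j => ?_
    simp; ring
  obtain ⟨R, hR⟩ := CStarAlgebra.nonneg_iff_eq_star_mul_self.mp hG.nonneg
  refine ⟨R, fun i j => ?_⟩
  rw [hR, Matrix.mul_apply]
  refine scg fun l => ?_
  simp [Matrix.star_apply]
lemma gram_exists (hm : ∀ t, StronglyMeasurable (W t)) (hb : ∀ t e, ‖W t e‖ ≤ r) :
    ∃ (N : ℕ) (b : Fin N → Mc k), ∀ β : Mc k →ₗ[ℝ] Mc k →ₗ[ℝ] ℂ,
      ∑ t, ∫ e, β (W t e) (W t e) ∂(ν t) = ∑ j, β (b j) (b j) := by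
  have : Module.Finite ℝ (Mc k) := inferInstance
  set N := Module.finrank ℝ (Mc k)
  let B : Module.Basis (Fin N) ℝ (Mc k) := Module.finBasis ℝ _
  set x : T → E → Fin N → ℝ := fun t e s => B.coord s (W t e) with hx
  have xm : ∀ t s, StronglyMeasurable fun e => x t e s := fun t s =>
    (LinearMap.toContinuousLinearMap (B.coord s)).continuous.comp_stronglyMeasurable (hm t)
  have xb : ∀ s, ∃ C, ∀ t e, ‖x t e s‖ ≤ C := fun s => ⟨‖LinearMap.toContinuousLinearMap (B.coord s)‖ * r, fun t e =>
    ((LinearMap.toContinuousLinearMap (B.coord s)).le_opNorm _).trans (mlL (hb t e) nng)⟩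
  choose C hC using xb
  have xi : ∀ t s s', Integrable (fun e => x t e s * x t e s') (ν t) := fun t s s' =>
    Integrable.of_bound ((xm t s).mul (xm t s')).aestronglyMeasurable (C s * C s') (of_forall fun e => by
      rw [norm_mul]; exact mul_le_mul (hC s t e) (hC s' t e) nng (nng.trans (hC s t e)))
  obtain ⟨R, hR⟩ := psd_factor (G := of fun s s' => ∑ t, ∫ e, x t e s * x t e s' ∂(ν t)) (by
      ext s s'; simp [mul_comm]) (fun c => by
    have : ∑ i, ∑ j, c i * c j * (of (fun s s' => ∑ t, ∫ e, x t e s * x t e s' ∂(ν t)) i j) = ∑ t, ∫ e, (∑ i, c i * x t e i) ^ 2 ∂(ν t) := by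
      have : ∀ t, ∫ e, (∑ i, c i * x t e i) ^ 2 ∂(ν t) = ∑ i, ∑ j, c i * c j * ∫ e, x t e i * x t e j ∂(ν t) := fun t => by
        have e1 : ∀ e, (∑ i, c i * x t e i) ^ 2 = ∑ i, ∑ j, c i * c j * (x t e i * x t e j) := fun e => by
          rw [sq, Finset.sum_mul_sum]
          refine scg fun i => scg fun j => by ring
        simp only [e1]
        rw [integral_finsetSum _ fun i _ => integrable_finsetSum _ fun j _ => (xi t i j).const_mul _]
        refine scg fun i => ?_
        rw [integral_finsetSum _ fun j _ => (xi t i j).const_mul _]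
        refine scg fun j => integral_const_mul _ _
      simp only [this, of_apply, mul_sum]
      rw [sum_comm]
      rw [scg fun j => sum_comm, sum_comm]
      refine scg fun t => sum_comm
    rw [this]
    exact sum_nonneg fun t _ => integral_nonneg fun e => sq_nonneg _)
  refine ⟨N, fun j => ∑ s, R j s • B s, fun β => ?_⟩
  have hexp : ∀ c : Fin N → ℝ, β (∑ s, c s • B s) (∑ s, c s • B s) = ∑ s, ∑ s', ((c s * c s' : ℝ) : ℂ) * β (B s) (B s') := fun c => by
    simp only [map_sum, map_smul, LinearMap.sum_apply, LinearMap.smul_apply, smul_sum, smul_smul]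
    rw [sum_comm]
    refine scg fun s => Finset.sum_congr rfl fun s' _ => ?_
    rw [Complex.real_smul]; congr 2; ring
  have hW : ∀ t e, W t e = ∑ s, x t e s • B s := fun t e => (B.sum_repr (W t e)).symm
  simp only [hexp]
  have e1 : ∀ t, ∫ e, β (W t e) (W t e) ∂(ν t) = ∑ s, ∑ s', ((∫ e, x t e s * x t e s' ∂(ν t) : ℝ) : ℂ) * β (B s) (B s') := fun t => by
    have e2 : ∀ e, β (W t e) (W t e) = ∑ s, ∑ s', ((x t e s * x t e s' : ℝ) : ℂ) * β (B s) (B s') := fun e => by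
      conv_lhs => rw [hW t e]
      exact hexp _
    simp only [e2]
    rw [integral_finsetSum _ fun i _ => integrable_finsetSum _ fun j _ => ((xi t i j).ofReal).mul_const _]
    refine scg fun i => ?_
    rw [integral_finsetSum _ fun j _ => ((xi t i j).ofReal).mul_const _]
    refine scg fun j => ?_
    rw [integral_mul_const]
    congr 1
    exact integral_ofReal
  simp only [e1]
  rw [sum_comm, sum_comm (γ := Fin N) (s := univ) (t := univ) (f := fun j s => ∑ s', ((R j s * R j s' : ℝ) : ℂ) * β (B s) (B s'))]
  refine scg fun s => ?_
  rw [sum_comm, sum_comm (γ := Fin N) (s := univ) (t := univ) (f := fun j s' => ((R j s * R j s' : ℝ) : ℂ) * β (B s) (B s'))]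
  refine Finset.sum_congr rfl fun s' _ => ?_
  rw [← sum_mul, ← sum_mul, ← Complex.ofReal_sum, ← Complex.ofReal_sum]
  congr 2
  exact hR s s'
variable {ν : T → Measure E} [∀ i, IsProbabilityMeasure (ν i)] {W : T → E → Mc k} {r : ℝ}
lemma dil_cont : Continuous (dil : Mc k → Mc (k ⊕ k)) := by
  unfold dil
  exact continuous_const.matrix_fromBlocks continuous_id continuous_id.matrix_conjTranspose continuous_const
lemma dil_smul (c : ℝ) (X : Mc k) : dil (c • X) = c • dil X := by
  ext x y; rcases x with x | x <;> rcases y with y | y <;> simp [dil]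
lemma lf_add (u X Y : Mc k) : lf u (X + Y) = lf u X + lf u Y := by
  simp [lf, mul_add, sum_add_distrib]
lemma lf_sub (u X Y : Mc k) : lf u (X - Y) = lf u X - lf u Y := by
  simp [lf, mul_sub, Finset.sum_sub_distrib]
lemma lf_smul (u : Mc k) (c : ℝ) (X : Mc k) : lf u (c • X) = c • lf u X := by
  simp only [lf, smul_sum, Matrix.smul_apply, mul_smul_comm]
lemma lf_cont (u : Mc k) : Continuous (lf u) := by
  unfold lf
  refine continuous_finsetSum _ fun x _ => continuous_finsetSum _ fun y _ => continuous_const.mul ?_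
  exact continuous_id.matrix_elem x y
def colv (u : k → ℂ) (y : k) : Mc k := of fun x' y' => if y' = y then u x' else 0
def rowv (u : k → ℂ) (x : k) : Mc k := of fun x' y' => if x' = x then u y' else 0
lemma lf_colv (u : k → ℂ) (y : k) (X : Mc k) : lf (colv u y) X = ∑ x, u x * X x y := by
  simp [lf, colv]
lemma lf_rowv (u : k → ℂ) (x : k) (X : Mc k) : lf (rowv u x) X = ∑ y, u y * X x y := by
  simp only [lf, rowv, of_apply, ite_mul, zero_mul]
  rw [sum_comm]; simp
structure QB (q : Mc k → ℝ) (a c w : ℝ) : Prop where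
  ha : 0 ≤ a
  hc : 0 ≤ c
  hw : 0 ≤ w
  h1 : ∀ u : k → ℂ, ∑ y, q (colv u y) ≤ a ^ 2 * ∑ x, ‖u x‖ ^ 2
  h2 : ∀ u : k → ℂ, ∑ x, q (rowv u x) ≤ c ^ 2 * ∑ y, ‖u y‖ ^ 2
  h3 : ∀ u : Mc k, q u ≤ w * hs u
lemma dual_bd {N : ℕ} {b : Fin N → Mc k} {w : ℝ} (hw : 0 ≤ w) (h : ∀ u : Mc k, ∑ j, ‖lf u (b j)‖ ^ 2 ≤ w * hs u) (x : Fin N → ℂ) :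
    hs (∑ j, x j • b j) ≤ w * ∑ j, ‖x j‖ ^ 2 := by
  set Y := ∑ j, x j • b j with hY
  set u : Mc k := of fun a b => star (Y a b) with hu
  have hsu : hs u = hs Y := by simp [hs, hu]
  have e : ((hs Y : ℝ) : ℂ) = ∑ j, x j * lf u (b j) := by
    have e1 : ((hs Y : ℝ) : ℂ) = lf u Y := by
      simp only [hs, lf, hu, of_apply]; push_cast
      refine scg fun a => scg fun c => ?_
      rw [← Complex.conj_mul']; rfl
    rw [e1]
    conv_lhs => rw [hY]
    simp only [lf, Matrix.sum_apply, Matrix.smul_apply, smul_eq_mul, mul_sum]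
    rw [scg fun a => sum_comm, sum_comm]
    refine scg fun j => scg fun a => scg fun c => by ring
  have h0 := hs_nonneg Y
  have h1 : hs Y ≤ ∑ j, ‖x j‖ * ‖lf u (b j)‖ := by
    have : hs Y = ‖((hs Y : ℝ) : ℂ)‖ := by rw [norm_real, norm_eq_abs, abs_of_nonneg h0]
    rw [this, e]
    refine (norm_sum_le _ _).trans (le_of_eq (by simp only [norm_mul]))
  have h2 : hs Y ^ 2 ≤ (∑ j, ‖x j‖ ^ 2) * (w * hs Y) := by
    refine (pow_le_pow_left₀ h0 h1 2).trans ((Finset.sum_mul_sq_le_sq_mul_sq _ _ _).trans ?_)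
    have := h u
    rw [hsu] at this
    exact mlL this (by positivity)
  rcases h0.eq_or_lt with h | h'
  · rw [← h]
    positivity
  · have : hs Y * hs Y ≤ (w * ∑ j, ‖x j‖ ^ 2) * hs Y := by nlinarith
    exact le_of_mul_le_mul_right this h'
lemma hs_dil (N : ℕ) (b : Fin N → Mc k) (x : Fin N → ℂ) :
    hs (∑ j, x j • dil (b j)) = hs (∑ j, x j • b j) + hs (∑ j, star (x j) • b j) := by
  simp only [hs, Fintype.sum_sum_type, Matrix.sum_apply, Matrix.smul_apply, dil, fromBlocks_apply₁₁, fromBlocks_apply₁₂, fromBlocks_apply₂₁, fromBlocks_apply₂₂]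
  simp only [Matrix.zero_apply, smul_zero, Finset.sum_const_zero, norm_zero, conjTranspose_apply]
  have : ∑ x_1, ∑ x_2, ‖∑ j, x j • star (b j x_2 x_1)‖ ^ 2 = ∑ x_1, ∑ x_2, ‖∑ j, star (x j) • b j x_1 x_2‖ ^ 2 := by
    rw [sum_comm]
    refine scg fun p => scg fun q => ?_
    rw [← norm_star, star_sum]
    simp only [star_smul, star_star]
  simpa [sum_add_distrib] using this
set_option maxHeartbeats 1000000 in
lemma mk_mod {a c w : ℝ} (hm : ∀ t, StronglyMeasurable (W t)) (hr : 0 < r) (hb : ∀ t e, ‖W t e‖ ≤ r)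
    (h0 : ∀ t i j, ∫ e, W t e i j ∂(ν t) = 0) (Q : QB (fun u => ∑ t, ∫ e, ‖lf u (W t e)‖ ^ 2 ∂(ν t)) a c w) :
    ∃ (N : ℕ) (b : Fin N → Mc k), Mod ν (fun t e => dil (W t e)) (fun j => dil (b j)) (2 * r) (2 * w) (a ^ 2 + c ^ 2) ∧
      ‖∑ j, b j * (b j)ᴴ‖ ≤ a ^ 2 ∧ ‖∑ j, (b j)ᴴ * b j‖ ≤ c ^ 2 := by
  obtain ⟨N, b, hβ⟩ := gram_exists (ν := ν) hm hb
  have hq : ∀ u, ∑ j, ‖lf u (b j)‖ ^ 2 = ∑ t, ∫ e, ‖lf u (W t e)‖ ^ 2 ∂(ν t) := fun u => by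
    have := hβ (LinearMap.mk₂ ℝ (fun X Y => lf u X * star (lf u Y)) (fun X X' Y => by rw [lf_add, add_mul]) (fun c X Y => by rw [lf_smul, smul_mul_assoc])
      (fun X Y Y' => by rw [lf_add, star_add, mul_add]) (fun c X Y => by rw [lf_smul, star_smul, star_trivial, mul_smul_comm]))
    simp only [LinearMap.mk₂_apply] at this
    have e : ∀ z : ℂ, z * star z = ((‖z‖ ^ 2 : ℝ) : ℂ) := fun z => by push_cast; exact Complex.mul_conj' z
    simp only [e, integral_complex_ofReal] at this
    exact_mod_cast this.symm
  have b1 : ‖∑ j, b j * (b j)ᴴ‖ ≤ a ^ 2 := gram_norm Q.ha fun u => by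
    refine le_trans (le_of_eq ?_) (Q.h1 u)
    refine scg fun y => ?_
    show _ = ∑ t, ∫ e, ‖lf (colv u y) (W t e)‖ ^ 2 ∂(ν t)
    rw [← hq]; simp only [lf_colv]
  have b2 : ‖∑ j, (b j)ᴴ * b j‖ ≤ c ^ 2 := by
    have := gram_norm (b := fun j => (b j)ᴴ) Q.hc fun u => by
      refine le_trans (le_of_eq ?_) ((Q.h2 fun y => star (u y)).trans (le_of_eq (by simp only [norm_star])))
      refine scg fun y => ?_
      show _ = ∑ t, ∫ e, ‖lf (rowv (fun y => star (u y)) y) (W t e)‖ ^ 2 ∂(ν t)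
      rw [← hq]; simp only [lf_rowv]
      refine scg fun j => ?_
      rw [← norm_star, star_sum]
      simp only [star_mul', conjTranspose_apply, star_star]
    simpa only [conjTranspose_conjTranspose] using this
  refine ⟨N, b, ⟨fun t => dil_cont.comp_stronglyMeasurable (hm t), fun t e => dil_herm _, by linarith, fun t e => (dil_norm _).trans (by linarith [hb t e]), ?_, ?_, fun j => dil_herm _, by linarith [Q.hw], ?_, ?_⟩, b1, b2⟩
  · intro t i j
    rcases i with i | i <;> rcases j with j | j <;> simp only [dil, fromBlocks_apply₁₁, fromBlocks_apply₁₂, fromBlocks_apply₂₁, fromBlocks_apply₂₂, Matrix.zero_apply, integral_zero, h0]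
    simp only [conjTranspose_apply]
    have := integral_conj (μ := ν t) (f := fun e => W t e j i)
    rw [h0, map_zero] at this
    exact this
  · intro L
    exact hβ (LinearMap.mk₂ ℝ (fun X Y => L (dil X) (dil Y)) (fun X X' Y => by rw [dil_add, map_add, LinearMap.add_apply]) (fun c X Y => by rw [dil_smul, L.map_smul_of_tower, LinearMap.smul_apply])
      (fun X Y Y' => by rw [dil_add, map_add]) (fun c X Y => by rw [dil_smul, LinearMap.map_smul_of_tower]))
  · intro x
    have hd := dual_bd (b := b) Q.hw (fun u => (hq u).le.trans (Q.h3 u))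
    rw [hs_dil]
    have h1 := hd x
    have h2 := hd fun j => star (x j)
    simp only [norm_star] at h2
    linarith
  · have e : ∑ j, dil (b j) * dil (b j) = fromBlocks (∑ j, b j * (b j)ᴴ) 0 0 (∑ j, (b j)ᴴ * b j) := by
      simp only [dil_sq]
      ext x y; rcases x with x | x <;> rcases y with y | y <;> simp [Matrix.sum_apply]
    rw [e]
    exact (bd_norm _ _).trans (add_le_add b1 b2)
variable {ν : T → Measure E} [∀ i, IsProbabilityMeasure (ν i)] {W : T → E → Mc k} {r : ℝ}
lemma exp_dil_le [Nonempty k] (X : Mc k) {θ : ℝ} (hθ : 0 < θ) : exp (θ * ‖X‖) ≤ 2 * rtr (ex (θ • dil X)) := by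
  have hH : (θ • dil X).IsHermitian := by rw [← dil_smul]; exact dil_herm _
  have h := exp_norm_le hH
  have e : rtr (ex (-(θ • dil X))) = rtr (ex (θ • dil X)) := by
    rw [← dil_smul, ← Dm_dil, ex_conj _ _ _ Dm_sq]
    unfold rtr
    rw [trace_mul_cycle, Dm_sq, Matrix.one_mul]
  rw [e, norm_smul, norm_of_nonneg hθ.le] at h
  refine (exp_le_exp.2 (mlL (norm_le_dil X) hθ.le)).trans (h.trans (le_of_eq (by ring)))
lemma card_bd {m : ℝ} (hm : 2 ≤ m) {x y : ℝ} (hx : x ≤ m) (hy : y ≤ m) : 2 * (m * (2 + x + y)) ≤ m ^ 5 := by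
  have h1 : m * (2 + x + y) ≤ m * (2 + m + m) := by gcongr
  have h2 : (8:ℝ) ≤ m ^ 3 := by
    calc (8:ℝ) = 2 ^ 3 := by norm_num
      _ ≤ m ^ 3 := by gcongr
  have h3 : 8 * m ^ 2 ≤ m ^ 3 * m ^ 2 := by gcongr
  nlinarith
set_option maxHeartbeats 1000000 in
lemma bdd_bd [Nonempty k] {a c w : ℝ} (hm : ∀ t, StronglyMeasurable (W t)) (hr : 0 < r) (hb : ∀ t e, ‖W t e‖ ≤ r)
    (h0 : ∀ t i j, ∫ e, W t e i j ∂(ν t) = 0) (Q : QB (fun u => ∑ t, ∫ e, ‖lf u (W t e)‖ ^ 2 ∂(ν t)) a c w)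
    {m : ℝ} (hmk : m = card k) (hm2 : 2 ≤ m) (hac : a ≤ m * c) (hca : c ≤ m * a) {θ : ℝ} (hθ : 0 < θ) (hθr : θ * (2 * r) ≤ 1 / 100) :
    ∫ z, ‖Xs W z‖ ∂(Measure.pi ν) ≤ a + c + 5 * log m / θ + 2 * (8 * θ ^ 3 * (2 * w) * (a ^ 2 + c ^ 2) + 100 * θ ^ 2 * (2 * r) * (a ^ 2 + c ^ 2)) := by
  obtain ⟨N, b, M, b1, b2⟩ := mk_mod hm hr hb h0 Q
  have ha := Q.ha
  have hc := Q.hc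
  have Xm : StronglyMeasurable (Xs W) := Finset.stronglyMeasurable_fun_sum _ fun t _ => (hm t).comp_measurable (measurable_pi_apply t)
  have Xb : ∀ z, ‖Xs W z‖ ≤ crd T * r := fun z => by
    refine (norm_sum_le _ _).trans ((sle fun t => hb t (z t)).trans ?_)
    simp
  have i1 : Integrable (fun z => θ * ‖Xs W z‖) (Measure.pi ν) :=
    Integrable.of_bound ((continuous_const.mul continuous_norm).comp_stronglyMeasurable Xm).aestronglyMeasurable (θ * (crd T * r)) (of_forall fun z => by
      rw [norm_of_nonneg (by positivity)]; exact mlL (Xb z) hθ.le)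
  have i2 : Integrable (fun z => exp (θ * ‖Xs W z‖)) (Measure.pi ν) :=
    Integrable.of_bound ((Real.continuous_exp.comp (continuous_const.mul continuous_norm)).comp_stronglyMeasurable Xm).aestronglyMeasurable (exp (θ * (crd T * r))) (of_forall fun z => by
      rw [norm_of_nonneg exp0]; exact exp_le_exp.2 (mlL (Xb z) hθ.le))
  have i3 : Integrable (fun z => 2 * rtr (ex (θ • Xs (fun t e => dil (W t e)) z))) (Measure.pi ν) := by
    refine Integrable.const_mul ?_ 2
    refine Integrable.of_bound ((rtr_cont (ex_continuous.comp (continuous_const_smul θ))).comp_stronglyMeasurable M.Xm).aestronglyMeasurable (‖trL (n := k ⊕ k) 1 1‖ * exp (θ * (crd T * (2 * r)))) (of_forall fun z => ?_)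
    refine (rtr_norm_le _).trans (mlL ((norm_ex_le _).trans (exp_le_exp.2 ?_)) nng)
    rw [norm_smul, norm_of_nonneg hθ.le]
    exact mlL (M.Xb z) hθ.le
  have J : exp (∫ z, θ * ‖Xs W z‖ ∂(Measure.pi ν)) ≤ ∫ z, exp (θ * ‖Xs W z‖) ∂(Measure.pi ν) :=
    convexOn_exp.map_integral_le Real.continuous_exp.continuousOn isClosed_univ (of_forall fun _ => Set.mem_univ _) i1 i2
  have J2 : ∫ z, exp (θ * ‖Xs W z‖) ∂(Measure.pi ν) ≤ ∫ z, 2 * rtr (ex (θ • Xs (fun t e => dil (W t e)) z)) ∂(Measure.pi ν) := by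
    refine integral_mono i2 i3 fun z => ?_
    have : Xs (fun t e => dil (W t e)) z = dil (Xs W z) := (dil_sum _ _).symm
    simp only [this]
    exact exp_dil_le _ hθ
  rw [integral_const_mul] at J J2
  set I := ∫ z, ‖Xs W z‖ ∂(Measure.pi ν)
  refine le_of_forall_pos_le_add fun δ hδ => ?_
  have hd : 0 < δ / 2 := by positivity
  have B := model_bd M (a := a + δ / 2) (c := c + δ / 2) (by linarith) (by linarith) (b1.trans (by gcongr; linarith)) (b2.trans (by gcongr; linarith)) hθ hθr
  set G := 8 * θ ^ 4 * (2 * w) * (a ^ 2 + c ^ 2) + 100 * θ ^ 3 * (2 * r) * (a ^ 2 + c ^ 2) with hG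
  have q1 : (a + δ / 2) / (c + δ / 2) ≤ m := by rw [div_le_iff₀ (by linarith)]; nlinarith
  have q2 : (c + δ / 2) / (a + δ / 2) ≤ m := by rw [div_le_iff₀ (by linarith)]; nlinarith
  have cb := card_bd hm2 q1 q2
  rw [← hmk] at B
  have F : exp (θ * I) ≤ exp (2 * G + (a + c + δ) * θ + 5 * log m) := by
    refine J.trans (J2.trans ((mlL B zero_le_two).trans ?_))
    rw [exp_add, exp_add, show (5:ℝ) * log m = ((5:ℕ):ℝ) * log m by norm_num, Real.exp_nat_mul, Real.exp_log (by linarith)]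
    refine le_trans (le_of_eq ?_) (mlL cb (by positivity : 0 ≤ exp (2 * G) * exp ((a + c + δ) * θ)))
    rw [show a + δ / 2 + (c + δ / 2) = a + c + δ by ring]
    ring
  have F' := exp_le_exp.1 F
  have : I ≤ (2 * G + (a + c + δ) * θ + 5 * log m) / θ := by rw [le_div_iff₀ hθ]; linarith
  refine this.trans (le_of_eq ?_)
  rw [hG]; field_simp; ring
end
lemma opt0 {e S l s y r : ℝ} (hl : 0 < l) (hs : 0 ≤ s) (hy : 0 ≤ y) (hr : 0 ≤ r)
    (h : ∀ θ : ℝ, 0 < θ → θ * (4 * r ^ 3) ≤ 1 / 100 → e ≤ S + 5 * l ^ 12 / θ + 64 * θ ^ 3 * (y ^ 2) ^ 2 * (s ^ 6) ^ 2 + 1600 * θ ^ 2 * r ^ 3 * (s ^ 6) ^ 2) :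
    e ≤ S + 2000 * (l ^ 9 * s ^ 3 * y + l ^ 8 * s ^ 4 * r + l ^ 12 * r ^ 3) := by
  have key : ∀ δ : ℝ, 0 < δ → e ≤ S + 2000 * (l ^ 9 * s ^ 3 * y + l ^ 8 * s ^ 4 * r + l ^ 12 * r ^ 3) + 5 * l ^ 12 * δ := by
    intro δ hδ
    set q := s ^ 3 * y / l ^ 3 + s ^ 4 * r / l ^ 4 + 400 * r ^ 3 + δ with hq
    have hq0 : 0 < q := by positivity
    have h1 : s ^ 3 * y / l ^ 3 ≤ q := by
      have : 0 ≤ s ^ 4 * r / l ^ 4 + 400 * r ^ 3 + δ := by positivity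
      linarith
    have h2 : s ^ 4 * r / l ^ 4 ≤ q := by
      have : 0 ≤ s ^ 3 * y / l ^ 3 + 400 * r ^ 3 + δ := by positivity
      linarith
    have h3 : 400 * r ^ 3 ≤ q := by
      have : 0 ≤ s ^ 3 * y / l ^ 3 + s ^ 4 * r / l ^ 4 + δ := by positivity
      linarith
    have H := h (1 / q) (by positivity) (by rw [one_div, inv_mul_le_iff₀ hq0]; linarith)
    have t1 : 5 * l ^ 12 / (1 / q) = 5 * (l ^ 9 * s ^ 3 * y) + 5 * (l ^ 8 * s ^ 4 * r) + 2000 * (l ^ 12 * r ^ 3) + 5 * l ^ 12 * δ := by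
      rw [hq]; field_simp; ring
    have t2 : 64 * (1 / q) ^ 3 * (y ^ 2) ^ 2 * (s ^ 6) ^ 2 ≤ 64 * (l ^ 9 * s ^ 3 * y) := by
      have := mlL (pow_le_pow_left₀ (by positivity) h1 3) (by positivity : 0 ≤ 64 * (l ^ 9 * s ^ 3 * y))
      rw [show 64 * (1 / q) ^ 3 * (y ^ 2) ^ 2 * (s ^ 6) ^ 2 = 64 * y ^ 4 * s ^ 12 / q ^ 3 by field_simp, div_le_iff₀ (by positivity)]
      refine le_trans (le_of_eq ?_) this
      field_simp
    have t3 : 1600 * (1 / q) ^ 2 * r ^ 3 * (s ^ 6) ^ 2 ≤ 1600 * (l ^ 8 * s ^ 4 * r) := by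
      have := mlL (pow_le_pow_left₀ (by positivity) h2 2) (by positivity : 0 ≤ 1600 * (l ^ 8 * s ^ 4 * r))
      rw [show 1600 * (1 / q) ^ 2 * r ^ 3 * (s ^ 6) ^ 2 = 1600 * r ^ 3 * s ^ 12 / q ^ 2 by field_simp, div_le_iff₀ (by positivity)]
      refine le_trans (le_of_eq ?_) this
      field_simp
    have p1 : 0 ≤ l ^ 9 * s ^ 3 * y := by positivity
    have p2 : 0 ≤ l ^ 8 * s ^ 4 * r := by positivity
    rw [t1] at H
    linarith
  refine le_of_forall_pos_le_add fun ε hε => (key (ε / (5 * l ^ 12)) (by positivity)).trans (le_of_eq ?_)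
  field_simp
lemma rt {x a b : ℝ} {n : ℕ} (hx : 0 ≤ x) (h : a * n = b) : (x ^ a) ^ n = x ^ b := by
  rw [← Real.rpow_natCast, ← Real.rpow_mul hx, h]
lemma opt {e S L σ υ R : ℝ} (hL : 0 < L) (hσ : 0 ≤ σ) (hυ : 0 ≤ υ) (hR : 0 ≤ R)
    (h : ∀ θ : ℝ, 0 < θ → θ * (4 * R) ≤ 1 / 100 → e ≤ S + 5 * L / θ + 64 * θ ^ 3 * υ ^ 2 * σ ^ 2 + 1600 * θ ^ 2 * R * σ ^ 2) :
    e ≤ S + 2000 * (L ^ ((3 : ℝ)/4) * σ ^ ((1 : ℝ)/2) * υ ^ ((1 : ℝ)/2) + L ^ ((2 : ℝ)/3) * σ ^ ((2 : ℝ)/3) * R ^ ((1 : ℝ)/3) + L * R) := by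
  have H := opt0 (e := e) (S := S) (l := L ^ ((1:ℝ)/12)) (s := σ ^ ((1:ℝ)/6)) (y := υ ^ ((1:ℝ)/2)) (r := R ^ ((1:ℝ)/3)) (by positivity) (by positivity) (by positivity) (by positivity) (by
    rw [rt (b := 1) hL.le (by norm_num), rt (b := 1) hσ (by norm_num), rt (b := 1) hυ (by norm_num), rt (b := 1) hR (by norm_num)]
    simpa only [Real.rpow_one] using h)
  rwa [rt (b := 3/4) hL.le (by norm_num), rt (b := 1/2) hσ (by norm_num), rt (b := 2/3) hL.le (by norm_num), rt (b := 2/3) hσ (by norm_num), rt (b := 1) hL.le (by norm_num), rt (b := 1) hR (by norm_num), Real.rpow_one, Real.rpow_one] at H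
lemma opt_lim {e S L σ υ R : ℝ} (hL : 1 / 2 ≤ L) (hσ : 0 ≤ σ) (hυ : 0 ≤ υ) (hR : 0 ≤ R)
    (h : ∀ R' : ℝ, R < R' → ∀ θ : ℝ, 0 < θ → θ * (4 * R') ≤ 1 / 100 → e ≤ S + 2 * R' + 5 * L / θ + 64 * θ ^ 3 * υ ^ 2 * σ ^ 2 + 1600 * θ ^ 2 * R' * σ ^ 2) :
    e ≤ S + 2004 * (L ^ ((3 : ℝ)/4) * σ ^ ((1 : ℝ)/2) * υ ^ ((1 : ℝ)/2) + L ^ ((2 : ℝ)/3) * σ ^ ((2 : ℝ)/3) * R ^ ((1 : ℝ)/3) + L * R) := by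
  have hL0 : 0 < L := by linarith
  have key : ∀ R', R < R' → e ≤ S + 2004 * (L ^ ((3 : ℝ)/4) * σ ^ ((1 : ℝ)/2) * υ ^ ((1 : ℝ)/2) + L ^ ((2 : ℝ)/3) * σ ^ ((2 : ℝ)/3) * R' ^ ((1 : ℝ)/3) + L * R') := by
    intro R' hR'
    have hR0 : 0 ≤ R' := hR.trans hR'.le
    have := opt hL0 hσ hυ hR0 (h R' hR')
    have p1 : 0 ≤ L ^ ((3 : ℝ)/4) * σ ^ ((1 : ℝ)/2) * υ ^ ((1 : ℝ)/2) := by positivity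
    have p2 : 0 ≤ L ^ ((2 : ℝ)/3) * σ ^ ((2 : ℝ)/3) * R' ^ ((1 : ℝ)/3) := by positivity
    nlinarith
  have lim : Filter.Tendsto (fun R' : ℝ => S + 2004 * (L ^ ((3 : ℝ)/4) * σ ^ ((1 : ℝ)/2) * υ ^ ((1 : ℝ)/2) + L ^ ((2 : ℝ)/3) * σ ^ ((2 : ℝ)/3) * R' ^ ((1 : ℝ)/3) + L * R')) (nhdsWithin R (Ioi R)) (nhds (S + 2004 * (L ^ ((3 : ℝ)/4) * σ ^ ((1 : ℝ)/2) * υ ^ ((1 : ℝ)/2) + L ^ ((2 : ℝ)/3) * σ ^ ((2 : ℝ)/3) * R ^ ((1 : ℝ)/3) + L * R))) := by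
    refine Filter.Tendsto.mono_left (Continuous.tendsto ?_ R) nhdsWithin_le_nhds
    have : Continuous fun x : ℝ => x ^ ((1:ℝ)/3) := Real.continuous_rpow_const (by norm_num)
    fun_prop
  exact ge_of_tendsto lim (Filter.eventually_of_mem self_mem_nhdsWithin key)
section
variable {Ω : Type} [MeasurableSpace Ω] {μ : Measure Ω} [IsProbabilityMeasure μ]
instance borelM : BorelSpace (Mc k) := inferInstanceAs (BorelSpace (k → k → ℂ))
instance scM : SecondCountableTopology (Mc k) := inferInstanceAs (SecondCountableTopology (k → k → ℂ))
lemma norm_le_sum (Z : Mc k) : ‖Z‖ ≤ ∑ i, ∑ j, ‖Z i j‖ := by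
  have h := norm_sq_le_hs' Z
  have h2 : hs Z ≤ (∑ i, ∑ j, ‖Z i j‖) ^ 2 := by
    unfold hs
    rw [← Fintype.sum_prod_type' (f := fun i j => ‖Z i j‖ ^ 2), ← Fintype.sum_prod_type' (f := fun i j => ‖Z i j‖)]
    exact Finset.sum_sq_le_sq_sum_of_nonneg fun _ _ => nng
  exact le_of_sq_le_sq (h.trans h2) (by positivity)
lemma aem {Z : Ω → Mc k} (h : ∀ i j, AEStronglyMeasurable (fun ω => Z ω i j) μ) : AEMeasurable Z μ :=
  aemeasurable_pi_iff.2 fun i => aemeasurable_pi_iff.2 fun j => (h i j).aemeasurable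
lemma memLp_mat {Z : Ω → Mc k} {q : ℝ≥0∞} (h : ∀ i j, MemLp (fun ω => Z ω i j) q μ) : MemLp Z q μ := by
  have h1 : MemLp (fun ω => ∑ i, ∑ j, ‖Z ω i j‖) q μ := memLp_finset_sum _ fun i _ => memLp_finset_sum _ fun j _ => (h i j).norm
  exact h1.mono' (aem fun i j => (h i j).1).aestronglyMeasurable (of_forall fun ω => norm_le_sum _)
def entryL (i j : k) : Mc k →L[ℝ] ℂ :=
  LinearMap.toContinuousLinearMap { toFun := fun A => A i j, map_add' := fun _ _ => rfl, map_smul' := fun _ _ => rfl }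
lemma mint_apply {E : Type*} [MeasurableSpace E] {ν : Measure E} {f : E → Mc k} (hf : Integrable f ν) (i j : k) : (∫ e, f e ∂ν) i j = ∫ e, f e i j ∂ν :=
  ((entryL i j).integral_comp_comm hf).symm
lemma matExp_eq {f : Ω → Mc k} (hf : Integrable f μ) : matExp μ f = ∫ ω, f ω ∂μ := by
  ext i j; rw [mint_apply hf]; rfl
lemma quad_int {κ : Type*} [Fintype κ] [DecidableEq κ] {P : Ω → Mc κ} (hP : ∀ x y, Integrable (fun ω => P ω x y) μ) (u : κ → ℂ) {F : Ω → ℝ} (hF : ∀ ω, 0 ≤ F ω)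
    (h : ∀ ω, ((F ω : ℝ) : ℂ) = ∑ x, ∑ y, u x * P ω x y * star (u y)) : ∫ ω, F ω ∂μ ≤ ‖matExp μ P‖ * ∑ x, ‖u x‖ ^ 2 := by
  refine le_trans (le_of_eq ?_) (quad_le (matExp μ P) u)
  have e : ((∫ ω, F ω ∂μ : ℝ) : ℂ) = ∑ x, ∑ y, u x * matExp μ P x y * star (u y) := by
    rw [← integral_complex_ofReal]
    simp only [h]
    rw [integral_finsetSum _ fun x _ => integrable_finsetSum _ fun y _ => ((hP x y).const_mul _).mul_const _]
    refine scg fun x => ?_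
    rw [integral_finsetSum _ fun y _ => ((hP x y).const_mul _).mul_const _]
    refine scg fun y => ?_
    rw [integral_mul_const, integral_const_mul]; rfl
  rw [← e, norm_real, norm_of_nonneg (integral_nonneg hF)]
lemma nsq (z : ℂ) : ((‖z‖ ^ 2 : ℝ) : ℂ) = z * star z := by push_cast; exact (Complex.mul_conj' z).symm
lemma lf_memLp {X : Ω → Mc k} (hX : ∀ i j, MemLp (fun ω => X ω i j) 2 μ) (u : Mc k) : MemLp (fun ω => lf u (X ω)) 2 μ :=
  memLp_finset_sum _ fun i _ => memLp_finset_sum _ fun j _ => (hX i j).const_mul _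
lemma sq_intg {f : Ω → ℂ} (hf : MemLp f 2 μ) : Integrable (fun ω => ‖f ω‖ ^ 2) μ := (memLp_two_iff_integrable_sq_norm hf.1).1 hf
lemma ent_intg {X : Ω → Mc k} (hX : ∀ i j, MemLp (fun ω => X ω i j) 2 μ) (i j p q : k) : Integrable (fun ω => X ω i j * star (X ω p q)) μ :=
  (hX i j).integrable_mul (hX p q).star
set_option maxHeartbeats 1000000 in
lemma qb_base {X : Ω → Mc k} (hX : ∀ i j, MemLp (fun ω => X ω i j) 2 μ) {P : Ω → Mc (k × k)} (hP : ∀ ω p q, P ω p q = X ω p.1 p.2 * star (X ω q.1 q.2)) :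
    QB (fun u => ∫ ω, ‖lf u (X ω)‖ ^ 2 ∂μ) (sqrt ‖matExp μ fun ω => X ω * (X ω)ᴴ‖) (sqrt ‖matExp μ fun ω => (X ω)ᴴ * X ω‖) ‖matExp μ P‖ where
  ha := sqrt_nonneg _
  hc := sqrt_nonneg _
  hw := nng
  h1 := fun u => by
    rw [sq_sqrt nng]
    simp only [lf_colv]
    rw [← integral_finsetSum _ fun y _ => sq_intg (memLp_finset_sum _ fun x _ => (hX x y).const_mul (u x))]
    refine quad_int (fun x y => ?_) u (fun ω => by positivity) fun ω => ?_
    · simp only [Matrix.mul_apply, conjTranspose_apply]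
      exact integrable_finsetSum _ fun z _ => ent_intg hX _ _ _ _
    · push_cast
      have : ∀ z : ℂ, ((‖z‖ : ℝ) : ℂ) ^ 2 = z * star z := fun z => by rw [← nsq]; push_cast; rfl
      simp only [this, star_sum, star_mul', Matrix.mul_apply, conjTranspose_apply, sum_mul, mul_sum]
      rw [scg fun y => sum_comm, sum_comm]
      refine scg fun x => ?_
      rw [sum_comm]
      refine scg fun y => scg fun z => by ring
  h2 := fun u => by
    rw [sq_sqrt nng]
    simp only [lf_rowv]
    rw [← integral_finsetSum _ fun x _ => sq_intg (memLp_finset_sum _ fun y _ => (hX x y).const_mul (u y))]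
    refine (quad_int (P := fun ω => (X ω)ᴴ * X ω) (fun x y => ?_) (fun y => star (u y)) (fun ω => by positivity) fun ω => ?_).trans (le_of_eq (by simp only [norm_star]))
    · simp only [Matrix.mul_apply, conjTranspose_apply]
      refine integrable_finsetSum _ fun z _ => (ent_intg hX z y z x).congr (of_forall fun ω => mul_comm _ _)
    · push_cast
      have : ∀ z : ℂ, ((‖z‖ : ℝ) : ℂ) ^ 2 = z * star z := fun z => by rw [← nsq]; push_cast; rfl
      simp only [this, star_sum, star_mul', star_star, Matrix.mul_apply, conjTranspose_apply, sum_mul, mul_sum]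
      rw [sum_comm]
      refine scg fun x => ?_
      rw [sum_comm]
      refine scg fun y => scg fun z => by ring
  h3 := fun u => by
    have := quad_int (μ := μ) (P := P) (fun p q => by simp only [hP]; exact ent_intg hX _ _ _ _) (fun p => u p.1 p.2) (F := fun ω => ‖lf u (X ω)‖ ^ 2) (fun ω => by positivity) fun ω => by
      rw [nsq, show lf u (X ω) = ∑ p : k × k, u p.1 p.2 * X ω p.1 p.2 from (sum_prod_type (fun p : k × k => u p.1 p.2 * X ω p.1 p.2)).symm, star_sum, Finset.sum_mul_sum]
      refine scg fun p => scg fun q => ?_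
      rw [hP, star_mul']; ring
    refine this.trans (le_of_eq ?_)
    rw [sum_prod_type]; rfl
lemma QB.mono {q q' : Mc k → ℝ} {a c w : ℝ} (Q : QB q a c w) (h : ∀ u, q' u ≤ q u) : QB q' a c w :=
  ⟨Q.ha, Q.hc, Q.hw, fun u => (sle fun _ => h _).trans (Q.h1 u), fun u => (sle fun _ => h _).trans (Q.h2 u), fun u => (h u).trans (Q.h3 u)⟩
lemma hs_int_le {X : Ω → Mc k} (hX : ∀ i j, MemLp (fun ω => X ω i j) 2 μ) :
    ∫ ω, hs (X ω) ∂μ ≤ crd k * ‖matExp μ fun ω => X ω * (X ω)ᴴ‖ ∧ ‖matExp μ fun ω => X ω * (X ω)ᴴ‖ ≤ ∫ ω, hs (X ω) ∂μ := by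
  have hi : Integrable (fun ω => hs (X ω)) μ := by unfold hs; exact integrable_finsetSum _ fun i _ => integrable_finsetSum _ fun j _ => sq_intg (hX i j)
  constructor
  · unfold hs
    rw [integral_finsetSum _ fun i _ => integrable_finsetSum _ fun j _ => sq_intg (hX i j)]
    rw [← nsmul_eq_mul]
    refine Finset.sum_le_card_nsmul _ _ _ fun i _ => ?_
    refine le_trans (le_of_eq ?_) (norm_entry_le _ i i)
    have : matExp μ (fun ω => X ω * (X ω)ᴴ) i i = ((∫ ω, ∑ j, ‖X ω i j‖ ^ 2 ∂μ : ℝ) : ℂ) := by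
      rw [← integral_complex_ofReal]
      show ∫ ω, (X ω * (X ω)ᴴ) i i ∂μ = _
      refine integral_congr_ae (of_forall fun ω => ?_)
      simp only [Matrix.mul_apply, conjTranspose_apply, Complex.ofReal_sum, nsq]
    rw [this, norm_real, norm_of_nonneg (integral_nonneg fun ω => by positivity)]
  · have hb : ∀ ω, ‖X ω * (X ω)ᴴ‖ ≤ hs (X ω) := fun ω => by
      refine (norm_mul_le _ _).trans (le_trans (le_of_eq ?_) (norm_sq_le_hs' (X ω)))
      rw [l2_opNorm_conjTranspose]; ring
    have hi2 : Integrable (fun ω => X ω * (X ω)ᴴ) μ := hi.mono' (by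
      have := (memLp_mat hX).1
      exact (continuous_id.matrix_mul continuous_id.matrix_conjTranspose).comp_aestronglyMeasurable this) (of_forall hb)
    rw [matExp_eq hi2]
    exact (norm_integral_le_integral_norm _).trans (integral_mono hi2.norm hi hb)
lemma ratio {X : Ω → Mc k} (hX : ∀ i j, MemLp (fun ω => X ω i j) 2 μ) (hk : 2 ≤ crd k) :
    sqrt ‖matExp μ fun ω => X ω * (X ω)ᴴ‖ ≤ crd k * sqrt ‖matExp μ fun ω => (X ω)ᴴ * X ω‖ ∧
    sqrt ‖matExp μ fun ω => (X ω)ᴴ * X ω‖ ≤ crd k * sqrt ‖matExp μ fun ω => X ω * (X ω)ᴴ‖ := by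
  obtain ⟨h1, h2⟩ := hs_int_le hX
  obtain ⟨h3, h4⟩ := hs_int_le (X := fun ω => (X ω)ᴴ) (μ := μ) fun i j => (hX j i).star
  have e : ∀ ω, hs (X ω)ᴴ = hs (X ω) := fun ω => by unfold hs; rw [sum_comm]; simp
  simp only [conjTranspose_conjTranspose, e] at h3 h4
  have key : ∀ x y : ℝ, 0 ≤ y → x ≤ crd k * y → sqrt x ≤ crd k * sqrt y := fun x y hy h => by
    rw [← Real.sqrt_sq (by positivity : (0:ℝ) ≤ crd k), ← Real.sqrt_mul (by positivity)]
    refine Real.sqrt_le_sqrt (h.trans ?_)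
    nlinarith [mul_nonneg hy (by linarith : (0:ℝ) ≤ crd k - 1)]
  exact ⟨key _ _ nng (h2.trans h3), key _ _ nng (h4.trans h1)⟩
variable {Ω : Type} [MeasurableSpace Ω] {μ : Measure Ω} [IsProbabilityMeasure μ]
lemma var_le {E : Type*} [MeasurableSpace E] {ν : Measure E} [IsProbabilityMeasure ν] {f : E → ℂ} (hf : MemLp f 2 ν) :
    ∫ e, ‖f e - ∫ e, f e ∂ν‖ ^ 2 ∂ν ≤ ∫ e, ‖f e‖ ^ 2 ∂ν := by
  set c := ∫ e, f e ∂ν with hc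
  have i0 : Integrable (fun e => ‖f e‖ ^ 2) ν := (memLp_two_iff_integrable_sq_norm hf.1).1 hf
  have i1 : Integrable f ν := hf.integrable (by norm_num)
  have i2 : Integrable (fun e => 2 * (star c * f e).re) ν := ((i1.const_mul (star c)).re).const_mul 2
  have e1 : ∀ e, ‖f e - c‖ ^ 2 = ‖f e‖ ^ 2 - 2 * (star c * f e).re + ‖c‖ ^ 2 := fun e => by
    rw [← Complex.normSq_eq_norm_sq, ← Complex.normSq_eq_norm_sq, ← Complex.normSq_eq_norm_sq, Complex.normSq_apply, Complex.normSq_apply, Complex.normSq_apply]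
    simp; ring
  have e2 : ∫ e, (star c * f e).re ∂ν = ‖c‖ ^ 2 := by
    have : ∫ e, (star c * f e).re ∂ν = (∫ e, star c * f e ∂ν).re := integral_re (i1.const_mul (star c))
    rw [this, integral_const_mul, ← hc, ← Complex.normSq_eq_norm_sq, Complex.normSq_apply]
    simp
  simp only [e1]
  have i3 : Integrable (fun e => ‖f e‖ ^ 2 - 2 * (star c * f e).re) ν := i0.sub i2
  rw [integral_add i3 (integrable_const _), integral_sub i0 i2, integral_const_mul, e2]
  simp only [integral_const, probReal_univ, one_smul]
  linarith [sq_nonneg ‖c‖]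
lemma lf_int {E : Type*} [MeasurableSpace E] {ν : Measure E} {f : E → Mc k} (hf : Integrable f ν) (u : Mc k) : ∫ e, lf u (f e) ∂ν = lf u (∫ e, f e ∂ν) :=
  (LinearMap.toContinuousLinearMap ({ toFun := lf u, map_add' := lf_add u, map_smul' := fun c X => lf_smul u c X } : Mc k →ₗ[ℝ] ℂ)).integral_comp_comm hf
lemma orth {T : ℕ} {f : Fin T → Ω → ℂ} (hI : iIndepFun f μ) (hf : ∀ t, MemLp (f t) 2 μ) (h0 : ∀ t, ∫ ω, f t ω ∂μ = 0) :
    ∑ t, ∫ ω, ‖f t ω‖ ^ 2 ∂μ = ∫ ω, ‖∑ t, f t ω‖ ^ 2 ∂μ := by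
  have hi : ∀ s t, Integrable (fun ω => f s ω * star (f t ω)) μ := fun s t => (hf s).integrable_mul (hf t).star
  have key : ((∑ t, ∫ ω, ‖f t ω‖ ^ 2 ∂μ : ℝ) : ℂ) = ((∫ ω, ‖∑ t, f t ω‖ ^ 2 ∂μ : ℝ) : ℂ) := by
    rw [Complex.ofReal_sum, ← integral_complex_ofReal]
    simp only [← integral_complex_ofReal, nsq, star_sum, Finset.sum_mul_sum]
    rw [integral_finsetSum _ fun s _ => integrable_finsetSum _ fun t _ => hi s t]
    refine scg fun s => ?_
    rw [integral_finsetSum _ fun t _ => hi s t, Finset.sum_eq_single s]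
    · intro t _ hst
      have := (hI.indepFun hst.symm).comp measurable_id (continuous_star.measurable : Measurable (star : ℂ → ℂ))
      have := this.integral_fun_mul_eq_mul_integral (hf s).1 (continuous_star.comp_aestronglyMeasurable (hf t).1)
      refine this.trans ?_
      show (∫ ω, f s ω ∂μ) * _ = 0
      rw [h0, zero_mul]
    · simp
  exact_mod_cast key
open Classical in
def tau (R : ℝ) (e : Mc k) : Mc k := if ‖e‖ ≤ R then e else 0
lemma tau_meas (R : ℝ) : Measurable (tau R : Mc k → Mc k) := by
  unfold tau
  exact Measurable.ite (measurableSet_le measurable_norm measurable_const) measurable_id measurable_const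
lemma tau_sm (R : ℝ) : StronglyMeasurable (tau R : Mc k → Mc k) := (tau_meas R).stronglyMeasurable
lemma tau_norm {R : ℝ} (hR : 0 ≤ R) (e : Mc k) : ‖tau R e‖ ≤ R := by
  unfold tau; split_ifs with h
  · exact h
  · simpa using hR
lemma tau_lf (R : ℝ) (u e : Mc k) : ‖lf u (tau R e)‖ ≤ ‖lf u e‖ := by
  unfold tau; split_ifs with h
  · exact le_rfl
  · simp [lf]
lemma tau_err {R : ℝ} (hR : 0 < R) {p : ℕ} (hp : 1 ≤ p) (e : Mc k) : ‖e - tau R e‖ ≤ ‖e‖ ^ (2 * p) / R ^ (2 * p - 1) := by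
  unfold tau; split_ifs with h
  · simp; positivity
  · rw [sub_zero, le_div_iff₀ (by positivity)]
    push Not at h
    calc ‖e‖ * R ^ (2 * p - 1) ≤ ‖e‖ * ‖e‖ ^ (2 * p - 1) := by gcongr
      _ = ‖e‖ ^ (2 * p) := by rw [← pow_succ']; congr 1; omega
set_option maxHeartbeats 2000000 in
lemma trunc [Nonempty k] {T : ℕ} {Z : Fin T → Ω → Mc k} (hI : iIndepFun Z μ) (hL : ∀ t i j (p : ℕ), MemLp (fun ω => Z t ω i j) p μ)
    (h0 : ∀ t i j, ∫ ω, Z t ω i j ∂μ = 0) {p : ℕ} (hp : 1 ≤ p) {R : ℝ} (hR : 0 < R) (hRp : ∑ t, ∫ ω, ‖Z t ω‖ ^ (2 * p) ∂μ ≤ R ^ (2 * p))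
    {m : ℝ} (hmk : m = card k) (hm2 : 2 ≤ m) {a c w : ℝ} (hac : a ≤ m * c) (hca : c ≤ m * a)
    (Q : QB (fun u => ∫ ω, ‖lf u (∑ t, Z t ω)‖ ^ 2 ∂μ) a c w) {θ : ℝ} (hθ : 0 < θ) (hθr : θ * (4 * R) ≤ 1 / 100) :
    ∫ ω, ‖∑ t, Z t ω‖ ∂μ ≤ a + c + 2 * R + 5 * log m / θ + 2 * (8 * θ ^ 3 * (2 * w) * (a ^ 2 + c ^ 2) + 100 * θ ^ 2 * (4 * R) * (a ^ 2 + c ^ 2)) := by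
  have hL2 : ∀ t i j, MemLp (fun ω => Z t ω i j) 2 μ := fun t i j => hL t i j 2
  have Zm : ∀ t, AEMeasurable (Z t) μ := fun t => aem fun i j => (hL2 t i j).1
  have Zi : ∀ t, Integrable (Z t) μ := fun t => (memLp_mat (hL2 t)).integrable (by norm_num)
  have Zp : ∀ t, Integrable (fun ω => ‖Z t ω‖ ^ (2 * p)) μ := fun t =>
    (memLp_mat (q := ((2 * p : ℕ) : ℝ≥0∞)) fun i j => hL t i j (2 * p)).integrable_norm_pow (by omega)
  have Z0 : ∀ t, ∫ ω, Z t ω ∂μ = 0 := fun t => by ext i j; rw [mint_apply (Zi t), h0]; rfl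
  let ν : Fin T → Measure (Mc k) := fun t => μ.map (Z t)
  have : ∀ t, IsProbabilityMeasure (ν t) := fun t => Measure.isProbabilityMeasure_map (Zm t)
  let C : Fin T → Mc k := fun t => ∫ e, tau R e ∂(ν t)
  let W : Fin T → Mc k → Mc k := fun t e => tau R e - C t
  have ti : ∀ t, Integrable (tau R : Mc k → Mc k) (ν t) := fun t =>
    Integrable.of_bound (tau_sm R).aestronglyMeasurable R (of_forall fun e => tau_norm hR.le e)
  have Cn : ∀ t, ‖C t‖ ≤ R := fun t => by
    refine (norm_integral_le_of_norm_le_const (of_forall fun e => tau_norm hR.le e)).trans (le_of_eq (by simp))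
  have Wm : ∀ t, StronglyMeasurable (W t) := fun t => (tau_sm R).sub stronglyMeasurable_const
  have Wb : ∀ t e, ‖W t e‖ ≤ 2 * R := fun t e => (norm_sub_le _ _).trans (by linarith [tau_norm hR.le e, Cn t])
  have W0 : ∀ t i j, ∫ e, W t e i j ∂(ν t) = 0 := fun t i j => by
    have e1 : ∫ e, W t e ∂(ν t) = 0 := by
      show ∫ e, (tau R e - C t) ∂(ν t) = 0
      rw [integral_sub (ti t) (integrable_const _)]
      simp [C]
    have wi : Integrable (W t) (ν t) := (ti t).sub (integrable_const _)
    rw [← mint_apply wi, e1]; rfl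
  have QW : QB (fun u => ∑ t, ∫ e, ‖lf u (W t e)‖ ^ 2 ∂(ν t)) a c w := by
    refine Q.mono fun u => ?_
    have hIu : iIndepFun (fun t ω => lf u (Z t ω)) μ := hI.comp (fun _ => lf u) fun _ => (lf_cont u).measurable
    have hf : ∀ t, MemLp (fun ω => lf u (Z t ω)) 2 μ := fun t => lf_memLp (hL2 t) u
    have o := orth hIu hf fun t => by rw [lf_int (Zi t), Z0]; simp [lf]
    have e : ∀ ω, lf u (∑ t, Z t ω) = ∑ t, lf u (Z t ω) := fun ω => by
      simp only [lf, Matrix.sum_apply, mul_sum]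
      rw [scg fun i => sum_comm, sum_comm]
    simp only [e]
    rw [← o]
    refine sle fun t => ?_
    have i1 : Integrable (fun e => ‖lf u e‖ ^ 2) (ν t) := (integrable_map_measure (((lf_cont u).norm.pow 2).aestronglyMeasurable) (Zm t)).2 (sq_intg (hf t))
    have e1 : ∫ ω, ‖lf u (Z t ω)‖ ^ 2 ∂μ = ∫ e, ‖lf u e‖ ^ 2 ∂(ν t) := (integral_map (Zm t) (((lf_cont u).norm.pow 2).aestronglyMeasurable)).symm
    rw [e1]
    have lm : AEStronglyMeasurable (fun e => lf u (tau R e)) (ν t) := ((lf_cont u).comp_stronglyMeasurable (tau_sm R)).aestronglyMeasurable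
    have i2 : Integrable (fun e => ‖lf u (tau R e)‖ ^ 2) (ν t) := i1.mono' ((continuous_norm.pow 2).comp_aestronglyMeasurable lm) (of_forall fun e => by
      rw [norm_of_nonneg (by positivity)]; gcongr; exact tau_lf R u e)
    have e2 : lf u (C t) = ∫ e, lf u (tau R e) ∂(ν t) := (lf_int (ti t) u).symm
    have v := var_le ((memLp_two_iff_integrable_sq_norm lm).2 i2)
    rw [← e2] at v
    simp only [← lf_sub] at v
    exact v.trans (integral_mono i2 i1 fun e => by dsimp only; gcongr; exact tau_lf R u e)
  have B := bdd_bd (θ := θ) Wm (by linarith : 0 < 2 * R) Wb W0 QW hmk hm2 hac hca hθ (by linarith)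
  have Xm : StronglyMeasurable (Xs W) := Finset.stronglyMeasurable_fun_sum _ fun t _ => (Wm t).comp_measurable (measurable_pi_apply t)
  have hpi := (iIndepFun_iff_map_fun_eq_pi_map Zm).1 hI
  have eB : ∫ z, ‖Xs W z‖ ∂(Measure.pi ν) = ∫ ω, ‖∑ t, W t (Z t ω)‖ ∂μ := by
    rw [← hpi, integral_map (aemeasurable_pi_iff.2 Zm) (continuous_norm.comp_stronglyMeasurable Xm).aestronglyMeasurable]
    rfl
  rw [eB] at B
  have tz : ∀ t, Integrable (fun ω => tau R (Z t ω)) μ := fun t => (ti t).comp_aemeasurable (Zm t)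
  have di : ∀ t, Integrable (fun ω => Z t ω - tau R (Z t ω)) μ := fun t => (Zi t).sub (tz t)
  have dn : ∀ t, ∫ ω, ‖Z t ω - tau R (Z t ω)‖ ∂μ ≤ (∫ ω, ‖Z t ω‖ ^ (2 * p) ∂μ) / R ^ (2 * p - 1) := fun t => by
    rw [← integral_div]
    exact integral_mono (di t).norm ((Zp t).div_const _) fun ω => tau_err hR hp _
  have dR : ∑ t, ∫ ω, ‖Z t ω - tau R (Z t ω)‖ ∂μ ≤ R := by
    refine (sle fun t => dn t).trans ?_
    rw [← Finset.sum_div, div_le_iff₀ (by positivity), ← pow_succ', show 2 * p - 1 + 1 = 2 * p by omega]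
    exact hRp
  have Cd : ∀ t, ‖C t‖ ≤ ∫ ω, ‖Z t ω - tau R (Z t ω)‖ ∂μ := fun t => by
    have : C t = - ∫ ω, (Z t ω - tau R (Z t ω)) ∂μ := by
      rw [integral_sub (Zi t) (tz t), Z0, zero_sub, neg_neg]
      exact integral_map (Zm t) (tau_sm R).aestronglyMeasurable
    rw [this, norm_neg]
    exact norm_integral_le_integral_norm _
  have wi : Integrable (fun ω => ∑ t, W t (Z t ω)) μ := integrable_finsetSum _ fun t _ => (tz t).sub (integrable_const _)
  have pt : ∀ ω, ‖∑ t, Z t ω‖ ≤ ‖∑ t, W t (Z t ω)‖ + ∑ t, ‖Z t ω - tau R (Z t ω)‖ + ∑ t, ‖C t‖ := fun ω => by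
    have : ∑ t, Z t ω = ∑ t, W t (Z t ω) + ∑ t, (Z t ω - tau R (Z t ω)) + ∑ t, C t := by
      rw [← sum_add_distrib, ← sum_add_distrib]
      exact scg fun t => by simp only [W]; abel
    rw [this]
    exact (norm_add_le _ _).trans (add_le_add ((norm_add_le _ _).trans (add_le_add le_rfl (norm_sum_le _ _))) (norm_sum_le _ _))
  have di' : Integrable (fun ω => ∑ t, ‖Z t ω - tau R (Z t ω)‖) μ := integrable_finsetSum _ fun t _ => (di t).norm
  have S := integral_mono (μ := μ) (integrable_finsetSum _ fun t _ => Zi t).norm ((wi.norm.add di').add (integrable_const (∑ t, ‖C t‖))) pt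
  rw [integral_add' (wi.norm.add di') (integrable_const _), integral_add' wi.norm di', integral_finsetSum _ fun t _ => (di t).norm] at S
  have hC := (Finset.sum_le_sum fun t (_ : t ∈ univ) => Cd t).trans dR
  simp only [integral_const, probReal_univ, one_smul] at S
  rw [show 100 * θ ^ 2 * (4 * R) * (a ^ 2 + c ^ 2) = 100 * θ ^ 2 * (2 * (2 * R)) * (a ^ 2 + c ^ 2) by ring]
  linarith
end
lemma opNorm2_eq {n : Type*} [Fintype n] [DecidableEq n] (A : Mc n) : opNorm2 A = ‖A‖ := by
  rw [l2_opNorm_def]; rfl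
lemma fin_num {a c w R θ x y : ℝ} (a0 : 0 ≤ a) (c0 : 0 ≤ c) (w0 : 0 ≤ w) (R0 : 0 ≤ R) (hθ : 0 ≤ θ) :
    a + c + x + y + 2 * (8 * θ ^ 3 * (2 * w) * (a ^ 2 + c ^ 2) + 100 * θ ^ 2 * (4 * R) * (a ^ 2 + c ^ 2)) ≤ a + c + x + y + 64 * θ ^ 3 * w * (max a c) ^ 2 + 1600 * θ ^ 2 * R * (max a c) ^ 2 := by
  have hs2 : a ^ 2 + c ^ 2 ≤ 2 * (max a c) ^ 2 := by
    have h1 : a ^ 2 ≤ (max a c) ^ 2 := by gcongr; exact le_max_left _ _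
    have h2 : c ^ 2 ≤ (max a c) ^ 2 := by gcongr; exact le_max_right _ _
    linarith
  have x1 : 8 * θ ^ 3 * (2 * w) * (a ^ 2 + c ^ 2) ≤ 8 * θ ^ 3 * (2 * w) * (2 * (max a c) ^ 2) := mlL hs2 (by positivity)
  have x2 : 100 * θ ^ 2 * (4 * R) * (a ^ 2 + c ^ 2) ≤ 100 * θ ^ 2 * (4 * R) * (2 * (max a c) ^ 2) := mlL hs2 (by positivity)
  linarith
set_option maxHeartbeats 1000000 in
lemma main_bd (m T : ℕ) (hm : 2 ≤ m) (Ω : Type) [MeasurableSpace Ω] (μ : Measure Ω) [IsProbabilityMeasure μ] (Z : Fin T → Ω → Mc (Fin m))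
    (hI : iIndepFun Z μ) (hL : ∀ t i j (p : ℕ), MemLp (fun ω => Z t ω i j) p μ) (h0 : ∀ t i j, ∫ ω, Z t ω i j ∂μ = 0) (p : ℕ) (hp : log m ≤ p) :
    (∫ ω, ‖∑ t, Z t ω‖ ∂μ) ≤ sqrt ‖matExp μ fun ω => (∑ t, Z t ω) * (∑ t, Z t ω)ᴴ‖ + sqrt ‖matExp μ fun ω => (∑ t, Z t ω)ᴴ * (∑ t, Z t ω)‖
        + 2004 * (log m ^ ((3 : ℝ)/4) * sigmaParam μ (fun ω => ∑ t, Z t ω) ^ ((1 : ℝ)/2) * upsilonParam μ (fun ω => ∑ t, Z t ω) ^ ((1 : ℝ)/2)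
            + log m ^ ((2 : ℝ)/3) * sigmaParam μ (fun ω => ∑ t, Z t ω) ^ ((2 : ℝ)/3) * RParam μ Z p ^ ((1 : ℝ)/3)
            + log m * RParam μ Z p) := by
  have : Nonempty (Fin m) := ⟨⟨0, by omega⟩⟩
  have hm' : (2:ℝ) ≤ m := by exact_mod_cast hm
  have hlog : 1 / 2 ≤ log m := by
    have h1 := Real.log_le_log (by norm_num) hm'
    have := Real.log_two_gt_d9
    linarith
  have hp1 : 1 ≤ p := by
    have : (0:ℝ) < p := by linarith
    exact_mod_cast this
  have hL2 : ∀ t i j, MemLp (fun ω => Z t ω i j) 2 μ := fun t i j => hL t i j 2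
  have hX : ∀ i j, MemLp (fun ω => (∑ t, Z t ω) i j) 2 μ := fun i j => by
    simp only [Matrix.sum_apply]
    exact memLp_finset_sum _ fun t _ => hL2 t i j
  have hX0 : ∀ i j, ∫ ω, (∑ t, Z t ω) i j ∂μ = 0 := fun i j => by
    simp only [Matrix.sum_apply]
    rw [integral_finsetSum _ fun t _ => (hL2 t i j).integrable (by norm_num)]
    exact Finset.sum_eq_zero fun t _ => h0 t i j
  have hcov : covMatrix μ (fun ω => ∑ t, Z t ω) = matExp μ fun ω => of fun p q : Fin m × Fin m => (∑ t, Z t ω) p.1 p.2 * star ((∑ t, Z t ω) q.1 q.2) := by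
    ext x y
    simp only [covMatrix, matExp, of_apply, hX0, zero_mul, sub_zero]
    rfl
  have Q := qb_base hX (P := fun ω => of fun p q : Fin m × Fin m => (∑ t, Z t ω) p.1 p.2 * star ((∑ t, Z t ω) q.1 q.2)) fun ω p q => rfl
  rw [← hcov] at Q
  have hcard : (m:ℝ) = card (Fin m) := by simp
  obtain ⟨r1, r2⟩ := ratio hX (by rw [← hcard]; exact hm')
  rw [← hcard] at r1 r2
  set a := sqrt ‖matExp μ fun ω => (∑ t, Z t ω) * (∑ t, Z t ω)ᴴ‖ with ha
  set c := sqrt ‖matExp μ fun ω => (∑ t, Z t ω)ᴴ * (∑ t, Z t ω)‖ with hc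
  have hσ : sigmaParam μ (fun ω => ∑ t, Z t ω) = max a c := by unfold sigmaParam; rw [opNorm2_eq, opNorm2_eq]
  have hυ : upsilonParam μ (fun ω => ∑ t, Z t ω) = sqrt ‖covMatrix μ fun ω => ∑ t, Z t ω‖ := by unfold upsilonParam; rw [opNorm2_eq]
  rw [hσ, hυ]
  have a0 : 0 ≤ a := sqrt_nonneg _
  have c0 : 0 ≤ c := sqrt_nonneg _
  have Zp : ∀ t, Integrable (fun ω => ‖Z t ω‖ ^ (2 * p)) μ := fun t =>
    (memLp_mat (q := ((2 * p : ℕ) : ℝ≥0∞)) fun i j => hL t i j (2 * p)).integrable_norm_pow (by omega)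
  have Ti : ∀ t, Integrable (fun ω => (((Z t ω)ᴴ * Z t ω) ^ p).trace.re) μ := fun t => by
    refine ((Zp t).const_mul ‖trL (n := Fin m) 1 1‖).mono' ?_ (of_forall fun ω => ?_)
    · have hc : Continuous fun A : Mc (Fin m) => ((Aᴴ * A) ^ p).trace.re :=
        Complex.continuous_re.comp (((continuous_id.matrix_conjTranspose.matrix_mul continuous_id).pow p).matrix_trace)
      exact hc.comp_aestronglyMeasurable (memLp_mat (hL2 t)).1
    · refine (rtr_norm_le _).trans (mlL ?_ nng)
      refine (norm_pow_le' _ hp1).trans ?_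
      rw [pow_mul]
      refine pow_le_pow_left₀ nng ((norm_mul_le _ _).trans (le_of_eq ?_)) p
      rw [l2_opNorm_conjTranspose]; ring
  have Tn : ∀ t ω, 0 ≤ (((Z t ω)ᴴ * Z t ω) ^ p).trace.re := fun t ω => (by positivity : (0:ℝ) ≤ ‖Z t ω‖ ^ (2 * p)).trans (pow_norm_le _ p)
  have Sn : 0 ≤ ∑ t, ∫ ω, (((Z t ω)ᴴ * Z t ω) ^ p).trace.re ∂μ := sum_nonneg fun t _ => integral_nonneg (Tn t)
  have hRn : 0 ≤ RParam μ Z p := Real.rpow_nonneg Sn _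
  have hRpow : RParam μ Z p ^ (2 * p) = ∑ t, ∫ ω, (((Z t ω)ᴴ * Z t ω) ^ p).trace.re ∂μ := by
    unfold RParam
    rw [rt (b := 1) Sn, Real.rpow_one]
    have : (p:ℝ) ≠ 0 := by positivity
    push_cast; field_simp
  refine opt_lim hlog (le_max_of_le_left a0) (sqrt_nonneg _) hRn fun R hR θ hθ hθr => ?_
  have B := trunc (a := a) (c := c) hI hL h0 hp1 (hRn.trans_lt hR) (by
    refine le_trans ?_ (pow_le_pow_left₀ hRn hR.le (2 * p))
    rw [hRpow]
    exact sle fun t => integral_mono (Zp t) (Ti t) fun ω => pow_norm_le _ p) hcard hm' r1 r2 Q hθ hθr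
  refine B.trans ?_
  rw [sq_sqrt Q.hw]
  exact fin_num a0 c0 Q.hw (hRn.trans hR.le) hθ.le
theorem expectation_bound_sum_independent_random_matrices :
    ∃ C : ℝ, 0 < C ∧ ∃ C' : ℝ, 0 < C' ∧
    ∀ (m T : ℕ), 2 ≤ m →
    ∀ (Ω : Type) (_ : MeasurableSpace Ω) (μ : Measure Ω), IsProbabilityMeasure μ →
    ∀ Z : Fin T → Ω → Mc (Fin m),
      iIndepFun Z μ →
      (∀ t i j (p : ℕ), MemLp (fun ω => Z t ω i j) p μ) →
      (∀ t i j, ∫ ω, Z t ω i j ∂μ = 0) →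
      ∀ p : ℕ, C' * log m ≤ (p : ℝ) →
      (∫ ω, opNorm2 (∑ t, Z t ω) ∂μ) ≤
        sqrt (opNorm2 (matExp μ fun ω => (∑ t, Z t ω) * (∑ t, Z t ω)ᴴ))
        + sqrt (opNorm2 (matExp μ fun ω => (∑ t, Z t ω)ᴴ * (∑ t, Z t ω)))
        + C * (log m ^ ((3 : ℝ)/4)
              * sigmaParam μ (fun ω => ∑ t, Z t ω) ^ ((1 : ℝ)/2)
              * upsilonParam μ (fun ω => ∑ t, Z t ω) ^ ((1 : ℝ)/2)
            + log m ^ ((2 : ℝ)/3)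
              * sigmaParam μ (fun ω => ∑ t, Z t ω) ^ ((2 : ℝ)/3)
              * RParam μ Z p ^ ((1 : ℝ)/3)
            + log m * RParam μ Z p) := by
  refine ⟨2004, by norm_num, 1, one_pos, fun m T hm Ω _ μ _ Z hI hL h0 p hp => ?_⟩
  simp only [NCK.opNorm2_eq]
  exact NCK.main_bd m T hm Ω μ Z hI hL h0 p (by linarith)
end
end NCK

theorem expectation_bound_sum_independent_random_matrices :
    ∃ C : ℝ, 0 < C ∧ ∃ C' : ℝ, 0 < C' ∧
    ∀ (m T : ℕ), 2 ≤ m →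
    ∀ (Ω : Type) (_ : MeasurableSpace Ω) (μ : Measure Ω), IsProbabilityMeasure μ →
    ∀ Z : Fin T → Ω → Matrix (Fin m) (Fin m) ℂ,
      iIndepFun Z μ →
      (∀ t i j (p : ℕ), MemLp (fun ω => Z t ω i j) p μ) →
      (∀ t i j, ∫ ω, Z t ω i j ∂μ = 0) →
      ∀ p : ℕ, C' * Real.log m ≤ (p : ℝ) →
      (∫ ω, Matrix.opNorm2 (∑ t, Z t ω) ∂μ) ≤
        Real.sqrt (Matrix.opNorm2 (matExp μ fun ω => (∑ t, Z t ω) * (∑ t, Z t ω)ᴴ))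
        + Real.sqrt (Matrix.opNorm2 (matExp μ fun ω => (∑ t, Z t ω)ᴴ * (∑ t, Z t ω)))
        + C * (Real.log m ^ ((3 : ℝ)/4)
              * sigmaParam μ (fun ω => ∑ t, Z t ω) ^ ((1 : ℝ)/2)
              * upsilonParam μ (fun ω => ∑ t, Z t ω) ^ ((1 : ℝ)/2)
            + Real.log m ^ ((2 : ℝ)/3)
              * sigmaParam μ (fun ω => ∑ t, Z t ω) ^ ((2 : ℝ)/3)
              * RParam μ Z p ^ ((1 : ℝ)/3)
            + Real.log m * RParam μ Z p) := by
  refine ⟨2004, by norm_num, 1, one_pos, fun m T hm Ω _ μ _ Z hI hL h0 p hp => ?_⟩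
  simp only [NCK.opNorm2_eq]
  exact NCK.main_bd m T hm Ω μ Z hI hL h0 p (by linarith)
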